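/- Let γ = 4/15 + Σ_{a=2}^∞ Σ_{1 ≤ b < a, gcd(a,b)=1} 2(3+(−1)^{a+b}) f(a,b), where f(a,b) = (20a^6 + 25a^5 b − 7a^4 b^2 + 28a^3 b^3 − 20a^2 b^4 + 3ab^5 − b^6)/(240 a^5 (a+b)^2 (a^2+b^2)). Then the number of 4-element subsets of [n]^2 whose four points lie on a common line or on a common circle is (γ + 7π^2/(360·ζ(3)) + o(1)) · n^5 as n → ∞; in particular, there exists N ∈ ℕ such that this number is at most 0.51983 · n^5 for all n ≥ N. -/

import Mathlib

open scoped Real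

/-- The grid `[n]^2`: points of `ℝ^2` with both coordinates integers in `{1, …, n}`. -/
def grid (n : ℕ) : Set (EuclideanSpace ℝ (Fin 2)) :=
  {x | ∀ i, ∃ m : ℕ, 1 ≤ m ∧ m ≤ n ∧ x i = (m : ℝ)}

/-- The rational function `f(a,b)` from the definition of `γ`. -/
noncomputable def fab (a b : ℕ) : ℝ :=
  (20 * (a : ℝ) ^ 6 + 25 * (a : ℝ) ^ 5 * (b : ℝ) - 7 * (a : ℝ) ^ 4 * (b : ℝ) ^ 2
      + 28 * (a : ℝ) ^ 3 * (b : ℝ) ^ 3 - 20 * (a : ℝ) ^ 2 * (b : ℝ) ^ 4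
      + 3 * (a : ℝ) * (b : ℝ) ^ 5 - (b : ℝ) ^ 6) /
    (240 * (a : ℝ) ^ 5 * ((a : ℝ) + (b : ℝ)) ^ 2 * ((a : ℝ) ^ 2 + (b : ℝ) ^ 2))

/-- The constant `γ = 4/15 + Σ_{a≥2} Σ_{1 ≤ b < a, gcd(a,b)=1} 2(3+(−1)^{a+b}) f(a,b)`.
(The summands with `a < 2` are empty sums, so the outer sum may run over all of `ℕ`.) -/
noncomputable def gammaConst : ℝ :=
  4 / 15 + ∑' a : ℕ, ∑ b ∈ (Finset.Ico 1 a).filter (fun b => Nat.gcd a b = 1),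
    2 * (3 + (-1 : ℝ) ^ (a + b)) * fab a b

/-- The number of 4-element subsets of `[n]^2` whose four points lie on a common line
or on a common circle. -/
noncomputable def badQuadCount (n : ℕ) : ℕ :=
  {Q : Set (EuclideanSpace ℝ (Fin 2)) | Q ⊆ grid n ∧ Q.ncard = 4 ∧
    ((∃ L : AffineSubspace ℝ (EuclideanSpace ℝ (Fin 2)),
        Module.finrank ℝ L.direction = 1 ∧ Q ⊆ (L : Set (EuclideanSpace ℝ (Fin 2)))) ∨
      (∃ (c : EuclideanSpace ℝ (Fin 2)) (ρ : ℝ), 0 < ρ ∧ Q ⊆ Metric.sphere c ρ))}.ncard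

/-! ### Divisor bound for Gaussian integers -/

theorem gunit_mem (u : GaussianInt) (hu : IsUnit u) :
    u = 1 ∨ u = -1 ∨ u = ⟨0, 1⟩ ∨ u = ⟨0, -1⟩ := by
  rw [← Zsqrtd.norm_eq_one_iff] at hu
  obtain ⟨x, y⟩ := u
  have h : x * x + y * y = 1 := by
    have h1 : (Zsqrtd.norm (⟨x, y⟩ : GaussianInt)) = x * x + y * y := by
      simp [Zsqrtd.norm]
    have h2 : 0 ≤ x * x + y * y := by nlinarith [mul_self_nonneg x, mul_self_nonneg y]
    rw [h1] at hu
    omega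
  have hx1 : x ≤ 1 := by nlinarith
  have hx2 : -1 ≤ x := by nlinarith
  have hy1 : y ≤ 1 := by nlinarith
  have hy2 : -1 ≤ y := by nlinarith
  interval_cases x <;> interval_cases y <;> simp_all [Zsqrtd.ext_iff]

theorem gnorm_nonneg (z : GaussianInt) : 0 ≤ z.norm := Zsqrtd.norm_nonneg (by norm_num) z

theorem gnorm_pos {z : GaussianInt} (hz : z ≠ 0) : 0 < z.norm := GaussianInt.norm_pos.mpr hz

theorem gnorm_def (z : GaussianInt) : z.norm = z.re * z.re + z.im * z.im := by
  simp [Zsqrtd.norm]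

theorem gsmall_finite (B : ℝ) : {z : GaussianInt | (z.norm : ℝ) ≤ B}.Finite := by
  have : {z : GaussianInt | (z.norm : ℝ) ≤ B} ⊆
      (fun p : ℤ × ℤ => (⟨p.1, p.2⟩ : GaussianInt)) ''
        ((Set.Icc (-⌈B⌉) ⌈B⌉) ×ˢ (Set.Icc (-⌈B⌉) ⌈B⌉)) := by
    intro z hz
    have h1 : (z.norm : ℝ) ≤ ⌈B⌉ := le_trans hz (Int.le_ceil B)
    have h2 : z.norm ≤ ⌈B⌉ := by exact_mod_cast h1
    rw [gnorm_def] at h2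
    refine ⟨(z.re, z.im), ⟨⟨?_, ?_⟩, ⟨?_, ?_⟩⟩, rfl⟩ <;>
      simp only [] <;> nlinarith [mul_self_nonneg (z.re), mul_self_nonneg (z.im), Int.le_self_sq z.re,
        Int.le_self_sq z.im, Int.le_self_sq (-z.re), Int.le_self_sq (-z.im)]
  exact Set.Finite.subset (Set.Finite.image _ ((Set.finite_Icc _ _).prod (Set.finite_Icc _ _))) this

open UniqueFactorizationMonoid in
theorem gdivisors_subset (z : GaussianInt) (hz : z ≠ 0) :
    ∃ m : Multiset GaussianInt, (∀ p ∈ m, 2 ≤ p.norm) ∧ (m.map Zsqrtd.norm).prod = z.norm ∧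
      {d : GaussianInt | d ∣ z}.Finite ∧
      {d : GaussianInt | d ∣ z}.ncard ≤ 4 * (∏ i ∈ m.toFinset, (m.count i + 1)) := by
  classical
  let _ : StrongNormalizationMonoid GaussianInt :=
    UniqueFactorizationMonoid.strongNormalizationMonoid
  refine ⟨normalizedFactors z, ?_, ?_, ?_⟩
  · intro p hp
    have hp' := (prime_of_normalized_factor p hp)
    have h0 := gnorm_pos hp'.ne_zero
    have h1 : p.norm ≠ 1 := by
      intro h
      apply hp'.not_isUnit
      rw [← Zsqrtd.norm_eq_one_iff, h]; rfl
    omega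
  · have h := prod_normalizedFactors hz
    obtain ⟨u, hu⟩ := h
    have h1 : ∀ m : Multiset GaussianInt, (m.map Zsqrtd.norm).prod = m.prod.norm := by
      intro m
      induction m using Multiset.induction_on with
      | empty => simp
      | cons a s ih => simp [ih, Zsqrtd.norm_mul]
    rw [h1]
    have hu1 : (u : GaussianInt).norm = 1 := by
      have := Zsqrtd.norm_eq_one_iff.mpr u.isUnit
      have := gnorm_nonneg (u : GaussianInt)
      omega
    conv_rhs => rw [← hu, Zsqrtd.norm_mul, hu1, mul_one]
  · set m := normalizedFactors z with hm
    let U : Finset GaussianInt := {1, -1, ⟨0, 1⟩, ⟨0, -1⟩}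
    have hU : U.card ≤ 4 := Finset.card_le_four
    let I : Finset GaussianInt := ((Finset.Iic m) ×ˢ U).image (fun q => q.1.prod * q.2)
    have hsub : {d : GaussianInt | d ∣ z} ⊆ (I : Set GaussianInt) := by
      intro d hd
      have hd0 : d ≠ 0 := by rintro rfl; exact hz (zero_dvd_iff.mp hd)
      have hle := (dvd_iff_normalizedFactors_le_normalizedFactors hd0 hz).mp hd
      obtain ⟨u, hu⟩ := prod_normalizedFactors hd0
      rw [Finset.mem_coe, Finset.mem_image]
      refine ⟨(normalizedFactors d, (u : GaussianInt)), ?_, hu⟩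
      rw [Finset.mem_product]
      refine ⟨Finset.mem_Iic.mpr hle, ?_⟩
      have := gunit_mem u u.isUnit
      simp only [U, Finset.mem_insert, Finset.mem_singleton]
      exact this
    refine ⟨I.finite_toSet.subset hsub, ?_⟩
    calc _ ≤ (I : Set GaussianInt).ncard := Set.ncard_le_ncard hsub I.finite_toSet
      _ = I.card := Set.ncard_coe_finset I
      _ ≤ ((Finset.Iic m) ×ˢ U).card := Finset.card_image_le
      _ = (Finset.Iic m).card * U.card := Finset.card_product _ _
      _ ≤ _ := by rw [Multiset.card_Iic, mul_comm]; exact Nat.mul_le_mul_right _ hU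

theorem gdivisors_finite (z : GaussianInt) (hz : z ≠ 0) : {d : GaussianInt | d ∣ z}.Finite := by
  obtain ⟨m, _, _, h, _⟩ := gdivisors_subset z hz
  exact h

theorem gdivisor_bound (ε : ℝ) (hε : 0 < ε) : ∃ C : ℝ, 1 ≤ C ∧ ∀ z : GaussianInt, z ≠ 0 →
    ({d : GaussianInt | d ∣ z}.ncard : ℝ) ≤ C * (z.norm : ℝ) ^ ε := by
  classical
  set c0 : ℝ := 1 / (ε * Real.log 2) + 1 with hc0
  have hl2 : 0 < Real.log 2 := Real.log_pos (by norm_num)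
  have hc01 : 1 ≤ c0 := by rw [hc0]; have : 0 < 1 / (ε * Real.log 2) := by positivity
                           linarith
  have key1 : ∀ k : ℕ, ((k : ℝ) + 1) ≤ c0 * (2 : ℝ) ^ (ε * k) := by
    intro k
    have h1 : (2 : ℝ) ^ (ε * k) ≥ 1 + ε * k * Real.log 2 := by
      rw [Real.rpow_def_of_pos (by norm_num : (0:ℝ) < 2)]
      have := Real.add_one_le_exp (Real.log 2 * (ε * k))
      linarith
    calc (k : ℝ) + 1 ≤ c0 * (1 + ε * k * Real.log 2) := by
          rw [hc0]
          have : 1 / (ε * Real.log 2) * (ε * k * Real.log 2) = k := by field_simp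
          have h3 : 0 < 1 / (ε * Real.log 2) := by positivity
          have h4 : 0 ≤ ε * k * Real.log 2 := by positivity
          nlinarith
      _ ≤ _ := mul_le_mul_of_nonneg_left h1 (by linarith)
  set B : ℝ := (2 : ℝ) ^ (1 / ε) with hB
  set S := (gsmall_finite B).toFinset with hS
  refine ⟨4 * c0 ^ S.card, ?_, ?_⟩
  · have := one_le_pow₀ hc01 (n := S.card)
    linarith
  intro z hz
  obtain ⟨m, hm2, hmp, -, hcard⟩ := gdivisors_subset z hz
  have hc : ({d : GaussianInt | d ∣ z}.ncard : ℝ) ≤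
      4 * (∏ i ∈ m.toFinset, ((m.count i : ℝ) + 1)) := by exact_mod_cast hcard
  have hprod : (z.norm : ℝ) ^ ε = ∏ i ∈ m.toFinset, ((i.norm : ℝ) ^ (ε * m.count i)) := by
    rw [← hmp, Finset.prod_multiset_map_count]
    push_cast
    rw [← Real.finsetProd_rpow]
    · apply Finset.prod_congr rfl
      intro i hi
      have : (0:ℝ) ≤ i.norm := by exact_mod_cast gnorm_nonneg i
      rw [← Real.rpow_natCast, ← Real.rpow_mul this, mul_comm]
    · intro i hi
      have : (0:ℝ) ≤ i.norm := by exact_mod_cast gnorm_nonneg i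
      positivity
  have hterm : ∀ i ∈ m.toFinset, ((m.count i : ℝ) + 1) ≤
      (if i ∈ S then c0 else 1) * ((i.norm : ℝ) ^ (ε * m.count i)) := by
    intro i hi
    have h2 : (2 : ℝ) ≤ i.norm := by exact_mod_cast hm2 i (Multiset.mem_toFinset.mp hi)
    split_ifs with h
    · refine (key1 _).trans ?_
      apply mul_le_mul_of_nonneg_left _ (by linarith)
      apply Real.rpow_le_rpow (by norm_num) h2 (by positivity)
    · rw [one_mul]
      have hBi : B < i.norm := by
        rw [hS, Set.Finite.mem_toFinset] at h
        simpa using h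
      calc ((m.count i : ℝ) + 1) ≤ 2 ^ (m.count i) := by
            have := Nat.lt_two_pow_self (n := m.count i)
            exact_mod_cast this
        _ = B ^ (ε * m.count i) := by
            rw [hB, ← Real.rpow_mul (by norm_num), ← mul_assoc, one_div, inv_mul_cancel₀ hε.ne',
              one_mul, Real.rpow_natCast]
        _ ≤ _ := Real.rpow_le_rpow (by positivity) hBi.le (by positivity)
  have hifs : ∏ i ∈ m.toFinset, (if i ∈ S then c0 else 1) ≤ c0 ^ S.card := by
    rw [Finset.prod_ite, Finset.prod_const, Finset.prod_const_one, mul_one]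
    apply pow_le_pow_right₀ hc01
    apply Finset.card_le_card
    intro i hi
    exact (Finset.mem_filter.mp hi).2
  calc _ ≤ _ := hc
    _ ≤ 4 * ∏ i ∈ m.toFinset, ((if i ∈ S then c0 else 1) * ((i.norm : ℝ) ^ (ε * m.count i))) := by
        apply mul_le_mul_of_nonneg_left _ (by norm_num)
        apply Finset.prod_le_prod
        · intro i _; positivity
        · exact hterm
    _ = 4 * ((∏ i ∈ m.toFinset, (if i ∈ S then c0 else 1)) * (z.norm : ℝ) ^ ε) := by
        rw [Finset.prod_mul_distrib, hprod]
    _ ≤ _ := by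
        rw [← mul_assoc]
        apply mul_le_mul_of_nonneg_right
        · exact mul_le_mul_of_nonneg_left hifs (by norm_num)
        · have : (0:ℝ) ≤ z.norm := by exact_mod_cast gnorm_nonneg z
          positivity

/-! ### Data attached to a concyclic quadruple -/

/-- Arithmetic data of a quadruple of lattice points. -/
structure QD where
  g : GaussianInt
  ta : GaussianInt
  tb : GaussianInt
  tc : GaussianInt
  td : GaussianInt
  u : GaussianInt
  v : GaussianInt
  w : GaussianInt
  s1 : ℤ
  s2 : ℤ
  s3 : ℤ
  kab : ℤ
  kcd : ℤ
  kac : ℤ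
  kbd : ℤ
  kad : ℤ
  kbc : ℤ

/-- Conditions satisfied by the data of a non-symmetric concyclic quadruple. -/
structure QOk (R : ℤ) (d : QD) : Prop where
  g0 : d.g ≠ 0
  ta0 : d.ta ≠ 0
  tb0 : d.tb ≠ 0
  tc0 : d.tc ≠ 0
  td0 : d.td ≠ 0
  u0 : d.u ≠ 0
  v0 : d.v ≠ 0
  w0 : d.w ≠ 0
  s10 : d.s1 ≠ 0
  s20 : d.s2 ≠ 0
  s30 : d.s3 ≠ 0
  kab0 : d.kab ≠ 0
  kcd0 : d.kcd ≠ 0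
  kac0 : d.kac ≠ 0
  kbd0 : d.kbd ≠ 0
  kad0 : d.kad ≠ 0
  kbc0 : d.kbc ≠ 0
  rabc : (d.s1 : GaussianInt) * d.kab * d.u * d.tc + d.s3 * d.kbc * star d.w * d.ta =
    d.s2 * d.kac * d.v * d.tb
  rabd : (d.s1 : GaussianInt) * d.kab * d.u * d.td + d.s2 * d.kbd * star d.v * d.ta =
    d.s3 * d.kad * d.w * d.tb
  racd : (d.s2 : GaussianInt) * d.kac * d.v * d.td + d.s1 * d.kcd * star d.u * d.ta =
    d.s3 * d.kad * d.w * d.tc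
  rbcd : (d.s3 : GaussianInt) * d.kbc * star d.w * d.td + d.s1 * d.kcd * star d.u * d.tb =
    d.s2 * d.kbd * star d.v * d.tc
  c12 : IsCoprime (d.s1 * d.kab * d.kcd) (d.s2 * d.kac * d.kbd)
  c13 : IsCoprime (d.s1 * d.kab * d.kcd) (d.s3 * d.kad * d.kbc)
  c23 : IsCoprime (d.s2 * d.kac * d.kbd) (d.s3 * d.kad * d.kbc)
  c1 : IsCoprime d.kab d.kcd
  c2 : IsCoprime d.kac d.kbd
  c3 : IsCoprime d.kad d.kbc
  iab : (star d.v * star d.w * star d.tb * d.ta).im ≠ 0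
  icd : (d.w * star d.v * d.tc * star d.td).im ≠ 0
  ibd : (star d.u * d.w * star d.td * d.tb).im ≠ 0
  iac : (star d.u * star d.w * star d.tc * d.ta).im ≠ 0
  iad : (star d.u * star d.v * star d.td * d.ta).im ≠ 0
  ibc : (star d.u * d.v * star d.tc * d.tb).im ≠ 0
  l1 : d.kab ^ 2 * d.tc.norm * d.td.norm ≠ d.kcd ^ 2 * d.ta.norm * d.tb.norm
  l2 : d.kac ^ 2 * d.tb.norm * d.td.norm ≠ d.kbd ^ 2 * d.ta.norm * d.tc.norm
  l3 : d.kad ^ 2 * d.tb.norm * d.tc.norm ≠ d.kbc ^ 2 * d.ta.norm * d.td.norm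
  p1 : (star d.u * star d.u * star d.tc * star d.td * d.ta * d.tb).im ≠ 0
  p2 : (star d.v * star d.v * star d.tb * star d.td * d.ta * d.tc).im ≠ 0
  p3 : (star d.w * star d.w * star d.tb * star d.tc * d.ta * d.td).im ≠ 0
  zab : d.g.norm * d.tc.norm * d.td.norm * d.u.norm * (d.s1 * d.kab) ^ 2 ≤ R
  zcd : d.g.norm * d.ta.norm * d.tb.norm * d.u.norm * (d.s1 * d.kcd) ^ 2 ≤ R
  zac : d.g.norm * d.tb.norm * d.td.norm * d.v.norm * (d.s2 * d.kac) ^ 2 ≤ R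
  zbd : d.g.norm * d.ta.norm * d.tc.norm * d.v.norm * (d.s2 * d.kbd) ^ 2 ≤ R
  zad : d.g.norm * d.tb.norm * d.tc.norm * d.w.norm * (d.s3 * d.kad) ^ 2 ≤ R
  zbc : d.g.norm * d.ta.norm * d.td.norm * d.w.norm * (d.s3 * d.kbc) ^ 2 ≤ R

/-- exchange the points `A` and `B` -/
def QD.swAB (d : QD) : QD where
  g := d.g
  ta := d.tb
  tb := d.ta
  tc := d.tc
  td := d.td
  u := d.u
  v := star d.w
  w := star d.v
  s1 := d.s1
  s2 := d.s3
  s3 := d.s2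
  kab := -d.kab
  kcd := d.kcd
  kac := d.kbc
  kbd := d.kad
  kad := d.kbd
  kbc := d.kac

/-- exchange the points `B` and `C` -/
def QD.swBC (d : QD) : QD where
  g := d.g
  ta := d.ta
  tb := d.tc
  tc := d.tb
  td := d.td
  u := d.v
  v := d.u
  w := d.w
  s1 := d.s2
  s2 := d.s1
  s3 := d.s3
  kab := d.kac
  kcd := d.kbd
  kac := d.kab
  kbd := d.kcd
  kad := d.kad
  kbc := -d.kbc

/-- exchange the points `C` and `D` -/
def QD.swCD (d : QD) : QD where
  g := d.g
  ta := d.ta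
  tb := d.tb
  tc := d.td
  td := d.tc
  u := d.u
  v := d.w
  w := d.v
  s1 := d.s1
  s2 := d.s3
  s3 := d.s2
  kab := d.kab
  kcd := -d.kcd
  kac := d.kad
  kbd := d.kbc
  kad := d.kac
  kbc := d.kbd

theorem QD.swAB_swAB (d : QD) : d.swAB.swAB = d := by simp [QD.swAB]
theorem QD.swBC_swBC (d : QD) : d.swBC.swBC = d := by simp [QD.swBC]
theorem QD.swCD_swCD (d : QD) : d.swCD.swCD = d := by simp [QD.swCD]

theorem g_im_star_ne {z w : GaussianInt} (hz : z.im ≠ 0) (h : w = star z) : w.im ≠ 0 := by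
  rw [h]; simpa using hz

theorem g_cop_congr {a b a' b' : ℤ} (h : IsCoprime a b) (ha : a' = a) (hb : b' = b) :
    IsCoprime a' b' := by
  rw [ha, hb]; exact h

theorem g_im_same_ne {z w : GaussianInt} (hz : z.im ≠ 0) (h : w = z) : w.im ≠ 0 := by
  rw [h]; exact hz

theorem QOk.swAB {R : ℤ} {d : QD} (h : QOk R d) : QOk R d.swAB := by
  have hc := h.c12; have hc' := h.c13; have h23 := h.c23.symm
  constructor <;> simp only [QD.swAB, star_star, Zsqrtd.norm_conj]
  case g0 => exact h.g0
  case ta0 => exact h.tb0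
  case tb0 => exact h.ta0
  case tc0 => exact h.tc0
  case td0 => exact h.td0
  case u0 => exact h.u0
  case v0 => exact star_ne_zero.mpr h.w0
  case w0 => exact star_ne_zero.mpr h.v0
  case s10 => exact h.s10
  case s20 => exact h.s30
  case s30 => exact h.s20
  case kab0 => exact neg_ne_zero.mpr h.kab0
  case kcd0 => exact h.kcd0
  case kac0 => exact h.kbc0
  case kbd0 => exact h.kad0
  case kad0 => exact h.kbd0
  case kbc0 => exact h.kac0
  case rabc => push_cast; linear_combination -h.rabc
  case rabd => push_cast; linear_combination -h.rabd
  case racd => linear_combination h.rbcd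
  case rbcd => linear_combination h.racd
  case c12 => exact g_cop_congr hc'.neg_left (by ring) (by ring)
  case c13 => exact g_cop_congr hc.neg_left (by ring) (by ring)
  case c23 => exact g_cop_congr h23 (by ring) (by ring)
  case c1 => exact h.c1.neg_left
  case c2 => exact h.c3.symm
  case c3 => exact h.c2.symm
  case iab => exact g_im_star_ne h.iab (by simp only [star_mul, star_star]; ring)
  case icd => exact g_im_same_ne h.icd (by ring)
  case ibd => exact g_im_same_ne h.iad (by ring)
  case iac => exact g_im_same_ne h.ibc (by ring)
  case iad => exact g_im_same_ne h.ibd (by ring)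
  case ibc => exact g_im_same_ne h.iac (by ring)
  case l1 => intro h'; apply h.l1; linear_combination h'
  case l2 => intro h'; apply h.l3; linear_combination -h'
  case l3 => intro h'; apply h.l2; linear_combination -h'
  case p1 => exact g_im_same_ne h.p1 (by ring)
  case p2 => exact g_im_star_ne h.p3 (by simp only [star_mul, star_star]; ring)
  case p3 => exact g_im_star_ne h.p2 (by simp only [star_mul, star_star]; ring)
  case zab => linarith [h.zab]
  case zcd => linarith [h.zcd]
  case zac => linarith [h.zbc]
  case zbd => linarith [h.zad]
  case zad => linarith [h.zbd]
  case zbc => linarith [h.zac]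

theorem QOk.swBC {R : ℤ} {d : QD} (h : QOk R d) : QOk R d.swBC := by
  have h12 := h.c12.symm; have h13 := h.c13; have h23 := h.c23
  constructor <;> simp only [QD.swBC]
  case g0 => exact h.g0
  case ta0 => exact h.ta0
  case tb0 => exact h.tc0
  case tc0 => exact h.tb0
  case td0 => exact h.td0
  case u0 => exact h.v0
  case v0 => exact h.u0
  case w0 => exact h.w0
  case s10 => exact h.s20
  case s20 => exact h.s10
  case s30 => exact h.s30
  case kab0 => exact h.kac0
  case kcd0 => exact h.kbd0
  case kac0 => exact h.kab0
  case kbd0 => exact h.kcd0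
  case kad0 => exact h.kad0
  case kbc0 => exact neg_ne_zero.mpr h.kbc0
  case rabc => push_cast; linear_combination -h.rabc
  case rabd => linear_combination h.racd
  case racd => linear_combination h.rabd
  case rbcd => push_cast; linear_combination -h.rbcd
  case c12 => exact h12
  case c13 => exact g_cop_congr h23.neg_right (by ring) (by ring)
  case c23 => exact g_cop_congr h13.neg_right (by ring) (by ring)
  case c1 => exact h.c2
  case c2 => exact h.c1
  case c3 => exact h.c3.neg_right
  case iab => exact g_im_same_ne h.iac (by ring)
  case icd => exact g_im_same_ne h.ibd (by ring)
  case ibd => exact g_im_same_ne h.icd (by ring)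
  case iac => exact g_im_same_ne h.iab (by ring)
  case iad => exact g_im_same_ne h.iad (by ring)
  case ibc => exact g_im_star_ne h.ibc (by simp only [star_mul, star_star]; ring)
  case l1 => intro h'; apply h.l2; linear_combination h'
  case l2 => intro h'; apply h.l1; linear_combination h'
  case l3 => intro h'; apply h.l3; linear_combination h'
  case p1 => exact g_im_same_ne h.p2 (by ring)
  case p2 => exact g_im_same_ne h.p1 (by ring)
  case p3 => exact g_im_same_ne h.p3 (by ring)
  case zab => linarith [h.zac]
  case zcd => linarith [h.zbd]
  case zac => linarith [h.zab]
  case zbd => linarith [h.zcd]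
  case zad => linarith [h.zad]
  case zbc => linarith [h.zbc]

theorem QOk.swCD {R : ℤ} {d : QD} (h : QOk R d) : QOk R d.swCD := by
  have h12 := h.c12; have h13 := h.c13; have h23 := h.c23.symm
  constructor <;> simp only [QD.swCD]
  case g0 => exact h.g0
  case ta0 => exact h.ta0
  case tb0 => exact h.tb0
  case tc0 => exact h.td0
  case td0 => exact h.tc0
  case u0 => exact h.u0
  case v0 => exact h.w0
  case w0 => exact h.v0
  case s10 => exact h.s10
  case s20 => exact h.s30
  case s30 => exact h.s20
  case kab0 => exact h.kab0
  case kcd0 => exact neg_ne_zero.mpr h.kcd0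
  case kac0 => exact h.kad0
  case kbd0 => exact h.kbc0
  case kad0 => exact h.kac0
  case kbc0 => exact h.kbd0
  case rabc => linear_combination h.rabd
  case rabd => linear_combination h.rabc
  case racd => push_cast; linear_combination -h.racd
  case rbcd => push_cast; linear_combination -h.rbcd
  case c12 => exact g_cop_congr h13.neg_left (by ring) (by ring)
  case c13 => exact g_cop_congr h12.neg_left (by ring) (by ring)
  case c23 => exact h23
  case c1 => exact h.c1.neg_right
  case c2 => exact h.c3
  case c3 => exact h.c2
  case iab => exact g_im_same_ne h.iab (by ring)
  case icd => exact g_im_star_ne h.icd (by simp only [star_mul, star_star]; ring)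
  case ibd => exact g_im_same_ne h.ibc (by ring)
  case iac => exact g_im_same_ne h.iad (by ring)
  case iad => exact g_im_same_ne h.iac (by ring)
  case ibc => exact g_im_same_ne h.ibd (by ring)
  case l1 => intro h'; apply h.l1; linear_combination h'
  case l2 => intro h'; apply h.l3; linear_combination h'
  case l3 => intro h'; apply h.l2; linear_combination h'
  case p1 => exact g_im_same_ne h.p1 (by ring)
  case p2 => exact g_im_same_ne h.p3 (by ring)
  case p3 => exact g_im_same_ne h.p2 (by ring)
  case zab => linarith [h.zab]
  case zcd => linarith [h.zcd]
  case zac => linarith [h.zad]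
  case zbd => linarith [h.zbc]
  case zad => linarith [h.zac]
  case zbc => linarith [h.zbd]

/-! ### Algebraic consequences -/

theorem g_im_int_mul (k : ℤ) (z : GaussianInt) : ((k : GaussianInt) * z).im = k * z.im := by
  simp

theorem g_area_zero (a b c e : GaussianInt) (h : e - b = c - a) :
    (star b * e).im - (star a * c).im + (star c * e).im - (star a * b).im = 0 := by
  have h1 : e.re - b.re = c.re - a.re := by simpa using congrArg Zsqrtd.re h
  have h2 : e.im - b.im = c.im - a.im := by simpa using congrArg Zsqrtd.im h
  simp
  have e1 : e.re = b.re + c.re - a.re := by linarith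
  have e2 : e.im = b.im + c.im - a.im := by linarith
  rw [e1, e2]; ring

theorem g_area_par (a b c e : GaussianInt) (h : e - b = c - a) :
    (star (a - b) * (c - a)).im = -((star b * e).im - (star a * c).im) := by
  have h1 : e.re - b.re = c.re - a.re := by simpa using congrArg Zsqrtd.re h
  have h2 : e.im - b.im = c.im - a.im := by simpa using congrArg Zsqrtd.im h
  simp
  have e1 : e.re = b.re + c.re - a.re := by linarith
  have e2 : e.im = b.im + c.im - a.im := by linarith
  rw [e1, e2]; ring

theorem gnorm_eq (z : GaussianInt) : ((z.norm : ℤ) : GaussianInt) = z * star z :=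
  Zsqrtd.norm_eq_mul_conj z

/-- first factor of the area equation -/
def QD.X (d : QD) : ℤ := d.kbc * d.kbd * d.ta.norm - d.kac * d.kad * d.tb.norm
/-- second factor of the area equation -/
def QD.Y (d : QD) : ℤ := d.kad * d.kbd * d.tc.norm - d.kac * d.kbc * d.td.norm

section
variable {R : ℤ} {d : QD}

theorem QOk.zrel (h : QOk R d) :
    d.ta * (d.s2 * d.kbd * star d.v * d.tc) - d.ta * (d.s3 * d.kbc * star d.w * d.td) =
    d.tb * (d.s3 * d.kad * d.w * d.tc) - d.tb * (d.s2 * d.kac * d.v * d.td) := by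
  linear_combination d.tb * h.racd - d.ta * h.rbcd

theorem QOk.arBCD (d : QD) : (star (d.ta * (d.s3 * d.kbc * star d.w * d.td)) *
    (d.ta * (d.s2 * d.kbd * star d.v * d.tc))).im =
    d.s2 * d.s3 * (d.kbc * d.kbd * d.ta.norm) * (d.w * star d.v * d.tc * star d.td).im := by
  rw [show d.s2 * d.s3 * (d.kbc * d.kbd * d.ta.norm) * (d.w * star d.v * d.tc * star d.td).im =
    (((d.s2 * d.s3 * (d.kbc * d.kbd * d.ta.norm) : ℤ) : GaussianInt) *
      (d.w * star d.v * d.tc * star d.td)).im from (g_im_int_mul _ _).symm]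
  congr 1
  push_cast [gnorm_eq]
  simp only [star_mul, star_star, star_intCast]
  ring

theorem QOk.arACD (d : QD) : (star (d.tb * (d.s2 * d.kac * d.v * d.td)) *
    (d.tb * (d.s3 * d.kad * d.w * d.tc))).im =
    d.s2 * d.s3 * (d.kac * d.kad * d.tb.norm) * (d.w * star d.v * d.tc * star d.td).im := by
  rw [show d.s2 * d.s3 * (d.kac * d.kad * d.tb.norm) * (d.w * star d.v * d.tc * star d.td).im =
    (((d.s2 * d.s3 * (d.kac * d.kad * d.tb.norm) : ℤ) : GaussianInt) *
      (d.w * star d.v * d.tc * star d.td)).im from (g_im_int_mul _ _).symm]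
  congr 1
  push_cast [gnorm_eq]
  simp only [star_mul, star_intCast]
  ring

theorem QOk.arABD (d : QD) : (star (d.tb * (d.s3 * d.kad * d.w * d.tc)) *
    (d.ta * (d.s2 * d.kbd * star d.v * d.tc))).im =
    d.s2 * d.s3 * (d.kad * d.kbd * d.tc.norm) * (star d.v * star d.w * star d.tb * d.ta).im := by
  rw [show d.s2 * d.s3 * (d.kad * d.kbd * d.tc.norm) * (star d.v * star d.w * star d.tb * d.ta).im =
    (((d.s2 * d.s3 * (d.kad * d.kbd * d.tc.norm) : ℤ) : GaussianInt) *
      (star d.v * star d.w * star d.tb * d.ta)).im from (g_im_int_mul _ _).symm]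
  congr 1
  push_cast [gnorm_eq]
  simp only [star_mul, star_intCast]
  ring

theorem QOk.arABC (d : QD) : (star (d.tb * (d.s2 * d.kac * d.v * d.td)) *
    (d.ta * (d.s3 * d.kbc * star d.w * d.td))).im =
    d.s2 * d.s3 * (d.kac * d.kbc * d.td.norm) * (star d.v * star d.w * star d.tb * d.ta).im := by
  rw [show d.s2 * d.s3 * (d.kac * d.kbc * d.td.norm) * (star d.v * star d.w * star d.tb * d.ta).im =
    (((d.s2 * d.s3 * (d.kac * d.kbc * d.td.norm) : ℤ) : GaussianInt) *
      (star d.v * star d.w * star d.tb * d.ta)).im from (g_im_int_mul _ _).symm]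
  congr 1
  push_cast [gnorm_eq]
  simp only [star_mul, star_intCast]
  ring

theorem QOk.area (h : QOk R d) :
    (d.w * star d.v * d.tc * star d.td).im * d.X +
      (star d.v * star d.w * star d.tb * d.ta).im * d.Y = 0 := by
  have h1 := g_area_zero _ _ _ _ h.zrel
  rw [QOk.arBCD, QOk.arACD, QOk.arABD, QOk.arABC] at h1
  have : d.s2 * d.s3 ≠ 0 := mul_ne_zero h.s20 h.s30
  apply mul_left_cancel₀ this
  rw [QD.X, QD.Y]
  linear_combination h1

theorem QOk.X_ne (h : QOk R d) : d.X ≠ 0 := by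
  intro hX
  have h1 := g_area_par _ _ _ _ h.zrel
  rw [QOk.arBCD, QOk.arACD] at h1
  have h2 : d.tb * (d.s2 * d.kac * d.v * d.td) - d.ta * (d.s3 * d.kbc * star d.w * d.td) =
      d.s1 * d.kab * (d.u * d.tc * d.td) := by linear_combination -d.td * h.rabc
  have h3 : d.tb * (d.s3 * d.kad * d.w * d.tc) - d.tb * (d.s2 * d.kac * d.v * d.td) =
      d.s1 * d.kcd * (star d.u * d.ta * d.tb) := by linear_combination -d.tb * h.racd
  rw [h2, h3] at h1
  have h4 : star (d.s1 * d.kab * (d.u * d.tc * d.td)) * (d.s1 * d.kcd * (star d.u * d.ta * d.tb)) =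
    ((d.s1 * d.kab * d.s1 * d.kcd : ℤ) : GaussianInt) *
      (star d.u * star d.u * star d.tc * star d.td * d.ta * d.tb) := by
    push_cast
    simp only [star_mul, star_intCast]
    ring
  rw [h4, g_im_int_mul] at h1
  have h5 : d.s1 * d.kab * d.s1 * d.kcd *
      (star d.u * star d.u * star d.tc * star d.td * d.ta * d.tb).im ≠ 0 :=
    mul_ne_zero (mul_ne_zero (mul_ne_zero (mul_ne_zero h.s10 h.kab0) h.s10) h.kcd0) h.p1
  apply h5
  rw [h1]
  rw [QD.X] at hX
  linear_combination -(d.s2 * d.s3 * (d.w * star d.v * d.tc * star d.td).im) * hX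

theorem QOk.jeq (h : QOk R d) : d.kcd * d.X + d.kab * d.Y = 0 := by
  have e1 : d.s2 * d.kbd * (star d.v * star d.w * star d.tb * d.ta).im =
      d.s1 * d.kab * (star d.u * d.w * star d.td * d.tb).im := by
    have := congrArg (fun z => (z * star (d.w * d.tb)).im) h.rabd
    simp at this ⊢
    linear_combination this
  have e2 : d.s2 * d.kbd * (d.w * star d.v * d.tc * star d.td).im =
      d.s1 * d.kcd * (star d.u * d.w * star d.td * d.tb).im := by
    have := congrArg (fun z => (z * star (star d.w * d.td)).im) h.rbcd
    simp at this ⊢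
    linear_combination -this
  have e3 := h.area
  have hne : d.s2 * d.kbd * (star d.v * star d.w * star d.tb * d.ta).im ≠ 0 :=
    mul_ne_zero (mul_ne_zero h.s20 h.kbd0) h.iab
  have hs : d.s1 ≠ 0 := h.s10
  apply mul_left_cancel₀ (mul_ne_zero hne hs)
  linear_combination (d.s1 * d.kab * (d.s2 * d.kbd)) * e3 - (d.s1 * d.kab) * d.X * e2 +
    (d.s1 * d.kcd * d.X) * e1

theorem QOk.kab_dvd (h : QOk R d) : d.kab ∣ d.X := by
  have h1 : d.kab ∣ d.kcd * d.X := ⟨-d.Y, by linear_combination h.jeq⟩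
  exact h.c1.dvd_of_dvd_mul_left h1

theorem QOk.ptolemy (h : QOk R d) :
    d.s1 ^ 2 * d.kab * d.kcd * d.u.norm + d.s3 ^ 2 * d.kad * d.kbc * d.w.norm =
      d.s2 ^ 2 * d.kac * d.kbd * d.v.norm := by
  have : ((d.s1 ^ 2 * d.kab * d.kcd * d.u.norm + d.s3 ^ 2 * d.kad * d.kbc * d.w.norm : ℤ) :
    GaussianInt) = ((d.s2 ^ 2 * d.kac * d.kbd * d.v.norm : ℤ) : GaussianInt) := by
    push_cast [gnorm_eq]
    have hne : d.tb * d.tc ≠ 0 := mul_ne_zero h.tb0 h.tc0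
    apply mul_left_cancel₀ hne
    linear_combination (d.s1 * d.kcd * star d.u * d.tb) * h.rabc
      + (d.s2 * d.kac * d.v * d.tb) * h.rbcd - (d.s3 * d.kbc * star d.w) * d.tb * h.racd
  exact_mod_cast this

end

theorem g_lin_inj (P Q z : GaussianInt) (hPQ : P.norm ≠ Q.norm) (h : P * z = Q * star z) : z = 0 := by
  by_contra hz
  have := congrArg Zsqrtd.norm h
  rw [Zsqrtd.norm_mul, Zsqrtd.norm_mul, Zsqrtd.norm_conj] at this
  exact hPQ (mul_right_cancel₀ (gnorm_pos hz).ne' this)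

theorem gnorm_int (k : ℤ) : ((k : GaussianInt)).norm = k ^ 2 := by
  rw [Zsqrtd.norm_intCast]; ring

/-- Given the real factors, the `t`s and `u`, the remaining directions are determined. -/
theorem QOk.det_u {R : ℤ} {d e : QD} (h : QOk R d) (k : QOk R e)
    (ha : d.ta = e.ta) (hb : d.tb = e.tb) (hc : d.tc = e.tc) (hd : d.td = e.td)
    (h1 : d.s1 = e.s1) (h2 : d.s2 = e.s2) (h3 : d.s3 = e.s3)
    (hab : d.kab = e.kab) (hcd : d.kcd = e.kcd) (hac : d.kac = e.kac) (hbd : d.kbd = e.kbd)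
    (had : d.kad = e.kad) (hu : d.u = e.u) : d.v = e.v ∧ d.w = e.w := by
  have hv : d.v = e.v := by
    have r1 := h.rabd
    have r2 := h.racd
    have q1 := k.rabd
    have q2 := k.racd
    rw [← ha, ← hb, ← hd, ← h1, ← h2, ← h3, ← hab, ← hbd, ← had, ← hu] at q1
    rw [← ha, ← hc, ← hd, ← h1, ← h2, ← h3, ← hac, ← hcd, ← had, ← hu] at q2
    have : d.v - e.v = 0 := by
      apply g_lin_inj (d.kac * d.tb * d.td) (d.kbd * d.ta * d.tc)
      · simp only [Zsqrtd.norm_mul, gnorm_int]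
        exact h.l2
      · have hs : (d.s2 : GaussianInt) ≠ 0 := by exact_mod_cast h.s20
        apply mul_left_cancel₀ hs
        rw [star_sub]
        linear_combination d.tb * r2 - d.tb * q2 - d.tc * r1 + d.tc * q1
    exact sub_eq_zero.mp this
  refine ⟨hv, ?_⟩
  have r2 := h.racd
  have q2 := k.racd
  rw [← ha, ← hc, ← hd, ← h1, ← h2, ← h3, ← hac, ← hcd, ← had, ← hu, ← hv] at q2
  have hne : (d.s3 : GaussianInt) * d.kad * d.tc ≠ 0 :=
    mul_ne_zero (mul_ne_zero (by exact_mod_cast h.s30) (by exact_mod_cast h.kad0)) h.tc0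
  apply mul_left_cancel₀ hne
  linear_combination q2 - r2

theorem QOk.det_v {R : ℤ} {d e : QD} (h : QOk R d) (k : QOk R e)
    (ha : d.ta = e.ta) (hb : d.tb = e.tb) (hc : d.tc = e.tc) (hd : d.td = e.td)
    (h1 : d.s1 = e.s1) (h2 : d.s2 = e.s2) (h3 : d.s3 = e.s3)
    (hab : d.kab = e.kab) (hcd : d.kcd = e.kcd) (hac : d.kac = e.kac) (hbd : d.kbd = e.kbd)
    (had : d.kad = e.kad) (hv : d.v = e.v) : d.u = e.u ∧ d.w = e.w := by
  have := QOk.det_u h.swBC k.swBC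
  simp only [QD.swBC] at this
  exact this ha hc hb hd h2 h1 h3 hac hbd hab hcd had hv

/-- two relations between three pairwise nonparallel vectors are proportional -/
theorem g_ratio (P Q R : GaussianInt) (a b c a' b' c' : ℤ)
    (h : (a : GaussianInt) * P + b * Q = c * R) (h' : (a' : GaussianInt) * P + b' * Q = c' * R)
    (hPQ : (star P * Q).im ≠ 0) (hac : IsCoprime a c) (hac' : IsCoprime a' c') :
    a.natAbs = a'.natAbs := by
  have e1 : a * (star P * Q).im = c * (star R * Q).im := by
    have := congrArg (fun z => (star z * Q).im) h
    simp at this ⊢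
    linear_combination this
  have e2 : a' * (star P * Q).im = c' * (star R * Q).im := by
    have := congrArg (fun z => (star z * Q).im) h'
    simp at this ⊢
    linear_combination this
  have e3 : a * c' = a' * c := by
    apply mul_right_cancel₀ hPQ
    linear_combination c' * e1 - c * e2
  apply Int.natAbs_eq_of_dvd_dvd
  · exact hac.dvd_of_dvd_mul_right ⟨c', e3.symm⟩
  · exact hac'.dvd_of_dvd_mul_right ⟨c, e3⟩

/-! ### Determination of the real factors up to sign -/

/-- the same Gaussian parts -/
def QD.SameG (d e : QD) : Prop :=
  d.ta = e.ta ∧ d.tb = e.tb ∧ d.tc = e.tc ∧ d.td = e.td ∧ d.u = e.u ∧ d.v = e.v ∧ d.w = e.w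

theorem QD.SameG.swAB {d e : QD} (h : d.SameG e) : d.swAB.SameG e.swAB := by
  obtain ⟨h1, h2, h3, h4, h5, h6, h7⟩ := h
  simp [QD.SameG, QD.swAB, *]
theorem QD.SameG.swBC {d e : QD} (h : d.SameG e) : d.swBC.SameG e.swBC := by
  obtain ⟨h1, h2, h3, h4, h5, h6, h7⟩ := h
  simp [QD.SameG, QD.swBC, *]
theorem QD.SameG.swCD {d e : QD} (h : d.SameG e) : d.swCD.SameG e.swCD := by
  obtain ⟨h1, h2, h3, h4, h5, h6, h7⟩ := h
  simp [QD.SameG, QD.swCD, *]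

section
variable {R : ℤ} {d e : QD}

theorem QOk.abs_ab (h : QOk R d) (k : QOk R e) (hs : d.SameG e) :
    (d.s1 * d.kab).natAbs = (e.s1 * e.kab).natAbs := by
  obtain ⟨h1, h2, h3, h4, h5, h6, h7⟩ := hs
  have q := k.rabc
  rw [← h1, ← h2, ← h3, ← h5, ← h6, ← h7] at q
  apply g_ratio (d.u * d.tc) (star d.w * d.ta) (d.v * d.tb) _ (d.s3 * d.kbc) (d.s2 * d.kac) _
    (e.s3 * e.kbc) (e.s2 * e.kac)
  · push_cast; linear_combination h.rabc
  · push_cast; linear_combination q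
  · exact g_im_same_ne h.iac (by simp only [star_mul]; ring)
  · exact h.c12.of_mul_left_left.of_mul_right_left
  · exact k.c12.of_mul_left_left.of_mul_right_left

theorem QOk.abs_ac (h : QOk R d) (k : QOk R e) (hs : d.SameG e) :
    (d.s2 * d.kac).natAbs = (e.s2 * e.kac).natAbs := QOk.abs_ab h.swBC k.swBC hs.swBC
theorem QOk.abs_ad (h : QOk R d) (k : QOk R e) (hs : d.SameG e) :
    (d.s3 * d.kad).natAbs = (e.s3 * e.kad).natAbs := QOk.abs_ac h.swCD k.swCD hs.swCD
theorem QOk.abs_bc (h : QOk R d) (k : QOk R e) (hs : d.SameG e) :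
    (d.s3 * d.kbc).natAbs = (e.s3 * e.kbc).natAbs := QOk.abs_ac h.swAB k.swAB hs.swAB
theorem QOk.abs_bd (h : QOk R d) (k : QOk R e) (hs : d.SameG e) :
    (d.s2 * d.kbd).natAbs = (e.s2 * e.kbd).natAbs := QOk.abs_ad h.swAB k.swAB hs.swAB
theorem QOk.abs_cd (h : QOk R d) (k : QOk R e) (hs : d.SameG e) :
    (d.s1 * d.kcd).natAbs = (e.s1 * e.kcd).natAbs := QOk.abs_bd h.swBC k.swBC hs.swBC

theorem abs_split (s k l s' k' l' : ℤ) (hs : s ≠ 0) (hc : IsCoprime k l) (hc' : IsCoprime k' l')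
    (h1 : (s * k).natAbs = (s' * k').natAbs) (h2 : (s * l).natAbs = (s' * l').natAbs) :
    s.natAbs = s'.natAbs ∧ k.natAbs = k'.natAbs ∧ l.natAbs = l'.natAbs := by
  have e1 : s.natAbs = Int.gcd (s * k) (s * l) := by
    rw [Int.gcd_mul_left, Int.isCoprime_iff_gcd_eq_one.mp hc, mul_one]
  have e2 : s'.natAbs = Int.gcd (s' * k') (s' * l') := by
    rw [Int.gcd_mul_left, Int.isCoprime_iff_gcd_eq_one.mp hc', mul_one]
  have e3 : s.natAbs = s'.natAbs := by
    rw [e1, e2, Int.gcd_def, Int.gcd_def, h1, h2]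
  have hs0 : 0 < s.natAbs := Int.natAbs_pos.mpr hs
  rw [Int.natAbs_mul, Int.natAbs_mul, ← e3] at h1 h2
  exact ⟨e3, Nat.eq_of_mul_eq_mul_left hs0 h1, Nat.eq_of_mul_eq_mul_left hs0 h2⟩

/-- the nine sign bits -/
def QD.sg (d : QD) : Fin 9 → Bool :=
  ![decide (0 < d.s1), decide (0 < d.s2), decide (0 < d.s3), decide (0 < d.kab),
    decide (0 < d.kcd), decide (0 < d.kac), decide (0 < d.kbd), decide (0 < d.kad),
    decide (0 < d.kbc)]

theorem int_eq_of_abs_sg {a b : ℤ} (h : a.natAbs = b.natAbs) (h' : decide (0 < a) = decide (0 < b)) :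
    a = b := by
  have : (0 < a) ↔ (0 < b) := by simpa using h'
  omega

theorem QOk.det_sg (h : QOk R d) (k : QOk R e) (hg : d.g = e.g) (hs : d.SameG e)
    (hsg : d.sg = e.sg) : d = e := by
  obtain ⟨a1, a2, a3⟩ := abs_split _ _ _ _ _ _ h.s10 h.c1 k.c1 (h.abs_ab k hs) (h.abs_cd k hs)
  obtain ⟨b1, b2, b3⟩ := abs_split _ _ _ _ _ _ h.s20 h.c2 k.c2 (h.abs_ac k hs) (h.abs_bd k hs)
  obtain ⟨c1, c2, c3⟩ := abs_split _ _ _ _ _ _ h.s30 h.c3 k.c3 (h.abs_ad k hs) (h.abs_bc k hs)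
  obtain ⟨h1, h2, h3, h4, h5, h6, h7⟩ := hs
  have t0 := int_eq_of_abs_sg a1 (congrFun hsg 0)
  have t1 := int_eq_of_abs_sg b1 (congrFun hsg 1)
  have t2 := int_eq_of_abs_sg c1 (congrFun hsg 2)
  have t3 := int_eq_of_abs_sg a2 (congrFun hsg 3)
  have t4 := int_eq_of_abs_sg a3 (congrFun hsg 4)
  have t5 := int_eq_of_abs_sg b2 (congrFun hsg 5)
  have t6 := int_eq_of_abs_sg b3 (congrFun hsg 6)
  have t7 := int_eq_of_abs_sg c2 (congrFun hsg 7)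
  have t8 := int_eq_of_abs_sg c3 (congrFun hsg 8)
  cases d; cases e
  simp only at *
  subst_vars
  rfl

end

/-! ### Counting framework -/

/-- the image of `S` under `f` has at most `M` elements -/
def FB {α β : Type*} (S : Set α) (f : α → β) (M : ℝ) : Prop :=
  (f '' S).Finite ∧ ((f '' S).ncard : ℝ) ≤ M

theorem FB.start {α : Type*} (S : Set α) : FB S (fun _ => ()) 1 := by
  refine ⟨Set.toFinite _, ?_⟩
  have := Set.ncard_le_ncard (Set.subset_univ ((fun _ : α => ()) '' S)) (Set.toFinite _)
  have h2 : (Set.univ : Set Unit).ncard = 1 := by simp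
  rw [h2] at this
  exact_mod_cast this

theorem FB.step {α β γ : Type*} {S : Set α} {f : α → β} {M : ℝ} (hf : FB S f M) (h : α → γ)
    (B : ℝ) (hB0 : 0 ≤ B)
    (hB : ∀ s ∈ S, ∃ F : Set γ, F.Finite ∧ (F.ncard : ℝ) ≤ B ∧ ∀ t ∈ S, f t = f s → h t ∈ F) :
    FB S (fun x => (f x, h x)) (M * B) := by
  classical
  obtain ⟨hfin, hM⟩ := hf
  choose! F hF1 hF2 hF3 using hB
  have hsec : ∀ y, y ∈ f '' S → ∃ s, s ∈ S ∧ f s = y := fun y hy => hy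
  choose r hr1 hr2 using hsec
  let I : Finset (β × γ) := hfin.toFinset.biUnion
    (fun y => if hy : y ∈ f '' S then ((hF1 (r y hy) (hr1 y hy)).toFinset).image (fun z => (y, z)) else ∅)
  have hsub : (fun x => (f x, h x)) '' S ⊆ (I : Set (β × γ)) := by
    rintro _ ⟨s, hs, rfl⟩
    have hy : f s ∈ f '' S := ⟨s, hs, rfl⟩
    simp only [I, Finset.mem_coe, Finset.mem_biUnion]
    refine ⟨f s, hfin.mem_toFinset.mpr hy, ?_⟩
    rw [dif_pos hy, Finset.mem_image]
    exact ⟨h s, (Set.Finite.mem_toFinset _).mpr (hF3 _ (hr1 _ hy) s hs (hr2 _ hy).symm), rfl⟩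
  refine ⟨I.finite_toSet.subset hsub, ?_⟩
  have h1 : ((fun x => (f x, h x)) '' S).ncard ≤ I.card := by
    rw [← Set.ncard_coe_finset I]; exact Set.ncard_le_ncard hsub I.finite_toSet
  have h2 : (I.card : ℝ) ≤ ∑ y ∈ hfin.toFinset, B := by
    refine le_trans (Nat.cast_le.mpr Finset.card_biUnion_le) ?_
    push_cast
    apply Finset.sum_le_sum
    intro y hy
    have hy' : y ∈ f '' S := hfin.mem_toFinset.mp hy
    rw [dif_pos hy']
    refine le_trans (Nat.cast_le.mpr Finset.card_image_le) ?_
    rw [← Set.ncard_eq_toFinset_card _ (hF1 _ (hr1 y hy'))]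
    exact hF2 _ (hr1 y hy')
  rw [Finset.sum_const, nsmul_eq_mul, ← Set.ncard_eq_toFinset_card _ hfin] at h2
  calc _ ≤ (I.card : ℝ) := by exact_mod_cast h1
    _ ≤ _ := h2
    _ ≤ _ := mul_le_mul_of_nonneg_right hM hB0

theorem FB.done {α β : Type*} {S : Set α} {f : α → β} {M : ℝ} (hf : FB S f M)
    (hinj : ∀ s ∈ S, ∀ t ∈ S, f s = f t → s = t) : S.Finite ∧ (S.ncard : ℝ) ≤ M := by
  have hi : Set.InjOn f S := fun s hs t ht h => hinj s hs t ht h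
  refine ⟨Set.Finite.of_finite_image hf.1 hi, ?_⟩
  rw [← Set.InjOn.ncard_image hi]
  exact hf.2

theorem FB.det {α β γ : Type*} {S : Set α} {f : α → β} {M : ℝ} (hf : FB S f M) (h : α → γ)
    (hd : ∀ s ∈ S, ∀ t ∈ S, f s = f t → h s = h t) : FB S (fun x => (f x, h x)) M := by
  have := hf.step h 1 zero_le_one (fun s hs => ⟨{h s}, Set.finite_singleton _, by simp,
    fun t ht hts => (hd t ht s hs hts)⟩)
  simpa using this

theorem FB.univ {α β γ : Type*} [Fintype γ] {S : Set α} {f : α → β} {M : ℝ} (hf : FB S f M)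
    (h : α → γ) : FB S (fun x => (f x, h x)) (M * Fintype.card γ) := by
  refine hf.step h _ (Nat.cast_nonneg _) (fun s _ => ⟨Set.univ, Set.toFinite _, ?_, fun _ _ _ => trivial⟩)
  rw [Set.ncard_univ, Nat.card_eq_fintype_card]

theorem FB.ibox {α β : Type*} {S : Set α} {f : α → β} {M : ℝ} (hf : FB S f M) (h : α → ℤ) (e : ℕ)
    (hb : ∀ s ∈ S, (h s).natAbs < 2 ^ (e + 1)) : FB S (fun x => (f x, h x)) (M * (4 * 2 ^ e)) := by
  refine hf.step h _ (by positivity) (fun s _ =>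
    ⟨Set.Ico (-(2 ^ (e + 1) : ℤ)) (2 ^ (e + 1)), Set.finite_Ico _ _, ?_, ?_⟩)
  · rw [← Finset.coe_Ico, Set.ncard_coe_finset, Int.card_Ico]
    have : ((2 ^ (e + 1) : ℤ) - -2 ^ (e + 1)).toNat = 4 * 2 ^ e := by
      have : ((2 ^ (e + 1) : ℤ) - -2 ^ (e + 1)) = ((4 * 2 ^ e : ℕ) : ℤ) := by push_cast; ring
      rw [this, Int.toNat_natCast]
    rw [this]; push_cast; exact le_rfl
  · intro t ht _
    have h1 := hb t ht
    have h2 : ((h t).natAbs : ℤ) < 2 ^ (e + 1) := by exact_mod_cast h1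
    rw [Set.mem_Ico]
    omega

theorem g_coord_lt {z : GaussianInt} {e : ℕ} (h : z.norm < 4 ^ e) :
    z.re.natAbs < 2 ^ e ∧ z.im.natAbs < 2 ^ e := by
  rw [gnorm_def] at h
  have h4 : (4 : ℤ) ^ e = (2 ^ e) ^ 2 := by rw [← pow_mul, mul_comm, pow_mul]; norm_num
  have hp : (0 : ℤ) < 2 ^ e := by positivity
  rw [h4] at h
  constructor
  · zify
    apply abs_lt_of_sq_lt_sq _ hp.le
    nlinarith [mul_self_nonneg z.im]
  · zify
    apply abs_lt_of_sq_lt_sq _ hp.le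
    nlinarith [mul_self_nonneg z.re]

theorem FB.comp {α β γ : Type*} {S : Set α} {f : α → β} {M : ℝ} (hf : FB S f M) (φ : β → γ) :
    FB S (fun x => φ (f x)) M := by
  have : (fun x => φ (f x)) '' S = φ '' (f '' S) := by rw [Set.image_image]
  refine ⟨by rw [this]; exact hf.1.image φ, ?_⟩
  rw [this]
  exact le_trans (Nat.cast_le.mpr (Set.ncard_image_le hf.1)) hf.2

theorem FB.gbox {α β : Type*} {S : Set α} {f : α → β} {M : ℝ} (hf : FB S f M)
    (h : α → GaussianInt) (e : ℕ) (hb : ∀ s ∈ S, (h s).norm < 4 ^ (e + 1)) :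
    FB S (fun x => (f x, h x)) (M * (16 * 2 ^ (2 * e))) := by
  have h1 := (hf.ibox (fun x => (h x).re) e (fun s hs => (g_coord_lt (hb s hs)).1)).ibox
    (fun x => (h x).im) e (fun s hs => (g_coord_lt (hb s hs)).2)
  have h2 := h1.comp (fun q => (q.1.1, (⟨q.1.2, q.2⟩ : GaussianInt)))
  have h3 : M * (16 * 2 ^ (2 * e)) = M * (4 * 2 ^ e) * (4 * 2 ^ e) := by ring
  rw [h3]
  exact h2

/-- `Dv` bounds the number of divisors of every Gaussian integer of norm at most `R'` -/
def DivB (R' : ℤ) (Dv : ℝ) : Prop :=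
  0 ≤ Dv ∧ ∀ z : GaussianInt, z ≠ 0 → z.norm ≤ R' → ({d : GaussianInt | d ∣ z}.ncard : ℝ) ≤ Dv

theorem FB.gdiv {α β : Type*} {S : Set α} {f : α → β} {M : ℝ} (hf : FB S f M)
    (h : α → GaussianInt) (z : α → GaussianInt) {R' : ℤ} {Dv : ℝ} (hD : DivB R' Dv)
    (hz : ∀ s ∈ S, z s ≠ 0) (hn : ∀ s ∈ S, (z s).norm ≤ R') (hd : ∀ s ∈ S, h s ∣ z s)
    (hdet : ∀ s ∈ S, ∀ t ∈ S, f s = f t → z s = z t) :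
    FB S (fun x => (f x, h x)) (M * Dv) := by
  refine hf.step h _ hD.1 (fun s hs => ⟨{d | d ∣ z s}, gdivisors_finite _ (hz s hs),
    hD.2 _ (hz s hs) (hn s hs), ?_⟩)
  intro t ht hts
  have := hdet t ht s hs hts
  rw [Set.mem_ofPred_eq, ← this]
  exact hd t ht

theorem FB.idiv {α β : Type*} {S : Set α} {f : α → β} {M : ℝ} (hf : FB S f M)
    (h : α → ℤ) (z : α → GaussianInt) {R' : ℤ} {Dv : ℝ} (hD : DivB R' Dv)
    (hz : ∀ s ∈ S, z s ≠ 0) (hn : ∀ s ∈ S, (z s).norm ≤ R')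
    (hd : ∀ s ∈ S, (h s : GaussianInt) ∣ z s)
    (hdet : ∀ s ∈ S, ∀ t ∈ S, f s = f t → z s = z t) :
    FB S (fun x => (f x, h x)) (M * Dv) := by
  have h1 := hf.gdiv (fun x => (h x : GaussianInt)) z hD hz hn hd hdet
  have h2 := h1.comp (fun q => (q.1, q.2.re))
  simpa using h2

/-- residue class counting -/
theorem FB.ires {α β : Type*} {S : Set α} {f : α → β} {M : ℝ} (hf : FB S f M)
    (h : α → ℤ) (q : α → ℤ) (N Q : ℕ) (hQ : 0 < Q) (hq : ∀ s ∈ S, Q ≤ (q s).natAbs)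
    (hb : ∀ s ∈ S, (h s).natAbs < N)
    (hdet : ∀ s ∈ S, ∀ t ∈ S, f s = f t → (q s) ∣ h s - h t) :
    FB S (fun x => (f x, h x)) (M * (1 + 2 * N / Q)) := by
  refine hf.step h _ (by positivity) (fun s hs =>
    ⟨{x : ℤ | x.natAbs < N ∧ q s ∣ x - h s}, ?_, ?_, ?_⟩)
  · apply (Set.finite_Ico (-(N : ℤ)) N).subset
    rintro x ⟨hx, -⟩
    rw [Set.mem_Ico]; omega
  · have hq0 : 0 < (q s).natAbs := lt_of_lt_of_le hQ (hq s hs)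
    set r : ℤ := |q s| with hr
    have hr0 : 0 < r := abs_pos.mpr (Int.natAbs_pos.mp hq0)
    -- map x to (x - h s) / r
    have hsub : {x : ℤ | x.natAbs < N ∧ q s ∣ x - h s} ⊆
        (fun m : ℤ => h s + r * m) '' (Set.Icc (-((N + h s) / r)) ((N - h s) / r)) := by
      rintro x ⟨hx, hdv⟩
      have : r ∣ x - h s := (abs_dvd _ _).mpr hdv
      obtain ⟨m, hm⟩ := this
      refine ⟨m, ⟨?_, ?_⟩, by linarith⟩
      · rw [neg_le, Int.le_ediv_iff_mul_le hr0]
        nlinarith [abs_lt.mp (show |x| < N by rw [Int.abs_eq_natAbs]; exact_mod_cast hx)]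
      · rw [Int.le_ediv_iff_mul_le hr0]
        nlinarith [abs_lt.mp (show |x| < N by rw [Int.abs_eq_natAbs]; exact_mod_cast hx)]
    have h1 : {x : ℤ | x.natAbs < N ∧ q s ∣ x - h s}.ncard ≤
        (Set.Icc (-((N + h s) / r)) ((N - h s) / r)).ncard :=
      (Set.ncard_le_ncard hsub ((Set.finite_Icc _ _).image _)).trans
        (Set.ncard_image_le (Set.finite_Icc _ _))
    rw [← Finset.coe_Icc, Set.ncard_coe_finset, Int.card_Icc] at h1
    have hNs : |h s| < N := by
      have := hb s hs
      rw [Int.abs_eq_natAbs]; exact_mod_cast this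
    have hNs' := abs_lt.mp hNs
    have h2 : (((N - h s) / r + 1 - (-((N + h s) / r))).toNat : ℤ) =
        (N - h s) / r + 1 + ((N + h s) / r) := by
      rw [Int.toNat_of_nonneg]; · ring
      have a1 : 0 ≤ (N - h s) / r := Int.ediv_nonneg (by linarith) hr0.le
      have a2 : 0 ≤ (N + h s) / r := Int.ediv_nonneg (by linarith) hr0.le
      linarith
    have hrR : (0 : ℝ) < r := by exact_mod_cast hr0
    have h3 : ((((N - h s) / r + 1 + ((N + h s) / r) : ℤ)) : ℝ) ≤ 1 + 2 * N / r := by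
      push_cast
      have a1 : ((((N : ℤ) - h s) / r : ℤ) : ℝ) ≤ ((N : ℝ) - h s) / r := by
        rw [le_div_iff₀ hrR]
        exact_mod_cast Int.ediv_mul_le _ hr0.ne'
      have a2 : ((((N : ℤ) + h s) / r : ℤ) : ℝ) ≤ ((N : ℝ) + h s) / r := by
        rw [le_div_iff₀ hrR]
        exact_mod_cast Int.ediv_mul_le _ hr0.ne'
      have a3 : ((N : ℝ) - h s) / r + ((N : ℝ) + h s) / r = 2 * N / r := by ring
      linarith
    have hQr : (Q : ℝ) ≤ r := by
      have := hq s hs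
      have : (Q : ℤ) ≤ r := by rw [hr, Int.abs_eq_natAbs]; exact_mod_cast this
      exact_mod_cast this
    have hQ0 : (0 : ℝ) < Q := by exact_mod_cast hQ
    calc (({x : ℤ | x.natAbs < N ∧ q s ∣ x - h s}.ncard : ℕ) : ℝ)
        ≤ (((N - h s) / r + 1 - (-((N + h s) / r))).toNat : ℝ) := by exact_mod_cast h1
      _ = ((((N - h s) / r + 1 + ((N + h s) / r) : ℤ)) : ℝ) := by exact_mod_cast h2
      _ ≤ _ := h3
      _ ≤ _ := by gcongr
  · intro t ht hts
    refine ⟨hb t ht, ?_⟩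
    have := hdet s hs t ht hts.symm
    rw [← dvd_neg, neg_sub] at this
    exact this

/-! ### Dyadic cells -/

/-- dyadic sizes of the data -/
structure Cell where
  g : ℕ
  ta : ℕ
  tb : ℕ
  tc : ℕ
  td : ℕ
  u : ℕ
  v : ℕ
  w : ℕ
  s1 : ℕ
  s2 : ℕ
  s3 : ℕ
  kab : ℕ
  kcd : ℕ
  kac : ℕ
  kbd : ℕ
  kad : ℕ
  kbc : ℕ

/-- the cell of a datum -/
def QD.cell (d : QD) : Cell where
  g := Nat.log 4 d.g.norm.natAbs
  ta := Nat.log 4 d.ta.norm.natAbs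
  tb := Nat.log 4 d.tb.norm.natAbs
  tc := Nat.log 4 d.tc.norm.natAbs
  td := Nat.log 4 d.td.norm.natAbs
  u := Nat.log 4 d.u.norm.natAbs
  v := Nat.log 4 d.v.norm.natAbs
  w := Nat.log 4 d.w.norm.natAbs
  s1 := Nat.log 2 d.s1.natAbs
  s2 := Nat.log 2 d.s2.natAbs
  s3 := Nat.log 2 d.s3.natAbs
  kab := Nat.log 2 d.kab.natAbs
  kcd := Nat.log 2 d.kcd.natAbs
  kac := Nat.log 2 d.kac.natAbs
  kbd := Nat.log 2 d.kbd.natAbs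
  kad := Nat.log 2 d.kad.natAbs
  kbc := Nat.log 2 d.kbc.natAbs

/-- exchange on cells -/
def Cell.swAB (c : Cell) : Cell where
  g := c.g
  ta := c.tb
  tb := c.ta
  tc := c.tc
  td := c.td
  u := c.u
  v := c.w
  w := c.v
  s1 := c.s1
  s2 := c.s3
  s3 := c.s2
  kab := c.kab
  kcd := c.kcd
  kac := c.kbc
  kbd := c.kad
  kad := c.kbd
  kbc := c.kac

theorem QD.cell_swAB (d : QD) : d.swAB.cell = d.cell.swAB := by
  simp [QD.cell, QD.swAB, Cell.swAB]
theorem Cell.swAB_swAB (c : Cell) : c.swAB.swAB = c := rfl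

/-- exchange on cells -/
def Cell.swBC (c : Cell) : Cell where
  g := c.g
  ta := c.ta
  tb := c.tc
  tc := c.tb
  td := c.td
  u := c.v
  v := c.u
  w := c.w
  s1 := c.s2
  s2 := c.s1
  s3 := c.s3
  kab := c.kac
  kcd := c.kbd
  kac := c.kab
  kbd := c.kcd
  kad := c.kad
  kbc := c.kbc

theorem QD.cell_swBC (d : QD) : d.swBC.cell = d.cell.swBC := by
  simp [QD.cell, QD.swBC, Cell.swBC]
theorem Cell.swBC_swBC (c : Cell) : c.swBC.swBC = c := rfl

/-- exchange on cells -/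
def Cell.swCD (c : Cell) : Cell where
  g := c.g
  ta := c.ta
  tb := c.tb
  tc := c.td
  td := c.tc
  u := c.u
  v := c.w
  w := c.v
  s1 := c.s1
  s2 := c.s3
  s3 := c.s2
  kab := c.kab
  kcd := c.kcd
  kac := c.kad
  kbd := c.kbc
  kad := c.kac
  kbc := c.kbd

theorem QD.cell_swCD (d : QD) : d.swCD.cell = d.cell.swCD := by
  simp [QD.cell, QD.swCD, Cell.swCD]
theorem Cell.swCD_swCD (c : Cell) : c.swCD.swCD = c := rfl

/-- data in a given cell -/
def QS (R : ℤ) (c : Cell) : Set QD := {d | QOk R d ∧ d.cell = c}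

theorem QS_swAB (R : ℤ) (c : Cell) : QS R c.swAB = QD.swAB '' QS R c := by
  ext d
  constructor
  · rintro ⟨h1, h2⟩
    refine ⟨d.swAB, ⟨h1.swAB, ?_⟩, d.swAB_swAB⟩
    rw [QD.cell_swAB, h2, Cell.swAB_swAB]
  · rintro ⟨e, ⟨h1, h2⟩, rfl⟩
    exact ⟨h1.swAB, by rw [QD.cell_swAB, h2]⟩

theorem QS_swBC (R : ℤ) (c : Cell) : QS R c.swBC = QD.swBC '' QS R c := by
  ext d
  constructor
  · rintro ⟨h1, h2⟩
    refine ⟨d.swBC, ⟨h1.swBC, ?_⟩, d.swBC_swBC⟩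
    rw [QD.cell_swBC, h2, Cell.swBC_swBC]
  · rintro ⟨e, ⟨h1, h2⟩, rfl⟩
    exact ⟨h1.swBC, by rw [QD.cell_swBC, h2]⟩

theorem QS_swCD (R : ℤ) (c : Cell) : QS R c.swCD = QD.swCD '' QS R c := by
  ext d
  constructor
  · rintro ⟨h1, h2⟩
    refine ⟨d.swCD, ⟨h1.swCD, ?_⟩, d.swCD_swCD⟩
    rw [QD.cell_swCD, h2, Cell.swCD_swCD]
  · rintro ⟨e, ⟨h1, h2⟩, rfl⟩
    exact ⟨h1.swCD, by rw [QD.cell_swCD, h2]⟩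


/-- cell bound -/
def TB (R : ℤ) (Dv : ℝ) (c : Cell) (e : ℕ) : Prop :=
  (QS R c).Finite ∧ ((QS R c).ncard : ℝ) ≤ 2 ^ 64 * Dv ^ 8 * 2 ^ e

theorem TB.swAB {R : ℤ} {Dv : ℝ} {c : Cell} {e : ℕ} (h : TB R Dv c.swAB e) : TB R Dv c e := by
  have hi : Set.InjOn QD.swAB (QS R c) := fun a _ b _ hab => by
    rw [← a.swAB_swAB, ← b.swAB_swAB, hab]
  obtain ⟨h1, h2⟩ := h
  rw [QS_swAB] at h1 h2
  rw [Set.InjOn.ncard_image hi] at h2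
  exact ⟨Set.Finite.of_finite_image h1 hi, h2⟩

theorem TB.swBC {R : ℤ} {Dv : ℝ} {c : Cell} {e : ℕ} (h : TB R Dv c.swBC e) : TB R Dv c e := by
  have hi : Set.InjOn QD.swBC (QS R c) := fun a _ b _ hab => by
    rw [← a.swBC_swBC, ← b.swBC_swBC, hab]
  obtain ⟨h1, h2⟩ := h
  rw [QS_swBC] at h1 h2
  rw [Set.InjOn.ncard_image hi] at h2
  exact ⟨Set.Finite.of_finite_image h1 hi, h2⟩

theorem TB.swCD {R : ℤ} {Dv : ℝ} {c : Cell} {e : ℕ} (h : TB R Dv c.swCD e) : TB R Dv c e := by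
  have hi : Set.InjOn QD.swCD (QS R c) := fun a _ b _ hab => by
    rw [← a.swCD_swCD, ← b.swCD_swCD, hab]
  obtain ⟨h1, h2⟩ := h
  rw [QS_swCD] at h1 h2
  rw [Set.InjOn.ncard_image hi] at h2
  exact ⟨Set.Finite.of_finite_image h1 hi, h2⟩


theorem log_box {m b : ℕ} (hb : 1 < b) (hm : m ≠ 0) {e : ℕ} (h : Nat.log b m = e) :
    b ^ e ≤ m ∧ m < b ^ (e + 1) := by
  subst h
  exact ⟨Nat.pow_log_le_self b hm, Nat.lt_pow_succ_log_self hb m⟩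

theorem glog_box {z : GaussianInt} (hz : z ≠ 0) {e : ℕ} (h : Nat.log 4 z.norm.natAbs = e) :
    (4 : ℤ) ^ e ≤ z.norm ∧ z.norm < 4 ^ (e + 1) := by
  have hp := gnorm_pos hz
  obtain ⟨h1, h2⟩ := log_box (by norm_num) (by omega) h
  have h3 : ((z.norm.natAbs : ℕ) : ℤ) = z.norm := by omega
  constructor
  · rw [← h3]; exact_mod_cast h1
  · rw [← h3]; exact_mod_cast h2

section
variable {R : ℤ} {c : Cell} {d : QD}

theorem QS.b_g (h : d ∈ QS R c) : (4 : ℤ) ^ c.g ≤ d.g.norm ∧ d.g.norm < 4 ^ (c.g + 1) :=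
  glog_box h.1.g0 (congrArg Cell.g h.2)
theorem QS.b_ta (h : d ∈ QS R c) : (4 : ℤ) ^ c.ta ≤ d.ta.norm ∧ d.ta.norm < 4 ^ (c.ta + 1) :=
  glog_box h.1.ta0 (congrArg Cell.ta h.2)
theorem QS.b_tb (h : d ∈ QS R c) : (4 : ℤ) ^ c.tb ≤ d.tb.norm ∧ d.tb.norm < 4 ^ (c.tb + 1) :=
  glog_box h.1.tb0 (congrArg Cell.tb h.2)
theorem QS.b_tc (h : d ∈ QS R c) : (4 : ℤ) ^ c.tc ≤ d.tc.norm ∧ d.tc.norm < 4 ^ (c.tc + 1) :=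
  glog_box h.1.tc0 (congrArg Cell.tc h.2)
theorem QS.b_td (h : d ∈ QS R c) : (4 : ℤ) ^ c.td ≤ d.td.norm ∧ d.td.norm < 4 ^ (c.td + 1) :=
  glog_box h.1.td0 (congrArg Cell.td h.2)
theorem QS.b_u (h : d ∈ QS R c) : (4 : ℤ) ^ c.u ≤ d.u.norm ∧ d.u.norm < 4 ^ (c.u + 1) :=
  glog_box h.1.u0 (congrArg Cell.u h.2)
theorem QS.b_v (h : d ∈ QS R c) : (4 : ℤ) ^ c.v ≤ d.v.norm ∧ d.v.norm < 4 ^ (c.v + 1) :=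
  glog_box h.1.v0 (congrArg Cell.v h.2)
theorem QS.b_w (h : d ∈ QS R c) : (4 : ℤ) ^ c.w ≤ d.w.norm ∧ d.w.norm < 4 ^ (c.w + 1) :=
  glog_box h.1.w0 (congrArg Cell.w h.2)
theorem QS.b_s1 (h : d ∈ QS R c) : 2 ^ c.s1 ≤ d.s1.natAbs ∧ d.s1.natAbs < 2 ^ (c.s1 + 1) :=
  log_box (by norm_num) (Int.natAbs_ne_zero.mpr h.1.s10) (congrArg Cell.s1 h.2)
theorem QS.b_s2 (h : d ∈ QS R c) : 2 ^ c.s2 ≤ d.s2.natAbs ∧ d.s2.natAbs < 2 ^ (c.s2 + 1) :=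
  log_box (by norm_num) (Int.natAbs_ne_zero.mpr h.1.s20) (congrArg Cell.s2 h.2)
theorem QS.b_s3 (h : d ∈ QS R c) : 2 ^ c.s3 ≤ d.s3.natAbs ∧ d.s3.natAbs < 2 ^ (c.s3 + 1) :=
  log_box (by norm_num) (Int.natAbs_ne_zero.mpr h.1.s30) (congrArg Cell.s3 h.2)
theorem QS.b_kab (h : d ∈ QS R c) : 2 ^ c.kab ≤ d.kab.natAbs ∧ d.kab.natAbs < 2 ^ (c.kab + 1) :=
  log_box (by norm_num) (Int.natAbs_ne_zero.mpr h.1.kab0) (congrArg Cell.kab h.2)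
theorem QS.b_kcd (h : d ∈ QS R c) : 2 ^ c.kcd ≤ d.kcd.natAbs ∧ d.kcd.natAbs < 2 ^ (c.kcd + 1) :=
  log_box (by norm_num) (Int.natAbs_ne_zero.mpr h.1.kcd0) (congrArg Cell.kcd h.2)
theorem QS.b_kac (h : d ∈ QS R c) : 2 ^ c.kac ≤ d.kac.natAbs ∧ d.kac.natAbs < 2 ^ (c.kac + 1) :=
  log_box (by norm_num) (Int.natAbs_ne_zero.mpr h.1.kac0) (congrArg Cell.kac h.2)
theorem QS.b_kbd (h : d ∈ QS R c) : 2 ^ c.kbd ≤ d.kbd.natAbs ∧ d.kbd.natAbs < 2 ^ (c.kbd + 1) :=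
  log_box (by norm_num) (Int.natAbs_ne_zero.mpr h.1.kbd0) (congrArg Cell.kbd h.2)
theorem QS.b_kad (h : d ∈ QS R c) : 2 ^ c.kad ≤ d.kad.natAbs ∧ d.kad.natAbs < 2 ^ (c.kad + 1) :=
  log_box (by norm_num) (Int.natAbs_ne_zero.mpr h.1.kad0) (congrArg Cell.kad h.2)
theorem QS.b_kbc (h : d ∈ QS R c) : 2 ^ c.kbc ≤ d.kbc.natAbs ∧ d.kbc.natAbs < 2 ^ (c.kbc + 1) :=
  log_box (by norm_num) (Int.natAbs_ne_zero.mpr h.1.kbc0) (congrArg Cell.kbc h.2)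
end

/-! ### The basic cell bounds -/

theorem gint_cancel {k : ℤ} (hk : k ≠ 0) {a b : GaussianInt} (h : (k : GaussianInt) * a = k * b) :
    a = b := by
  have : (k : GaussianInt) ≠ 0 := by exact_mod_cast hk
  exact mul_left_cancel₀ this h

theorem le_prod4 {a b c x R : ℤ} (ha : 0 < a) (hb : 0 < b) (hc : 0 < c) (hx : 0 ≤ x)
    (h : a * b * c * x ≤ R) : x ≤ R := by
  have h0 : 0 < a * b * c := by positivity
  have h1 : 1 ≤ a * b * c := h0
  nlinarith

section
variable {R : ℤ} {c : Cell} {d : QD}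

theorem QOk.m3_sq (h : QOk R d) : (d.s3 ^ 2 * d.kad * d.kbc * d.w.norm) ^ 2 ≤ R ^ 2 := by
  have h1 := h.zad
  have h2 := h.zbc
  have ga := gnorm_pos h.ta0
  have gb := gnorm_pos h.tb0
  have gc := gnorm_pos h.tc0
  have gd := gnorm_pos h.td0
  have gg := gnorm_pos h.g0
  have gw := gnorm_pos h.w0
  have e1 : d.w.norm * (d.s3 * d.kad) ^ 2 ≤ R :=
    le_prod4 gg gb gc (by positivity) (by linarith)
  have e2 : d.w.norm * (d.s3 * d.kbc) ^ 2 ≤ R :=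
    le_prod4 gg ga gd (by positivity) (by linarith)
  have e3 : 0 ≤ d.w.norm * (d.s3 * d.kad) ^ 2 := by positivity
  have e4 : 0 ≤ d.w.norm * (d.s3 * d.kbc) ^ 2 := by positivity
  nlinarith [mul_le_mul e1 e2 e4 (e3.trans e1)]

theorem QOk.X_sq (h : QOk R d) : d.X ^ 2 ≤ 4 * R ^ 2 := by
  have ga := gnorm_pos h.ta0
  have gb := gnorm_pos h.tb0
  have gc := gnorm_pos h.tc0
  have gd := gnorm_pos h.td0
  have gg := gnorm_pos h.g0
  have gv := gnorm_pos h.v0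
  have gw := gnorm_pos h.w0
  have s2p : 0 < d.s2 ^ 2 := by have := h.s20; positivity
  have s3p : 0 < d.s3 ^ 2 := by have := h.s30; positivity
  have e1 : d.ta.norm * d.kbc ^ 2 ≤ R :=
    le_prod4 (a := d.g.norm * d.td.norm) (by positivity) gw s3p (by positivity) (by linarith [h.zbc])
  have e2 : d.ta.norm * d.kbd ^ 2 ≤ R :=
    le_prod4 (a := d.g.norm * d.tc.norm) (by positivity) gv s2p (by positivity) (by linarith [h.zbd])
  have e3 : d.tb.norm * d.kac ^ 2 ≤ R :=
    le_prod4 (a := d.g.norm * d.td.norm) (by positivity) gv s2p (by positivity) (by linarith [h.zac])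
  have e4 : d.tb.norm * d.kad ^ 2 ≤ R :=
    le_prod4 (a := d.g.norm * d.tc.norm) (by positivity) gw s3p (by positivity) (by linarith [h.zad])
  have n1 : 0 ≤ d.ta.norm * d.kbc ^ 2 := by positivity
  have n2 : 0 ≤ d.ta.norm * d.kbd ^ 2 := by positivity
  have n3 : 0 ≤ d.tb.norm * d.kac ^ 2 := by positivity
  have n4 : 0 ≤ d.tb.norm * d.kad ^ 2 := by positivity
  have f1 : (d.kbc * d.kbd * d.ta.norm) ^ 2 ≤ R ^ 2 := by
    nlinarith [mul_le_mul e1 e2 n2 (n1.trans e1)]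
  have f2 : (d.kac * d.kad * d.tb.norm) ^ 2 ≤ R ^ 2 := by
    nlinarith [mul_le_mul e3 e4 n4 (n3.trans e3)]
  rw [QD.X]
  nlinarith [sq_nonneg (d.kbc * d.kbd * d.ta.norm + d.kac * d.kad * d.tb.norm)]

end


theorem TB.of {R : ℤ} {Dv : ℝ} {c : Cell} {β : Type*} {f : QD → β} {M C : ℝ} {e j : ℕ}
    (hD1 : 1 ≤ Dv) (hf : FB (QS R c) f M)
    (hM : M ≤ C * Dv ^ j * 2 ^ e) (hC : C ≤ 2 ^ 64) (hj : j ≤ 8)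
    (hinj : ∀ s ∈ QS R c, ∀ t ∈ QS R c, f s = f t → s = t) : TB R Dv c e := by
  obtain ⟨h1, h2⟩ := hf.done hinj
  refine ⟨h1, h2.trans (hM.trans ?_)⟩
  have : Dv ^ j ≤ Dv ^ 8 := pow_le_pow_right₀ hD1 hj
  have h0 : 0 ≤ Dv := zero_le_one.trans hD1
  gcongr

theorem QD.ext' {d e : QD} (h0 : d.g = e.g) (h1 : d.ta = e.ta) (h2 : d.tb = e.tb) (h3 : d.tc = e.tc)
    (h4 : d.td = e.td) (h5 : d.u = e.u) (h6 : d.v = e.v) (h7 : d.w = e.w) (h8 : d.s1 = e.s1)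
    (h9 : d.s2 = e.s2) (h10 : d.s3 = e.s3) (h11 : d.kab = e.kab) (h12 : d.kcd = e.kcd)
    (h13 : d.kac = e.kac) (h14 : d.kbd = e.kbd) (h15 : d.kad = e.kad) (h16 : d.kbc = e.kbc) :
    d = e := by
  cases d; cases e; simp_all


theorem TB.III {R : ℤ} {Dv : ℝ} (hD1 : 1 ≤ Dv) (c : Cell) : TB R Dv c (2 * c.g + 2 * c.ta + 2 * c.tb + 2 * c.tc + 2 * c.td + 2 * c.u + 2 * c.v
    + 2 * c.w) := by
  have F := (((((((((FB.start (QS R c)).gbox QD.g c.g fun s h => (QS.b_g h).2).gbox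
    QD.ta c.ta fun s h => (QS.b_ta h).2).gbox
    QD.tb c.tb fun s h => (QS.b_tb h).2).gbox
    QD.tc c.tc fun s h => (QS.b_tc h).2).gbox
    QD.td c.td fun s h => (QS.b_td h).2).gbox
    QD.u c.u fun s h => (QS.b_u h).2).gbox
    QD.v c.v fun s h => (QS.b_v h).2).gbox
    QD.w c.w fun s h => (QS.b_w h).2).univ QD.sg
  refine TB.of (C := 16 ^ 8 * 2 ^ 9) (j := 0) hD1 F (le_of_eq ?_) (by norm_num)
    (by norm_num) ?_
  · simp only [Fintype.card_pi, Fintype.card_bool, Finset.prod_const, Finset.card_univ,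
      Fintype.card_fin]
    push_cast
    ring
  · intro s hs t ht hst
    simp only [Prod.mk.injEq] at hst
    obtain ⟨⟨⟨⟨⟨⟨⟨⟨⟨-, h1⟩, h2⟩, h3⟩, h4⟩, h5⟩, h6⟩, h7⟩, h8⟩, h9⟩ := hst
    exact hs.1.det_sg ht.1 h1 ⟨h2, h3, h4, h5, h6, h7, h8⟩ h9


theorem TB.I {R : ℤ} {Dv : ℝ} (hD : DivB (4 * R ^ 2) Dv) (hD1 : 1 ≤ Dv) (c : Cell) : TB R Dv c (2 * c.g + 2 * c.ta + 2 * c.tb + c.s1 + c.kab + c.kcd + 2 * c.u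
    + c.s2 + c.kac + c.kbd + 2 * c.v) := by
  have F := (((((((((((FB.start (QS R c)).gbox QD.g c.g fun s h => (QS.b_g h).2).gbox
    QD.ta c.ta fun s h => (QS.b_ta h).2).gbox
    QD.tb c.tb fun s h => (QS.b_tb h).2).ibox
    QD.s1 c.s1 fun s h => (QS.b_s1 h).2).ibox
    QD.kab c.kab fun s h => (QS.b_kab h).2).ibox
    QD.kcd c.kcd fun s h => (QS.b_kcd h).2).gbox
    QD.u c.u fun s h => (QS.b_u h).2).ibox
    QD.s2 c.s2 fun s h => (QS.b_s2 h).2).ibox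
    QD.kac c.kac fun s h => (QS.b_kac h).2).ibox
    QD.kbd c.kbd fun s h => (QS.b_kbd h).2).gbox
    QD.v c.v fun s h => (QS.b_v h).2
  let z : QD → GaussianInt := fun d => ((d.s3 ^ 2 * d.kad * d.kbc * d.w.norm : ℤ) : GaussianInt)
  have hz0 : ∀ s ∈ QS R c, z s ≠ 0 := fun s hs => by
    have := hs.1.s30; have := hs.1.kad0; have := hs.1.kbc0; have := (gnorm_pos hs.1.w0).ne'
    have h0 : s.s3 ^ 2 * s.kad * s.kbc * s.w.norm ≠ 0 := by positivity
    simp only [z]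
    exact_mod_cast h0
  have hzn : ∀ s ∈ QS R c, (z s).norm ≤ 4 * R ^ 2 := fun s hs => by
    rw [gnorm_int]
    nlinarith [hs.1.m3_sq]
  have hzd : ∀ s ∈ QS R c, ∀ t ∈ QS R c, s.s1 = t.s1 → s.kab = t.kab → s.kcd = t.kcd → s.u = t.u →
      s.s2 = t.s2 → s.kac = t.kac → s.kbd = t.kbd → s.v = t.v → z s = z t := by
    intro s hs t ht a1 a2 a3 a4 a5 a6 a7 a8
    have e1 := hs.1.ptolemy
    have e2 := ht.1.ptolemy
    rw [← a1, ← a2, ← a3, ← a4, ← a5, ← a6, ← a7, ← a8] at e2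
    have : s.s3 ^ 2 * s.kad * s.kbc * s.w.norm = t.s3 ^ 2 * t.kad * t.kbc * t.w.norm := by linarith
    simp only [z, this]
  have F2 := (((F.gdiv QD.w z hD hz0 hzn (by
      intro s hs
      refine ⟨(s.s3 ^ 2 * s.kad * s.kbc : ℤ) * star s.w, ?_⟩
      simp only [z]
      push_cast [gnorm_eq]; ring) (by
      intro s hs t ht hst
      simp only [Prod.mk.injEq] at hst
      apply hzd s hs t ht <;> simp only [hst])).idiv QD.s3 z hD hz0 hzn (by
      intro s hs
      refine ⟨(s.s3 * s.kad * s.kbc * s.w.norm : ℤ), ?_⟩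
      simp only [z]
      push_cast; ring) (by
      intro s hs t ht hst
      simp only [Prod.mk.injEq] at hst
      apply hzd s hs t ht <;> simp only [hst])).idiv QD.kad z hD hz0 hzn (by
      intro s hs
      refine ⟨(s.s3 ^ 2 * s.kbc * s.w.norm : ℤ), ?_⟩
      simp only [z]
      push_cast; ring) (by
      intro s hs t ht hst
      simp only [Prod.mk.injEq] at hst
      apply hzd s hs t ht <;> simp only [hst])).idiv QD.kbc z hD hz0 hzn (by
      intro s hs
      refine ⟨(s.s3 ^ 2 * s.kad * s.w.norm : ℤ), ?_⟩
      simp only [z]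
      push_cast; ring) (by
      intro s hs t ht hst
      simp only [Prod.mk.injEq] at hst
      apply hzd s hs t ht <;> simp only [hst])
  refine TB.of (C := 16 ^ 5 * 4 ^ 6) (j := 4) hD1 F2 (le_of_eq ?_) (by norm_num)
    (by norm_num) ?_
  · ring
  · intro s hs t ht hst
    simp only [Prod.mk.injEq] at hst
    obtain ⟨⟨⟨⟨⟨⟨⟨⟨⟨⟨⟨⟨⟨⟨⟨-, h1⟩, h2⟩, h3⟩, h4⟩, h5⟩, h6⟩, h7⟩, h8⟩, h9⟩, h10⟩, h11⟩, h12⟩, h13⟩, h14⟩, h15⟩ := hst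
    have e1 := hs.1.rabc
    have e2 := ht.1.rabc
    have e3 := hs.1.rabd
    have e4 := ht.1.rabd
    simp only [← h2, ← h3, ← h4, ← h5, ← h7, ← h8, ← h9, ← h10, ← h11, ← h12, ← h13, ← h14, ← h15] at e2 e4
    have hne : (s.s1 : GaussianInt) * s.kab * s.u ≠ 0 := by
      have := hs.1.s10; have := hs.1.kab0; have := hs.1.u0
      simp_all
    have k1 : s.tc = t.tc := mul_left_cancel₀ hne (by linear_combination e1 - e2)
    have k2 : s.td = t.td := mul_left_cancel₀ hne (by linear_combination e3 - e4)
    exact QD.ext' h1 h2 h3 k1 k2 h7 h11 h12 h4 h8 h13 h5 h6 h9 h10 h14 h15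

/-- kcd is determined by the rest -/
theorem QOk.kcd_det {R : ℤ} {s t : QD} (h : QOk R s) (k : QOk R t) (h1 : s.X = t.X) (h2 : s.Y = t.Y)
    (h3 : s.kab = t.kab) : s.kcd = t.kcd := by
  have e1 := h.jeq
  have e2 := k.jeq
  rw [← h1, ← h2, ← h3] at e2
  exact mul_right_cancel₀ h.X_ne (by linarith)

theorem TB.II2same {R : ℤ} {Dv : ℝ} (hD : DivB (4 * R ^ 2) Dv) (hD1 : 1 ≤ Dv) (c : Cell) : TB R Dv c (2 * c.g + c.s1 + c.s2 + c.s3 + c.kac + c.kbd + c.kad + c.kbc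
    + 2 * c.ta + 2 * c.tb + 2 * c.tc + 2 * c.td + 2 * c.u) := by
  have F := ((((((((((((((FB.start (QS R c)).gbox QD.g c.g fun s h => (QS.b_g h).2).gbox
    QD.ta c.ta fun s h => (QS.b_ta h).2).gbox
    QD.tb c.tb fun s h => (QS.b_tb h).2).gbox
    QD.tc c.tc fun s h => (QS.b_tc h).2).gbox
    QD.td c.td fun s h => (QS.b_td h).2).ibox
    QD.s1 c.s1 fun s h => (QS.b_s1 h).2).ibox
    QD.s2 c.s2 fun s h => (QS.b_s2 h).2).ibox
    QD.s3 c.s3 fun s h => (QS.b_s3 h).2).ibox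
    QD.kac c.kac fun s h => (QS.b_kac h).2).ibox
    QD.kbd c.kbd fun s h => (QS.b_kbd h).2).ibox
    QD.kad c.kad fun s h => (QS.b_kad h).2).ibox
    QD.kbc c.kbc fun s h => (QS.b_kbc h).2).gbox
    QD.u c.u fun s h => (QS.b_u h).2).idiv QD.kab (fun d => (d.X : GaussianInt)) hD
    (fun s hs => by exact_mod_cast hs.1.X_ne)
    (fun s hs => by rw [gnorm_int]; exact hs.1.X_sq)
    (fun s hs => by
      obtain ⟨m, hm⟩ := hs.1.kab_dvd
      exact ⟨(m : GaussianInt), by rw [hm]; push_cast; ring⟩)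
    (by
      intro s hs t ht hst
      simp only [Prod.mk.injEq] at hst
      simp only [QD.X, hst])
  refine TB.of (C := 16 ^ 6 * 4 ^ 7) (j := 1) hD1 F (le_of_eq ?_) (by norm_num)
    (by norm_num) ?_
  · ring
  · intro s hs t ht hst
    simp only [Prod.mk.injEq] at hst
    obtain ⟨⟨⟨⟨⟨⟨⟨⟨⟨⟨⟨⟨⟨⟨-, h1⟩, h2⟩, h3⟩, h4⟩, h5⟩, h6⟩, h7⟩, h8⟩, h9⟩, h10⟩, h11⟩, h12⟩, h13⟩, h14⟩ := hst
    have k1 := hs.1.kcd_det ht.1 (by simp only [QD.X, *]) (by simp only [QD.Y, *]) h14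
    obtain ⟨k2, k3⟩ := hs.1.det_u ht.1 h2 h3 h4 h5 h6 h7 h8 h14 k1 h9 h10 h11 h13
    exact QD.ext' h1 h2 h3 h4 h5 h13 k2 k3 h6 h7 h8 h14 k1 h9 h10 h11 h12

theorem TB.II2diff {R : ℤ} {Dv : ℝ} (hD : DivB (4 * R ^ 2) Dv) (hD1 : 1 ≤ Dv) (c : Cell) : TB R Dv c (2 * c.g + c.s1 + c.s2 + c.s3 + c.kac + c.kbd + c.kad + c.kbc
    + 2 * c.ta + 2 * c.tb + 2 * c.tc + 2 * c.td + 2 * c.v) := by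
  have F := ((((((((((((((FB.start (QS R c)).gbox QD.g c.g fun s h => (QS.b_g h).2).gbox
    QD.ta c.ta fun s h => (QS.b_ta h).2).gbox
    QD.tb c.tb fun s h => (QS.b_tb h).2).gbox
    QD.tc c.tc fun s h => (QS.b_tc h).2).gbox
    QD.td c.td fun s h => (QS.b_td h).2).ibox
    QD.s1 c.s1 fun s h => (QS.b_s1 h).2).ibox
    QD.s2 c.s2 fun s h => (QS.b_s2 h).2).ibox
    QD.s3 c.s3 fun s h => (QS.b_s3 h).2).ibox
    QD.kac c.kac fun s h => (QS.b_kac h).2).ibox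
    QD.kbd c.kbd fun s h => (QS.b_kbd h).2).ibox
    QD.kad c.kad fun s h => (QS.b_kad h).2).ibox
    QD.kbc c.kbc fun s h => (QS.b_kbc h).2).gbox
    QD.v c.v fun s h => (QS.b_v h).2).idiv QD.kab (fun d => (d.X : GaussianInt)) hD
    (fun s hs => by exact_mod_cast hs.1.X_ne)
    (fun s hs => by rw [gnorm_int]; exact hs.1.X_sq)
    (fun s hs => by
      obtain ⟨m, hm⟩ := hs.1.kab_dvd
      exact ⟨(m : GaussianInt), by rw [hm]; push_cast; ring⟩)
    (by
      intro s hs t ht hst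
      simp only [Prod.mk.injEq] at hst
      simp only [QD.X, hst])
  refine TB.of (C := 16 ^ 6 * 4 ^ 7) (j := 1) hD1 F (le_of_eq ?_) (by norm_num)
    (by norm_num) ?_
  · ring
  · intro s hs t ht hst
    simp only [Prod.mk.injEq] at hst
    obtain ⟨⟨⟨⟨⟨⟨⟨⟨⟨⟨⟨⟨⟨⟨-, h1⟩, h2⟩, h3⟩, h4⟩, h5⟩, h6⟩, h7⟩, h8⟩, h9⟩, h10⟩, h11⟩, h12⟩, h13⟩, h14⟩ := hst
    have k1 := hs.1.kcd_det ht.1 (by simp only [QD.X, *]) (by simp only [QD.Y, *]) h14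
    obtain ⟨k2, k3⟩ := hs.1.det_v ht.1 h2 h3 h4 h5 h6 h7 h8 h14 k1 h9 h10 h11 h13
    exact QD.ext' h1 h2 h3 h4 h5 k2 h13 k3 h6 h7 h8 h14 k1 h9 h10 h11 h12

/-! ### Bounds using residue classes -/

theorem QOk.Y_det {R : ℤ} {s t : QD} (h : QOk R s) (k : QOk R t) (h1 : s.X = t.X)
    (h2 : s.kcd = t.kcd) (h3 : s.kab = t.kab) : s.Y = t.Y := by
  have e1 := h.jeq
  have e2 := k.jeq
  rw [← h1, ← h2, ← h3] at e2
  exact mul_left_cancel₀ h.kab0 (by linarith)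

theorem QOk.nc_cong {R : ℤ} {s t : QD} (h : QOk R s) (hY : s.Y = t.Y)
    (h1 : s.kac = t.kac) (h2 : s.kbd = t.kbd) (h3 : s.kad = t.kad) (h4 : s.kbc = t.kbc) :
    s.kac * s.kbc ∣ s.tc.norm - t.tc.norm := by
  have hc : IsCoprime (s.kac * s.kbc) (s.kad * s.kbd) := by
    have c2 := h.c2
    have c3 := h.c3
    have c23 := h.c23
    have a1 : IsCoprime s.kac s.kad := c23.of_mul_left_left.of_mul_left_right.of_mul_right_left.of_mul_right_right
    have a2 : IsCoprime s.kbd s.kbc := c23.of_mul_left_right.of_mul_right_right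
    exact IsCoprime.mul_left (a1.mul_right c2) (c3.symm.mul_right a2.symm)
  apply hc.dvd_of_dvd_mul_left
  rw [QD.Y, QD.Y, ← h1, ← h2, ← h3, ← h4] at hY
  exact ⟨s.td.norm - t.td.norm, by linear_combination hY⟩

theorem QOk.nd_det {R : ℤ} {s t : QD} (h : QOk R s) (hY : s.Y = t.Y)
    (h1 : s.kac = t.kac) (h2 : s.kbd = t.kbd) (h3 : s.kad = t.kad) (h4 : s.kbc = t.kbc)
    (h5 : s.tc.norm = t.tc.norm) : s.td.norm = t.td.norm := by
  rw [QD.Y, QD.Y, ← h1, ← h2, ← h3, ← h4, ← h5] at hY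
  exact mul_left_cancel₀ (mul_ne_zero h.kac0 h.kbc0) (by linarith)

theorem QOk.nc_sq {R : ℤ} {s : QD} (h : QOk R s) : s.tc.norm ^ 2 ≤ 4 * R ^ 2 := by
  have ga := gnorm_pos h.ta0
  have gc := gnorm_pos h.tc0
  have gg := gnorm_pos h.g0
  have gv := gnorm_pos h.v0
  have kp : 0 < (s.s2 * s.kbd) ^ 2 := by have := h.s20; have := h.kbd0; positivity
  have e2 : s.tc.norm ≤ R :=
    le_prod4 (a := s.g.norm * s.ta.norm) (by positivity) gv kp gc.le (by linarith [h.zbd])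
  nlinarith

theorem QOk.nd_sq {R : ℤ} {s : QD} (h : QOk R s) : s.td.norm ^ 2 ≤ 4 * R ^ 2 := h.swCD.nc_sq

theorem res_fac (a b : ℕ) : 1 + 2 * ((4 ^ (a + 1) : ℕ) : ℝ) / ((2 ^ b : ℕ) : ℝ) ≤ 16 * 2 ^ (2 * a - b) := by
  have h4 : ((4 ^ (a + 1) : ℕ) : ℝ) = 4 * 2 ^ (2 * a) := by
    push_cast; rw [pow_mul]; norm_num; ring
  rw [h4]
  have h1 : (1 : ℝ) ≤ 2 ^ (2 * a - b) := one_le_pow₀ (by norm_num)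
  have h2 : (2 : ℝ) ^ (2 * a) / ((2 ^ b : ℕ) : ℝ) ≤ 2 ^ (2 * a - b) := by
    push_cast
    rw [div_le_iff₀ (by positivity), ← pow_add]
    exact pow_le_pow_right₀ (by norm_num) (by omega)
  have : 2 * (4 * (2 : ℝ) ^ (2 * a)) / ((2 ^ b : ℕ) : ℝ) = 8 * (2 ^ (2 * a) / ((2 ^ b : ℕ) : ℝ)) := by
    ring
  linarith

theorem TB.II3same {R : ℤ} {Dv : ℝ} (hD : DivB (4 * R ^ 2) Dv) (hD1 : 1 ≤ Dv) (c : Cell) :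
    TB R Dv c (2 * c.g + c.s1 + c.s2 + c.s3 + c.kcd + c.kac + c.kbd + c.kad + c.kbc
    + 2 * c.ta + 2 * c.tb + 2 * c.u + (2 * c.tc - (c.kac + c.kbc))) := by
  have F := (((((((((((((FB.start (QS R c)).gbox QD.g c.g fun s h => (QS.b_g h).2).gbox
    QD.ta c.ta fun s h => (QS.b_ta h).2).gbox
    QD.tb c.tb fun s h => (QS.b_tb h).2).ibox
    QD.kcd c.kcd fun s h => (QS.b_kcd h).2).ibox
    QD.s1 c.s1 fun s h => (QS.b_s1 h).2).ibox
    QD.s2 c.s2 fun s h => (QS.b_s2 h).2).ibox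
    QD.s3 c.s3 fun s h => (QS.b_s3 h).2).ibox
    QD.kac c.kac fun s h => (QS.b_kac h).2).ibox
    QD.kbd c.kbd fun s h => (QS.b_kbd h).2).ibox
    QD.kad c.kad fun s h => (QS.b_kad h).2).ibox
    QD.kbc c.kbc fun s h => (QS.b_kbc h).2).gbox
    QD.u c.u fun s h => (QS.b_u h).2).idiv QD.kab (fun d => (d.X : GaussianInt)) hD
    (fun s hs => by exact_mod_cast hs.1.X_ne)
    (fun s hs => by rw [gnorm_int]; exact hs.1.X_sq)
    (fun s hs => by
      obtain ⟨m, hm⟩ := hs.1.kab_dvd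
      exact ⟨(m : GaussianInt), by rw [hm]; push_cast; ring⟩)
    (by
      intro s hs t ht hst
      simp only [Prod.mk.injEq] at hst
      simp only [QD.X, hst])
  have F2 := F.ires (fun d => d.tc.norm) (fun d => d.kac * d.kbc) (4 ^ (c.tc + 1))
    (2 ^ (c.kac + c.kbc)) (by positivity) (fun s hs => by
      rw [Int.natAbs_mul, pow_add]
      exact Nat.mul_le_mul (QS.b_kac hs).1 (QS.b_kbc hs).1) (fun s hs => by
      have := (QS.b_tc hs).2
      have h0 := gnorm_nonneg s.tc
      zify
      rw [abs_of_nonneg h0]; exact this) (by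
      intro s hs t ht hst
      simp only [Prod.mk.injEq] at hst
      obtain ⟨⟨⟨⟨⟨⟨⟨⟨⟨⟨⟨⟨⟨-, h1⟩, h2⟩, h3⟩, h4⟩, h5⟩, h6⟩, h7⟩, h8⟩, h9⟩, h10⟩, h11⟩, h12⟩, h13⟩ := hst
      have hY := hs.1.Y_det ht.1 (by simp only [QD.X, *]) h4 h13
      exact hs.1.nc_cong hY h8 h9 h10 h11)
  have F3 := F2.gdiv QD.tc (fun d => (d.tc.norm : GaussianInt)) hD
    (fun s hs => by exact_mod_cast (gnorm_pos hs.1.tc0).ne')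
    (fun s hs => by rw [gnorm_int]; exact hs.1.nc_sq)
    (fun s hs => ⟨star s.tc, gnorm_eq _⟩)
    (by
      intro s hs t ht hst
      simp only [Prod.mk.injEq] at hst
      simp only [hst])
  have F4 := F3.gdiv QD.td (fun d => (d.td.norm : GaussianInt)) hD
    (fun s hs => by exact_mod_cast (gnorm_pos hs.1.td0).ne')
    (fun s hs => by rw [gnorm_int]; exact hs.1.nd_sq)
    (fun s hs => ⟨star s.td, gnorm_eq _⟩)
    (by
      intro s hs t ht hst
      simp only [Prod.mk.injEq] at hst
      obtain ⟨⟨⟨⟨⟨⟨⟨⟨⟨⟨⟨⟨⟨⟨⟨-, h1⟩, h2⟩, h3⟩, h4⟩, h5⟩, h6⟩, h7⟩, h8⟩, h9⟩, h10⟩, h11⟩, h12⟩, h13⟩, h14⟩, h15⟩ := hst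
      have hY := hs.1.Y_det ht.1 (by simp only [QD.X, *]) h4 h13
      simp only [hs.1.nd_det hY h8 h9 h10 h11 h14])
  have h0 : (0 : ℝ) ≤ Dv := zero_le_one.trans hD1
  refine TB.of (C := 16 ^ 5 * 4 ^ 8) (j := 3) hD1 F4 ?_ (by norm_num)
    (by norm_num) ?_
  · have := res_fac c.tc (c.kac + c.kbc)
    refine (mul_le_mul_of_nonneg_right (mul_le_mul_of_nonneg_right (mul_le_mul_of_nonneg_left this
      (by positivity)) h0) h0).trans (le_of_eq ?_)
    rw [pow_add _ _ (2 * c.tc - (c.kac + c.kbc))]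
    ring
  · intro s hs t ht hst
    simp only [Prod.mk.injEq] at hst
    obtain ⟨⟨⟨⟨⟨⟨⟨⟨⟨⟨⟨⟨⟨⟨⟨⟨-, h1⟩, h2⟩, h3⟩, h4⟩, h5⟩, h6⟩, h7⟩, h8⟩, h9⟩, h10⟩, h11⟩, h12⟩, h13⟩, h14⟩, h15⟩, h16⟩ := hst
    obtain ⟨k2, k3⟩ := hs.1.det_u ht.1 h2 h3 h15 h16 h5 h6 h7 h13 h4 h8 h9 h10 h12
    exact QD.ext' h1 h2 h3 h15 h16 h12 k2 k3 h5 h6 h7 h13 h4 h8 h9 h10 h11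

theorem TB.II3diff {R : ℤ} {Dv : ℝ} (hD : DivB (4 * R ^ 2) Dv) (hD1 : 1 ≤ Dv) (c : Cell) :
    TB R Dv c (2 * c.g + c.s1 + c.s2 + c.s3 + c.kcd + c.kac + c.kbd + c.kad + c.kbc
    + 2 * c.ta + 2 * c.tb + 2 * c.v + (2 * c.tc - (c.kac + c.kbc))) := by
  have F := (((((((((((((FB.start (QS R c)).gbox QD.g c.g fun s h => (QS.b_g h).2).gbox
    QD.ta c.ta fun s h => (QS.b_ta h).2).gbox
    QD.tb c.tb fun s h => (QS.b_tb h).2).ibox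
    QD.kcd c.kcd fun s h => (QS.b_kcd h).2).ibox
    QD.s1 c.s1 fun s h => (QS.b_s1 h).2).ibox
    QD.s2 c.s2 fun s h => (QS.b_s2 h).2).ibox
    QD.s3 c.s3 fun s h => (QS.b_s3 h).2).ibox
    QD.kac c.kac fun s h => (QS.b_kac h).2).ibox
    QD.kbd c.kbd fun s h => (QS.b_kbd h).2).ibox
    QD.kad c.kad fun s h => (QS.b_kad h).2).ibox
    QD.kbc c.kbc fun s h => (QS.b_kbc h).2).gbox
    QD.v c.v fun s h => (QS.b_v h).2).idiv QD.kab (fun d => (d.X : GaussianInt)) hD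
    (fun s hs => by exact_mod_cast hs.1.X_ne)
    (fun s hs => by rw [gnorm_int]; exact hs.1.X_sq)
    (fun s hs => by
      obtain ⟨m, hm⟩ := hs.1.kab_dvd
      exact ⟨(m : GaussianInt), by rw [hm]; push_cast; ring⟩)
    (by
      intro s hs t ht hst
      simp only [Prod.mk.injEq] at hst
      simp only [QD.X, hst])
  have F2 := F.ires (fun d => d.tc.norm) (fun d => d.kac * d.kbc) (4 ^ (c.tc + 1))
    (2 ^ (c.kac + c.kbc)) (by positivity) (fun s hs => by
      rw [Int.natAbs_mul, pow_add]
      exact Nat.mul_le_mul (QS.b_kac hs).1 (QS.b_kbc hs).1) (fun s hs => by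
      have := (QS.b_tc hs).2
      have h0 := gnorm_nonneg s.tc
      zify
      rw [abs_of_nonneg h0]; exact this) (by
      intro s hs t ht hst
      simp only [Prod.mk.injEq] at hst
      obtain ⟨⟨⟨⟨⟨⟨⟨⟨⟨⟨⟨⟨⟨-, h1⟩, h2⟩, h3⟩, h4⟩, h5⟩, h6⟩, h7⟩, h8⟩, h9⟩, h10⟩, h11⟩, h12⟩, h13⟩ := hst
      have hY := hs.1.Y_det ht.1 (by simp only [QD.X, *]) h4 h13
      exact hs.1.nc_cong hY h8 h9 h10 h11)
  have F3 := F2.gdiv QD.tc (fun d => (d.tc.norm : GaussianInt)) hD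
    (fun s hs => by exact_mod_cast (gnorm_pos hs.1.tc0).ne')
    (fun s hs => by rw [gnorm_int]; exact hs.1.nc_sq)
    (fun s hs => ⟨star s.tc, gnorm_eq _⟩)
    (by
      intro s hs t ht hst
      simp only [Prod.mk.injEq] at hst
      simp only [hst])
  have F4 := F3.gdiv QD.td (fun d => (d.td.norm : GaussianInt)) hD
    (fun s hs => by exact_mod_cast (gnorm_pos hs.1.td0).ne')
    (fun s hs => by rw [gnorm_int]; exact hs.1.nd_sq)
    (fun s hs => ⟨star s.td, gnorm_eq _⟩)
    (by
      intro s hs t ht hst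
      simp only [Prod.mk.injEq] at hst
      obtain ⟨⟨⟨⟨⟨⟨⟨⟨⟨⟨⟨⟨⟨⟨⟨-, h1⟩, h2⟩, h3⟩, h4⟩, h5⟩, h6⟩, h7⟩, h8⟩, h9⟩, h10⟩, h11⟩, h12⟩, h13⟩, h14⟩, h15⟩ := hst
      have hY := hs.1.Y_det ht.1 (by simp only [QD.X, *]) h4 h13
      simp only [hs.1.nd_det hY h8 h9 h10 h11 h14])
  have h0 : (0 : ℝ) ≤ Dv := zero_le_one.trans hD1
  refine TB.of (C := 16 ^ 5 * 4 ^ 8) (j := 3) hD1 F4 ?_ (by norm_num)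
    (by norm_num) ?_
  · have := res_fac c.tc (c.kac + c.kbc)
    refine (mul_le_mul_of_nonneg_right (mul_le_mul_of_nonneg_right (mul_le_mul_of_nonneg_left this
      (by positivity)) h0) h0).trans (le_of_eq ?_)
    rw [pow_add _ _ (2 * c.tc - (c.kac + c.kbc))]
    ring
  · intro s hs t ht hst
    simp only [Prod.mk.injEq] at hst
    obtain ⟨⟨⟨⟨⟨⟨⟨⟨⟨⟨⟨⟨⟨⟨⟨⟨-, h1⟩, h2⟩, h3⟩, h4⟩, h5⟩, h6⟩, h7⟩, h8⟩, h9⟩, h10⟩, h11⟩, h12⟩, h13⟩, h14⟩, h15⟩, h16⟩ := hst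
    obtain ⟨k2, k3⟩ := hs.1.det_v ht.1 h2 h3 h15 h16 h5 h6 h7 h13 h4 h8 h9 h10 h12
    exact QD.ext' h1 h2 h3 h15 h16 k2 h12 k3 h5 h6 h7 h13 h4 h8 h9 h10 h11

theorem res_fac2 (a b : ℕ) : 1 + 2 * ((2 ^ (a + 2) : ℕ) : ℝ) / ((2 ^ b : ℕ) : ℝ) ≤ 16 * 2 ^ (a - b) := by
  have h4 : ((2 ^ (a + 2) : ℕ) : ℝ) = 4 * 2 ^ a := by
    push_cast; rw [pow_add]; norm_num; ring
  rw [h4]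
  have h1 : (1 : ℝ) ≤ 2 ^ (a - b) := one_le_pow₀ (by norm_num)
  have h2 : (2 : ℝ) ^ a / ((2 ^ b : ℕ) : ℝ) ≤ 2 ^ (a - b) := by
    push_cast
    rw [div_le_iff₀ (by positivity), ← pow_add]
    exact pow_le_pow_right₀ (by norm_num) (by omega)
  have : 2 * (4 * (2 : ℝ) ^ a) / ((2 ^ b : ℕ) : ℝ) = 8 * (2 ^ a / ((2 ^ b : ℕ) : ℝ)) := by
    ring
  linarith

theorem imul_box {x y : ℤ} {a b : ℕ} (h1 : x.natAbs < 2 ^ (a + 1)) (h2 : y.natAbs < 2 ^ (b + 1)) :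
    (x * y).natAbs < 2 ^ (a + b + 1 + 1) := by
  rw [Int.natAbs_mul, show a + b + 1 + 1 = (a + 1) + (b + 1) by ring, pow_add]
  exact Nat.mul_lt_mul'' h1 h2

theorem gmul_box {x y : GaussianInt} {a b : ℕ} (h1 : x.norm < 4 ^ (a + 1)) (h2 : y.norm < 4 ^ (b + 1)) :
    (x * y).norm < 4 ^ (a + b + 1 + 1) := by
  rw [Zsqrtd.norm_mul, show a + b + 1 + 1 = (a + 1) + (b + 1) by ring, pow_add]
  exact mul_lt_mul'' h1 h2 (gnorm_nonneg _) (gnorm_nonneg _)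

theorem QOk.vcong {R : ℤ} {s t : QD} (h : QOk R s) (k : QOk R t)
    (h1 : s.s1 * s.kab = t.s1 * t.kab) (h2 : s.s2 * s.kac = t.s2 * t.kac)
    (h3 : s.s3 * s.kbc = t.s3 * t.kbc) (hU : s.v * s.tb = t.v * t.tb) :
    ((s.s1 * s.kab : ℤ) : GaussianInt) ∣ (star s.w * s.ta) - (star t.w * t.ta) := by
  have e1 : ((s.s1 * s.kab : ℤ) : GaussianInt) * (s.u * s.tc) +
      ((s.s3 * s.kbc : ℤ) : GaussianInt) * (star s.w * s.ta) =
      ((s.s2 * s.kac : ℤ) : GaussianInt) * (s.v * s.tb) := by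
    push_cast; linear_combination h.rabc
  have e2 : ((t.s1 * t.kab : ℤ) : GaussianInt) * (t.u * t.tc) +
      ((t.s3 * t.kbc : ℤ) : GaussianInt) * (star t.w * t.ta) =
      ((t.s2 * t.kac : ℤ) : GaussianInt) * (t.v * t.tb) := by
    push_cast; linear_combination k.rabc
  rw [← h1, ← h2, ← h3, ← hU] at e2
  have hc : IsCoprime (s.s1 * s.kab) (s.s3 * s.kbc) := by
    have := h.c13.of_mul_left_left
    rw [mul_assoc, mul_comm s.kad, ← mul_assoc] at this
    exact this.of_mul_right_left
  obtain ⟨p, q, hpq⟩ := hc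
  have hpq' : (p : GaussianInt) * ((s.s1 * s.kab : ℤ) : GaussianInt) +
      (q : GaussianInt) * ((s.s3 * s.kbc : ℤ) : GaussianInt) = 1 := by exact_mod_cast hpq
  refine ⟨p * (star s.w * s.ta - star t.w * t.ta) - q * (s.u * s.tc - t.u * t.tc), ?_⟩
  linear_combination (-(star s.w * s.ta - star t.w * t.ta)) * hpq' + (q : GaussianInt) * (e1 - e2)

theorem QOk.ucong {R : ℤ} {s t : QD} (h : QOk R s) (k : QOk R t)
    (h1 : s.s1 * s.kab = t.s1 * t.kab) (h2 : s.s2 * s.kac = t.s2 * t.kac)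
    (h3 : s.s3 * s.kbc = t.s3 * t.kbc) (hU : s.v * s.tb = t.v * t.tb)
    (hV : star s.w * s.ta = star t.w * t.ta) : s.u * s.tc = t.u * t.tc := by
  have e1 : ((s.s1 * s.kab : ℤ) : GaussianInt) * (s.u * s.tc) +
      ((s.s3 * s.kbc : ℤ) : GaussianInt) * (star s.w * s.ta) =
      ((s.s2 * s.kac : ℤ) : GaussianInt) * (s.v * s.tb) := by
    push_cast; linear_combination h.rabc
  have e2 : ((t.s1 * t.kab : ℤ) : GaussianInt) * (t.u * t.tc) +
      ((t.s3 * t.kbc : ℤ) : GaussianInt) * (star t.w * t.ta) =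
      ((t.s2 * t.kac : ℤ) : GaussianInt) * (t.v * t.tb) := by
    push_cast; linear_combination k.rabc
  rw [← h1, ← h2, ← h3, ← hU, ← hV] at e2
  exact gint_cancel (mul_ne_zero h.s10 h.kab0) (by linear_combination e1 - e2)

theorem QOk.utc_le {R : ℤ} {s : QD} (h : QOk R s) : (s.u * s.tc).norm ≤ R := by
  have gc := gnorm_pos h.tc0
  have gd := gnorm_pos h.td0
  have gg := gnorm_pos h.g0
  have gu := gnorm_pos h.u0
  have kp : 0 < (s.s1 * s.kab) ^ 2 := by have := h.s10; have := h.kab0; positivity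
  rw [Zsqrtd.norm_mul]
  exact le_prod4 gg gd kp (by positivity) (by linarith [h.zab])

theorem QOk.vtb_le {R : ℤ} {s : QD} (h : QOk R s) : (s.v * s.tb).norm ≤ R := h.swBC.utc_le
theorem QOk.wta_le {R : ℤ} {s : QD} (h : QOk R s) : (star s.w * s.ta).norm ≤ R := h.swAB.vtb_le

theorem gle4 {x R : ℤ} (h0 : 0 < x) (h : x ≤ R) : x ≤ 4 * R ^ 2 := by nlinarith

theorem TB.V {R : ℤ} {Dv : ℝ} (hD : DivB (4 * R ^ 2) Dv) (hD1 : 1 ≤ Dv) (c : Cell) :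
    TB R Dv c (2 * c.g + 2 * c.td + (c.s1 + c.kab) + (c.s2 + c.kac) + (c.s3 + c.kbc)
    + 2 * (c.v + c.tb) + 2 * ((c.w + c.ta) - (c.s1 + c.kab))) := by
  have F := ((((((FB.start (QS R c)).gbox QD.g c.g fun s h => (QS.b_g h).2).gbox
    QD.td c.td fun s h => (QS.b_td h).2).ibox
    (fun d => d.s1 * d.kab) (c.s1 + c.kab + 1)
      fun s h => imul_box (QS.b_s1 h).2 (QS.b_kab h).2).ibox
    (fun d => d.s2 * d.kac) (c.s2 + c.kac + 1)
      fun s h => imul_box (QS.b_s2 h).2 (QS.b_kac h).2).ibox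
    (fun d => d.s3 * d.kbc) (c.s3 + c.kbc + 1)
      fun s h => imul_box (QS.b_s3 h).2 (QS.b_kbc h).2).gbox
    (fun d => d.v * d.tb) (c.v + c.tb + 1)
      fun s h => gmul_box (QS.b_v h).2 (QS.b_tb h).2
  have hVb : ∀ s ∈ QS R c, (star s.w * s.ta).norm < 4 ^ (c.w + c.ta + 1 + 1) := fun s h =>
    gmul_box (by rw [Zsqrtd.norm_conj]; exact (QS.b_w h).2) (QS.b_ta h).2
  have hKb : ∀ s ∈ QS R c, 2 ^ (c.s1 + c.kab) ≤ (s.s1 * s.kab).natAbs := fun s hs => by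
      rw [Int.natAbs_mul, pow_add]
      exact Nat.mul_le_mul (QS.b_s1 hs).1 (QS.b_kab hs).1
  have F2 := (F.ires (fun d => (star d.w * d.ta).re) (fun d => d.s1 * d.kab) (2 ^ (c.w + c.ta + 2))
    (2 ^ (c.s1 + c.kab)) (by positivity) hKb (fun s hs => (g_coord_lt (hVb s hs)).1) (by
      intro s hs t ht hst
      simp only [Prod.mk.injEq] at hst
      obtain ⟨⟨⟨⟨⟨⟨-, h1⟩, h2⟩, h3⟩, h4⟩, h5⟩, h6⟩ := hst
      obtain ⟨m, hm⟩ := hs.1.vcong ht.1 h3 h4 h5 h6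
      have := congrArg Zsqrtd.re hm
      rw [Zsqrtd.re_sub, Zsqrtd.re_smul] at this
      exact ⟨m.re, this⟩)).ires (fun d => (star d.w * d.ta).im) (fun d => d.s1 * d.kab)
    (2 ^ (c.w + c.ta + 2))
    (2 ^ (c.s1 + c.kab)) (by positivity) hKb (fun s hs => (g_coord_lt (hVb s hs)).2) (by
      intro s hs t ht hst
      simp only [Prod.mk.injEq] at hst
      obtain ⟨⟨⟨⟨⟨⟨⟨-, h1⟩, h2⟩, h3⟩, h4⟩, h5⟩, h6⟩, h7⟩ := hst
      obtain ⟨m, hm⟩ := hs.1.vcong ht.1 h3 h4 h5 h6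
      have := congrArg Zsqrtd.im hm
      rw [Zsqrtd.im_sub, Zsqrtd.im_smul] at this
      exact ⟨m.im, this⟩)
  have F3 := F2.gdiv QD.v (fun d => d.v * d.tb) hD
    (fun s hs => mul_ne_zero hs.1.v0 hs.1.tb0)
    (fun s hs => gle4 (gnorm_pos (mul_ne_zero hs.1.v0 hs.1.tb0)) hs.1.vtb_le)
    (fun s hs => dvd_mul_right _ _)
    (by
      intro s hs t ht hst
      simp only [Prod.mk.injEq] at hst
      simp only [hst])
  have F4 := F3.gdiv QD.tb (fun d => d.v * d.tb) hD
    (fun s hs => mul_ne_zero hs.1.v0 hs.1.tb0)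
    (fun s hs => gle4 (gnorm_pos (mul_ne_zero hs.1.v0 hs.1.tb0)) hs.1.vtb_le)
    (fun s hs => dvd_mul_left _ _)
    (by
      intro s hs t ht hst
      simp only [Prod.mk.injEq] at hst
      exact hst.1.1.1.2)
  have F5 := F4.gdiv QD.ta (fun d => star d.w * d.ta) hD
    (fun s hs => mul_ne_zero (star_ne_zero.mpr hs.1.w0) hs.1.ta0)
    (fun s hs => gle4 (gnorm_pos (mul_ne_zero (star_ne_zero.mpr hs.1.w0) hs.1.ta0)) hs.1.wta_le)
    (fun s hs => dvd_mul_left _ _)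
    (by
      intro s hs t ht hst
      simp only [Prod.mk.injEq] at hst
      obtain ⟨⟨⟨⟨⟨⟨⟨⟨⟨⟨-, h1⟩, h2⟩, h3⟩, h4⟩, h5⟩, h6⟩, h7⟩, h8⟩, h9⟩, h10⟩ := hst
      exact Zsqrtd.ext h7 h8)
  have F6 := F5.det QD.w (by
      intro s hs t ht hst
      simp only [Prod.mk.injEq] at hst
      obtain ⟨⟨⟨⟨⟨⟨⟨⟨⟨⟨⟨-, h1⟩, h2⟩, h3⟩, h4⟩, h5⟩, h6⟩, h7⟩, h8⟩, h9⟩, h10⟩, h11⟩ := hst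
      have hV : star s.w * s.ta = star t.w * t.ta := Zsqrtd.ext h7 h8
      rw [← h11] at hV
      exact star_injective (mul_right_cancel₀ hs.1.ta0 hV))
  have F7 := F6.gdiv QD.tc (fun d => d.u * d.tc) hD
    (fun s hs => mul_ne_zero hs.1.u0 hs.1.tc0)
    (fun s hs => gle4 (gnorm_pos (mul_ne_zero hs.1.u0 hs.1.tc0)) hs.1.utc_le)
    (fun s hs => dvd_mul_left _ _)
    (by
      intro s hs t ht hst
      simp only [Prod.mk.injEq] at hst
      obtain ⟨⟨⟨⟨⟨⟨⟨⟨⟨⟨⟨⟨-, h1⟩, h2⟩, h3⟩, h4⟩, h5⟩, h6⟩, h7⟩, h8⟩, h9⟩, h10⟩, h11⟩, h12⟩ := hst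
      exact hs.1.ucong ht.1 h3 h4 h5 h6 (Zsqrtd.ext h7 h8))
  have F8 := F7.univ QD.sg
  have h0 : (0 : ℝ) ≤ Dv := zero_le_one.trans hD1
  refine TB.of (C := 16 ^ 2 * 8 ^ 3 * 64 * 16 ^ 2 * 2 ^ 9) (j := 4) hD1 F8 ?_ (by norm_num)
    (by norm_num) ?_
  · have := res_fac2 (c.w + c.ta) (c.s1 + c.kab)
    simp only [Fintype.card_pi, Fintype.card_bool, Finset.prod_const, Finset.card_univ,
      Fintype.card_fin, Nat.cast_pow, Nat.cast_ofNat] at this ⊢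
    generalize hP : 1 + 2 * (2 : ℝ) ^ (c.w + c.ta + 2) / 2 ^ (c.s1 + c.kab) = P at this ⊢
    have hP0 : 0 ≤ P := by rw [← hP]; positivity
    have hPP : P * P ≤ (16 * 2 ^ (c.w + c.ta - (c.s1 + c.kab))) * (16 * 2 ^ (c.w + c.ta - (c.s1 + c.kab))) :=
      mul_le_mul this this hP0 (by positivity)
    calc _ = (16 ^ 2 * 8 ^ 3 * 64 * 2 ^ 9) * Dv ^ 4 * 2 ^ (2 * c.g + 2 * c.td + (c.s1 + c.kab) + (c.s2 + c.kac) + (c.s3 + c.kbc)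
    + 2 * (c.v + c.tb)) * (P * P) := by ring
      _ ≤ _ := mul_le_mul_of_nonneg_left hPP (by positivity)
      _ = _ := by
        rw [pow_add _ _ (2 * ((c.w + c.ta) - (c.s1 + c.kab)))]
        ring
  · intro s hs t ht hst
    simp only [Prod.mk.injEq] at hst
    obtain ⟨⟨⟨⟨⟨⟨⟨⟨⟨⟨⟨⟨⟨⟨-, h1⟩, h2⟩, h3⟩, h4⟩, h5⟩, h6⟩, h7⟩, h8⟩, h9⟩, h10⟩, h11⟩, h12⟩, h13⟩, h14⟩ := hst
    have hu := hs.1.ucong ht.1 h3 h4 h5 h6 (Zsqrtd.ext h7 h8)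
    rw [← h13] at hu
    exact hs.1.det_sg ht.1 h1 ⟨h11, h10, h13, h2, mul_right_cancel₀ hs.1.tc0 hu, h9, h12⟩ h14

/-! ### The linear programming step -/

section
variable {R : ℤ} {c : Cell} {d : QD}

theorem size_log {a b c d x y : ℤ} {ea eb ec ed ex ey L : ℕ} (h : a * b * c * d * (x * y) ^ 2 ≤ R)
    (hR : R < 4 ^ (L + 1)) (ha : 4 ^ ea ≤ a) (hb : 4 ^ eb ≤ b) (hc : 4 ^ ec ≤ c) (hd : 4 ^ ed ≤ d)
    (hx : 2 ^ ex ≤ x.natAbs) (hy : 2 ^ ey ≤ y.natAbs) : ea + eb + ec + ed + ex + ey ≤ L := by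
  have hx' : (4 : ℤ) ^ ex ≤ x ^ 2 := by
    have h1 : (2 : ℤ) ^ ex ≤ (x.natAbs : ℤ) := by exact_mod_cast hx
    rw [← Int.natAbs_sq, show (4 : ℤ) = 2 ^ 2 by norm_num, ← pow_mul, mul_comm, pow_mul]
    exact pow_le_pow_left₀ (by positivity) h1 2
  have hy' : (4 : ℤ) ^ ey ≤ y ^ 2 := by
    have h1 : (2 : ℤ) ^ ey ≤ (y.natAbs : ℤ) := by exact_mod_cast hy
    rw [← Int.natAbs_sq, show (4 : ℤ) = 2 ^ 2 by norm_num, ← pow_mul, mul_comm, pow_mul]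
    exact pow_le_pow_left₀ (by positivity) h1 2
  have h1 : (4 : ℤ) ^ (ea + eb + ec + ed + ex + ey) < 4 ^ (L + 1) := by
    refine lt_of_le_of_lt ?_ hR
    refine le_trans ?_ h
    rw [mul_pow, ← mul_assoc]
    simp only [pow_add]
    have ha0 : 0 ≤ a := le_trans (by positivity) ha
    have hb0 : 0 ≤ b := le_trans (by positivity) hb
    have hc0 : 0 ≤ c := le_trans (by positivity) hc
    have hd0 : 0 ≤ d := le_trans (by positivity) hd
    gcongr
  have := (pow_lt_pow_iff_right₀ (by norm_num : (1 : ℤ) < 4)).mp h1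
  omega
end

theorem TB.of_eq {R : ℤ} {Dv : ℝ} {c : Cell} {e e' : ℕ} (h : TB R Dv c e) (he : e = e') :
    TB R Dv c e' := he ▸ h

theorem cell_lp {R : ℤ} {Dv : ℝ} (hD : DivB (4 * R ^ 2) Dv) (hD1 : 1 ≤ Dv) (c : Cell) (L : ℕ)
    (hR : R < 4 ^ (L + 1)) (hne : (QS R c).Nonempty) (t : ℝ) (ht : ∀ e : ℕ, TB R Dv c e → t ≤ e) :
    37 * t ≤ 110 * L := by
  obtain ⟨d, hd⟩ := hne
  have zab := size_log hd.1.zab hR (QS.b_g hd).1 (QS.b_tc hd).1 (QS.b_td hd).1 (QS.b_u hd).1 (QS.b_s1 hd).1 (QS.b_kab hd).1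
  have zcd := size_log hd.1.zcd hR (QS.b_g hd).1 (QS.b_ta hd).1 (QS.b_tb hd).1 (QS.b_u hd).1 (QS.b_s1 hd).1 (QS.b_kcd hd).1
  have zac := size_log hd.1.zac hR (QS.b_g hd).1 (QS.b_tb hd).1 (QS.b_td hd).1 (QS.b_v hd).1 (QS.b_s2 hd).1 (QS.b_kac hd).1
  have zbd := size_log hd.1.zbd hR (QS.b_g hd).1 (QS.b_ta hd).1 (QS.b_tc hd).1 (QS.b_v hd).1 (QS.b_s2 hd).1 (QS.b_kbd hd).1
  have zad := size_log hd.1.zad hR (QS.b_g hd).1 (QS.b_tb hd).1 (QS.b_tc hd).1 (QS.b_w hd).1 (QS.b_s3 hd).1 (QS.b_kad hd).1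
  have zbc := size_log hd.1.zbc hR (QS.b_g hd).1 (QS.b_ta hd).1 (QS.b_td hd).1 (QS.b_w hd).1 (QS.b_s3 hd).1 (QS.b_kbc hd).1
  have III := ht _ (TB.III hD1 c)
  have I0102 := ht (2 * c.g + 2 * c.ta + 2 * c.tc + 2 * c.u + 2 * c.v + c.s1 + c.s2 + c.kab + c.kac + c.kbd + c.kcd) (TB.of_eq (TB.I hD hD1 c.swBC).swBC (by simp only [Cell.swBC]; omega))
  have I1213 := ht (2 * c.g + 2 * c.tb + 2 * c.td + 2 * c.v + 2 * c.w + c.s2 + c.s3 + c.kac + c.kad + c.kbc + c.kbd) (TB.of_eq (TB.I hD hD1 c.swAB.swBC.swCD.swBC).swBC.swCD.swBC.swAB (by simp only [Cell.swAB, Cell.swBC, Cell.swCD]; omega))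
  have I0201 := ht (2 * c.g + 2 * c.ta + 2 * c.tb + 2 * c.u + 2 * c.w + c.s1 + c.s3 + c.kab + c.kad + c.kbc + c.kcd) (TB.of_eq (TB.I hD hD1 c.swAB).swAB (by simp only [Cell.swAB]; omega))
  have I1203 := ht (2 * c.g + 2 * c.ta + 2 * c.td + 2 * c.v + 2 * c.w + c.s2 + c.s3 + c.kac + c.kad + c.kbc + c.kbd) (TB.of_eq (TB.I hD hD1 c.swBC.swCD.swBC).swBC.swCD.swBC (by simp only [Cell.swBC, Cell.swCD]; omega))
  have I0203 := ht (2 * c.g + 2 * c.ta + 2 * c.td + 2 * c.u + 2 * c.w + c.s1 + c.s3 + c.kab + c.kad + c.kbc + c.kcd) (TB.of_eq (TB.I hD hD1 c.swCD.swBC).swBC.swCD (by simp only [Cell.swBC, Cell.swCD]; omega))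
  have I1202 := ht (2 * c.g + 2 * c.ta + 2 * c.tc + 2 * c.v + 2 * c.w + c.s2 + c.s3 + c.kac + c.kad + c.kbc + c.kbd) (TB.of_eq (TB.I hD hD1 c.swBC.swAB).swAB.swBC (by simp only [Cell.swAB, Cell.swBC]; omega))
  have I0113 := ht (2 * c.g + 2 * c.tb + 2 * c.td + 2 * c.u + 2 * c.v + c.s1 + c.s2 + c.kab + c.kac + c.kbd + c.kcd) (TB.of_eq (TB.I hD hD1 c.swAB.swCD.swBC).swBC.swCD.swAB (by simp only [Cell.swAB, Cell.swBC, Cell.swCD]; omega))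
  have II2_22 := ht (2 * c.g + 2 * c.ta + 2 * c.tb + 2 * c.tc + 2 * c.td + 2 * c.w + c.s1 + c.s2 + c.s3 + c.kab + c.kac + c.kbd + c.kcd) (TB.of_eq (TB.II2same hD hD1 c.swAB.swBC).swBC.swAB (by simp only [Cell.swAB, Cell.swBC]; omega))
  have II2_11 := ht (2 * c.g + 2 * c.ta + 2 * c.tb + 2 * c.tc + 2 * c.td + 2 * c.v + c.s1 + c.s2 + c.s3 + c.kab + c.kad + c.kbc + c.kcd) (TB.of_eq (TB.II2same hD hD1 c.swBC).swBC (by simp only [Cell.swBC]; omega))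
  have II2_12 := ht (2 * c.g + 2 * c.ta + 2 * c.tb + 2 * c.tc + 2 * c.td + 2 * c.w + c.s1 + c.s2 + c.s3 + c.kab + c.kad + c.kbc + c.kcd) (TB.of_eq (TB.II2diff hD hD1 c.swBC.swAB).swAB.swBC (by simp only [Cell.swAB, Cell.swBC]; omega))
  have II2_21 := ht (2 * c.g + 2 * c.ta + 2 * c.tb + 2 * c.tc + 2 * c.td + 2 * c.v + c.s1 + c.s2 + c.s3 + c.kab + c.kac + c.kbd + c.kcd) (TB.of_eq (TB.II2diff hD hD1 c.swAB.swBC.swAB).swAB.swBC.swAB (by simp only [Cell.swAB, Cell.swBC]; omega))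
  have II3_010 := ht (2 * c.g + 2 * c.tc + 2 * c.td + 2 * c.u + c.s1 + c.s2 + c.s3 + c.kab + c.kac + c.kad + c.kbc + c.kbd + ((2 * c.ta) - (c.kac + c.kad))) (TB.of_eq (TB.II3same hD hD1 c.swBC.swAB.swCD.swBC).swBC.swCD.swAB.swBC (by simp only [Cell.swAB, Cell.swBC, Cell.swCD]; omega))
  have II3_011 := ht (2 * c.g + 2 * c.tc + 2 * c.td + 2 * c.v + c.s1 + c.s2 + c.s3 + c.kab + c.kac + c.kad + c.kbc + c.kbd + ((2 * c.ta) - (c.kac + c.kad))) (TB.of_eq (TB.II3diff hD hD1 c.swBC.swAB.swCD.swBC).swBC.swCD.swAB.swBC (by simp only [Cell.swAB, Cell.swBC, Cell.swCD]; omega))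
  have II3_030 := ht (2 * c.g + 2 * c.tb + 2 * c.tc + 2 * c.u + c.s1 + c.s2 + c.s3 + c.kab + c.kac + c.kad + c.kbd + c.kcd + ((2 * c.ta) - (c.kab + c.kac))) (TB.of_eq (TB.II3diff hD hD1 c.swAB.swBC).swBC.swAB (by simp only [Cell.swAB, Cell.swBC]; omega))
  have II3_020 := ht (2 * c.g + 2 * c.tb + 2 * c.td + 2 * c.u + c.s1 + c.s2 + c.s3 + c.kab + c.kac + c.kad + c.kbc + c.kcd + ((2 * c.ta) - (c.kab + c.kad))) (TB.of_eq (TB.II3diff hD hD1 c.swAB.swCD.swBC).swBC.swCD.swAB (by simp only [Cell.swAB, Cell.swBC, Cell.swCD]; omega))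
  have V_12_13 := ht (2 * c.g + 2 * c.ta + 2 * c.tc + 2 * c.v + c.kbc + c.s3 + c.kbd + c.s2 + c.kcd + c.s1 + 2 * ((c.tb + c.u) - (c.kbc + c.s3))) (TB.of_eq (TB.V hD hD1 c.swAB.swBC.swCD).swCD.swBC.swAB (by simp only [Cell.swAB, Cell.swBC, Cell.swCD]; omega))
  have V_12_23 := ht (2 * c.g + 2 * c.ta + 2 * c.tb + 2 * c.u + c.kbc + c.s3 + c.kbd + c.s2 + c.kcd + c.s1 + 2 * ((c.tc + c.v) - (c.kbc + c.s3))) (TB.of_eq (TB.V hD hD1 c.swAB.swBC.swAB.swCD).swCD.swAB.swBC.swAB (by simp only [Cell.swAB, Cell.swBC, Cell.swCD]; omega))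
  have n_g : (0 : ℝ) ≤ (c.g : ℝ) := Nat.cast_nonneg _
  have n_ta : (0 : ℝ) ≤ (c.ta : ℝ) := Nat.cast_nonneg _
  have n_tb : (0 : ℝ) ≤ (c.tb : ℝ) := Nat.cast_nonneg _
  have n_tc : (0 : ℝ) ≤ (c.tc : ℝ) := Nat.cast_nonneg _
  have n_td : (0 : ℝ) ≤ (c.td : ℝ) := Nat.cast_nonneg _
  have n_u : (0 : ℝ) ≤ (c.u : ℝ) := Nat.cast_nonneg _
  have n_v : (0 : ℝ) ≤ (c.v : ℝ) := Nat.cast_nonneg _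
  have n_w : (0 : ℝ) ≤ (c.w : ℝ) := Nat.cast_nonneg _
  have n_s1 : (0 : ℝ) ≤ (c.s1 : ℝ) := Nat.cast_nonneg _
  have n_s2 : (0 : ℝ) ≤ (c.s2 : ℝ) := Nat.cast_nonneg _
  have n_s3 : (0 : ℝ) ≤ (c.s3 : ℝ) := Nat.cast_nonneg _
  have n_kab : (0 : ℝ) ≤ (c.kab : ℝ) := Nat.cast_nonneg _
  have n_kcd : (0 : ℝ) ≤ (c.kcd : ℝ) := Nat.cast_nonneg _
  have n_kac : (0 : ℝ) ≤ (c.kac : ℝ) := Nat.cast_nonneg _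
  have n_kbd : (0 : ℝ) ≤ (c.kbd : ℝ) := Nat.cast_nonneg _
  have n_kad : (0 : ℝ) ≤ (c.kad : ℝ) := Nat.cast_nonneg _
  have n_kbc : (0 : ℝ) ≤ (c.kbc : ℝ) := Nat.cast_nonneg _
  clear hd hR hD ht
  have zab' : ((c.g + c.tc + c.td + c.u + c.s1 + c.kab : ℕ) : ℝ) ≤ L := Nat.cast_le.mpr zab
  have zcd' : ((c.g + c.ta + c.tb + c.u + c.s1 + c.kcd : ℕ) : ℝ) ≤ L := Nat.cast_le.mpr zcd
  have zac' : ((c.g + c.tb + c.td + c.v + c.s2 + c.kac : ℕ) : ℝ) ≤ L := Nat.cast_le.mpr zac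
  have zbd' : ((c.g + c.ta + c.tc + c.v + c.s2 + c.kbd : ℕ) : ℝ) ≤ L := Nat.cast_le.mpr zbd
  have zad' : ((c.g + c.tb + c.tc + c.w + c.s3 + c.kad : ℕ) : ℝ) ≤ L := Nat.cast_le.mpr zad
  have zbc' : ((c.g + c.ta + c.td + c.w + c.s3 + c.kbc : ℕ) : ℝ) ≤ L := Nat.cast_le.mpr zbc
  push_cast at zab' zcd' zac' zbd' zad' zbc' III I0102 I1213 I0201 I1203 I0203 I1202 I0113 II2_22 II2_11 II2_12 II2_21
  have II3_010' : ((2 * (c.ta : ℝ) ≤ (c.kac : ℝ) + (c.kad : ℝ)) ∧ t ≤ 2 * (c.g : ℝ) + 2 * (c.tc : ℝ) + 2 * (c.td : ℝ) + 2 * (c.u : ℝ) + (c.s1 : ℝ) + (c.s2 : ℝ) + (c.s3 : ℝ) + (c.kab : ℝ) + (c.kac : ℝ) + (c.kad : ℝ) + (c.kbc : ℝ) + (c.kbd : ℝ)) ∨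
      (((c.kac : ℝ) + (c.kad : ℝ) ≤ 2 * (c.ta : ℝ)) ∧ t ≤ 2 * (c.g : ℝ) + 2 * (c.tc : ℝ) + 2 * (c.td : ℝ) + 2 * (c.u : ℝ) + (c.s1 : ℝ) + (c.s2 : ℝ) + (c.s3 : ℝ) + (c.kab : ℝ) + (c.kac : ℝ) + (c.kad : ℝ) + (c.kbc : ℝ) + (c.kbd : ℝ) + ((2 * (c.ta : ℝ)) - ((c.kac : ℝ) + (c.kad : ℝ)))) := by
    rcases le_total (2 * c.ta) (c.kac + c.kad) with h | h
    · left
      rw [Nat.sub_eq_zero_of_le h] at II3_010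
      refine ⟨by exact_mod_cast h, ?_⟩
      push_cast at II3_010
      linarith only [II3_010]
    · right
      refine ⟨by exact_mod_cast h, ?_⟩
      have h2 := Nat.cast_sub (R := ℝ) h
      push_cast at II3_010 h2
      rw [h2] at II3_010
      linarith only [II3_010]
  clear II3_010
  have II3_011' : ((2 * (c.ta : ℝ) ≤ (c.kac : ℝ) + (c.kad : ℝ)) ∧ t ≤ 2 * (c.g : ℝ) + 2 * (c.tc : ℝ) + 2 * (c.td : ℝ) + 2 * (c.v : ℝ) + (c.s1 : ℝ) + (c.s2 : ℝ) + (c.s3 : ℝ) + (c.kab : ℝ) + (c.kac : ℝ) + (c.kad : ℝ) + (c.kbc : ℝ) + (c.kbd : ℝ)) ∨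
      (((c.kac : ℝ) + (c.kad : ℝ) ≤ 2 * (c.ta : ℝ)) ∧ t ≤ 2 * (c.g : ℝ) + 2 * (c.tc : ℝ) + 2 * (c.td : ℝ) + 2 * (c.v : ℝ) + (c.s1 : ℝ) + (c.s2 : ℝ) + (c.s3 : ℝ) + (c.kab : ℝ) + (c.kac : ℝ) + (c.kad : ℝ) + (c.kbc : ℝ) + (c.kbd : ℝ) + ((2 * (c.ta : ℝ)) - ((c.kac : ℝ) + (c.kad : ℝ)))) := by
    rcases le_total (2 * c.ta) (c.kac + c.kad) with h | h
    · left
      rw [Nat.sub_eq_zero_of_le h] at II3_011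
      refine ⟨by exact_mod_cast h, ?_⟩
      push_cast at II3_011
      linarith only [II3_011]
    · right
      refine ⟨by exact_mod_cast h, ?_⟩
      have h2 := Nat.cast_sub (R := ℝ) h
      push_cast at II3_011 h2
      rw [h2] at II3_011
      linarith only [II3_011]
  clear II3_011
  have II3_030' : ((2 * (c.ta : ℝ) ≤ (c.kab : ℝ) + (c.kac : ℝ)) ∧ t ≤ 2 * (c.g : ℝ) + 2 * (c.tb : ℝ) + 2 * (c.tc : ℝ) + 2 * (c.u : ℝ) + (c.s1 : ℝ) + (c.s2 : ℝ) + (c.s3 : ℝ) + (c.kab : ℝ) + (c.kac : ℝ) + (c.kad : ℝ) + (c.kbd : ℝ) + (c.kcd : ℝ)) ∨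
      (((c.kab : ℝ) + (c.kac : ℝ) ≤ 2 * (c.ta : ℝ)) ∧ t ≤ 2 * (c.g : ℝ) + 2 * (c.tb : ℝ) + 2 * (c.tc : ℝ) + 2 * (c.u : ℝ) + (c.s1 : ℝ) + (c.s2 : ℝ) + (c.s3 : ℝ) + (c.kab : ℝ) + (c.kac : ℝ) + (c.kad : ℝ) + (c.kbd : ℝ) + (c.kcd : ℝ) + ((2 * (c.ta : ℝ)) - ((c.kab : ℝ) + (c.kac : ℝ)))) := by
    rcases le_total (2 * c.ta) (c.kab + c.kac) with h | h
    · left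
      rw [Nat.sub_eq_zero_of_le h] at II3_030
      refine ⟨by exact_mod_cast h, ?_⟩
      push_cast at II3_030
      linarith only [II3_030]
    · right
      refine ⟨by exact_mod_cast h, ?_⟩
      have h2 := Nat.cast_sub (R := ℝ) h
      push_cast at II3_030 h2
      rw [h2] at II3_030
      linarith only [II3_030]
  clear II3_030
  have II3_020' : ((2 * (c.ta : ℝ) ≤ (c.kab : ℝ) + (c.kad : ℝ)) ∧ t ≤ 2 * (c.g : ℝ) + 2 * (c.tb : ℝ) + 2 * (c.td : ℝ) + 2 * (c.u : ℝ) + (c.s1 : ℝ) + (c.s2 : ℝ) + (c.s3 : ℝ) + (c.kab : ℝ) + (c.kac : ℝ) + (c.kad : ℝ) + (c.kbc : ℝ) + (c.kcd : ℝ)) ∨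
      (((c.kab : ℝ) + (c.kad : ℝ) ≤ 2 * (c.ta : ℝ)) ∧ t ≤ 2 * (c.g : ℝ) + 2 * (c.tb : ℝ) + 2 * (c.td : ℝ) + 2 * (c.u : ℝ) + (c.s1 : ℝ) + (c.s2 : ℝ) + (c.s3 : ℝ) + (c.kab : ℝ) + (c.kac : ℝ) + (c.kad : ℝ) + (c.kbc : ℝ) + (c.kcd : ℝ) + ((2 * (c.ta : ℝ)) - ((c.kab : ℝ) + (c.kad : ℝ)))) := by
    rcases le_total (2 * c.ta) (c.kab + c.kad) with h | h
    · left
      rw [Nat.sub_eq_zero_of_le h] at II3_020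
      refine ⟨by exact_mod_cast h, ?_⟩
      push_cast at II3_020
      linarith only [II3_020]
    · right
      refine ⟨by exact_mod_cast h, ?_⟩
      have h2 := Nat.cast_sub (R := ℝ) h
      push_cast at II3_020 h2
      rw [h2] at II3_020
      linarith only [II3_020]
  clear II3_020
  have V_12_13' : (((c.tb : ℝ) + (c.u : ℝ) ≤ (c.kbc : ℝ) + (c.s3 : ℝ)) ∧ t ≤ 2 * (c.g : ℝ) + 2 * (c.ta : ℝ) + 2 * (c.tc : ℝ) + 2 * (c.v : ℝ) + (c.kbc : ℝ) + (c.s3 : ℝ) + (c.kbd : ℝ) + (c.s2 : ℝ) + (c.kcd : ℝ) + (c.s1 : ℝ)) ∨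
      (((c.kbc : ℝ) + (c.s3 : ℝ) ≤ (c.tb : ℝ) + (c.u : ℝ)) ∧ t ≤ 2 * (c.g : ℝ) + 2 * (c.ta : ℝ) + 2 * (c.tc : ℝ) + 2 * (c.v : ℝ) + (c.kbc : ℝ) + (c.s3 : ℝ) + (c.kbd : ℝ) + (c.s2 : ℝ) + (c.kcd : ℝ) + (c.s1 : ℝ) + 2 * (((c.tb : ℝ) + (c.u : ℝ)) - ((c.kbc : ℝ) + (c.s3 : ℝ)))) := by
    rcases le_total (c.tb + c.u) (c.kbc + c.s3) with h | h
    · left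
      rw [Nat.sub_eq_zero_of_le h] at V_12_13
      refine ⟨by exact_mod_cast h, ?_⟩
      push_cast at V_12_13
      linarith only [V_12_13]
    · right
      refine ⟨by exact_mod_cast h, ?_⟩
      have h2 := Nat.cast_sub (R := ℝ) h
      push_cast at V_12_13 h2
      rw [h2] at V_12_13
      linarith only [V_12_13]
  clear V_12_13
  have V_12_23' : (((c.tc : ℝ) + (c.v : ℝ) ≤ (c.kbc : ℝ) + (c.s3 : ℝ)) ∧ t ≤ 2 * (c.g : ℝ) + 2 * (c.ta : ℝ) + 2 * (c.tb : ℝ) + 2 * (c.u : ℝ) + (c.kbc : ℝ) + (c.s3 : ℝ) + (c.kbd : ℝ) + (c.s2 : ℝ) + (c.kcd : ℝ) + (c.s1 : ℝ)) ∨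
      (((c.kbc : ℝ) + (c.s3 : ℝ) ≤ (c.tc : ℝ) + (c.v : ℝ)) ∧ t ≤ 2 * (c.g : ℝ) + 2 * (c.ta : ℝ) + 2 * (c.tb : ℝ) + 2 * (c.u : ℝ) + (c.kbc : ℝ) + (c.s3 : ℝ) + (c.kbd : ℝ) + (c.s2 : ℝ) + (c.kcd : ℝ) + (c.s1 : ℝ) + 2 * (((c.tc : ℝ) + (c.v : ℝ)) - ((c.kbc : ℝ) + (c.s3 : ℝ)))) := by
    rcases le_total (c.tc + c.v) (c.kbc + c.s3) with h | h
    · left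
      rw [Nat.sub_eq_zero_of_le h] at V_12_23
      refine ⟨by exact_mod_cast h, ?_⟩
      push_cast at V_12_23
      linarith only [V_12_23]
    · right
      refine ⟨by exact_mod_cast h, ?_⟩
      have h2 := Nat.cast_sub (R := ℝ) h
      push_cast at V_12_23 h2
      rw [h2] at V_12_23
      linarith only [V_12_23]
  clear V_12_23
  rcases V_12_13' with ⟨x1, y1⟩ | ⟨x1, y1⟩
  · -- K large
    rcases V_12_23' with ⟨x2, y2⟩ | ⟨x2, y2⟩
    · linarith
    · rcases II3_020' with ⟨x3, y3⟩ | ⟨x3, y3⟩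
      · linarith
      · linarith
  · rcases II3_010' with ⟨x2, y2⟩ | ⟨x2, y2⟩
    · rcases II3_030' with ⟨x3, y3⟩ | ⟨x3, y3⟩
      · rcases II3_020' with ⟨x4, y4⟩ | ⟨x4, y4⟩
        · linarith
        · linarith
      · rcases II3_011' with ⟨x4, y4⟩ | ⟨x4, y4⟩
        · linarith
        · linarith
    · rcases II3_011' with ⟨x3, y3⟩ | ⟨x3, y3⟩
      · linarith
      · linarith

/-! ### Counting all data -/

theorem QS_count {R : ℤ} {Dv : ℝ} (hD : DivB (4 * R ^ 2) Dv) (hD1 : 1 ≤ Dv) (c : Cell) (L : ℕ)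
    (hR : R < 4 ^ (L + 1)) : (QS R c).Finite ∧
    ((QS R c).ncard : ℝ) ≤ 2 ^ 64 * Dv ^ 8 * ((2 : ℝ) ^ L) ^ (110 / 37 : ℝ) := by
  have hfin : (QS R c).Finite := (TB.III hD1 c).1
  refine ⟨hfin, ?_⟩
  have hA : (0 : ℝ) < 2 ^ 64 * Dv ^ 8 := by positivity
  rcases (QS R c).eq_empty_or_nonempty with h | h
  · rw [h, Set.ncard_empty]; simp only [Nat.cast_zero]; positivity
  · have hpos : (0 : ℝ) < (QS R c).ncard := by
      exact_mod_cast (Set.ncard_pos hfin).mpr h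
    set N : ℝ := ((QS R c).ncard : ℝ) with hN
    have key := cell_lp hD hD1 c L hR h (Real.logb 2 (N / (2 ^ 64 * Dv ^ 8))) (by
      intro e he
      rw [Real.logb_le_iff_le_rpow (by norm_num) (by positivity), Real.rpow_natCast,
        div_le_iff₀ hA]
      linarith [he.2])
    have h2 : Real.logb 2 (N / (2 ^ 64 * Dv ^ 8)) ≤ L * (110 / 37 : ℝ) := by linarith
    rw [Real.logb_le_iff_le_rpow (by norm_num) (by positivity), div_le_iff₀ hA, Real.rpow_mul
      (by norm_num), Real.rpow_natCast] at h2
    linarith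

theorem QOk_count {R : ℤ} {Dv : ℝ} (hD : DivB (4 * R ^ 2) Dv) (hD1 : 1 ≤ Dv) (L : ℕ)
    (hR : R < 4 ^ (L + 1)) : {d | QOk R d}.Finite ∧
    ({d | QOk R d}.ncard : ℝ) ≤ (L + 1) ^ 17 * (2 ^ 64 * Dv ^ 8 * ((2 : ℝ) ^ L) ^ (110 / 37 : ℝ)) := by
  have hb : ∀ d ∈ {d | QOk R d}, d.cell.g < L + 1 ∧ d.cell.ta < L + 1 ∧ d.cell.tb < L + 1 ∧ d.cell.tc < L + 1 ∧ d.cell.td < L + 1 ∧ d.cell.u < L + 1 ∧ d.cell.v < L + 1 ∧ d.cell.w < L + 1 ∧ d.cell.s1 < L + 1 ∧ d.cell.s2 < L + 1 ∧ d.cell.s3 < L + 1 ∧ d.cell.kab < L + 1 ∧ d.cell.kcd < L + 1 ∧ d.cell.kac < L + 1 ∧ d.cell.kbd < L + 1 ∧ d.cell.kad < L + 1 ∧ d.cell.kbc < L + 1 := by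
    intro d hd
    have hd' : d ∈ QS R d.cell := ⟨hd, rfl⟩
    have zab := size_log hd.zab hR (QS.b_g hd').1 (QS.b_tc hd').1 (QS.b_td hd').1 (QS.b_u hd').1 (QS.b_s1 hd').1 (QS.b_kab hd').1
    have zcd := size_log hd.zcd hR (QS.b_g hd').1 (QS.b_ta hd').1 (QS.b_tb hd').1 (QS.b_u hd').1 (QS.b_s1 hd').1 (QS.b_kcd hd').1
    have zac := size_log hd.zac hR (QS.b_g hd').1 (QS.b_tb hd').1 (QS.b_td hd').1 (QS.b_v hd').1 (QS.b_s2 hd').1 (QS.b_kac hd').1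
    have zbd := size_log hd.zbd hR (QS.b_g hd').1 (QS.b_ta hd').1 (QS.b_tc hd').1 (QS.b_v hd').1 (QS.b_s2 hd').1 (QS.b_kbd hd').1
    have zad := size_log hd.zad hR (QS.b_g hd').1 (QS.b_tb hd').1 (QS.b_tc hd').1 (QS.b_w hd').1 (QS.b_s3 hd').1 (QS.b_kad hd').1
    have zbc := size_log hd.zbc hR (QS.b_g hd').1 (QS.b_ta hd').1 (QS.b_td hd').1 (QS.b_w hd').1 (QS.b_s3 hd').1 (QS.b_kbc hd').1
    omega
  obtain ⟨h1, h2⟩ := (((((((((((((((((((FB.start {d | QOk R d}).univ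
    (fun d => Fin.ofNat (L + 1) d.cell.g)).univ
    (fun d => Fin.ofNat (L + 1) d.cell.ta)).univ
    (fun d => Fin.ofNat (L + 1) d.cell.tb)).univ
    (fun d => Fin.ofNat (L + 1) d.cell.tc)).univ
    (fun d => Fin.ofNat (L + 1) d.cell.td)).univ
    (fun d => Fin.ofNat (L + 1) d.cell.u)).univ
    (fun d => Fin.ofNat (L + 1) d.cell.v)).univ
    (fun d => Fin.ofNat (L + 1) d.cell.w)).univ
    (fun d => Fin.ofNat (L + 1) d.cell.s1)).univ
    (fun d => Fin.ofNat (L + 1) d.cell.s2)).univ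
    (fun d => Fin.ofNat (L + 1) d.cell.s3)).univ
    (fun d => Fin.ofNat (L + 1) d.cell.kab)).univ
    (fun d => Fin.ofNat (L + 1) d.cell.kcd)).univ
    (fun d => Fin.ofNat (L + 1) d.cell.kac)).univ
    (fun d => Fin.ofNat (L + 1) d.cell.kbd)).univ
    (fun d => Fin.ofNat (L + 1) d.cell.kad)).univ
    (fun d => Fin.ofNat (L + 1) d.cell.kbc)).step id (2 ^ 64 * Dv ^ 8 * ((2 : ℝ) ^ L) ^ (110 / 37 : ℝ)) (by positivity) (by
      intro s hs
      obtain ⟨q1, q2⟩ := QS_count hD hD1 s.cell L hR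
      refine ⟨QS R s.cell, q1, q2, ?_⟩
      intro t ht hst
      refine ⟨ht, ?_⟩
      have bs := hb s hs
      have bt := hb t ht
      simp only [Prod.mk.injEq, Fin.ext_iff, Fin.val_ofNat] at hst
      obtain ⟨⟨⟨⟨⟨⟨⟨⟨⟨⟨⟨⟨⟨⟨⟨⟨⟨-, e0⟩, e1⟩, e2⟩, e3⟩, e4⟩, e5⟩, e6⟩, e7⟩, e8⟩, e9⟩, e10⟩, e11⟩, e12⟩, e13⟩, e14⟩, e15⟩, e16⟩ := hst
      obtain ⟨a0, a1, a2, a3, a4, a5, a6, a7, a8, a9, a10, a11, a12, a13, a14, a15, a16⟩ := bs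
      obtain ⟨b0, b1, b2, b3, b4, b5, b6, b7, b8, b9, b10, b11, b12, b13, b14, b15, b16⟩ := bt
      rw [Nat.mod_eq_of_lt a0, Nat.mod_eq_of_lt b0] at e0
      rw [Nat.mod_eq_of_lt a1, Nat.mod_eq_of_lt b1] at e1
      rw [Nat.mod_eq_of_lt a2, Nat.mod_eq_of_lt b2] at e2
      rw [Nat.mod_eq_of_lt a3, Nat.mod_eq_of_lt b3] at e3
      rw [Nat.mod_eq_of_lt a4, Nat.mod_eq_of_lt b4] at e4
      rw [Nat.mod_eq_of_lt a5, Nat.mod_eq_of_lt b5] at e5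
      rw [Nat.mod_eq_of_lt a6, Nat.mod_eq_of_lt b6] at e6
      rw [Nat.mod_eq_of_lt a7, Nat.mod_eq_of_lt b7] at e7
      rw [Nat.mod_eq_of_lt a8, Nat.mod_eq_of_lt b8] at e8
      rw [Nat.mod_eq_of_lt a9, Nat.mod_eq_of_lt b9] at e9
      rw [Nat.mod_eq_of_lt a10, Nat.mod_eq_of_lt b10] at e10
      rw [Nat.mod_eq_of_lt a11, Nat.mod_eq_of_lt b11] at e11
      rw [Nat.mod_eq_of_lt a12, Nat.mod_eq_of_lt b12] at e12
      rw [Nat.mod_eq_of_lt a13, Nat.mod_eq_of_lt b13] at e13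
      rw [Nat.mod_eq_of_lt a14, Nat.mod_eq_of_lt b14] at e14
      rw [Nat.mod_eq_of_lt a15, Nat.mod_eq_of_lt b15] at e15
      rw [Nat.mod_eq_of_lt a16, Nat.mod_eq_of_lt b16] at e16
      show t.cell = s.cell
      generalize t.cell = x at *
      generalize s.cell = y at *
      cases x; cases y
      simp_all)).done (by
      intro s hs t ht hst
      simp only [Prod.mk.injEq] at hst
      exact hst.2)
  refine ⟨h1, h2.trans (le_of_eq ?_)⟩
  simp only [Fintype.card_fin]
  push_cast
  ring

/-! ### The number of data is `o(n^3)` -/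

theorem QOk_bound : ∃ M : ℝ, 0 ≤ M ∧ ∀ n : ℕ, 1 ≤ n → {d | QOk (2 * (n : ℤ) ^ 2) d}.Finite ∧
    ({d | QOk (2 * (n : ℤ) ^ 2) d}.ncard : ℝ) ≤ M * (2 * (n : ℝ)) ^ (298 / 100 : ℝ) := by
  obtain ⟨C, hC1, hC⟩ := gdivisor_bound (1 / 10000) (by norm_num)
  refine ⟨20001 ^ 17 * (2 ^ 64 * C ^ 8), by positivity, ?_⟩
  intro n hn
  have hn' : (1 : ℝ) ≤ n := by exact_mod_cast hn
  set x : ℝ := 2 * (n : ℝ) with hx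
  have hx1 : 1 ≤ x := by linarith
  have hx0 : 0 < x := by linarith
  set L := Nat.log 4 (2 * n ^ 2) with hL
  have hL1 : 4 ^ L ≤ 2 * n ^ 2 := Nat.pow_log_le_self 4 (by positivity)
  have hL2 : 2 * n ^ 2 < 4 ^ (L + 1) := Nat.lt_pow_succ_log_self (by norm_num) _
  have hLx : (2 : ℝ) ^ L ≤ x := by
    have h1 : ((4 : ℝ)) ^ L ≤ 2 * (n : ℝ) ^ 2 := by exact_mod_cast hL1
    have h2 : ((2 : ℝ) ^ L) ^ 2 = 4 ^ L := by rw [← pow_mul, mul_comm, pow_mul]; norm_num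
    refine le_of_sq_le_sq ?_ hx0.le
    rw [h2, hx]; nlinarith
  set Dv : ℝ := C * x ^ (4 / 10000 : ℝ) with hDv
  have hxp : ∀ e : ℝ, 0 ≤ e → 1 ≤ x ^ e := fun e he => Real.one_le_rpow hx1 he
  have hDv1 : 1 ≤ Dv := by
    have := hxp (4 / 10000) (by norm_num)
    rw [hDv]; nlinarith
  have hD : DivB (4 * (2 * (n : ℤ) ^ 2) ^ 2) Dv := by
    refine ⟨by linarith, ?_⟩
    intro z hz hzn
    refine (hC z hz).trans ?_
    rw [hDv]
    have h1 : (z.norm : ℝ) ≤ x ^ (4 : ℝ) := by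
      have h2 : (z.norm : ℝ) ≤ 4 * (2 * (n : ℝ) ^ 2) ^ 2 := by exact_mod_cast hzn
      refine h2.trans (le_of_eq ?_)
      rw [hx, show (4 : ℝ) = ((4 : ℕ) : ℝ) by norm_num, Real.rpow_natCast]
      push_cast; ring
    have h0 : (0 : ℝ) ≤ z.norm := by exact_mod_cast gnorm_nonneg z
    refine mul_le_mul_of_nonneg_left ?_ (by linarith)
    refine (Real.rpow_le_rpow h0 h1 (by norm_num)).trans (le_of_eq ?_)
    rw [← Real.rpow_mul hx0.le]
    norm_num
  obtain ⟨f1, f2⟩ := QOk_count hD hDv1 L (by exact_mod_cast hL2)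
  refine ⟨f1, f2.trans ?_⟩
  have hLb : (L : ℝ) + 1 ≤ 20001 * x ^ (1 / 10000 : ℝ) := by
    have h1 := Real.log_le_rpow_div hx0.le (show (0 : ℝ) < 1 / 10000 by norm_num)
    have h2 : (L : ℝ) * Real.log 2 ≤ Real.log x := by
      rw [← Real.log_pow]; exact Real.log_le_log (by positivity) hLx
    have h3 := Real.log_two_gt_d9
    have h4 := hxp (1 / 10000) (by norm_num)
    have h5 : (0 : ℝ) ≤ L := Nat.cast_nonneg _
    have h6 : (L : ℝ) * (1 / 2) ≤ L * Real.log 2 := mul_le_mul_of_nonneg_left (by linarith) h5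
    have h7 : x ^ (1 / 10000 : ℝ) / (1 / 10000) = 10000 * x ^ (1 / 10000 : ℝ) := by ring
    rw [h7] at h1
    linarith
  have hA : ((L : ℝ) + 1) ^ 17 ≤ 20001 ^ 17 * x ^ (17 / 10000 : ℝ) := by
    refine (pow_le_pow_left₀ (by positivity) hLb 17).trans (le_of_eq ?_)
    rw [mul_pow, ← Real.rpow_natCast (x ^ (1 / 10000 : ℝ)), ← Real.rpow_mul hx0.le]
    norm_num
  have hB : Dv ^ 8 = C ^ 8 * x ^ (32 / 10000 : ℝ) := by
    rw [hDv, mul_pow, ← Real.rpow_natCast (x ^ (4 / 10000 : ℝ)), ← Real.rpow_mul hx0.le]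
    norm_num
  have hCx : ((2 : ℝ) ^ L) ^ (110 / 37 : ℝ) ≤ x ^ (110 / 37 : ℝ) :=
    Real.rpow_le_rpow (by positivity) hLx (by norm_num)
  have hC0 : 0 ≤ C := by linarith
  calc ((L : ℝ) + 1) ^ 17 * (2 ^ 64 * Dv ^ 8 * ((2 : ℝ) ^ L) ^ (110 / 37 : ℝ))
      ≤ (20001 ^ 17 * x ^ (17 / 10000 : ℝ)) *
        (2 ^ 64 * (C ^ 8 * x ^ (32 / 10000 : ℝ)) * x ^ (110 / 37 : ℝ)) := by
        rw [hB]
        exact mul_le_mul hA (mul_le_mul_of_nonneg_left hCx (by positivity)) (by positivity)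
          (by positivity)
    _ = 20001 ^ 17 * (2 ^ 64 * C ^ 8) *
        (x ^ (17 / 10000 : ℝ) * x ^ (32 / 10000 : ℝ) * x ^ (110 / 37 : ℝ)) := by ring
    _ ≤ 20001 ^ 17 * (2 ^ 64 * C ^ 8) * x ^ (298 / 100 : ℝ) := by
        refine mul_le_mul_of_nonneg_left ?_ (by positivity)
        rw [← Real.rpow_add hx0, ← Real.rpow_add hx0]
        exact Real.rpow_le_rpow_of_exponent_le hx1 (by norm_num)

theorem QOk_finite (n : ℕ) (hn : 1 ≤ n) : {d | QOk (2 * (n : ℤ) ^ 2) d}.Finite := by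
  obtain ⟨M, -, h⟩ := QOk_bound
  exact (h n hn).1

theorem QOk_tendsto : Filter.Tendsto
    (fun n : ℕ => ({d | QOk (2 * (n : ℤ) ^ 2) d}.ncard : ℝ) / (n : ℝ) ^ 3)
    Filter.atTop (nhds 0) := by
  obtain ⟨M, hM, h⟩ := QOk_bound
  have h1 : Filter.Tendsto (fun n : ℕ => (n : ℝ) ^ (-(2 / 100) : ℝ)) Filter.atTop (nhds 0) :=
    (tendsto_rpow_neg_atTop (by norm_num)).comp tendsto_natCast_atTop_atTop
  have h2 := h1.const_mul (M * 2 ^ (298 / 100 : ℝ))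
  rw [mul_zero] at h2
  refine squeeze_zero' (Filter.Eventually.of_forall (fun n => by positivity)) ?_ h2
  filter_upwards [Filter.eventually_ge_atTop 1] with n hn
  have hn0 : (0 : ℝ) < n := by exact_mod_cast hn
  rw [div_le_iff₀ (by positivity)]
  refine (h n hn).2.trans (le_of_eq ?_)
  rw [Real.mul_rpow (by norm_num) hn0.le, mul_assoc, mul_assoc, ← Real.rpow_natCast (n : ℝ) 3, ← Real.rpow_add hn0]
  norm_num

/-! ### Existence of the data -/

theorem gauss_im_intCast_mul (n : ℤ) (z : GaussianInt) : ((n : GaussianInt) * z).im = n * z.im := by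
  simp

theorem gauss_re_intCast_mul (n : ℤ) (z : GaussianInt) : ((n : GaussianInt) * z).re = n * z.re := by
  simp

theorem gauss_intCast_ext {a b : ℤ} (h : (a : GaussianInt) = b) : a = b := by
  exact_mod_cast h

theorem gauss_coprime_int {a b : ℤ} (h : IsCoprime (a : GaussianInt) b) : IsCoprime a b := by
  obtain ⟨p, q, hpq⟩ := h
  refine ⟨p.re, q.re, ?_⟩
  have := congrArg Zsqrtd.re hpq
  rw [mul_comm p, mul_comm q] at this
  simp only [Zsqrtd.re_add, gauss_re_intCast_mul, Zsqrtd.re_one] at this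
  linarith

theorem ed_gcd {R : Type*} [EuclideanDomain R] (p q : R) (h : p ≠ 0 ∨ q ≠ 0) :
    ∃ g a b : R, g ≠ 0 ∧ p = g * a ∧ q = g * b ∧ IsCoprime a b := by
  classical
  have hg : EuclideanDomain.gcd p q ≠ 0 := by
    intro h0
    rw [EuclideanDomain.gcd_eq_zero_iff] at h0
    tauto
  obtain ⟨a, ha⟩ := EuclideanDomain.gcd_dvd_left p q
  obtain ⟨b, hb⟩ := EuclideanDomain.gcd_dvd_right p q
  refine ⟨_, a, b, hg, ha, hb, EuclideanDomain.gcdA p q, EuclideanDomain.gcdB p q, ?_⟩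
  have h1 := EuclideanDomain.gcd_eq_gcd_ab p q
  refine mul_left_cancel₀ hg ?_
  have h2 : EuclideanDomain.gcd p q * (EuclideanDomain.gcdA p q * a + EuclideanDomain.gcdB p q * b)
      = (EuclideanDomain.gcd p q * a) * EuclideanDomain.gcdA p q +
        (EuclideanDomain.gcd p q * b) * EuclideanDomain.gcdB p q := by ring
  rw [h2, ← ha, ← hb, ← h1, mul_one]

theorem gauss_prim (p : GaussianInt) (hp : p ≠ 0) : ∃ (k : ℤ) (u : GaussianInt), k ≠ 0 ∧ p = k * u ∧
    IsCoprime u.re u.im := by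
  have hne : p.re ≠ 0 ∨ p.im ≠ 0 := by
    by_contra! h
    exact hp (by ext <;> simp [h])
  obtain ⟨g, a, b, hg⟩ := ed_gcd p.re p.im hne
  exact ⟨g, ⟨a, b⟩, hg.1, by ext <;> simp [hg.2.1, hg.2.2.1], hg.2.2.2⟩

theorem split_pair (p q : GaussianInt) (m : ℤ) (hm : p * q = m) (hp : p ≠ 0) (hq : q ≠ 0) :
    ∃ (s k k' : ℤ) (u : GaussianInt), p = s * k * u ∧ q = s * k' * star u ∧ IsCoprime k k' ∧
      s * k * k' ∣ m := by
  obtain ⟨K, u, hK, hpu, hu⟩ := gauss_prim p hp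
  have hu0 : u ≠ 0 := by rintro rfl; simp [hpu] at hp
  -- `(K N(u)) q = m ū`
  have h1 : ((K * u.norm : ℤ) : GaussianInt) * q = (m : GaussianInt) * star u := by
    rw [← hm, hpu]; push_cast; rw [Zsqrtd.norm_eq_mul_conj]; ring
  have hKn : K * u.norm ≠ 0 := mul_ne_zero hK (gnorm_pos hu0).ne'
  obtain ⟨a, b, hab⟩ := hu
  have hre := congrArg Zsqrtd.re h1
  have him := congrArg Zsqrtd.im h1
  rw [gauss_re_intCast_mul, gauss_re_intCast_mul, Zsqrtd.re_star] at hre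
  rw [gauss_im_intCast_mul, gauss_im_intCast_mul, Zsqrtd.im_star] at him
  obtain ⟨c, hc⟩ : ∃ c, m = K * u.norm * c := ⟨a * q.re - b * q.im, by
    linear_combination (-m) * hab - a * hre + b * him⟩
  have hqc : q = (c : GaussianInt) * star u := by
    have h3 : ((K * u.norm : ℤ) : GaussianInt) ≠ 0 := by exact_mod_cast hKn
    refine mul_left_cancel₀ h3 ?_
    rw [h1, hc]; push_cast; ring
  have hc0 : c ≠ 0 := by rintro rfl; simp [hqc] at hq
  obtain ⟨s, k, k', -, h4, h5, h6⟩ := ed_gcd K c (Or.inl hK)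
  refine ⟨s, k, k', u, ?_, ?_, h6, ?_⟩
  · rw [hpu, h4]; push_cast; ring
  · rw [hqc, h5]; push_cast; ring
  · rw [hc, h4, h5]; exact ⟨s * u.norm, by ring⟩

/-- Coprime Gaussian integers with real ratio are both real or both purely imaginary. -/
theorem coprime_real_ratio (m₁ m₂ : GaussianInt) (hc : IsCoprime m₁ m₂) (h1 : m₁ ≠ 0)
    (h : (m₁ * star m₂).im = 0) : (m₁.im = 0 ∧ m₂.im = 0) ∨ (m₁.re = 0 ∧ m₂.re = 0) := by
  have e : m₁ * star m₂ = star m₁ * m₂ := by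
    ext
    · simp
    · simp at h ⊢; linarith
  have d1 : m₁ ∣ star m₁ := hc.dvd_of_dvd_mul_right ⟨star m₂, e.symm⟩
  obtain ⟨ε, hε⟩ := d1
  have e2 : star m₂ = ε * m₂ := by
    refine mul_left_cancel₀ h1 ?_
    rw [e, hε]; ring
  have hn : ε.norm = 1 := by
    have := congrArg Zsqrtd.norm hε
    rw [Zsqrtd.norm_mul, Zsqrtd.norm_conj] at this
    have h3 := (gnorm_pos h1).ne'
    exact mul_left_cancel₀ h3 (by rw [← this, mul_one])
  have hn' : ε.re ^ 2 + ε.im ^ 2 = 1 := by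
    rw [Zsqrtd.norm_def] at hn; linarith
  have r1 := congrArg Zsqrtd.re hε
  have i1 := congrArg Zsqrtd.im hε
  have r2 := congrArg Zsqrtd.re e2
  have i2 := congrArg Zsqrtd.im e2
  simp at r1 i1 r2 i2
  have hb1 : -1 ≤ ε.re := by nlinarith
  have hb2 : ε.re ≤ 1 := by nlinarith
  have hb3 : -1 ≤ ε.im := by nlinarith
  have hb4 : ε.im ≤ 1 := by nlinarith
  obtain ⟨a, b, hab⟩ := hc
  have ra := congrArg Zsqrtd.re hab
  have ia := congrArg Zsqrtd.im hab
  simp at ra ia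
  generalize ε.re = er at *
  generalize ε.im = ei at *
  have : er = -1 ∨ er = 0 ∨ er = 1 := by omega
  have : ei = -1 ∨ ei = 0 ∨ ei = 1 := by omega
  rcases ‹er = -1 ∨ er = 0 ∨ er = 1› with rfl | rfl | rfl <;>
  rcases ‹ei = -1 ∨ ei = 0 ∨ ei = 1› with rfl | rfl | rfl <;>
  first
  | (exfalso; norm_num at hn'; done)
  | (right; constructor <;> linarith)
  | (left; constructor <;> linarith)
  | skip
  · exfalso
    have a1 : m₁.re = m₁.im := by linarith
    have a2 : m₂.re = m₂.im := by linarith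
    rw [a1, a2] at ra ia
    have : (2 : ℤ) ∣ 1 := ⟨a.re * m₁.im + b.re * m₂.im, by linarith⟩
    omega
  · exfalso
    have a1 : m₁.re = -m₁.im := by linarith
    have a2 : m₂.re = -m₂.im := by linarith
    rw [a1, a2] at ra ia
    have : (2 : ℤ) ∣ 1 := ⟨-(a.im * m₁.im + b.im * m₂.im) - 0 * a.re, by linarith⟩
    omega

theorem coprime_sub_mul {a b : GaussianInt} (h : IsCoprime a b) (t : GaussianInt) :
    IsCoprime (a - t * b) b := by
  have := h.add_mul_right_left (-t)
  rwa [neg_mul, ← sub_eq_add_neg] at this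

theorem quad_struct (x y z : GaussianInt) (hx : x ≠ 0) (hy : y ≠ 0) (hz : z ≠ 0) (hxy : y - x ≠ 0) :
    ∃ G ta tb tc td ab ac ad bc bd cd : GaussianInt,
      x = G * tc * td * ab ∧ y = G * tb * td * ac ∧ z = G * tb * tc * ad ∧
      y - x = G * ta * td * bc ∧ z - x = G * ta * tc * bd ∧ z - y = G * ta * tb * cd ∧
      IsCoprime (ab * cd) (ac * bd) := by
  obtain ⟨g0, a, b, hg0, ha, hb, hab⟩ := ed_gcd x y (Or.inl hx)
  obtain ⟨G, td, z', hG, htd, hz', hdz⟩ := ed_gcd g0 z (Or.inl hg0)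
  have hz0 : z' ≠ 0 := by rintro rfl; simp [hz'] at hz
  obtain ⟨tc, a1, z1, htc, h1, h2, h3⟩ := ed_gcd a z' (Or.inr hz0)
  have hz1 : z1 ≠ 0 := by rintro rfl; simp [h2] at hz0
  obtain ⟨tb, b1, z2, htb, h4, h5, h6⟩ := ed_gcd b z1 (Or.inr hz1)
  subst h5 h4 h2 h1 hz' htd ha hb
  have htd0 : td ≠ 0 := by rintro rfl; simp at hx
  have hp : tb * b1 - tc * a1 ≠ 0 := by
    intro h
    apply hxy
    linear_combination (G * td) * h
  obtain ⟨ta, p1, q1, hta, h7, h8, h9⟩ := ed_gcd (tb * b1 - tc * a1) (tb * z2 - td * a1) (Or.inl hp)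
  have c1 : IsCoprime ta tb := by
    have : IsCoprime (tc * a1) tb := hab.of_mul_right_left
    have := coprime_sub_mul this b1
    have h : IsCoprime (ta * p1) tb := by
      rw [← h7]
      rw [show tb * b1 - tc * a1 = -(tc * a1 - b1 * tb) by ring]
      exact this.neg_left
    exact h.of_mul_left_left
  have hr : ta ∣ tb * (tc * z2 - td * b1) := by
    refine ⟨tc * q1 - td * p1, ?_⟩
    linear_combination tc * h8 - td * h7
  obtain ⟨r1, hr1⟩ := c1.dvd_of_dvd_mul_left hr
  have hrel : tb * r1 = tc * q1 - td * p1 := by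
    refine mul_left_cancel₀ hta ?_
    linear_combination tc * h8 - td * h7 - tb * hr1
  refine ⟨G, ta, tb, tc, td, a1, b1, z2, p1, q1, r1, by ring, by ring, by ring, ?_, ?_, ?_, ?_⟩
  · linear_combination G * td * h7
  · linear_combination G * tc * h8
  · linear_combination G * tb * hr1
  · have k1 : IsCoprime a1 b1 := hab.of_mul_left_right.of_mul_right_right
    have k2 : IsCoprime a1 q1 := by
      have := coprime_sub_mul h3.symm td
      rw [h8] at this
      exact this.of_mul_left_right.symm
    have k3 : IsCoprime r1 b1 := by
      have e1 : IsCoprime tc b1 := hab.of_mul_left_left.of_mul_right_right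
      have := coprime_sub_mul (e1.mul_left h6.symm) td
      rw [hr1] at this
      exact this.of_mul_left_right
    have k4 : IsCoprime r1 q1 := by
      have e1 : IsCoprime q1 td := by
        have e2 : IsCoprime (tb * z2) td := hdz.symm.of_mul_left_right
        have := coprime_sub_mul e2 a1
        rw [mul_comm a1, h8] at this
        exact this.of_mul_left_right
      have e3 : IsCoprime (td * p1) q1 := (e1.symm).mul_left h9
      have := coprime_sub_mul e3 tc
      have e4 : IsCoprime (tb * r1) q1 := by
        rw [hrel, show tc * q1 - td * p1 = -(td * p1 - tc * q1) by ring]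
        exact this.neg_left
      exact e4.of_mul_left_right
    exact (k1.mul_right k2).mul_left (k3.mul_right k4)

theorem gnorm_im_zero {z : GaussianInt} (h : z.im = 0) : z = (z.re : GaussianInt) := by
  ext <;> simp [h]

/-- same as `quad_struct` for a concyclic quadruple, with the products real -/
theorem quad_struct' (x y z : GaussianInt) (hx : x ≠ 0) (hy : y ≠ 0) (hz : z ≠ 0)
    (hxy : y - x ≠ 0) (hxz : z - x ≠ 0) (hyz : z - y ≠ 0)
    (hc : (x * (z - y) * star (y * (z - x))).im = 0) :
    ∃ G ta tb tc td ab ac ad bc bd cd : GaussianInt, ∃ m1 m2 m3 : ℤ,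
      x = G * tc * td * ab ∧ y = G * tb * td * ac ∧ z = G * tb * tc * ad ∧
      y - x = G * ta * td * bc ∧ z - x = G * ta * tc * bd ∧ z - y = G * ta * tb * cd ∧
      ab * cd = m1 ∧ ac * bd = m2 ∧ ad * bc = m3 ∧ IsCoprime m1 m2 ∧ IsCoprime m1 m3 ∧
      IsCoprime m2 m3 := by
  obtain ⟨G, ta, tb, tc, td, ab, ac, ad, bc, bd, cd, e1, e2, e3, e4, e5, e6, hcop⟩ :=
    quad_struct x y z hx hy hz hxy
  have f1 : G * G * ta * tb * tc * td ≠ 0 := by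
    intro h
    have : x * (z - y) = 0 := by
      rw [e6, e1]; linear_combination (ab * cd) * h
    exact (mul_ne_zero hx hyz) this
  have f2 : ab * cd ≠ 0 := by
    intro h
    have : x * (z - y) = 0 := by
      rw [e6, e1]; linear_combination (G * G * ta * tb * tc * td) * h
    exact (mul_ne_zero hx hyz) this
  have hpt : ab * cd + ad * bc = ac * bd := by
    refine mul_left_cancel₀ f1 ?_
    have : x * (z - y) + z * (y - x) = y * (z - x) := by ring
    rw [e4, e5, e6] at this
    nth_rewrite 1 [e1] at this
    nth_rewrite 1 [e3] at this
    nth_rewrite 1 [e2] at this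
    linear_combination this
  have him : ((ab * cd) * star (ac * bd)).im = 0 := by
    have h1 : x * (z - y) * star (y * (z - x)) = ((G * G * ta * tb * tc * td).norm : GaussianInt) *
        ((ab * cd) * star (ac * bd)) := by
      rw [Zsqrtd.norm_eq_mul_conj, e5, e6]
      nth_rewrite 1 [e1]
      nth_rewrite 1 [e2]
      simp only [star_mul]
      ring
    rw [h1, gauss_im_intCast_mul] at hc
    rcases mul_eq_zero.mp hc with h | h
    · exact absurd h (gnorm_pos f1).ne'
    · exact h
  have main : ∀ (ta bc bd cd : GaussianInt), y - x = G * ta * td * bc → z - x = G * ta * tc * bd →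
      z - y = G * ta * tb * cd → ab * cd + ad * bc = ac * bd → IsCoprime (ab * cd) (ac * bd) →
      (ab * cd).im = 0 → (ac * bd).im = 0 → ∃ G ta tb tc td ab ac ad bc bd cd : GaussianInt, ∃ m1 m2 m3 : ℤ,
      x = G * tc * td * ab ∧ y = G * tb * td * ac ∧ z = G * tb * tc * ad ∧
      y - x = G * ta * td * bc ∧ z - x = G * ta * tc * bd ∧ z - y = G * ta * tb * cd ∧
      ab * cd = m1 ∧ ac * bd = m2 ∧ ad * bc = m3 ∧ IsCoprime m1 m2 ∧ IsCoprime m1 m3 ∧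
      IsCoprime m2 m3 := by
    intro ta bc bd cd g4 g5 g6 hp hcop i1 i2
    have g1 := gnorm_im_zero i1
    have g2 := gnorm_im_zero i2
    have hm : IsCoprime (ab * cd).re (ac * bd).re := by
      apply gauss_coprime_int
      rw [← g1, ← g2]; exact hcop
    refine ⟨G, ta, tb, tc, td, ab, ac, ad, bc, bd, cd, (ab * cd).re, (ac * bd).re,
      (ac * bd).re - (ab * cd).re, e1, e2, e3, g4, g5, g6, g1, g2, ?_, hm, ?_, ?_⟩
    · push_cast
      rw [← g1, ← g2]; linear_combination hp
    · have := hm.symm.add_mul_right_left (-1)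
      rw [neg_one_mul, ← sub_eq_add_neg] at this
      exact this.symm
    · have := hm.add_mul_right_left (-1)
      rw [neg_one_mul, ← sub_eq_add_neg] at this
      have := this.symm.neg_right
      rwa [neg_sub] at this
  rcases coprime_real_ratio _ _ hcop f2 him with ⟨i1, i2⟩ | ⟨i1, i2⟩
  · exact main ta bc bd cd e4 e5 e6 hpt hcop i1 i2
  · set I : GaussianInt := ⟨0, 1⟩ with hI
    have hII : I * I = -1 := by ext <;> simp [hI]
    have hu : IsUnit I := ⟨⟨I, -I, by linear_combination -hII, by linear_combination -hII⟩, rfl⟩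
    refine main (-I * ta) (I * bc) (I * bd) (I * cd) ?_ ?_ ?_ ?_ ?_ ?_ ?_
    · linear_combination e4 - (-G * ta * td * bc) * hII
    · linear_combination e5 - (-G * ta * tc * bd) * hII
    · linear_combination e6 - (-G * ta * tb * cd) * hII
    · linear_combination I * hpt
    · rw [show ab * (I * cd) = I * (ab * cd) by ring, show ac * (I * bd) = I * (ac * bd) by ring]
      exact (isCoprime_mul_unit_left hu _ _).mpr hcop
    · rw [show ab * (I * cd) = I * (ab * cd) by ring]; simp [hI] at i1 ⊢; linarith
    · rw [show ac * (I * bd) = I * (ac * bd) by ring]; simp [hI] at i2 ⊢; linarith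

theorem im_ne_of {N : ℤ} {e t : GaussianInt} (ht : t.im ≠ 0) (h : t = (N : GaussianInt) * e) :
    e.im ≠ 0 := by
  intro h0
  rw [h, gauss_im_intCast_mul, h0, mul_zero] at ht
  exact ht rfl

/-- The data attached to a nonsymmetric concyclic quadruple. -/
theorem exists_data (R : ℤ) (x y z : GaussianInt)
    (hc : (x * (z - y) * star (y * (z - x))).im = 0)
    (hABC : (star x * y).im ≠ 0) (hABD : (star x * z).im ≠ 0) (hACD : (star y * z).im ≠ 0)
    (hp1 : (star x * (z - y)).im ≠ 0) (hp2 : (star y * (z - x)).im ≠ 0)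
    (hp3 : (star z * (y - x)).im ≠ 0)
    (hl1 : x.norm ≠ (z - y).norm) (hl2 : y.norm ≠ (z - x).norm) (hl3 : z.norm ≠ (y - x).norm)
    (n1 : x.norm ≤ R) (n2 : y.norm ≤ R) (n3 : z.norm ≤ R) (n4 : (y - x).norm ≤ R)
    (n5 : (z - x).norm ≤ R) (n6 : (z - y).norm ≤ R) :
    ∃ d : QD, QOk R d ∧ x = d.g * d.tc * d.td * (d.s1 * d.kab * d.u) ∧
      y = d.g * d.tb * d.td * (d.s2 * d.kac * d.v) ∧ z = d.g * d.tb * d.tc * (d.s3 * d.kad * d.w) := by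
  have hx : x ≠ 0 := by rintro rfl; simp at hABC
  have hy : y ≠ 0 := by rintro rfl; simp at hABC
  have hz : z ≠ 0 := by rintro rfl; simp at hABD
  have hxy : y - x ≠ 0 := by intro h; rw [h] at hp3; simp at hp3
  have hxz : z - x ≠ 0 := by intro h; rw [h] at hp2; simp at hp2
  have hyz : z - y ≠ 0 := by intro h; rw [h] at hp1; simp at hp1
  obtain ⟨G, ta, tb, tc, td, ab, ac, ad, bc, bd, cd, m1, m2, m3, e1, e2, e3, e4, e5, e6, f1, f2, f3,
    c12, c13, c23⟩ := quad_struct' x y z hx hy hz hxy hxz hyz hc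
  have z1 := hx
  have z2 := hy
  have z3 := hz
  have z4 := hxy
  have z5 := hxz
  have z6 := hyz
  rw [e1] at z1; rw [e2] at z2; rw [e3] at z3; rw [e4] at z4; rw [e5] at z5; rw [e6] at z6
  simp only [mul_ne_zero_iff] at z1 z2 z3 z4 z5 z6
  obtain ⟨s1, kab, kcd, u, g1, g2, g3, g4⟩ := split_pair ab cd m1 f1 z1.2 z6.2
  obtain ⟨s2, kac, kbd, v, g5, g6, g7, g8⟩ := split_pair ac bd m2 f2 z2.2 z5.2
  obtain ⟨s3, kad, kbc, w, g9, g10, g11, g12⟩ := split_pair ad bc m3 f3 z3.2 z4.2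
  subst g1 g2 g5 g6 g9 g10
  simp only [mul_ne_zero_iff, ne_eq, Int.cast_eq_zero] at z1 z2 z3 z4 z5 z6
  have hG : G ≠ 0 := z1.1.1.1
  have hta : ta ≠ 0 := z4.1.1.2
  have htb : tb ≠ 0 := z2.1.1.2
  have htc : tc ≠ 0 := z1.1.1.2
  have htd : td ≠ 0 := z1.1.2
  have qim : ∀ a b : GaussianInt, (star a * (b - a)).im = (star a * b).im := by
    intro a b; simp; ring
  have qim2 : ∀ a b : GaussianInt, (star b * (b - a)).im = (star a * b).im := by
    intro a b; simp; ring
  refine ⟨⟨G, ta, tb, tc, td, u, v, w, s1, s2, s3, kab, kcd, kac, kbd, kad, kbc⟩, ?_, e1, e2, e3⟩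
  constructor
  case g0 => exact hG
  case ta0 => exact hta
  case tb0 => exact htb
  case tc0 => exact htc
  case td0 => exact htd
  case u0 => exact z1.2.2
  case v0 => exact z2.2.2
  case w0 => exact z3.2.2
  case s10 => exact z1.2.1.1
  case s20 => exact z2.2.1.1
  case s30 => exact z3.2.1.1
  case kab0 => exact z1.2.1.2
  case kcd0 => exact z6.2.1.2
  case kac0 => exact z2.2.1.2
  case kbd0 => exact z5.2.1.2
  case kad0 => exact z3.2.1.2
  case kbc0 => exact z4.2.1.2
  case rabc =>
    refine mul_left_cancel₀ (mul_ne_zero hG htd) ?_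
    simp only
    linear_combination -e1 - e4 + e2
  case rabd =>
    refine mul_left_cancel₀ (mul_ne_zero hG htc) ?_
    simp only
    linear_combination -e1 - e5 + e3
  case racd =>
    refine mul_left_cancel₀ (mul_ne_zero hG htb) ?_
    simp only
    linear_combination -e2 - e6 + e3
  case rbcd =>
    refine mul_left_cancel₀ (mul_ne_zero hG hta) ?_
    simp only
    linear_combination -e4 - e6 + e5
  case c12 => exact (c12.of_isCoprime_of_dvd_left g4).of_isCoprime_of_dvd_right g8
  case c13 => exact (c13.of_isCoprime_of_dvd_left g4).of_isCoprime_of_dvd_right g12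
  case c23 => exact (c23.of_isCoprime_of_dvd_left g8).of_isCoprime_of_dvd_right g12
  case c1 => exact g3
  case c2 => exact g7
  case c3 => exact g11
  case iab =>
    refine im_ne_of (N := G.norm * td.norm * (s2 * kac) * (s3 * kbc)) (t := star y * (y - x))
      (by rwa [qim2]) ?_
    rw [e4, e2]; push_cast; simp only [Zsqrtd.norm_eq_mul_conj, star_mul, star_intCast]; ring
  case icd =>
    refine im_ne_of (N := G.norm * tb.norm * (s2 * kac) * (s3 * kad)) (t := star y * z)
      hACD ?_
    rw [e3, e2]; push_cast; simp only [Zsqrtd.norm_eq_mul_conj, star_mul, star_intCast]; ring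
  case ibd =>
    refine im_ne_of (N := G.norm * tc.norm * (s1 * kab) * (s3 * kad)) (t := star x * z)
      hABD ?_
    rw [e3, e1]; push_cast; simp only [Zsqrtd.norm_eq_mul_conj, star_mul, star_intCast]; ring
  case iac =>
    refine im_ne_of (N := G.norm * td.norm * (s1 * kab) * (s3 * kbc)) (t := star x * (y - x))
      (by rwa [qim]) ?_
    rw [e4, e1]; push_cast; simp only [Zsqrtd.norm_eq_mul_conj, star_mul, star_intCast]; ring
  case iad =>
    refine im_ne_of (N := G.norm * tc.norm * (s1 * kab) * (s2 * kbd)) (t := star x * (z - x))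
      (by rwa [qim]) ?_
    rw [e5, e1]; push_cast; simp only [Zsqrtd.norm_eq_mul_conj, star_mul, star_intCast]; ring
  case ibc =>
    refine im_ne_of (N := G.norm * td.norm * (s1 * kab) * (s2 * kac)) (t := star x * y)
      hABC ?_
    rw [e1, e2]; push_cast; simp only [Zsqrtd.norm_eq_mul_conj, star_mul, star_intCast]; ring
  case l1 =>
    intro h
    apply hl1
    rw [e6, e1]
    simp only [Zsqrtd.norm_mul, Zsqrtd.norm_conj, Zsqrtd.norm_intCast]
    simp only at h
    linear_combination (G.norm * s1 ^ 2 * u.norm) * h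
  case l2 =>
    intro h
    apply hl2
    rw [e5, e2]
    simp only [Zsqrtd.norm_mul, Zsqrtd.norm_conj, Zsqrtd.norm_intCast]
    simp only at h
    linear_combination (G.norm * s2 ^ 2 * v.norm) * h
  case l3 =>
    intro h
    apply hl3
    rw [e4, e3]
    simp only [Zsqrtd.norm_mul, Zsqrtd.norm_conj, Zsqrtd.norm_intCast]
    simp only at h
    linear_combination (G.norm * s3 ^ 2 * w.norm) * h
  case p1 =>
    refine im_ne_of (N := G.norm * (s1 * kab) * (s1 * kcd)) hp1 ?_
    rw [e6, e1]; push_cast; simp only [Zsqrtd.norm_eq_mul_conj, star_mul, star_intCast]; ring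
  case p2 =>
    refine im_ne_of (N := G.norm * (s2 * kac) * (s2 * kbd)) hp2 ?_
    rw [e5, e2]; push_cast; simp only [Zsqrtd.norm_eq_mul_conj, star_mul, star_intCast]; ring
  case p3 =>
    refine im_ne_of (N := G.norm * (s3 * kad) * (s3 * kbc)) hp3 ?_
    rw [e4, e3]; push_cast; simp only [Zsqrtd.norm_eq_mul_conj, star_mul, star_intCast]; ring
  case zab =>
    rw [e1] at n1; refine le_trans (le_of_eq ?_) n1
    simp only [Zsqrtd.norm_mul, Zsqrtd.norm_conj, Zsqrtd.norm_intCast]; ring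
  case zcd =>
    rw [e6] at n6; refine le_trans (le_of_eq ?_) n6
    simp only [Zsqrtd.norm_mul, Zsqrtd.norm_conj, Zsqrtd.norm_intCast]; ring
  case zac =>
    rw [e2] at n2; refine le_trans (le_of_eq ?_) n2
    simp only [Zsqrtd.norm_mul, Zsqrtd.norm_conj, Zsqrtd.norm_intCast]; ring
  case zbd =>
    rw [e5] at n5; refine le_trans (le_of_eq ?_) n5
    simp only [Zsqrtd.norm_mul, Zsqrtd.norm_conj, Zsqrtd.norm_intCast]; ring
  case zad =>
    rw [e3] at n3; refine le_trans (le_of_eq ?_) n3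
    simp only [Zsqrtd.norm_mul, Zsqrtd.norm_conj, Zsqrtd.norm_intCast]; ring
  case zbc =>
    rw [e4] at n4; refine le_trans (le_of_eq ?_) n4
    simp only [Zsqrtd.norm_mul, Zsqrtd.norm_conj, Zsqrtd.norm_intCast]; ring

/-! ### Concyclic points -/

/-- the point `a` lies on the circle with centre `c` and squared radius `r` -/
def OnC (c : ℂ) (r : ℝ) (a : GaussianInt) : Prop :=
  ((a : ℂ) - c) * ((starRingEnd ℂ) (a : ℂ) - (starRingEnd ℂ) c) = r

theorem OnC_iff (c : ℂ) (r : ℝ) (a : GaussianInt) :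
    OnC c r a ↔ ((a.re : ℝ) - c.re) ^ 2 + ((a.im : ℝ) - c.im) ^ 2 = r := by
  unfold OnC
  rw [← map_sub, Complex.mul_conj, Complex.normSq_apply]
  simp only [Complex.sub_re, Complex.sub_im, GaussianInt.intCast_re, GaussianInt.intCast_im]
  norm_cast
  rw [← pow_two, ← pow_two]

theorem gim_zero_iff (z : GaussianInt) : z.im = 0 ↔ (starRingEnd ℂ) (z : ℂ) = (z : ℂ) := by
  rw [Complex.conj_eq_iff_im, ← GaussianInt.intCast_im]
  exact_mod_cast Iff.rfl

theorem gnorm_complex (z : GaussianInt) : ((z.norm : ℤ) : ℂ) = (z : ℂ) * (starRingEnd ℂ) (z : ℂ) := by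
  rw [GaussianInt.intCast_complex_norm, Complex.mul_conj]

theorem fld_inv {a A r : ℂ} (hr : r ≠ 0) (h : a * A = r) : a ≠ 0 ∧ A = r / a := by
  have : a ≠ 0 := by rintro rfl; simp at h; exact hr h.symm
  exact ⟨this, by field_simp; linear_combination h⟩

theorem fld_g1 {a b c A B C r : ℂ} (hr : r ≠ 0) (ha : a * A = r) (hb : b * B = r) (hc : c * C = r)
    (hab : a ≠ b) (hac : a ≠ c) (h : (b - a) * (C - A) = (B - A) * (c - a)) : b = c := by
  obtain ⟨a0, rfl⟩ := fld_inv hr ha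
  obtain ⟨b0, rfl⟩ := fld_inv hr hb
  obtain ⟨c0, rfl⟩ := fld_inv hr hc
  have e : (b - a) * (r / c - r / a) - (r / b - r / a) * (c - a) =
      (b - a) * (a - c) * (b - c) * (r / (a * b * c)) := by
    field_simp; ring
  rw [h, sub_self] at e
  have h1 : r / (a * b * c) ≠ 0 := by positivity
  have h2 : b - a ≠ 0 := sub_ne_zero.mpr hab.symm
  have h3 : a - c ≠ 0 := sub_ne_zero.mpr hac
  have := mul_eq_zero.mp e.symm
  have h4 : b - c = 0 := by
    simpa [h1, h2, h3] using e.symm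
  linear_combination h4

theorem fld_g2 {a b c d A B C D r : ℂ} (hr : r ≠ 0) (ha : a * A = r) (hb : b * B = r)
    (hc : c * C = r) (hd : d * D = r) :
    (B - A) * (D - C) * ((c - a) * (d - b)) = (b - a) * (d - c) * ((C - A) * (D - B)) := by
  obtain ⟨a0, rfl⟩ := fld_inv hr ha
  obtain ⟨b0, rfl⟩ := fld_inv hr hb
  obtain ⟨c0, rfl⟩ := fld_inv hr hc
  obtain ⟨d0, rfl⟩ := fld_inv hr hd
  field_simp; ring

theorem fld_g3 {a b c d A B C D r : ℂ} (hr : r ≠ 0) (ha : a * A = r) (hb : b * B = r)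
    (hc : c * C = r) (hd : d * D = r) (h : (b - a) * (B - A) = (d - c) * (D - C)) :
    (c - a) * (D - B) = (C - A) * (d - b) ∨ (d - a) * (C - B) = (D - A) * (c - b) := by
  obtain ⟨a0, rfl⟩ := fld_inv hr ha
  obtain ⟨b0, rfl⟩ := fld_inv hr hb
  obtain ⟨c0, rfl⟩ := fld_inv hr hc
  obtain ⟨d0, rfl⟩ := fld_inv hr hd
  have e : (b * c - a * d) * (b * d - a * c) = 0 := by
    field_simp at h
    linear_combination -h
  rcases mul_eq_zero.mp e with h1 | h1
  · right
    field_simp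
    linear_combination (a - d) * (b - c) * h1
  · left
    field_simp
    linear_combination (a - c) * (b - d) * h1

theorem onC_noncollinear {c : ℂ} {r : ℝ} (hr : 0 < r) {x y z : GaussianInt} (hx : OnC c r x)
    (hy : OnC c r y) (hz : OnC c r z) (hxy : x ≠ y) (hxz : x ≠ z) (hyz : y ≠ z) :
    (star (y - x) * (z - x)).im ≠ 0 := by
  rw [ne_eq, gim_zero_iff]
  intro h
  have hr' : (r : ℂ) ≠ 0 := by exact_mod_cast hr.ne'
  simp only [map_mul, map_sub, GaussianInt.toComplex_star, Complex.conj_conj] at h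
  have n1 : (x : ℂ) - c ≠ y - c := by
    intro h; exact hxy (GaussianInt.toComplex_inj.mp (by linear_combination h))
  have n2 : (x : ℂ) - c ≠ z - c := by
    intro h; exact hxz (GaussianInt.toComplex_inj.mp (by linear_combination h))
  have := fld_g1 hr' hx hy hz n1 n2 (by linear_combination h)
  exact hyz (GaussianInt.toComplex_inj.mp (by linear_combination this))

theorem onC_cross {c : ℂ} {r : ℝ} (hr : 0 < r) {x y z t : GaussianInt} (hx : OnC c r x)
    (hy : OnC c r y) (hz : OnC c r z) (ht : OnC c r t) :
    ((y - x) * (t - z) * star ((z - x) * (t - y))).im = 0 := by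
  rw [gim_zero_iff]
  have hr' : (r : ℂ) ≠ 0 := by exact_mod_cast hr.ne'
  simp only [map_mul, map_sub, GaussianInt.toComplex_star, Complex.conj_conj]
  have := fld_g2 hr' hx hy hz ht
  linear_combination this

theorem onC_len {c : ℂ} {r : ℝ} (hr : 0 < r) {x y z t : GaussianInt} (hx : OnC c r x)
    (hy : OnC c r y) (hz : OnC c r z) (ht : OnC c r t) (h : (y - x).norm = (t - z).norm) :
    (star (z - x) * (t - y)).im = 0 ∨ (star (t - x) * (z - y)).im = 0 := by
  rw [gim_zero_iff, gim_zero_iff]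
  have hr' : (r : ℂ) ≠ 0 := by exact_mod_cast hr.ne'
  have h1 := congrArg (fun n : ℤ => (n : ℂ)) h
  simp only [gnorm_complex, map_sub] at h1
  simp only [map_mul, map_sub, GaussianInt.toComplex_star, Complex.conj_conj]
  rcases fld_g3 hr' hx hy hz ht (by linear_combination h1) with h | h
  · left; linear_combination h
  · right; linear_combination h

/-- A concyclic quadruple without parallel opposite sides comes from data. -/
theorem onC_data {c : ℂ} {r : ℝ} (hr : 0 < r) {A B C D : GaussianInt} (hA : OnC c r A)
    (hB : OnC c r B) (hC : OnC c r C) (hD : OnC c r D) (hAB : A ≠ B) (hAC : A ≠ C) (hAD : A ≠ D)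
    (hBC : B ≠ C) (hBD : B ≠ D) (hCD : C ≠ D)
    (p1 : (star (B - A) * (D - C)).im ≠ 0) (p2 : (star (C - A) * (D - B)).im ≠ 0)
    (p3 : (star (D - A) * (C - B)).im ≠ 0) {R : ℤ} (n1 : (B - A).norm ≤ R) (n2 : (C - A).norm ≤ R)
    (n3 : (D - A).norm ≤ R) (n4 : (C - B).norm ≤ R) (n5 : (D - B).norm ≤ R)
    (n6 : (D - C).norm ≤ R) :
    ∃ d : QD, QOk R d ∧ B = A + d.g * d.tc * d.td * (d.s1 * d.kab * d.u) ∧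
      C = A + d.g * d.tb * d.td * (d.s2 * d.kac * d.v) ∧
      D = A + d.g * d.tb * d.tc * (d.s3 * d.kad * d.w) := by
  have q1 : (C - A) - (B - A) = C - B := by ring
  have q2 : (D - A) - (B - A) = D - B := by ring
  have q3 : (D - A) - (C - A) = D - C := by ring
  have sw : ∀ x y : GaussianInt, (star (x - y)) = - star (y - x) := by
    intro x y; rw [← star_neg]; congr 1; ring
  obtain ⟨d, hd, h1, h2, h3⟩ := exists_data R (B - A) (C - A) (D - A)
    (by rw [q2, q3]; exact onC_cross hr hA hB hC hD)
    (onC_noncollinear hr hA hB hC hAB hAC hBC) (onC_noncollinear hr hA hB hD hAB hAD hBD)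
    (onC_noncollinear hr hA hC hD hAC hAD hCD) (by rwa [q3]) (by rwa [q2]) (by rwa [q1])
    (by
      rw [q3]; intro h
      rcases onC_len hr hA hB hC hD h with h | h
      · exact p2 h
      · exact p3 h)
    (by
      rw [q2]; intro h
      rcases onC_len hr hA hC hB hD h with h | h
      · exact p1 h
      · apply p3
        rw [← neg_sub B C, mul_neg, Zsqrtd.im_neg, h, neg_zero])
    (by
      rw [q1]; intro h
      rcases onC_len hr hA hD hB hC h with h | h
      · apply p1
        rw [← neg_sub C D, mul_neg, Zsqrtd.im_neg, h, neg_zero]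
      · apply p2
        rw [← neg_sub B D, mul_neg, Zsqrtd.im_neg, h, neg_zero])
    n1 n2 n3 (by rwa [q1]) (by rwa [q2]) (by rwa [q3])
  exact ⟨d, hd, by linear_combination h1, by linear_combination h2, by linear_combination h3⟩

/-! ### Translation to Gaussian integers -/

/-- the grid inside the Gaussian integers -/
noncomputable def gr (n : ℕ) : Finset GaussianInt :=
  ((Finset.Icc (1 : ℤ) n) ×ˢ (Finset.Icc (1 : ℤ) n)).map
    ⟨fun p => (⟨p.1, p.2⟩ : GaussianInt), fun p q h => by
      have h1 := congrArg Zsqrtd.re h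
      have h2 := congrArg Zsqrtd.im h
      exact Prod.ext h1 h2⟩

theorem mem_gr {n : ℕ} {z : GaussianInt} : z ∈ gr n ↔ (1 ≤ z.re ∧ z.re ≤ n) ∧ (1 ≤ z.im ∧ z.im ≤ n) := by
  unfold gr
  simp only [Finset.mem_map, Finset.mem_product, Finset.mem_Icc, Function.Embedding.coeFn_mk,
    Prod.exists]
  constructor
  · rintro ⟨a, b, h, rfl⟩; exact h
  · intro h; exact ⟨z.re, z.im, h, rfl⟩

theorem gr_card (n : ℕ) : (gr n).card = n ^ 2 := by
  unfold gr
  rw [Finset.card_map, Finset.card_product, Int.card_Icc, pow_two]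
  simp

/-- four collinear points -/
def CollQ (Q : Finset GaussianInt) : Prop :=
  ∀ p ∈ Q, ∀ q ∈ Q, ∀ r ∈ Q, (star (q - p) * (r - p)).im = 0

/-- concyclic points -/
def ConcQ (Q : Finset GaussianInt) : Prop :=
  ∃ (c : ℂ) (r : ℝ), 0 < r ∧ ∀ z ∈ Q, OnC c r z

/-- the embedding into the plane -/
noncomputable def emb (z : GaussianInt) : EuclideanSpace ℝ (Fin 2) := !₂[(z.re : ℝ), (z.im : ℝ)]

theorem emb_inj : Function.Injective emb := by
  intro a b h
  have h0 := congrArg (fun v : EuclideanSpace ℝ (Fin 2) => v 0) h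
  have h1 := congrArg (fun v : EuclideanSpace ℝ (Fin 2) => v 1) h
  simp [emb, -GaussianInt.intCast_re, -GaussianInt.intCast_im] at h0 h1
  ext
  · exact_mod_cast h0
  · exact_mod_cast h1

theorem emb_grid (n : ℕ) : emb '' (gr n : Set GaussianInt) = grid n := by
  ext v
  constructor
  · rintro ⟨z, hz, rfl⟩
    rw [Finset.mem_coe, mem_gr] at hz
    intro i
    fin_cases i
    · refine ⟨z.re.toNat, by omega, by omega, ?_⟩
      have : ((z.re.toNat : ℤ) : ℝ) = z.re := by rw [Int.toNat_of_nonneg (by omega)]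
      simp only [emb]; rw [← Int.cast_natCast, this]; simp
    · refine ⟨z.im.toNat, by omega, by omega, ?_⟩
      have : ((z.im.toNat : ℤ) : ℝ) = z.im := by rw [Int.toNat_of_nonneg (by omega)]
      simp only [emb]; rw [← Int.cast_natCast, this]; simp
  · intro h
    obtain ⟨a, a1, a2, a3⟩ := h 0
    obtain ⟨b, b1, b2, b3⟩ := h 1
    refine ⟨⟨a, b⟩, ?_, ?_⟩
    · rw [Finset.mem_coe, mem_gr]; simp only; omega
    · ext i; fin_cases i
      · simp [emb, a3]
      · simp [emb, b3]

theorem emb_line (Q : Finset GaussianInt) (hQ : Q.card = 4) :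
    (∃ L : AffineSubspace ℝ (EuclideanSpace ℝ (Fin 2)),
        Module.finrank ℝ L.direction = 1 ∧ emb '' Q ⊆ (L : Set (EuclideanSpace ℝ (Fin 2)))) ↔
    CollQ Q := by
  constructor
  · rintro ⟨L, hL, hQL⟩ p hp q hq r hr
    obtain ⟨v, hv0, hv⟩ := finrank_eq_one_iff'.mp hL
    have mem : ∀ z ∈ Q, emb z ∈ L := fun z hz => hQL ⟨z, hz, rfl⟩
    obtain ⟨s, hs⟩ := hv ⟨_, AffineSubspace.vsub_mem_direction (mem q hq) (mem p hp)⟩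
    obtain ⟨t, ht⟩ := hv ⟨_, AffineSubspace.vsub_mem_direction (mem r hr) (mem p hp)⟩
    have hs' := congrArg Subtype.val hs
    have ht' := congrArg Subtype.val ht
    simp only [Submodule.coe_smul, vsub_eq_sub] at hs' ht'
    have s0 := congrArg (fun v : EuclideanSpace ℝ (Fin 2) => v 0) hs'
    have s1 := congrArg (fun v : EuclideanSpace ℝ (Fin 2) => v 1) hs'
    have t0 := congrArg (fun v : EuclideanSpace ℝ (Fin 2) => v 0) ht'
    have t1 := congrArg (fun v : EuclideanSpace ℝ (Fin 2) => v 1) ht'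
    simp [emb] at s0 s1 t0 t1
    have : ((star (q - p) * (r - p)).im : ℝ) = 0 := by
      simp
      linear_combination (-((GaussianInt.toComplex r).im - (GaussianInt.toComplex p).im)) * s0 - s * v.1 0 * t1 +
        ((GaussianInt.toComplex r).re - (GaussianInt.toComplex p).re) * s1 + s * v.1 1 * t0
    exact_mod_cast this
  · intro h
    obtain ⟨p, hp, q, hq, hpq⟩ := Finset.one_lt_card.mp (by omega : 1 < Q.card)
    have hne : emb q - emb p ≠ 0 := sub_ne_zero.mpr (fun h => hpq (emb_inj h).symm)
    refine ⟨AffineSubspace.mk' (emb p) (Submodule.span ℝ {emb q - emb p}), ?_, ?_⟩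
    · rw [AffineSubspace.direction_mk']
      exact finrank_span_singleton hne
    · rintro _ ⟨r, hr, rfl⟩
      rw [SetLike.mem_coe, AffineSubspace.mem_mk', vsub_eq_sub, Submodule.mem_span_singleton]
      have h1 := h p hp q hq r hr
      have h2 : (((q - p).re : ℝ)) * (r - p).im - (q - p).im * (r - p).re = 0 := by
        have : (((star (q - p) * (r - p)).im : ℤ) : ℝ) = 0 := by rw [h1]; simp
        rw [← this]; simp; ring
      have hd : ((q - p).re : ℝ) ^ 2 + ((q - p).im : ℝ) ^ 2 ≠ 0 := by
        intro h0
        have e1 : ((q - p).re : ℝ) = 0 := by nlinarith [sq_nonneg ((q - p).re : ℝ), sq_nonneg ((q - p).im : ℝ)]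
        have e2 : ((q - p).im : ℝ) = 0 := by nlinarith [sq_nonneg ((q - p).re : ℝ), sq_nonneg ((q - p).im : ℝ)]
        apply hpq
        have f1 : (q - p).re = 0 := by exact_mod_cast e1
        have f2 : (q - p).im = 0 := by exact_mod_cast e2
        simp at f1 f2
        ext <;> omega
      refine ⟨(((q - p).re : ℝ) * (r - p).re + (q - p).im * (r - p).im) /
        (((q - p).re : ℝ) ^ 2 + ((q - p).im : ℝ) ^ 2), ?_⟩
      ext i; fin_cases i
      · have : (emb q - emb p) 0 = ((q - p).re : ℝ) := by simp [emb]
        have h3 : (emb r - emb p) 0 = ((r - p).re : ℝ) := by simp [emb]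
        show _ * (emb q - emb p) 0 = (emb r - emb p) 0
        rw [this, h3, div_mul_eq_mul_div, div_eq_iff hd]
        linear_combination ((q - p).im : ℝ) * h2
      · have : (emb q - emb p) 1 = ((q - p).im : ℝ) := by simp [emb]
        have h3 : (emb r - emb p) 1 = ((r - p).im : ℝ) := by simp [emb]
        show _ * (emb q - emb p) 1 = (emb r - emb p) 1
        rw [this, h3, div_mul_eq_mul_div, div_eq_iff hd]
        linear_combination -((q - p).re : ℝ) * h2

theorem emb_circ (Q : Finset GaussianInt) :
    (∃ (c : EuclideanSpace ℝ (Fin 2)) (ρ : ℝ), 0 < ρ ∧ emb '' Q ⊆ Metric.sphere c ρ) ↔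
    ConcQ Q := by
  have key : ∀ (z : GaussianInt) (c : EuclideanSpace ℝ (Fin 2)) (ρ : ℝ), 0 < ρ →
      (emb z ∈ Metric.sphere c ρ ↔ OnC ⟨c 0, c 1⟩ (ρ ^ 2) z) := by
    intro z c ρ hρ
    rw [OnC_iff, Metric.mem_sphere, EuclideanSpace.dist_eq, Fin.sum_univ_two,
      Real.sqrt_eq_iff_mul_self_eq (by positivity) hρ.le, Real.dist_eq, Real.dist_eq, sq_abs, sq_abs]
    simp only [emb]
    constructor
    · intro h; simp at h ⊢; linarith
    · intro h; simp at h ⊢; linarith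
  constructor
  · rintro ⟨c, ρ, hρ, h⟩
    exact ⟨⟨c 0, c 1⟩, ρ ^ 2, by positivity, fun z hz => (key z c ρ hρ).mp (h ⟨z, hz, rfl⟩)⟩
  · rintro ⟨c, r, hr, h⟩
    refine ⟨!₂[c.re, c.im], √r, Real.sqrt_pos.mpr hr, ?_⟩
    rintro _ ⟨z, hz, rfl⟩
    rw [key z _ _ (Real.sqrt_pos.mpr hr), Real.sq_sqrt hr.le]
    exact h z hz

open Classical in
theorem badQuad_eq (n : ℕ) : badQuadCount n =
    (((gr n).powersetCard 4).filter (fun Q => CollQ Q ∨ ConcQ Q)).card := by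
  unfold badQuadCount
  rw [← Set.ncard_coe_finset, ← Set.ncard_image_of_injective (f := fun Q : Finset GaussianInt => emb '' (Q : Set GaussianInt))]
  · congr 1
    ext S
    simp only [Set.mem_ofPred_eq, Set.mem_image, Finset.mem_coe, Finset.mem_filter,
      Finset.mem_powersetCard]
    constructor
    · rintro ⟨h1, h2, h3⟩
      have hS : emb '' (emb ⁻¹' S) = S := by
        rw [Set.image_preimage_eq_iff]
        intro v hv
        have := h1 hv
        rw [← emb_grid] at this
        obtain ⟨z, -, hz⟩ := this
        exact ⟨z, hz⟩
      have hsub : emb ⁻¹' S ⊆ (gr n : Set GaussianInt) := by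
        intro z hz
        have := h1 hz
        rw [← emb_grid] at this
        obtain ⟨z', hz', e⟩ := this
        rwa [← emb_inj e]
      have hfin : (emb ⁻¹' S).Finite := (Finset.finite_toSet _).subset hsub
      have hc : hfin.toFinset.card = 4 := by
        rw [← Set.ncard_coe_finset, Set.Finite.coe_toFinset,
          ← Set.ncard_image_of_injective _ emb_inj, hS, h2]
      refine ⟨hfin.toFinset, ⟨⟨?_, hc⟩, ?_⟩, ?_⟩
      · intro z hz; exact hsub (by simpa using hz)
      · rcases h3 with h | h
        · left; rw [← emb_line _ hc]; rwa [Set.Finite.coe_toFinset, hS]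
        · right; rw [← emb_circ]; rwa [Set.Finite.coe_toFinset, hS]
      · rw [Set.Finite.coe_toFinset, hS]
    · rintro ⟨Q, ⟨⟨h1, h2⟩, h3⟩, rfl⟩
      refine ⟨?_, ?_, ?_⟩
      · rw [← emb_grid]; exact Set.image_mono (by exact_mod_cast h1)
      · rw [Set.ncard_image_of_injective _ emb_inj, Set.ncard_coe_finset, h2]
      · rwa [emb_line _ h2, emb_circ]
  · intro a b h
    exact_mod_cast emb_inj.image_injective h

open Classical in
/-- collinear quadruples -/
noncomputable def collSet (n : ℕ) : Finset (Finset GaussianInt) :=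
  ((gr n).powersetCard 4).filter CollQ

open Classical in
/-- concyclic quadruples -/
noncomputable def concSet (n : ℕ) : Finset (Finset GaussianInt) :=
  ((gr n).powersetCard 4).filter ConcQ

theorem badQuad_split (n : ℕ) : badQuadCount n = (collSet n).card + (concSet n).card := by
  classical
  rw [badQuad_eq, collSet, concSet, Finset.filter_or, Finset.card_union_of_disjoint]
  rw [Finset.disjoint_filter]
  rintro Q hQ h1 ⟨c, r, hr, h2⟩
  rw [Finset.mem_powersetCard] at hQ
  obtain ⟨x, hx, y, hy, z, hz, hxy, hxz, hyz⟩ := Finset.two_lt_card.mp (by omega : 2 < Q.card)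
  exact onC_noncollinear hr (h2 x hx) (h2 y hy) (h2 z hz) hxy hxz hyz (h1 x hx y hy z hz)

/-! ### Trapezoids -/

/-- cross product -/
def crs (p q : GaussianInt) : ℤ := p.re * q.im - p.im * q.re

/-- dot product -/
def dt (p q : GaussianInt) : ℤ := p.re * q.re + p.im * q.im

theorem star_mul_im_eq (p q : GaussianInt) : (star p * q).im = crs p q := by
  simp [crs]; ring

/-- isosceles trapezoid, not a rectangle, with positively oriented longer base `AB` -/
structure IsTrap (A B C E : GaussianInt) : Prop where
  par : crs (B - A) (E - C) = 0
  dir : 0 < dt (B - A) (E - C)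
  lt : dt (E - C) (E - C) < dt (B - A) (B - A)
  ori : 0 < crs (B - A) (C - A)
  mir : dt (B - A) (A + B - C - E) = 0

theorem par_core {z1 z2 v1 v2 w1 w2 : ℤ} (par : z1 * v2 - z2 * v1 = 0)
    (dir : 0 < z1 * v1 + z2 * v2) (lt : v1 * v1 + v2 * v2 < z1 * z1 + z2 * z2)
    (ori : 0 < z1 * w2 - z2 * w1) :
    0 < w1 * (w2 + v2 - z2) - w2 * (w1 + v1 - z1) ∧
    0 < (w1 + v1) * (w2 - z2) - (w2 + v2) * (w1 - z1) := by
  have hN : 0 < z1 * z1 + z2 * z2 := by nlinarith [mul_self_nonneg v1, mul_self_nonneg v2]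
  have hs : (z1 * v1 + z2 * v2) < z1 * z1 + z2 * z2 := by
    have : (z1 * v1 + z2 * v2) ^ 2 = (z1 * z1 + z2 * z2) * (v1 * v1 + v2 * v2) := by
      linear_combination (-(z1 * v2 - z2 * v1)) * par
    by_contra hc
    push Not at hc
    nlinarith
  constructor
  · have : (z1 * z1 + z2 * z2) * (w1 * (w2 + v2 - z2) - w2 * (w1 + v1 - z1)) =
      ((z1 * z1 + z2 * z2) - (z1 * v1 + z2 * v2)) * (z1 * w2 - z2 * w1) := by
      linear_combination (z1 * w1 + z2 * w2) * par
    have h2 : 0 < ((z1 * z1 + z2 * z2) - (z1 * v1 + z2 * v2)) * (z1 * w2 - z2 * w1) :=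
      mul_pos (by linarith) ori
    rw [← this] at h2
    exact pos_of_mul_pos_right h2 hN.le
  · have : (z1 * z1 + z2 * z2) * ((w1 + v1) * (w2 - z2) - (w2 + v2) * (w1 - z1)) =
      ((z1 * z1 + z2 * z2) + (z1 * v1 + z2 * v2)) * (z1 * w2 - z2 * w1) := by
      linear_combination (z1 * z1 + z2 * z2 - (z1 * w1 + z2 * w2)) * par
    have h2 : 0 < ((z1 * z1 + z2 * z2) + (z1 * v1 + z2 * v2)) * (z1 * w2 - z2 * w1) :=
      mul_pos (by linarith) ori
    rw [← this] at h2
    exact pos_of_mul_pos_right h2 hN.le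

theorem IsTrap.extra {A B C E : GaussianInt} (h : IsTrap A B C E) :
    0 < crs (C - A) (E - B) ∧ 0 < crs (E - A) (C - B) := by
  obtain ⟨h1, h2, h3, h4, h5⟩ := h
  obtain ⟨e1, e2⟩ := par_core (z1 := (B - A).re) (z2 := (B - A).im) (v1 := (E - C).re)
    (v2 := (E - C).im) (w1 := (C - A).re) (w2 := (C - A).im) h1 h2 h3 h4
  simp only [Zsqrtd.re_sub, Zsqrtd.im_sub] at e1 e2
  constructor
  · simp only [crs, Zsqrtd.re_sub, Zsqrtd.im_sub]; linarith
  · simp only [crs, Zsqrtd.re_sub, Zsqrtd.im_sub]; linarith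

theorem IsTrap.distinct {A B C E : GaussianInt} (h : IsTrap A B C E) :
    A ≠ B ∧ A ≠ C ∧ A ≠ E ∧ B ≠ C ∧ B ≠ E ∧ C ≠ E := by
  obtain ⟨e1, e2⟩ := h.extra
  obtain ⟨h1, h2, h3, h4, h5⟩ := h
  refine ⟨?_, ?_, ?_, ?_, ?_, ?_⟩ <;> rintro rfl <;> simp [crs, dt] at *

theorem IsTrap.unique {A B C E A' B' C' E' : GaussianInt} (h : IsTrap A B C E)
    (h' : IsTrap A' B' C' E')
    (hQ : ({A, B, C, E} : Finset GaussianInt) = {A', B', C', E'}) :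
    A' = A ∧ B' = B ∧ C' = C ∧ E' = E := by
  obtain ⟨d1, d2, d3, d4, d5, d6⟩ := h'.distinct
  obtain ⟨e1, e2⟩ := h.extra
  have mA : A' ∈ ({A, B, C, E} : Finset GaussianInt) := by rw [hQ]; simp
  have mB : B' ∈ ({A, B, C, E} : Finset GaussianInt) := by rw [hQ]; simp
  have mC : C' ∈ ({A, B, C, E} : Finset GaussianInt) := by rw [hQ]; simp
  have mE : E' ∈ ({A, B, C, E} : Finset GaussianInt) := by rw [hQ]; simp
  clear hQ
  simp only [Finset.mem_insert, Finset.mem_singleton] at mA mB mC mE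
  obtain ⟨h1, h2, h3, h4, h5⟩ := h
  obtain ⟨h1', h2', h3', h4', h5'⟩ := h'
  clear h5 h5'
  rcases mA with rfl | rfl | rfl | rfl <;> rcases mB with rfl | rfl | rfl | rfl <;>
    first
    | exact absurd rfl d1
    | (rcases mC with rfl | rfl | rfl | rfl <;>
        first
        | exact absurd rfl d2
        | exact absurd rfl d4
        | (rcases mE with rfl | rfl | rfl | rfl <;>
            first
            | exact absurd rfl d3
            | exact absurd rfl d5
            | exact absurd rfl d6
            | exact ⟨rfl, rfl, rfl, rfl⟩
            | (exfalso
               simp only [crs, dt, Zsqrtd.re_sub, Zsqrtd.im_sub] at h1 h2 h3 h4 e1 e2 h1' h2' h3' h4'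
               linarith)))

theorem IsTrap.conc {A B C E : GaussianInt} (h : IsTrap A B C E) :
    ConcQ {A, B, C, E} := by
  obtain ⟨h1, h2, h3, h4, h5⟩ := h
  have cast : ∀ {a b : ℤ}, a = b → (a : ℝ) = b := fun h => by rw [h]
  have castl : ∀ {a b : ℤ}, a < b → (a : ℝ) < b := fun h => by exact_mod_cast h
  replace h1 := cast h1
  replace h2 := castl h2
  replace h3 := castl h3
  replace h4 := castl h4
  replace h5 := cast h5
  simp only [crs, dt, Zsqrtd.re_sub, Zsqrtd.im_sub, Zsqrtd.re_add, Zsqrtd.im_add] at h1 h2 h3 h4 h5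
  push_cast [-GaussianInt.intCast_re, -GaussianInt.intCast_im] at h1 h2 h3 h4 h5
  set a1 : ℝ := (A.re : ℝ) with ha1
  set a2 : ℝ := (A.im : ℝ) with ha2
  obtain ⟨z1, hz1⟩ : ∃ z1 : ℝ, z1 = (B.re : ℝ) - a1 := ⟨_, rfl⟩
  obtain ⟨z2, hz2⟩ : ∃ z1 : ℝ, z1 = (B.im : ℝ) - a2 := ⟨_, rfl⟩
  obtain ⟨w1, hw1⟩ : ∃ z1 : ℝ, z1 = (C.re : ℝ) - a1 := ⟨_, rfl⟩
  obtain ⟨w2, hw2⟩ : ∃ z1 : ℝ, z1 = (C.im : ℝ) - a2 := ⟨_, rfl⟩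
  obtain ⟨v1, hv1⟩ : ∃ z1 : ℝ, z1 = (E.re : ℝ) - (C.re : ℝ) := ⟨_, rfl⟩
  obtain ⟨v2, hv2⟩ : ∃ z1 : ℝ, z1 = (E.im : ℝ) - (C.im : ℝ) := ⟨_, rfl⟩
  rw [← hz1, ← hz2, ← hv1, ← hv2] at h1 h2 h3
  rw [← hz1, ← hz2, ← hw1, ← hw2] at h4
  rw [← hz1, ← hz2] at h5
  replace h5 : z1 * (z1 - 2 * w1 - v1) + z2 * (z2 - 2 * w2 - v2) = 0 := by
    rw [← h5, hw1, hw2, hv1, hv2]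
    linear_combination z1 * hz1 + z2 * hz2
  have hN : 0 < z1 * z1 + z2 * z2 := by nlinarith [mul_self_nonneg v1, mul_self_nonneg v2]
  obtain ⟨s, hs⟩ : ∃ s, s = (z1 * v1 + z2 * v2) / (z1 * z1 + z2 * z2) := ⟨_, rfl⟩
  have e1 : v1 = s * z1 := by
    rw [hs, div_mul_eq_mul_div, eq_div_iff hN.ne']; linear_combination (-z2) * h1
  have e2 : v2 = s * z2 := by
    rw [hs, div_mul_eq_mul_div, eq_div_iff hN.ne']; linear_combination (z1) * h1
  obtain ⟨t, ht⟩ : ∃ t, t = (w1 * w1 + w2 * w2 - (w1 * z1 + w2 * z2)) / (2 * (z1 * w2 - z2 * w1)) :=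
    ⟨_, rfl⟩
  rw [eq_div_iff (by linarith)] at ht
  refine ⟨⟨a1 + z1 / 2 - t * z2, a2 + z2 / 2 + t * z1⟩, (z1 * z1 + z2 * z2) * (1 / 4 + t ^ 2),
    by positivity, ?_⟩
  intro p hp
  rw [OnC_iff]
  simp only [Finset.mem_insert, Finset.mem_singleton] at hp
  rcases hp with rfl | rfl | rfl | rfl
  · rw [← ha1, ← ha2]; ring
  · have x1 : (p.re : ℝ) = a1 + z1 := by linarith
    have x2 : (p.im : ℝ) = a2 + z2 := by linarith
    rw [x1, x2]; ring
  · have x1 : (p.re : ℝ) = a1 + w1 := by linarith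
    have x2 : (p.im : ℝ) = a2 + w2 := by linarith
    rw [x1, x2]; linear_combination -ht
  · have x1 : (p.re : ℝ) = a1 + w1 + v1 := by linarith
    have x2 : (p.im : ℝ) = a2 + w2 + v2 := by linarith
    rw [x1, x2]
    rw [e1, e2] at h5 ⊢
    linear_combination -ht - s * h5

/-- rectangle -/
structure IsRect (A B C E : GaussianInt) : Prop where
  e : E = C + (B - A)
  perp : dt (B - A) (C - A) = 0
  nb : B ≠ A
  nc : C ≠ A

theorem onC_mirror {c : ℂ} {r : ℝ} {A B C E : GaussianInt} (hA : OnC c r A)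
    (hB : OnC c r B) (hC : OnC c r C) (hE : OnC c r E) (hz : B ≠ A)
    (hCE : C ≠ E) (par : crs (B - A) (E - C) = 0) : dt (B - A) (A + B - C - E) = 0 := by
  rw [OnC_iff] at hA hB hC hE
  have cast : ∀ {a b : ℤ}, a = b → (a : ℝ) = b := fun h => by rw [h]
  have hv : (E.re : ℝ) - C.re ≠ 0 ∨ (E.im : ℝ) - C.im ≠ 0 := by
    by_contra hc
    push Not at hc
    obtain ⟨c1, c2⟩ := hc
    apply hCE
    ext
    · have : (C.re : ℝ) = E.re := by linarith
      exact_mod_cast this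
    · have : (C.im : ℝ) = E.im := by linarith
      exact_mod_cast this
  replace par := cast par
  suffices h : ((dt (B - A) (A + B - C - E) : ℤ) : ℝ) = 0 by exact_mod_cast h
  simp only [crs, dt, Zsqrtd.re_sub, Zsqrtd.im_sub, Zsqrtd.re_add, Zsqrtd.im_add] at par ⊢
  push_cast [-GaussianInt.intCast_re, -GaussianInt.intCast_im] at par ⊢
  generalize (A.re : ℝ) = a1 at *
  generalize (A.im : ℝ) = a2 at *
  generalize (B.re : ℝ) = b1 at *
  generalize (B.im : ℝ) = b2 at *
  generalize (C.re : ℝ) = c1 at *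
  generalize (C.im : ℝ) = c2 at *
  generalize (E.re : ℝ) = e1 at *
  generalize (E.im : ℝ) = e2 at *
  have m1 : (b1 - a1) * (a1 + b1 - 2 * c.re) + (b2 - a2) * (a2 + b2 - 2 * c.im) = 0 := by
    linear_combination hB - hA
  have m2 : (e1 - c1) * (e1 + c1 - 2 * c.re) + (e2 - c2) * (e2 + c2 - 2 * c.im) = 0 := by
    linear_combination hE - hC
  have m3 : (b1 - a1) * (e1 + c1 - 2 * c.re) + (b2 - a2) * (e2 + c2 - 2 * c.im) = 0 := by
    rcases hv with hv | hv
    · apply mul_left_cancel₀ hv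
      linear_combination (b1 - a1) * m2 - (e2 + c2 - 2 * c.im) * par
    · apply mul_left_cancel₀ hv
      linear_combination (b2 - a2) * m2 + (e1 + c1 - 2 * c.re) * par
  linear_combination m1 - m3

theorem classify1 {c : ℂ} {r : ℝ} (hr : 0 < r) {A B C E : GaussianInt} (hA : OnC c r A)
    (hB : OnC c r B) (hC : OnC c r C) (hE : OnC c r E) (hAB : A ≠ B) (hAC : A ≠ C) (hAE : A ≠ E)
    (hBC : B ≠ C) (hBE : B ≠ E) (hCE : C ≠ E) (par : crs (B - A) (E - C) = 0)
    (dir : 0 < dt (B - A) (E - C)) :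
    IsTrap A B C E ∨ IsTrap B A E C ∨ IsTrap C E A B ∨ IsTrap E C B A ∨ IsRect A B C E := by
  have mir := onC_mirror hA hB hC hE hAB.symm hCE par
  have par' : crs (E - C) (B - A) = 0 := by
    simp only [crs] at par ⊢; linarith
  have mir' := onC_mirror hC hE hA hB hCE.symm hAB par'
  have n1 := onC_noncollinear hr hA hB hC hAB hAC hBC
  have n2 := onC_noncollinear hr hC hE hA hCE hAC.symm hAE.symm
  rw [star_mul_im_eq] at n1 n2
  simp only [crs, dt, Zsqrtd.re_sub, Zsqrtd.im_sub, Zsqrtd.re_add, Zsqrtd.im_add] at par dir mir mir' n1 n2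
  rcases lt_trichotomy (dt (E - C) (E - C)) (dt (B - A) (B - A)) with h | h | h
  · simp only [dt, Zsqrtd.re_sub, Zsqrtd.im_sub] at h
    rcases lt_or_gt_of_ne n1 with h4 | h4
    · right; left
      constructor <;> simp only [crs, dt, Zsqrtd.re_sub, Zsqrtd.im_sub, Zsqrtd.re_add, Zsqrtd.im_add] <;> linarith
    · left
      constructor <;> simp only [crs, dt, Zsqrtd.re_sub, Zsqrtd.im_sub, Zsqrtd.re_add, Zsqrtd.im_add] <;> linarith
  · right; right; right; right
    simp only [dt, Zsqrtd.re_sub, Zsqrtd.im_sub] at h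
    have key : (B.re - A.re - (E.re - C.re)) ^ 2 + (B.im - A.im - (E.im - C.im)) ^ 2 = 0 := by
      have hs : ((B.re - A.re) * (E.re - C.re) + (B.im - A.im) * (E.im - C.im)) ^ 2 =
        ((B.re - A.re) * (B.re - A.re) + (B.im - A.im) * (B.im - A.im)) ^ 2 := by
        linear_combination ((B.re - A.re) * (B.re - A.re) + (B.im - A.im) * (B.im - A.im)) * h
          - ((B.re - A.re) * (E.im - C.im) - (B.im - A.im) * (E.re - C.re)) * par
      have hs2 := (sq_eq_sq₀ dir.le (by nlinarith [mul_self_nonneg (B.re - A.re), mul_self_nonneg (B.im - A.im)])).mp hs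
      linear_combination h - 2 * hs2
    have k1 : B.re - A.re - (E.re - C.re) = 0 := by
      nlinarith [sq_nonneg (B.re - A.re - (E.re - C.re)), sq_nonneg (B.im - A.im - (E.im - C.im))]
    have k2 : B.im - A.im - (E.im - C.im) = 0 := by
      nlinarith [sq_nonneg (B.re - A.re - (E.re - C.re)), sq_nonneg (B.im - A.im - (E.im - C.im))]
    have x1 : E.re = C.re + (B.re - A.re) := by linarith
    have x2 : E.im = C.im + (B.im - A.im) := by linarith
    refine ⟨?_, ?_, hAB.symm, hAC.symm⟩
    · ext
      · simp; linarith
      · simp; linarith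
    · simp only [dt, Zsqrtd.re_sub, Zsqrtd.im_sub]
      rw [x1, x2] at mir
      linarith
  · simp only [dt, Zsqrtd.re_sub, Zsqrtd.im_sub] at h
    rcases lt_or_gt_of_ne n2 with h4 | h4
    · right; right; right; left
      constructor <;> simp only [crs, dt, Zsqrtd.re_sub, Zsqrtd.im_sub, Zsqrtd.re_add, Zsqrtd.im_add] <;> linarith
    · right; right; left
      constructor <;> simp only [crs, dt, Zsqrtd.re_sub, Zsqrtd.im_sub, Zsqrtd.re_add, Zsqrtd.im_add] <;> linarith

/-- the set is a trapezoid -/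
def TrapQ (Q : Finset GaussianInt) : Prop := ∃ A B C E, IsTrap A B C E ∧ Q = {A, B, C, E}

/-- the set is a rectangle -/
def RectQ (Q : Finset GaussianInt) : Prop := ∃ A B C E, IsRect A B C E ∧ Q = {A, B, C, E}

theorem classify2 {c : ℂ} {r : ℝ} (hr : 0 < r) {A B C E : GaussianInt} (hA : OnC c r A)
    (hB : OnC c r B) (hC : OnC c r C) (hE : OnC c r E) (hAB : A ≠ B) (hAC : A ≠ C) (hAE : A ≠ E)
    (hBC : B ≠ C) (hBE : B ≠ E) (hCE : C ≠ E) (par : crs (B - A) (E - C) = 0) :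
    TrapQ {A, B, C, E} ∨ RectQ {A, B, C, E} := by
  have s1 : ({A, B, C, E} : Finset GaussianInt) = {B, A, E, C} := by
    ext x; simp only [Finset.mem_insert, Finset.mem_singleton]; tauto
  have s2 : ({A, B, C, E} : Finset GaussianInt) = {C, E, A, B} := by
    ext x; simp only [Finset.mem_insert, Finset.mem_singleton]; tauto
  have s3 : ({A, B, C, E} : Finset GaussianInt) = {E, C, B, A} := by
    ext x; simp only [Finset.mem_insert, Finset.mem_singleton]; tauto
  have s4 : ({A, B, C, E} : Finset GaussianInt) = {A, B, E, C} := by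
    ext x; simp only [Finset.mem_insert, Finset.mem_singleton]; tauto
  have s5 : ({A, B, C, E} : Finset GaussianInt) = {B, A, C, E} := by
    ext x; simp only [Finset.mem_insert, Finset.mem_singleton]; tauto
  have s6 : ({A, B, C, E} : Finset GaussianInt) = {E, C, A, B} := by
    ext x; simp only [Finset.mem_insert, Finset.mem_singleton]; tauto
  have s7 : ({A, B, C, E} : Finset GaussianInt) = {C, E, B, A} := by
    ext x; simp only [Finset.mem_insert, Finset.mem_singleton]; tauto
  rcases lt_trichotomy 0 (dt (B - A) (E - C)) with h | h | h
  · rcases classify1 hr hA hB hC hE hAB hAC hAE hBC hBE hCE par h with h | h | h | h | h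
    · exact Or.inl ⟨_, _, _, _, h, rfl⟩
    · exact Or.inl ⟨_, _, _, _, h, s1⟩
    · exact Or.inl ⟨_, _, _, _, h, s2⟩
    · exact Or.inl ⟨_, _, _, _, h, s3⟩
    · exact Or.inr ⟨_, _, _, _, h, rfl⟩
  · exfalso
    simp only [crs, dt, Zsqrtd.re_sub, Zsqrtd.im_sub] at par h
    have key : ((B.re - A.re) ^ 2 + (B.im - A.im) ^ 2) * ((E.re - C.re) ^ 2 + (E.im - C.im) ^ 2) = 0 := by
      linear_combination (-((B.re - A.re) * (E.re - C.re) + (B.im - A.im) * (E.im - C.im))) * h +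
        ((B.re - A.re) * (E.im - C.im) - (B.im - A.im) * (E.re - C.re)) * par
    rcases mul_eq_zero.mp key with k | k
    · apply hAB
      ext
      · nlinarith [sq_nonneg (B.re - A.re), sq_nonneg (B.im - A.im)]
      · nlinarith [sq_nonneg (B.re - A.re), sq_nonneg (B.im - A.im)]
    · apply hCE
      ext
      · nlinarith [sq_nonneg (E.re - C.re), sq_nonneg (E.im - C.im)]
      · nlinarith [sq_nonneg (E.re - C.re), sq_nonneg (E.im - C.im)]
  · have par2 : crs (B - A) (C - E) = 0 := by
      simp only [crs, dt, Zsqrtd.re_sub, Zsqrtd.im_sub] at par ⊢; linarith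
    have h2 : 0 < dt (B - A) (C - E) := by
      simp only [crs, dt, Zsqrtd.re_sub, Zsqrtd.im_sub] at h ⊢; linarith
    rcases classify1 hr hA hB hE hC hAB hAE hAC hBE hBC hCE.symm par2 h2 with h | h | h | h | h
    · exact Or.inl ⟨_, _, _, _, h, s4⟩
    · exact Or.inl ⟨_, _, _, _, h, s5⟩
    · exact Or.inl ⟨_, _, _, _, h, s6⟩
    · exact Or.inl ⟨_, _, _, _, h, s7⟩
    · exact Or.inr ⟨_, _, _, _, h, s4⟩

/-- four distinct concyclic points without parallel opposite sides or diagonals -/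
def GenQ (Q : Finset GaussianInt) : Prop := ∃ A B C E, (A ≠ B ∧ A ≠ C ∧ A ≠ E ∧ B ≠ C ∧ B ≠ E ∧ C ≠ E) ∧
  (star (B - A) * (E - C)).im ≠ 0 ∧ (star (C - A) * (E - B)).im ≠ 0 ∧
  (star (E - A) * (C - B)).im ≠ 0 ∧ Q = {A, B, C, E}

theorem conc_cases {Q : Finset GaussianInt} (hQ : Q.card = 4) (h : ConcQ Q) :
    TrapQ Q ∨ RectQ Q ∨ GenQ Q := by
  obtain ⟨c, r, hr, hc⟩ := h
  obtain ⟨A, B, C, E, hAB, hAC, hAE, hBC, hBE, hCE, rfl⟩ := Finset.card_eq_four.mp hQ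
  have hA := hc A (by simp)
  have hB := hc B (by simp)
  have hC := hc C (by simp)
  have hE := hc E (by simp)
  have t1 : ({A, B, C, E} : Finset GaussianInt) = {A, C, B, E} := by
    ext x; simp only [Finset.mem_insert, Finset.mem_singleton]; tauto
  have t2 : ({A, B, C, E} : Finset GaussianInt) = {A, E, B, C} := by
    ext x; simp only [Finset.mem_insert, Finset.mem_singleton]; tauto
  by_cases p1 : crs (B - A) (E - C) = 0
  · rcases classify2 hr hA hB hC hE hAB hAC hAE hBC hBE hCE p1 with h | h
    · exact Or.inl h
    · exact Or.inr (Or.inl h)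
  by_cases p2 : crs (C - A) (E - B) = 0
  · rw [t1]
    rcases classify2 hr hA hC hB hE hAC hAB hAE hBC.symm hCE hBE p2 with h | h
    · exact Or.inl h
    · exact Or.inr (Or.inl h)
  by_cases p3 : crs (E - A) (C - B) = 0
  · rw [t2]
    rcases classify2 hr hA hE hB hC hAE hAB hAC hBE.symm hCE.symm hBC p3 with h | h
    · exact Or.inl h
    · exact Or.inr (Or.inl h)
  right; right
  refine ⟨A, B, C, E, ⟨hAB, hAC, hAE, hBC, hBE, hCE⟩, ?_, ?_, ?_, rfl⟩ <;> rw [star_mul_im_eq] <;>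
    assumption

/-! ### The error terms -/

theorem gr_diff_norm {n : ℕ} {x y : GaussianInt} (hx : x ∈ gr n) (hy : y ∈ gr n) :
    (y - x).norm ≤ 2 * (n : ℤ) ^ 2 := by
  rw [mem_gr] at hx hy
  obtain ⟨⟨a1, a2⟩, a3, a4⟩ := hx
  obtain ⟨⟨b1, b2⟩, b3, b4⟩ := hy
  rw [Zsqrtd.norm_def]
  simp only [Zsqrtd.re_sub, Zsqrtd.im_sub]
  have h1 : (y.re - x.re) ^ 2 ≤ (n : ℤ) ^ 2 := by
    apply sq_le_sq' <;> linarith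
  have h2 : (y.im - x.im) ^ 2 ≤ (n : ℤ) ^ 2 := by
    apply sq_le_sq' <;> linarith
  nlinarith

open Classical in
/-- general quadruples -/
noncomputable def genSet (n : ℕ) : Finset (Finset GaussianInt) := (concSet n).filter GenQ

open Classical in
/-- rectangles -/
noncomputable def rectSet (n : ℕ) : Finset (Finset GaussianInt) :=
  ((gr n).powersetCard 4).filter RectQ

open Classical in
/-- trapezoids -/
noncomputable def trapSet (n : ℕ) : Finset (Finset GaussianInt) :=
  ((gr n).powersetCard 4).filter TrapQ

theorem mem_concSet {n : ℕ} {Q : Finset GaussianInt} :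
    Q ∈ concSet n ↔ (Q ⊆ gr n ∧ Q.card = 4) ∧ ConcQ Q := by
  classical
  unfold concSet
  rw [Finset.mem_filter, Finset.mem_powersetCard]

theorem genSet_card (n : ℕ) (hn : 1 ≤ n) :
    (genSet n).card ≤ n ^ 2 * {d | QOk (2 * (n : ℤ) ^ 2) d}.ncard := by
  classical
  have hf := QOk_finite n hn
  rw [Set.ncard_eq_toFinset_card _ hf, ← gr_card, ← Finset.card_product]
  refine le_trans (Finset.card_le_card (t := ((gr n) ×ˢ hf.toFinset).image
    (fun p => ({p.1, p.1 + p.2.g * p.2.tc * p.2.td * ((p.2.s1 : GaussianInt) * (p.2.kab : GaussianInt) * p.2.u),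
      p.1 + p.2.g * p.2.tb * p.2.td * ((p.2.s2 : GaussianInt) * (p.2.kac : GaussianInt) * p.2.v),
      p.1 + p.2.g * p.2.tb * p.2.tc * ((p.2.s3 : GaussianInt) * (p.2.kad : GaussianInt) * p.2.w)} : Finset GaussianInt))) ?_)
    Finset.card_image_le
  intro Q hQ
  unfold genSet at hQ
  rw [Finset.mem_filter, mem_concSet] at hQ
  obtain ⟨⟨⟨hg, -⟩, c, r, hr, hc⟩, A, B, C, E, ⟨h1, h2, h3, h4, h5, h6⟩, p1, p2, p3, rfl⟩ := hQ
  have gA : A ∈ gr n := hg (by simp)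
  have gB : B ∈ gr n := hg (by simp)
  have gC : C ∈ gr n := hg (by simp)
  have gE : E ∈ gr n := hg (by simp)
  obtain ⟨d, hd, e1, e2, e3⟩ := onC_data hr (hc A (by simp)) (hc B (by simp)) (hc C (by simp)) (hc E (by simp))
    h1 h2 h3 h4 h5 h6 p1 p2 p3 (R := 2 * (n : ℤ) ^ 2) (gr_diff_norm gA gB) (gr_diff_norm gA gC)
    (gr_diff_norm gA gE) (gr_diff_norm gB gC) (gr_diff_norm gB gE) (gr_diff_norm gC gE)
  rw [Finset.mem_image]
  refine ⟨(A, d), ?_, ?_⟩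
  · rw [Finset.mem_product, Set.Finite.mem_toFinset]; exact ⟨gA, hd⟩
  · dsimp only
    rw [← e1, ← e2, ← e3]

theorem rect_bound : ∃ C : ℝ, 0 ≤ C ∧ ∀ n : ℕ, 1 ≤ n →
    ((rectSet n).card : ℝ) ≤ C * (n : ℝ) ^ (9 / 2 : ℝ) := by
  classical
  obtain ⟨C, hC1, hC⟩ := gdivisor_bound (1 / 8) (by norm_num)
  refine ⟨10 * C, by linarith, fun n hn => ?_⟩
  set M : Finset ℤ := (Finset.Icc (-(2 * (n : ℤ) ^ 2)) (2 * (n : ℤ) ^ 2)).filter (fun m => m ≠ 0) with hM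
  have hfin : ∀ m : ℤ, m ≠ 0 → {d : GaussianInt | d ∣ (⟨0, m⟩ : GaussianInt)}.Finite := by
    intro m hm
    apply gdivisors_finite
    intro h
    exact hm (congrArg Zsqrtd.im h)
  let Dv : ℤ → Finset GaussianInt := fun m => if h : m ≠ 0 then (hfin m h).toFinset else ∅
  have hDv : ∀ m ∈ M, ((Dv m).card : ℝ) ≤ C * (2 * (n : ℝ) ^ (1 / 2 : ℝ)) := by
    intro m hm
    rw [hM, Finset.mem_filter, Finset.mem_Icc] at hm
    have hm0 := hm.2
    have e : Dv m = (hfin m hm0).toFinset := by simp only [Dv]; rw [dif_pos hm0]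
    rw [e, ← Set.ncard_eq_toFinset_card _ (hfin m hm0)]
    refine (hC _ (fun h => hm0 (congrArg Zsqrtd.im h))).trans ?_
    gcongr
    have hnn : (0 : ℝ) ≤ (n : ℝ) := by positivity
    have e2 : (((⟨0, m⟩ : GaussianInt).norm : ℤ) : ℝ) ≤ 4 * (n : ℝ) ^ 4 := by
      have : (⟨0, m⟩ : GaussianInt).norm ≤ 4 * (n : ℤ) ^ 4 := by
        rw [Zsqrtd.norm_def]
        have : m ^ 2 ≤ (2 * (n : ℤ) ^ 2) ^ 2 := sq_le_sq' hm.1.1 hm.1.2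
        simp only; nlinarith
      exact_mod_cast this
    have e3 : (0 : ℝ) ≤ (((⟨0, m⟩ : GaussianInt).norm : ℤ) : ℝ) := by
      exact_mod_cast gnorm_nonneg _
    calc _ ≤ (4 * (n : ℝ) ^ 4) ^ (1 / 8 : ℝ) := Real.rpow_le_rpow e3 e2 (by norm_num)
      _ = 4 ^ (1 / 8 : ℝ) * (n : ℝ) ^ (1 / 2 : ℝ) := by
        rw [Real.mul_rpow (by norm_num) (by positivity)]
        congr 1
        rw [← Real.rpow_natCast, ← Real.rpow_mul hnn]
        norm_num
      _ ≤ 2 * (n : ℝ) ^ (1 / 2 : ℝ) := by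
        gcongr
        have : (2 : ℝ) = 4 ^ (1 / 2 : ℝ) := by
          rw [show (4 : ℝ) = 2 ^ (2 : ℝ) by norm_num, ← Real.rpow_mul (by norm_num)]; norm_num
        rw [this]
        exact Real.rpow_le_rpow_of_exponent_le (by norm_num) (by norm_num)
  have key : (rectSet n).card ≤ (gr n).card * (M.sigma Dv).card := by
    rw [← Finset.card_product]
    refine le_trans (Finset.card_le_card (t := ((gr n) ×ˢ (M.sigma Dv)).image
      (fun p => ({p.1, p.1 + star p.2.2, p.1 + (⟨0, p.2.1⟩ / p.2.2),
        p.1 + (⟨0, p.2.1⟩ / p.2.2) + star p.2.2} : Finset GaussianInt))) ?_) Finset.card_image_le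
    intro Q hQ
    unfold rectSet at hQ
    rw [Finset.mem_filter, Finset.mem_powersetCard] at hQ
    obtain ⟨⟨hg, h4⟩, A, B, C, E, ⟨he, hp, nb, nc⟩, rfl⟩ := hQ
    have gA : A ∈ gr n := hg (by simp)
    have gB : B ∈ gr n := hg (by simp)
    have gC : C ∈ gr n := hg (by simp)
    have hz : B - A ≠ 0 := sub_ne_zero.mpr nb
    have hw : C - A ≠ 0 := sub_ne_zero.mpr nc
    have hprod : star (B - A) * (C - A) = ⟨0, crs (B - A) (C - A)⟩ := by
      ext
      · simp only [dt] at hp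
        rw [Zsqrtd.re_mul]; simp at hp ⊢; linarith
      · exact star_mul_im_eq _ _
    have hsz : star (B - A) ≠ 0 := star_ne_zero.mpr hz
    have hcr0 : crs (B - A) (C - A) ≠ 0 := by
      intro h0
      have : star (B - A) * (C - A) = 0 := by rw [hprod, h0]; rfl
      rcases mul_eq_zero.mp this with h | h
      · exact hsz h
      · exact hw h
    have hcr : crs (B - A) (C - A) ∈ M := by
      rw [hM, Finset.mem_filter, Finset.mem_Icc, ← abs_le]
      refine ⟨?_, hcr0⟩
      rw [mem_gr] at gA gB gC
      simp only [crs, Zsqrtd.re_sub, Zsqrtd.im_sub]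
      have b1 : |B.re - A.re| ≤ n := by rw [abs_le]; constructor <;> linarith
      have b2 : |B.im - A.im| ≤ n := by rw [abs_le]; constructor <;> linarith
      have b3 : |C.re - A.re| ≤ n := by rw [abs_le]; constructor <;> linarith
      have b4 : |C.im - A.im| ≤ n := by rw [abs_le]; constructor <;> linarith
      calc _ ≤ |(B.re - A.re) * (C.im - A.im)| + |(B.im - A.im) * (C.re - A.re)| := abs_sub _ _
        _ ≤ n * n + n * n := by
          rw [abs_mul, abs_mul]; gcongr
        _ = _ := by ring
    rw [Finset.mem_image]
    refine ⟨(A, ⟨crs (B - A) (C - A), star (B - A)⟩), ?_, ?_⟩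
    · rw [Finset.mem_product, Finset.mem_sigma]
      refine ⟨gA, hcr, ?_⟩
      simp only [Dv]
      rw [dif_pos hcr0, Set.Finite.mem_toFinset]
      exact ⟨C - A, hprod.symm⟩
    · dsimp only
      rw [← hprod, star_star]
      rw [mul_div_cancel_left₀ _ hsz]
      rw [show A + (B - A) = B by ring, show A + (C - A) = C by ring, he]
  have hMc : (M.card : ℝ) ≤ 5 * (n : ℝ) ^ 2 := by
    have : M.card ≤ 5 * n ^ 2 := by
      refine (Finset.card_filter_le _ _).trans ?_
      rw [Int.card_Icc]
      have : 1 ≤ n ^ 2 := Nat.one_le_pow _ _ hn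
      have h2 : ((n : ℤ) ^ 2) = ((n ^ 2 : ℕ) : ℤ) := by push_cast; ring
      rw [h2]; omega
    exact_mod_cast this
  have hsig : ((M.sigma Dv).card : ℝ) ≤ 5 * (n : ℝ) ^ 2 * (C * (2 * (n : ℝ) ^ (1 / 2 : ℝ))) := by
    rw [Finset.card_sigma]
    push_cast
    calc _ ≤ ∑ m ∈ M, C * (2 * (n : ℝ) ^ (1 / 2 : ℝ)) := Finset.sum_le_sum hDv
      _ = M.card * (C * (2 * (n : ℝ) ^ (1 / 2 : ℝ))) := by rw [Finset.sum_const, nsmul_eq_mul]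
      _ ≤ _ := by gcongr
  have hn0 : (0 : ℝ) < n := by exact_mod_cast hn
  calc ((rectSet n).card : ℝ) ≤ ((gr n).card * (M.sigma Dv).card : ℕ) := by exact_mod_cast key
    _ = (n : ℝ) ^ 2 * ((M.sigma Dv).card : ℝ) := by rw [gr_card]; push_cast; ring
    _ ≤ (n : ℝ) ^ 2 * (5 * (n : ℝ) ^ 2 * (C * (2 * (n : ℝ) ^ (1 / 2 : ℝ)))) := by gcongr
    _ = 10 * C * ((n : ℝ) ^ 4 * (n : ℝ) ^ (1 / 2 : ℝ)) := by ring
    _ = _ := by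
      rw [← Real.rpow_natCast, ← Real.rpow_add hn0]; norm_num

theorem conc_split (n : ℕ) : (trapSet n).card ≤ (concSet n).card ∧
    (concSet n).card ≤ (trapSet n).card + (rectSet n).card + (genSet n).card := by
  classical
  constructor
  · apply Finset.card_le_card
    intro Q hQ
    unfold trapSet at hQ
    rw [Finset.mem_filter, Finset.mem_powersetCard] at hQ
    rw [mem_concSet]
    refine ⟨hQ.1, ?_⟩
    obtain ⟨A, B, C, E, h, rfl⟩ := hQ.2
    exact h.conc
  · refine le_trans (Finset.card_le_card (t := trapSet n ∪ rectSet n ∪ genSet n) ?_) ?_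
    · intro Q hQ
      rw [Finset.mem_union, Finset.mem_union]
      unfold trapSet rectSet genSet
      rw [Finset.mem_filter, Finset.mem_filter, Finset.mem_filter, Finset.mem_powersetCard]
      have h := mem_concSet.mp hQ
      rcases conc_cases h.1.2 h.2 with h' | h' | h'
      · exact Or.inl (Or.inl ⟨h.1, h'⟩)
      · exact Or.inl (Or.inr ⟨h.1, h'⟩)
      · exact Or.inr ⟨hQ, h'⟩
    · refine (Finset.card_union_le _ _).trans ?_
      gcongr
      exact Finset.card_union_le _ _

theorem conc_trap_tendsto : Filter.Tendsto
    (fun n : ℕ => ((concSet n).card : ℝ) / (n : ℝ) ^ 5 - ((trapSet n).card : ℝ) / (n : ℝ) ^ 5)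
    Filter.atTop (nhds 0) := by
  obtain ⟨C, hC0, hC⟩ := rect_bound
  have t1 : Filter.Tendsto (fun n : ℕ => C * (n : ℝ) ^ (-(1 / 2 : ℝ))) Filter.atTop (nhds 0) := by
    have := ((tendsto_rpow_neg_atTop (y := 1 / 2) (by norm_num)).comp
      tendsto_natCast_atTop_atTop).const_mul C
    simpa using this
  have t2 := t1.add QOk_tendsto
  rw [add_zero] at t2
  refine tendsto_of_tendsto_of_tendsto_of_le_of_le' tendsto_const_nhds t2 ?_ ?_
  · filter_upwards with n
    rw [← sub_div]
    have : ((trapSet n).card : ℝ) ≤ (concSet n).card := by exact_mod_cast (conc_split n).1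
    have h2 : (0 : ℝ) ≤ ((concSet n).card : ℝ) - (trapSet n).card := by linarith
    positivity
  · filter_upwards [Filter.eventually_ge_atTop 1] with n hn
    have hn0 : (0 : ℝ) < n := by exact_mod_cast hn
    have h1 : ((concSet n).card : ℝ) ≤ (trapSet n).card + (rectSet n).card + (genSet n).card := by
      exact_mod_cast (conc_split n).2
    have h2 := hC n hn
    have h3 : ((genSet n).card : ℝ) ≤ (n : ℝ) ^ 2 * ({d | QOk (2 * (n : ℤ) ^ 2) d}.ncard : ℝ) := by
      exact_mod_cast genSet_card n hn
    rw [← sub_div, div_le_iff₀ (by positivity)]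
    have e1 : (n : ℝ) ^ (-(1 / 2 : ℝ)) * (n : ℝ) ^ 5 = (n : ℝ) ^ (9 / 2 : ℝ) := by
      rw [← Real.rpow_natCast, ← Real.rpow_add hn0]; norm_num
    have e2 : ({d | QOk (2 * (n : ℤ) ^ 2) d}.ncard : ℝ) / (n : ℝ) ^ 3 * (n : ℝ) ^ 5 =
      (n : ℝ) ^ 2 * ({d | QOk (2 * (n : ℤ) ^ 2) d}.ncard : ℝ) := by
      field_simp
    have e3 : (C * (n : ℝ) ^ (-(1 / 2 : ℝ)) + ({d | QOk (2 * (n : ℤ) ^ 2) d}.ncard : ℝ) / (n : ℝ) ^ 3) * (n : ℝ) ^ 5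
      = C * (n : ℝ) ^ (9 / 2 : ℝ) + (n : ℝ) ^ 2 * ({d | QOk (2 * (n : ℤ) ^ 2) d}.ncard : ℝ) := by
      rw [add_mul, e2, mul_assoc, e1]
    rw [e3]
    linarith

/-! ### Counting trapezoids -/

/-- admissible trapezoid parameters in direction `(x, y)` -/
def trapOK (x y k D O : ℤ) : Prop :=
  0 < D ∧ D < k ∧ 0 < O ∧ 2 ∣ (D * x - O * y) ∧ 2 ∣ (D * y + O * x)

instance (x y k D O : ℤ) : Decidable (trapOK x y k D O) := by unfold trapOK; infer_instance

/-- width of the bounding box of a trapezoid -/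
def Wf (a b k D O : ℤ) : ℤ := k * a + max 0 ((O * b - D * a) / 2)

/-- number of translates -/
def cell (n : ℕ) (x y k D O : ℤ) : ℕ :=
  ((n : ℤ) - Wf |x| |y| k D O).toNat * ((n : ℤ) - Wf |y| |x| k D O).toNat

theorem count1_core (n : ℕ) (u v q e : ℤ) (h : (0 ≤ v ∧ v ≤ u) ∨ (u ≤ v ∧ v ≤ 0))
    (he : 2 * e = v - q) :
    ((Finset.Icc (1 : ℤ) n).filter (fun a => (1 ≤ a + u ∧ a + u ≤ n) ∧ (1 ≤ a + e ∧ a + e ≤ n) ∧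
      (1 ≤ a + e + (u - v) ∧ a + e + (u - v) ≤ n))).card =
    ((n : ℤ) - (|u| + max 0 ((|q| - |v|) / 2))).toNat := by
  have fin : ∀ m M : ℤ, (∀ a : ℤ, ((1 ≤ a ∧ a ≤ n) ∧ (1 ≤ a + u ∧ a + u ≤ n) ∧ (1 ≤ a + e ∧ a + e ≤ n) ∧
      (1 ≤ a + e + (u - v) ∧ a + e + (u - v) ≤ n)) ↔ (1 - m ≤ a ∧ a ≤ n - M)) →
      M - m = |u| + max 0 ((|q| - |v|) / 2) →
      ((Finset.Icc (1 : ℤ) n).filter (fun a => (1 ≤ a + u ∧ a + u ≤ n) ∧ (1 ≤ a + e ∧ a + e ≤ n) ∧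
      (1 ≤ a + e + (u - v) ∧ a + e + (u - v) ≤ n))).card =
      ((n : ℤ) - (|u| + max 0 ((|q| - |v|) / 2))).toNat := by
    intro m M h1 h2
    rw [← h2]
    have : ((Finset.Icc (1 : ℤ) n).filter (fun a => (1 ≤ a + u ∧ a + u ≤ n) ∧ (1 ≤ a + e ∧ a + e ≤ n) ∧
      (1 ≤ a + e + (u - v) ∧ a + e + (u - v) ≤ n))) = Finset.Icc (1 - m) (n - M) := by
      ext a
      simp only [Finset.mem_filter, Finset.mem_Icc]
      exact h1 a
    rw [this, Int.card_Icc]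
    congr 1
    ring
  rcases h with ⟨hv, hu⟩ | ⟨hu, hv⟩ <;> rcases le_total 0 q with hq | hq
  · apply fin (min 0 e) u
    · intro a; omega
    · rw [abs_of_nonneg hv, abs_of_nonneg hq, abs_of_nonneg (hv.trans hu)]; omega
  · apply fin 0 (max u (e + (u - v)))
    · intro a; omega
    · rw [abs_of_nonneg hv, abs_of_nonpos hq, abs_of_nonneg (hv.trans hu)]; omega
  · apply fin (min u (e + (u - v))) 0
    · intro a; omega
    · rw [abs_of_nonpos hv, abs_of_nonneg hq, abs_of_nonpos (hu.trans hv)]; omega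
  · apply fin u (max 0 e)
    · intro a; omega
    · rw [abs_of_nonpos hv, abs_of_nonpos hq, abs_of_nonpos (hu.trans hv)]; omega

theorem count1 (n : ℕ) (x y k D O e : ℤ) (hD : 0 < D) (hk : D < k) (hO : 0 < O)
    (he : 2 * e = D * x - O * y) :
    ((Finset.Icc (1 : ℤ) n).filter (fun a => (1 ≤ a + k * x ∧ a + k * x ≤ n) ∧ (1 ≤ a + e ∧ a + e ≤ n) ∧
      (1 ≤ a + e + (k - D) * x ∧ a + e + (k - D) * x ≤ n))).card =
    ((n : ℤ) - Wf |x| |y| k D O).toNat := by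
  have h1 : |k * x| = k * |x| := by rw [abs_mul, abs_of_pos (by omega)]
  have h2 : |D * x| = D * |x| := by rw [abs_mul, abs_of_pos (by omega)]
  have h3 : |O * y| = O * |y| := by rw [abs_mul, abs_of_pos (by omega)]
  have := count1_core n (k * x) (D * x) (O * y) e (by
    rcases le_total 0 x with h | h
    · left; constructor <;> nlinarith
    · right; constructor <;> nlinarith) he
  rw [h1, h2, h3] at this
  unfold Wf
  rw [← this]
  congr 1
  ext a
  rw [sub_mul]

theorem gr_filter_card (n : ℕ) (P Q : ℤ → Prop) [DecidablePred P] [DecidablePred Q] :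
    ((gr n).filter (fun A => P A.re ∧ Q A.im)).card =
    ((Finset.Icc (1 : ℤ) n).filter P).card * ((Finset.Icc (1 : ℤ) n).filter Q).card := by
  unfold gr
  rw [Finset.filter_map, Finset.card_map, ← Finset.card_product]
  congr 1
  ext ⟨a, b⟩
  simp only [Finset.mem_filter, Finset.mem_product, Function.comp]
  tauto

theorem par_prim {x y v1 v2 : ℤ} (h : IsCoprime x y) (hp : x * v2 - y * v1 = 0) :
    ∃ k, v1 = k * x ∧ v2 = k * y := by
  obtain ⟨s, t, hst⟩ := h
  refine ⟨s * v1 + t * v2, ?_, ?_⟩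
  · linear_combination (-v1) * hst - t * hp
  · linear_combination (-v2) * hst + s * hp

theorem prim_unique {x y x' y' k k' : ℤ} (h : IsCoprime x y) (h' : IsCoprime x' y') (hk : 0 < k)
    (hk' : 0 < k') (h1 : k * x = k' * x') (h2 : k * y = k' * y') : k = k' ∧ x = x' ∧ y = y' := by
  have e : k = k' := by
    have g1 : Int.gcd (k * x) (k * y) = k.natAbs := by
      rw [Int.gcd_mul_left, Int.isCoprime_iff_gcd_eq_one.mp h, mul_one]
    have g2 : Int.gcd (k' * x') (k' * y') = k'.natAbs := by
      rw [Int.gcd_mul_left, Int.isCoprime_iff_gcd_eq_one.mp h', mul_one]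
    rw [← h1, ← h2, g1] at g2
    omega
  subst e
  exact ⟨rfl, mul_left_cancel₀ hk.ne' h1, mul_left_cancel₀ hk.ne' h2⟩

theorem prim_norm_pos {x y : ℤ} (hc : IsCoprime x y) : 0 < x * x + y * y := by
  have : x ≠ 0 ∨ y ≠ 0 := by
    by_contra hc0; push Not at hc0
    rw [hc0.1, hc0.2, isCoprime_zero_left] at hc
    exact not_isUnit_zero hc
  rcases this with h | h
  · have := mul_self_pos.mpr h; nlinarith [mul_self_nonneg y]
  · have := mul_self_pos.mpr h; nlinarith [mul_self_nonneg x]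

/-- the vector from the start of the long base to the start of the short base -/
def evec (x y D O : ℤ) : GaussianInt := ⟨(D * x - O * y) / 2, (D * y + O * x) / 2⟩

/-- index set of directions -/
noncomputable def dirs (n : ℕ) : Finset (ℤ × ℤ) :=
  (Finset.Icc (-(n : ℤ)) n ×ˢ Finset.Icc (-(n : ℤ)) n).filter (fun p => Int.gcd p.1 p.2 = 1)

/-- index set of shapes -/
noncomputable def shapes (n : ℕ) : Finset (ℤ × ℤ × ℤ) :=
  Finset.Icc (1 : ℤ) n ×ˢ Finset.Icc (1 : ℤ) n ×ˢ Finset.Icc (1 : ℤ) (3 * n)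

theorem isTrap_param {x y k D O : ℤ} (A : GaussianInt) (hc : IsCoprime x y) (h : trapOK x y k D O) :
    IsTrap A (A + ⟨k * x, k * y⟩) (A + evec x y D O)
      (A + evec x y D O + ⟨(k - D) * x, (k - D) * y⟩) := by
  obtain ⟨h1, h2, h3, ⟨e1, h4⟩, ⟨e2, h5⟩⟩ := h
  have hE : evec x y D O = ⟨e1, e2⟩ := by
    unfold evec; rw [h4, h5]; ext <;> simp
  have hN : 0 < x * x + y * y := prim_norm_pos hc
  rw [hE]
  have hk : 0 < k := by omega
  have hkD : 0 < k - D := by omega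
  constructor <;> simp only [crs, dt, Zsqrtd.re_sub, Zsqrtd.im_sub, Zsqrtd.re_add, Zsqrtd.im_add]
  · ring
  · have : 0 < k * (k - D) * (x * x + y * y) := by positivity
    nlinarith
  · have : 0 < (k * k - (k - D) * (k - D)) * (x * x + y * y) := mul_pos (by nlinarith) hN
    nlinarith
  · have : 0 < k * O * (x * x + y * y) := by positivity
    have e : 2 * (k * x * e2 - k * y * e1) = k * O * (x * x + y * y) := by
      linear_combination (-k * x) * h5 + k * y * h4
    have : A.re + k * x - A.re = k * x := by ring
    nlinarith
  · linear_combination k * x * h4 + k * y * h5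

theorem trap_param_exists {n : ℕ} {A B C E : GaussianInt} (h : IsTrap A B C E) (hA : A ∈ gr n)
    (hB : B ∈ gr n) (hC : C ∈ gr n) :
    ∃ x y k D O : ℤ, IsCoprime x y ∧ trapOK x y k D O ∧ (x, y) ∈ dirs n ∧ (k, D, O) ∈ shapes n ∧
      B = A + ⟨k * x, k * y⟩ ∧ C = A + evec x y D O ∧
      E = A + evec x y D O + ⟨(k - D) * x, (k - D) * y⟩ := by
  have hne : B - A ≠ 0 := sub_ne_zero.mpr h.distinct.1.symm
  obtain ⟨k, x, y, hk, hxy, hz1, hz2⟩ : ∃ k x y : ℤ, 0 < k ∧ IsCoprime x y ∧ (B - A).re = k * x ∧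
      (B - A).im = k * y := by
    obtain ⟨k, u, hk, hu, hc⟩ := gauss_prim (B - A) hne
    rcases lt_or_gt_of_ne hk with h | h
    · refine ⟨-k, -u.re, -u.im, by omega, hc.neg_neg, ?_, ?_⟩
      · rw [hu]; simp
      · rw [hu]; simp
    · refine ⟨k, u.re, u.im, h, hc, ?_, ?_⟩
      · rw [hu]; simp
      · rw [hu]; simp
  obtain ⟨h1, h2, h3, h4, h5⟩ := h
  obtain ⟨k2, hv1, hv2⟩ := par_prim (v1 := (E - C).re) (v2 := (E - C).im) hxy (by
    simp only [crs] at h1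
    rw [hz1, hz2] at h1
    apply mul_left_cancel₀ hk.ne'
    linear_combination h1)
  have hN : 0 < x * x + y * y := prim_norm_pos hxy
  simp only [crs] at h4
  simp only [dt] at h2 h3 h5
  rw [hz1, hz2, hv1, hv2] at h2
  rw [hz1, hz2, hv1, hv2] at h3
  have hk2 : 0 < k2 := by
    have : 0 < (k * (x * x + y * y)) * k2 := by nlinarith
    exact pos_of_mul_pos_right this (by positivity)
  have hk2k : k2 < k := by
    have : 0 < (x * x + y * y) * (k * k - k2 * k2) := by nlinarith
    have := pos_of_mul_pos_right this hN.le
    nlinarith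
  have hsum : (A + B - C - E).re = (k - k2) * x - 2 * (C - A).re ∧
      (A + B - C - E).im = (k - k2) * y - 2 * (C - A).im := by
    simp only [Zsqrtd.re_sub, Zsqrtd.im_sub, Zsqrtd.re_add, Zsqrtd.im_add] at hz1 hz2 hv1 hv2 ⊢
    constructor <;> linarith
  rw [hsum.1, hsum.2, hz1, hz2] at h5
  obtain ⟨O, ho1, ho2⟩ := par_prim (x := -y) (y := x) (v1 := 2 * (C - A).re - (k - k2) * x)
    (v2 := 2 * (C - A).im - (k - k2) * y) (hxy.symm.neg_left) (by
      apply mul_left_cancel₀ hk.ne'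
      linear_combination h5)
  rw [hz1, hz2] at h4
  have hO : 0 < O := by
    have : 0 < (k * (x * x + y * y)) * O := by
      have e : (k * (x * x + y * y)) * O = 2 * (k * x * (C - A).im - k * y * (C - A).re) := by
        linear_combination (-k * x) * ho2 + k * y * ho1
      rw [e]; linarith
    exact pos_of_mul_pos_right this (by positivity)
  have hE : evec x y (k - k2) O = C - A := by
    unfold evec
    ext
    · simp only
      rw [show (k - k2) * x - O * y = 2 * (C - A).re by linarith]; simp
    · simp only
      rw [show (k - k2) * y + O * x = 2 * (C - A).im by linarith]; simp
  have hkx : |k * x| ≤ n ∧ |k * y| ≤ n ∧ |(C - A).re| ≤ n ∧ |(C - A).im| ≤ n := by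
    rw [← hz1, ← hz2]
    rw [mem_gr] at hA hB hC
    simp only [Zsqrtd.re_sub, Zsqrtd.im_sub, abs_le]
    omega
  have hk1 : 1 ≤ k := hk
  rw [abs_mul, abs_mul, abs_of_pos hk] at hkx
  obtain ⟨q1, q2, q3, q4⟩ := hkx
  have hx : |x| ≤ n := (le_mul_of_one_le_left (abs_nonneg x) hk1).trans q1
  have hy : |y| ≤ n := (le_mul_of_one_le_left (abs_nonneg y) hk1).trans q2
  have hxy1 : 1 ≤ |x| ∨ 1 ≤ |y| := by
    by_contra hc
    push Not at hc
    have : x = 0 := abs_eq_zero.mp (by have := abs_nonneg x; omega)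
    have : y = 0 := abs_eq_zero.mp (by have := abs_nonneg y; omega)
    subst x; subst y; simp at hN
  have hkn : k ≤ n := by
    rcases hxy1 with h | h
    · exact (le_mul_of_one_le_right hk.le h).trans q1
    · exact (le_mul_of_one_le_right hk.le h).trans q2
  have hOx : O * |x| ≤ 3 * n := by
    have : |O * x| ≤ 3 * n := by
      rw [show O * x = 2 * (C - A).im - (k - k2) * y by linarith]
      refine (abs_sub _ _).trans ?_
      rw [abs_mul, abs_mul, abs_of_pos (show 0 < k - k2 by omega)]
      have : (k - k2) * |y| ≤ k * |y| := by gcongr; omega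
      rw [abs_two]
      linarith
    rwa [abs_mul, abs_of_pos hO] at this
  have hOy : O * |y| ≤ 3 * n := by
    have : |O * y| ≤ 3 * n := by
      rw [show O * y = (k - k2) * x - 2 * (C - A).re by linarith]
      refine (abs_sub _ _).trans ?_
      rw [abs_mul, abs_mul, abs_of_pos (show 0 < k - k2 by omega)]
      have : (k - k2) * |x| ≤ k * |x| := by gcongr; omega
      rw [abs_two]
      linarith
    rwa [abs_mul, abs_of_pos hO] at this
  have hO3 : O ≤ 3 * n := by
    rcases hxy1 with h | h
    · exact (le_mul_of_one_le_right hO.le h).trans hOx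
    · exact (le_mul_of_one_le_right hO.le h).trans hOy
  refine ⟨x, y, k, k - k2, O, hxy, ⟨by omega, by omega, hO, ⟨(C - A).re, by linarith⟩,
    ⟨(C - A).im, by linarith⟩⟩, ?_, ?_, ?_, ?_, ?_⟩
  · unfold dirs
    rw [Finset.mem_filter, Finset.mem_product, Finset.mem_Icc, Finset.mem_Icc]
    exact ⟨⟨abs_le.mp hx, abs_le.mp hy⟩, Int.isCoprime_iff_gcd_eq_one.mp hxy⟩
  · unfold shapes
    simp only [Finset.mem_product, Finset.mem_Icc]
    omega
  · rw [← hz1, ← hz2]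
    show B = A + (B - A)
    ring
  · rw [hE]; ring
  · rw [hE, show k - (k - k2) = k2 by ring, ← hv1, ← hv2]
    show E = A + (C - A) + (E - C)
    ring

theorem trapSet_card (n : ℕ) : (trapSet n).card =
    ∑ p ∈ dirs n, ∑ t ∈ shapes n, if trapOK p.1 p.2 t.1 t.2.1 t.2.2 then
      cell n p.1 p.2 t.1 t.2.1 t.2.2 else 0 := by
  classical
  set U : Finset ((ℤ × ℤ) × (ℤ × ℤ × ℤ) × GaussianInt) := (dirs n ×ˢ shapes n ×ˢ gr n).filter
    (fun q => trapOK q.1.1 q.1.2 q.2.1.1 q.2.1.2.1 q.2.1.2.2 ∧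
      q.2.2 + ⟨q.2.1.1 * q.1.1, q.2.1.1 * q.1.2⟩ ∈ gr n ∧
      q.2.2 + evec q.1.1 q.1.2 q.2.1.2.1 q.2.1.2.2 ∈ gr n ∧
      q.2.2 + evec q.1.1 q.1.2 q.2.1.2.1 q.2.1.2.2 +
        ⟨(q.2.1.1 - q.2.1.2.1) * q.1.1, (q.2.1.1 - q.2.1.2.1) * q.1.2⟩ ∈ gr n) with hU
  have hUc : U.card = ∑ p ∈ dirs n, ∑ t ∈ shapes n, if trapOK p.1 p.2 t.1 t.2.1 t.2.2 then
      cell n p.1 p.2 t.1 t.2.1 t.2.2 else 0 := by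
    rw [hU, Finset.card_filter, Finset.sum_product]
    apply Finset.sum_congr rfl
    rintro ⟨x, y⟩ hp
    rw [Finset.sum_product]
    apply Finset.sum_congr rfl
    rintro ⟨k, D, O⟩ ht
    dsimp only
    split_ifs with hok
    · simp only [hok, true_and]
      rw [← Finset.card_filter]
      obtain ⟨h1, h2, h3, ⟨e1, h4⟩, ⟨e2, h5⟩⟩ := hok
      have hE : evec x y D O = ⟨e1, e2⟩ := by
        unfold evec; rw [h4, h5]; ext <;> simp
      have c1 := count1 n x y k D O e1 h1 h2 h3 h4.symm
      have c2 := count1 n y (-x) k D O e2 h1 h2 h3 (by rw [← h5]; ring)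
      rw [abs_neg] at c2
      unfold cell
      rw [← c1, ← c2, ← gr_filter_card]
      congr 1
      apply Finset.filter_congr
      intro A hA
      rw [hE, mem_gr, mem_gr, mem_gr]
      simp only [Zsqrtd.re_add, Zsqrtd.im_add]
      tauto
    · simp [hok]
  rw [← hUc]
  symm
  have hcop : ∀ q ∈ U, IsCoprime q.1.1 q.1.2 := by
    intro q hq
    rw [hU, Finset.mem_filter, Finset.mem_product] at hq
    have := hq.1.1
    unfold dirs at this
    rw [Finset.mem_filter] at this
    exact Int.isCoprime_iff_gcd_eq_one.mpr this.2
  refine Finset.card_bij (fun q _ => {q.2.2, q.2.2 + ⟨q.2.1.1 * q.1.1, q.2.1.1 * q.1.2⟩,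
      q.2.2 + evec q.1.1 q.1.2 q.2.1.2.1 q.2.1.2.2,
      q.2.2 + evec q.1.1 q.1.2 q.2.1.2.1 q.2.1.2.2 +
        ⟨(q.2.1.1 - q.2.1.2.1) * q.1.1, (q.2.1.1 - q.2.1.2.1) * q.1.2⟩}) ?_ ?_ ?_
  · intro q hq
    have hc := hcop q hq
    rw [hU, Finset.mem_filter, Finset.mem_product, Finset.mem_product] at hq
    obtain ⟨⟨-, -, hA⟩, hok, hB, hC, hE⟩ := hq
    have tr := isTrap_param q.2.2 hc hok
    unfold trapSet
    rw [Finset.mem_filter, Finset.mem_powersetCard]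
    refine ⟨⟨?_, ?_⟩, ?_⟩
    · intro z hz
      simp only [Finset.mem_insert, Finset.mem_singleton] at hz
      rcases hz with rfl | rfl | rfl | rfl <;> assumption
    · rw [Finset.card_eq_four]
      obtain ⟨d1, d2, d3, d4, d5, d6⟩ := tr.distinct
      exact ⟨_, _, _, _, d1, d2, d3, d4, d5, d6, rfl⟩
    · exact ⟨_, _, _, _, tr, rfl⟩
  · intro q hq q' hq' heq
    have hc := hcop q hq
    have hc' := hcop q' hq'
    rw [hU, Finset.mem_filter] at hq hq'
    have tr := isTrap_param q.2.2 hc hq.2.1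
    have tr' := isTrap_param q'.2.2 hc' hq'.2.1
    obtain ⟨u1, u2, u3, u4⟩ := tr.unique tr' heq
    obtain ⟨⟨x, y⟩, ⟨k, D, O⟩, A⟩ := q
    obtain ⟨⟨x', y'⟩, ⟨k', D', O'⟩, A'⟩ := q'
    dsimp only at *
    obtain ⟨g1, g2, g3, g4, g5⟩ := hq.2.1
    obtain ⟨g1', g2', g3', g4', g5'⟩ := hq'.2.1
    subst u1
    have u2 := add_left_cancel u2
    have a1 := congrArg Zsqrtd.re u2
    have a2 := congrArg Zsqrtd.im u2
    dsimp only at a1 a2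
    obtain ⟨rfl, rfl, rfl⟩ := prim_unique hc hc' (by omega) (by omega) a1.symm a2.symm
    have u3' := add_left_cancel u3
    rw [u3] at u4
    have u4 := add_left_cancel u4
    have a3 := congrArg Zsqrtd.re u4
    have a4 := congrArg Zsqrtd.im u4
    have a5 := congrArg Zsqrtd.re u3'
    have a6 := congrArg Zsqrtd.im u3'
    dsimp only [evec] at a3 a4 a5 a6
    obtain ⟨hD, -, -⟩ := prim_unique hc hc (by omega) (by omega) a3.symm a4.symm
    obtain rfl : D = D' := by omega
    have b1 : O * y = O' * y := by omega
    have b2 : O * x = O' * x := by omega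
    obtain ⟨rfl, -, -⟩ := prim_unique hc hc g3 g3' b2 b1
    rfl
  · intro Q hQ
    unfold trapSet at hQ
    rw [Finset.mem_filter, Finset.mem_powersetCard] at hQ
    obtain ⟨⟨hg, -⟩, A, B, C, E, tr, rfl⟩ := hQ
    have gA : A ∈ gr n := hg (by simp)
    have gB : B ∈ gr n := hg (by simp)
    have gC : C ∈ gr n := hg (by simp)
    have gE : E ∈ gr n := hg (by simp)
    obtain ⟨x, y, k, D, O, hc, hok, m1, m2, eB, eC, eE⟩ := trap_param_exists tr gA gB gC
    refine ⟨((x, y), (k, D, O), A), ?_, ?_⟩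
    · rw [hU, Finset.mem_filter, Finset.mem_product, Finset.mem_product]
      dsimp only
      rw [← eB, ← eC]
      rw [← eC] at eE
      rw [← eE]
      exact ⟨⟨m1, m2, gA⟩, hok, gB, gC, gE⟩
    · dsimp only
      rw [← eB, ← eC]
      rw [← eC] at eE
      rw [← eE]

/-! ### Counting collinear quadruples -/

/-- a linear functional, injective on the grid -/
def keyf (n : ℕ) (z : GaussianInt) : ℤ := (n + 1) * z.re + z.im

theorem keyf_add (n : ℕ) (z w : GaussianInt) : keyf n (z + w) = keyf n z + keyf n w := by
  simp [keyf]; ring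

theorem keyf_small {n : ℕ} {z : GaussianInt} (h : keyf n z = 0) (hz : |z.im| ≤ n) : z = 0 := by
  unfold keyf at h
  have h1 : z.re = 0 := by
    by_contra hne
    have : (n : ℤ) + 1 ≤ |z.im| := by
      have : z.im = -((n + 1) * z.re) := by linarith
      rw [this, abs_neg, abs_mul, abs_of_nonneg (by positivity : (0 : ℤ) ≤ n + 1)]
      have := Int.one_le_abs hne
      nlinarith
    omega
  rw [h1] at h
  ext
  · exact h1
  · simp at h; exact h

theorem keyf_inj {n : ℕ} {z w : GaussianInt} (hz : z ∈ gr n) (hw : w ∈ gr n)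
    (h : keyf n z = keyf n w) : z = w := by
  have : z - w = 0 := by
    apply keyf_small (n := n)
    · unfold keyf at h ⊢; simp; linarith
    · rw [mem_gr] at hz hw
      rw [abs_le]; simp; omega
  exact sub_eq_zero.mp this

/-- number of pairs of intermediate points -/
def prs (n k : ℕ) : ℕ :=
  ((Finset.range (n + 1) ×ˢ Finset.range (n + 1)).filter (fun p => 1 ≤ p.2 ∧ p.2 < p.1 ∧ p.1 < k)).card

theorem prs_eq {n k : ℕ} (hk : k ≤ n) (hk1 : 1 ≤ k) : (prs n k : ℝ) = ((k : ℝ) - 1) * (k - 2) / 2 := by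
  induction k with
  | zero => omega
  | succ m ih =>
    rcases Nat.eq_zero_or_pos m with rfl | hm
    · have : prs n (0 + 1) = 0 := by
        unfold prs
        rw [Finset.card_eq_zero, Finset.filter_eq_empty_iff]
        intro p hp; omega
      rw [this]; simp
    · have : prs n (m + 1) = prs n m + (m - 1) := by
        unfold prs
        have e : (Finset.range (n + 1) ×ˢ Finset.range (n + 1)).filter (fun p => 1 ≤ p.2 ∧ p.2 < p.1 ∧ p.1 < m + 1)
          = (Finset.range (n + 1) ×ˢ Finset.range (n + 1)).filter (fun p => 1 ≤ p.2 ∧ p.2 < p.1 ∧ p.1 < m) ∪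
            (Finset.Ico 1 m).image (fun i => (m, i)) := by
          ext ⟨a, b⟩
          simp only [Finset.mem_filter, Finset.mem_product, Finset.mem_range, Finset.mem_union,
            Finset.mem_image, Finset.mem_Ico, Prod.mk.injEq, exists_eq_right_right]
          constructor
          · rintro ⟨⟨h1, h2⟩, h3, h4, h5⟩
            by_cases h : a = m
            · right; omega
            · left; omega
          · rintro (h | h) <;> omega
        rw [e, Finset.card_union_of_disjoint, Finset.card_image_of_injective, Nat.card_Ico]
        · intro a b h; exact (Prod.mk.inj h).2
        · rw [Finset.disjoint_left]
          rintro ⟨a, b⟩ h1 h2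
          simp only [Finset.mem_filter, Finset.mem_image, Finset.mem_Ico, Prod.mk.injEq] at h1 h2
          omega
      rw [this]
      push_cast [Nat.cast_sub hm]
      rw [ih (by omega) hm]
      ring

theorem countl (n : ℕ) (u : ℤ) :
    ((Finset.Icc (1 : ℤ) n).filter (fun a => (1 ≤ a + u ∧ a + u ≤ n))).card = ((n : ℤ) - |u|).toNat := by
  rcases le_total 0 u with h | h
  · have : (Finset.Icc (1 : ℤ) n).filter (fun a => (1 ≤ a + u ∧ a + u ≤ n)) = Finset.Icc 1 (n - u) := by
      ext a; simp only [Finset.mem_filter, Finset.mem_Icc]; omega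
    rw [this, Int.card_Icc, abs_of_nonneg h]; congr 1; ring
  · have : (Finset.Icc (1 : ℤ) n).filter (fun a => (1 ≤ a + u ∧ a + u ≤ n)) = Finset.Icc (1 - u) n := by
      ext a; simp only [Finset.mem_filter, Finset.mem_Icc]; omega
    rw [this, Int.card_Icc, abs_of_nonpos h]; congr 1; ring

/-- number of translates of a segment -/
def lcell (n : ℕ) (x y : ℤ) (k : ℕ) : ℕ :=
  ((n : ℤ) - k * |x|).toNat * ((n : ℤ) - k * |y|).toNat

/-- multiple of a vector -/
def mvec (x y : ℤ) (k : ℕ) : GaussianInt := ⟨k * x, k * y⟩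

theorem keyf_mvec (n : ℕ) (x y : ℤ) (k : ℕ) : keyf n (mvec x y k) = k * keyf n ⟨x, y⟩ := by
  simp only [keyf, mvec]; ring

theorem sort3 {G : Type*} [DecidableEq G] (f : ℕ → G) {a b c : ℕ} (hab : a ≠ b) (hac : a ≠ c) (hbc : b ≠ c) :
    ∃ i j k, i < j ∧ j < k ∧ (i = a ∨ i = b ∨ i = c) ∧ (k = a ∨ k = b ∨ k = c) ∧
      ({f a, f b, f c} : Finset G) = {f i, f j, f k} := by
  rcases lt_or_gt_of_ne hab with h1 | h1 <;> rcases lt_or_gt_of_ne hac with h2 | h2 <;>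
    rcases lt_or_gt_of_ne hbc with h3 | h3
  · exact ⟨a, b, c, by omega, by omega, by simp, by simp, rfl⟩
  · exact ⟨a, c, b, by omega, by omega, by simp, by simp, by
      ext x; simp only [Finset.mem_insert, Finset.mem_singleton]; tauto⟩
  · omega
  · exact ⟨c, a, b, by omega, by omega, by simp, by simp, by
      ext x; simp only [Finset.mem_insert, Finset.mem_singleton]; tauto⟩
  · exact ⟨b, a, c, by omega, by omega, by simp, by simp, by
      ext x; simp only [Finset.mem_insert, Finset.mem_singleton]; tauto⟩
  · omega
  · exact ⟨b, c, a, by omega, by omega, by simp, by simp, by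
      ext x; simp only [Finset.mem_insert, Finset.mem_singleton]; tauto⟩
  · exact ⟨c, b, a, by omega, by omega, by simp, by simp, by
      ext x; simp only [Finset.mem_insert, Finset.mem_singleton]; tauto⟩

theorem mem_gr_between {n : ℕ} {A : GaussianInt} {x y : ℤ} {i k : ℕ} (h1 : A ∈ gr n)
    (h2 : A + mvec x y k ∈ gr n) (hik : i ≤ k) : A + mvec x y i ∈ gr n := by
  have key : ∀ a t : ℤ, 1 ≤ a → a ≤ n → 1 ≤ a + k * t → a + k * t ≤ n →
      1 ≤ a + i * t ∧ a + i * t ≤ n := by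
    intro a t g1 g2 g3 g4
    have hik' : (i : ℤ) ≤ k := by exact_mod_cast hik
    rcases le_total 0 t with h | h
    · have e1 : (i : ℤ) * t ≤ k * t := by gcongr
      have e2 : 0 ≤ (i : ℤ) * t := by positivity
      constructor <;> linarith
    · have e1 : (k : ℤ) * t ≤ i * t := mul_le_mul_of_nonpos_right hik' h
      have e2 : (i : ℤ) * t ≤ 0 := mul_nonpos_of_nonneg_of_nonpos (by positivity) h
      constructor <;> linarith
  rw [mem_gr] at h1 h2 ⊢
  simp only [mvec, Zsqrtd.re_add, Zsqrtd.im_add] at h2 ⊢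
  exact ⟨key _ _ h1.1.1 h1.1.2 h2.1.1 h2.1.2, key _ _ h1.2.1 h1.2.2 h2.2.1 h2.2.2⟩

theorem mem_collSet {n : ℕ} {Q : Finset GaussianInt} :
    Q ∈ collSet n ↔ (Q ⊆ gr n ∧ Q.card = 4) ∧ CollQ Q := by
  classical
  unfold collSet
  rw [Finset.mem_filter, Finset.mem_powersetCard]

theorem coll_param_exists {n : ℕ} {Q : Finset GaussianInt} (hQ : Q ∈ collSet n) :
    ∃ (x y : ℤ) (i j k : ℕ) (A : GaussianInt), (x, y) ∈ dirs n ∧ 0 < keyf n ⟨x, y⟩ ∧ 1 ≤ i ∧ i < j ∧ j < k ∧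
      k ≤ n ∧ A ∈ gr n ∧ A + mvec x y k ∈ gr n ∧
      Q = {A, A + mvec x y i, A + mvec x y j, A + mvec x y k} := by
  rw [mem_collSet] at hQ
  obtain ⟨⟨hg, h4⟩, hc⟩ := hQ
  obtain ⟨A, hA, hmin⟩ := Finset.exists_min_image Q (keyf n) (Finset.card_pos.mp (by omega))
  have h3 : (Q.erase A).card = 3 := by rw [Finset.card_erase_of_mem hA]; omega
  obtain ⟨b, c, d, hbc, hbd, hcd, hQ3⟩ := Finset.card_eq_three.mp h3
  have hQi : Q = insert A {b, c, d} := by rw [← hQ3, Finset.insert_erase hA]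
  have hmem : ∀ z ∈ Q.erase A, z ∈ Q ∧ z ≠ A := fun z hz =>
    ⟨Finset.mem_of_mem_erase hz, Finset.ne_of_mem_erase hz⟩
  have hb := hmem b (by rw [hQ3]; simp)
  have hne : b - A ≠ 0 := sub_ne_zero.mpr hb.2
  obtain ⟨k0, u, hk0, hu, hcop⟩ := gauss_prim (b - A) hne
  obtain ⟨x, y, hxy, hpos, hpar⟩ : ∃ x y : ℤ, IsCoprime x y ∧ 0 < keyf n ⟨x, y⟩ ∧
      ∀ v : GaussianInt, crs (b - A) v = 0 → x * v.im - y * v.re = 0 := by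
    have hpar : ∀ v : GaussianInt, crs (b - A) v = 0 → u.re * v.im - u.im * v.re = 0 := by
      intro v hv
      rw [hu] at hv
      simp [crs] at hv
      apply mul_left_cancel₀ hk0
      linarith
    have hkk : keyf n (b - A) = k0 * keyf n u := by
      rw [hu]; simp [keyf]; ring
    have hne0 : keyf n u ≠ 0 := by
      intro h0
      rw [h0, mul_zero] at hkk
      apply hb.2
      apply keyf_inj (hg hb.1) (hg hA)
      have := keyf_add n (b - A) A
      rw [sub_add_cancel, hkk] at this
      linarith
    rcases lt_or_gt_of_ne hne0 with h | h
    · refine ⟨-u.re, -u.im, hcop.neg_neg, ?_, ?_⟩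
      · unfold keyf at h ⊢; simp only; linarith
      · intro v hv; have := hpar v hv; linarith
    · exact ⟨u.re, u.im, hcop, h, hpar⟩
  have hz : ∀ z ∈ Q.erase A, ∃ k : ℕ, 1 ≤ k ∧ z = A + mvec x y k := by
    intro z hz
    obtain ⟨z1, z2⟩ := hmem z hz
    have h1 := hc A hA b hb.1 z z1
    rw [star_mul_im_eq] at h1
    obtain ⟨k, e1, e2⟩ := par_prim hxy (hpar _ h1)
    have e3 : z - A = ⟨k * x, k * y⟩ := by ext; exacts [e1, e2]
    have e4 : keyf n z = keyf n A + k * keyf n ⟨x, y⟩ := by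
      rw [← sub_add_cancel z A, keyf_add, e3]
      simp only [keyf]; ring
    have e5 := hmin z z1
    have e6 : keyf n z ≠ keyf n A := fun h => z2 (keyf_inj (hg z1) (hg hA) h)
    have e7 : 0 < k := by
      by_contra hk
      push Not at hk
      have : k * keyf n ⟨x, y⟩ ≤ 0 := mul_nonpos_of_nonpos_of_nonneg hk hpos.le
      omega
    refine ⟨k.toNat, by omega, ?_⟩
    have e8 : ((k.toNat : ℕ) : ℤ) = k := Int.toNat_of_nonneg e7.le
    rw [mvec, e8, ← e3]; ring
  obtain ⟨kb, kb1, rfl⟩ := hz b (by rw [hQ3]; simp)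
  obtain ⟨kc, kc1, rfl⟩ := hz c (by rw [hQ3]; simp)
  obtain ⟨kd, kd1, rfl⟩ := hz d (by rw [hQ3]; simp)
  have d1 : kb ≠ kc := by rintro rfl; exact hbc rfl
  have d2 : kb ≠ kd := by rintro rfl; exact hbd rfl
  have d3 : kc ≠ kd := by rintro rfl; exact hcd rfl
  obtain ⟨i, j, k, hij, hjk, hi, hk, hset⟩ := sort3 (fun k => A + mvec x y k) d1 d2 d3
  have gA := hg hA
  have gk : A + mvec x y k ∈ gr n := by
    apply hg
    rw [hQi, hset]; simp
  have hxn : k * |x| ≤ n ∧ k * |y| ≤ n := by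
    rw [mem_gr] at gA gk
    simp only [mvec, Zsqrtd.re_add, Zsqrtd.im_add] at gk
    rw [← Nat.abs_cast k, ← abs_mul, ← abs_mul, abs_le, abs_le]
    omega
  have hk1 : (1 : ℤ) ≤ k := by exact_mod_cast (by omega : 1 ≤ k)
  have hN := prim_norm_pos hxy
  have hxy1 : 1 ≤ |x| ∨ 1 ≤ |y| := by
    by_contra hc
    push Not at hc
    have : x = 0 := abs_eq_zero.mp (by have := abs_nonneg x; omega)
    have : y = 0 := abs_eq_zero.mp (by have := abs_nonneg y; omega)
    subst x; subst y; simp at hN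
  refine ⟨x, y, i, j, k, A, ?_, hpos, by omega, hij, hjk, ?_, gA, gk, ?_⟩
  · unfold dirs
    rw [Finset.mem_filter, Finset.mem_product, Finset.mem_Icc, Finset.mem_Icc]
    refine ⟨⟨abs_le.mp ?_, abs_le.mp ?_⟩, Int.isCoprime_iff_gcd_eq_one.mp hxy⟩
    · exact (le_mul_of_one_le_left (abs_nonneg x) hk1).trans hxn.1
    · exact (le_mul_of_one_le_left (abs_nonneg y) hk1).trans hxn.2
  · have : (k : ℤ) ≤ n := by
      rcases hxy1 with h | h
      · exact (le_mul_of_one_le_right (by omega) h).trans hxn.1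
      · exact (le_mul_of_one_le_right (by omega) h).trans hxn.2
    exact_mod_cast this
  · rw [hQi, hset]

open Classical in
theorem collSet_card_half (n : ℕ) : (collSet n).card =
    ∑ p ∈ (dirs n).filter (fun p => 0 < keyf n ⟨p.1, p.2⟩), ∑ k ∈ Finset.range (n + 1),
      prs n k * lcell n p.1 p.2 k := by
  set R := Finset.range (n + 1) with hR
  set U : Finset ((ℤ × ℤ) × ℕ × (ℕ × ℕ) × GaussianInt) :=
    (((dirs n).filter (fun p => 0 < keyf n ⟨p.1, p.2⟩)) ×ˢ R ×ˢ (R ×ˢ R) ×ˢ gr n).filter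
    (fun q => (1 ≤ q.2.2.1.2 ∧ q.2.2.1.2 < q.2.2.1.1 ∧ q.2.2.1.1 < q.2.1) ∧
      q.2.2.2 + mvec q.1.1 q.1.2 q.2.1 ∈ gr n) with hU
  have hUc : U.card = ∑ p ∈ (dirs n).filter (fun p => 0 < keyf n ⟨p.1, p.2⟩), ∑ k ∈ Finset.range (n + 1),
      prs n k * lcell n p.1 p.2 k := by
    rw [hU, Finset.card_filter, Finset.sum_product]
    apply Finset.sum_congr rfl
    rintro ⟨x, y⟩ hp
    rw [Finset.sum_product]
    apply Finset.sum_congr rfl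
    intro k hk
    rw [← Finset.card_filter]
    dsimp only
    have c1 := countl n (k * x)
    have c2 := countl n (k * y)
    rw [abs_mul, Nat.abs_cast] at c1 c2
    unfold prs lcell
    rw [← c1, ← c2, ← gr_filter_card, ← Finset.card_product]
    congr 1
    ext ⟨⟨a, b⟩, A⟩
    simp only [Finset.mem_filter, Finset.mem_product, mem_gr, mvec, Zsqrtd.re_add, Zsqrtd.im_add]
    tauto
  rw [← hUc]
  symm
  have hcop : ∀ q ∈ U, IsCoprime q.1.1 q.1.2 ∧ 0 < keyf n ⟨q.1.1, q.1.2⟩ ∧ q.2.2.2 ∈ gr n ∧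
     (1 ≤ q.2.2.1.2 ∧ q.2.2.1.2 < q.2.2.1.1 ∧ q.2.2.1.1 < q.2.1) ∧
      q.2.2.2 + mvec q.1.1 q.1.2 q.2.1 ∈ gr n := by
    intro q hq
    rw [hU, Finset.mem_filter, Finset.mem_product, Finset.mem_product, Finset.mem_product, Finset.mem_filter] at hq
    have := hq.1.1.1
    unfold dirs at this
    rw [Finset.mem_filter] at this
    exact ⟨Int.isCoprime_iff_gcd_eq_one.mpr this.2, hq.1.1.2, hq.1.2.2.2, hq.2⟩
  refine Finset.card_bij (fun q _ => {q.2.2.2, q.2.2.2 + mvec q.1.1 q.1.2 q.2.2.1.2,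
      q.2.2.2 + mvec q.1.1 q.1.2 q.2.2.1.1, q.2.2.2 + mvec q.1.1 q.1.2 q.2.1}) ?_ ?_ ?_
  · intro q hq
    obtain ⟨hc, hpos, gA, ⟨h1, h2, h3⟩, gk⟩ := hcop q hq
    obtain ⟨⟨x, y⟩, k, ⟨j, i⟩, A⟩ := q
    dsimp only at *
    have dist : ∀ a b : ℕ, a < b → A + mvec x y a ≠ A + mvec x y b := by
      intro a b hab h
      have := congrArg (keyf n) h
      rw [keyf_add, keyf_add, keyf_mvec, keyf_mvec] at this
      have h5 : (a : ℤ) = b := mul_right_cancel₀ hpos.ne' (by linarith)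
      omega
    have dist0 : ∀ b : ℕ, 0 < b → A ≠ A + mvec x y b := by
      intro b hb h
      apply dist 0 b hb
      rw [← h]
      simp [mvec]
      rfl
    rw [mem_collSet]
    refine ⟨⟨?_, ?_⟩, ?_⟩
    · intro z hz
      simp only [Finset.mem_insert, Finset.mem_singleton] at hz
      rcases hz with rfl | rfl | rfl | rfl
      · exact gA
      · exact mem_gr_between gA gk (by omega)
      · exact mem_gr_between gA gk (by omega)
      · exact gk
    · rw [Finset.card_eq_four]
      exact ⟨_, _, _, _, dist0 _ (by omega), dist0 _ (by omega), dist0 _ (by omega),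
        dist _ _ (by omega), dist _ _ (by omega), dist _ _ (by omega), rfl⟩
    · have all : ∀ z ∈ ({A, A + mvec x y i, A + mvec x y j, A + mvec x y k} : Finset GaussianInt),
          ∃ t : ℕ, z = A + mvec x y t := by
        intro z hz
        simp only [Finset.mem_insert, Finset.mem_singleton] at hz
        rcases hz with rfl | rfl | rfl | rfl
        · exact ⟨0, by simp [mvec]; rfl⟩
        · exact ⟨_, rfl⟩
        · exact ⟨_, rfl⟩
        · exact ⟨_, rfl⟩
      intro p hp q hq r hr
      obtain ⟨t1, rfl⟩ := all p hp
      obtain ⟨t2, rfl⟩ := all q hq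
      obtain ⟨t3, rfl⟩ := all r hr
      rw [star_mul_im_eq]
      simp only [crs, mvec, Zsqrtd.re_sub, Zsqrtd.im_sub, Zsqrtd.re_add, Zsqrtd.im_add]
      ring
  · intro q hq q' hq' heq
    obtain ⟨hc, hpos, gA, ⟨h1, h2, h3⟩, gk⟩ := hcop q hq
    obtain ⟨hc', hpos', gA', ⟨h1', h2', h3'⟩, gk'⟩ := hcop q' hq'
    obtain ⟨⟨x, y⟩, k, ⟨j, i⟩, A⟩ := q
    obtain ⟨⟨x', y'⟩, k', ⟨j', i'⟩, A'⟩ := q'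
    dsimp only at *
    have mono : ∀ (A : GaussianInt) (x y : ℤ) (h : 0 < keyf n ⟨x, y⟩) (a b : ℕ), a < b →
        keyf n (A + mvec x y a) < keyf n (A + mvec x y b) := by
      intro A x y h a b hab
      rw [keyf_add, keyf_add, keyf_mvec, keyf_mvec]
      have : (a : ℤ) < b := by exact_mod_cast hab
      have := mul_lt_mul_of_pos_right this h
      linarith
    have mono0 : ∀ (A : GaussianInt) (x y : ℤ) (h : 0 < keyf n ⟨x, y⟩) (b : ℕ), 0 < b →
        keyf n A < keyf n (A + mvec x y b) := by
      intro A x y h b hb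
      rw [keyf_add, keyf_mvec]
      have : (0 : ℤ) < b := by exact_mod_cast hb
      have := mul_pos this h
      linarith
    have o1 := mono0 A x y hpos i (by omega)
    have o2 := mono A x y hpos i j (by omega)
    have o3 := mono A x y hpos j k (by omega)
    have o1' := mono0 A' x' y' hpos' i' (by omega)
    have o2' := mono A' x' y' hpos' i' j' (by omega)
    have o3' := mono A' x' y' hpos' j' k' (by omega)
    have gi := mem_gr_between (i := i) gA gk (by omega)
    have gj := mem_gr_between (i := j) gA gk (by omega)
    have gi' := mem_gr_between (i := i') gA' gk' (by omega)
    have gj' := mem_gr_between (i := j') gA' gk' (by omega)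
    have tr : ∀ z ∈ ({A', A' + mvec x' y' i', A' + mvec x' y' j', A' + mvec x' y' k'} : Finset GaussianInt),
        keyf n z = keyf n A ∨ keyf n z = keyf n (A + mvec x y i) ∨ keyf n z = keyf n (A + mvec x y j) ∨
        keyf n z = keyf n (A + mvec x y k) := by
      intro z hz
      rw [← heq] at hz
      simp only [Finset.mem_insert, Finset.mem_singleton] at hz
      rcases hz with rfl | rfl | rfl | rfl <;> simp
    have m1 := tr A' (by simp)
    have m2 := tr (A' + mvec x' y' i') (by simp)
    have m3 := tr (A' + mvec x' y' j') (by simp)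
    have m4 := tr (A' + mvec x' y' k') (by simp)
    have e1 : A = A' := keyf_inj gA gA' (by omega)
    have e2 : A + mvec x y i = A' + mvec x' y' i' := keyf_inj gi gi' (by omega)
    have e3 : A + mvec x y j = A' + mvec x' y' j' := keyf_inj gj gj' (by omega)
    have e4 : A + mvec x y k = A' + mvec x' y' k' := keyf_inj gk gk' (by omega)
    subst e1
    have e4 := add_left_cancel e4
    have a1 := congrArg Zsqrtd.re e4
    have a2 := congrArg Zsqrtd.im e4
    dsimp only [mvec] at a1 a2
    obtain ⟨hk, rfl, rfl⟩ := prim_unique hc hc' (by omega) (by omega) a1 a2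
    obtain rfl : k = k' := by exact_mod_cast hk
    have fin : ∀ a b : ℕ, A + mvec x y a = A + mvec x y b → a = b := by
      intro a b h
      have := congrArg (keyf n) h
      rw [keyf_add, keyf_add, keyf_mvec, keyf_mvec] at this
      have h5 : (a : ℤ) = b := mul_right_cancel₀ hpos.ne' (by linarith)
      omega
    obtain rfl := fin _ _ e2
    obtain rfl := fin _ _ e3
    rfl
  · intro Q hQ
    obtain ⟨x, y, i, j, k, A, hd, hpos, h1, h2, h3, h4, gA, gk, rfl⟩ := coll_param_exists hQ
    refine ⟨((x, y), k, (j, i), A), ?_, rfl⟩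
    rw [hU, Finset.mem_filter]
    simp only [Finset.mem_product, Finset.mem_filter, hR, Finset.mem_range]
    refine ⟨⟨⟨hd, hpos⟩, by omega, ⟨by omega, by omega⟩, gA⟩, ⟨h1, h2, h3⟩, gk⟩

theorem collSet_card (n : ℕ) : 2 * (collSet n).card =
    ∑ p ∈ dirs n, ∑ k ∈ Finset.range (n + 1), prs n k * lcell n p.1 p.2 k := by
  classical
  rw [← Finset.sum_filter_add_sum_filter_not (dirs n) (fun p => 0 < keyf n ⟨p.1, p.2⟩), two_mul]
  rw [collSet_card_half]
  congr 1
  refine Finset.sum_bij (fun p _ => (-p.1, -p.2)) ?_ ?_ ?_ ?_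
  · rintro ⟨x, y⟩ hp
    unfold dirs at hp ⊢
    simp only [Finset.mem_filter, Finset.mem_product, Finset.mem_Icc] at hp ⊢
    refine ⟨⟨by omega, ?_⟩, ?_⟩
    · rw [Int.gcd_neg, Int.neg_gcd]; exact hp.1.2
    · have := hp.2; unfold keyf at this ⊢; simp only at this ⊢; linarith
  · rintro ⟨x, y⟩ hp ⟨x', y'⟩ hp' h
    simp only [Prod.mk.injEq] at h ⊢
    omega
  · rintro ⟨x, y⟩ hp
    refine ⟨(-x, -y), ?_, by simp⟩
    unfold dirs at hp ⊢
    simp only [Finset.mem_filter, Finset.mem_product, Finset.mem_Icc] at hp ⊢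
    have h0 : keyf n ⟨x, y⟩ ≠ 0 := by
      intro h0
      have := keyf_small h0 (by rw [abs_le]; exact hp.1.1.2)
      have e1 := congrArg Zsqrtd.re this
      have e2 := congrArg Zsqrtd.im this
      simp at e1 e2
      have := hp.1.2
      rw [e1, e2] at this
      simp at this
    refine ⟨⟨by omega, ?_⟩, ?_⟩
    · rw [Int.gcd_neg, Int.neg_gcd]; exact hp.1.2
    · have := hp.2; unfold keyf at this h0 ⊢; simp only at this h0 ⊢
      have h1 : ((n : ℤ) + 1) * x + y < 0 := lt_of_le_of_ne (not_lt.mp this) h0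
      linarith
  · rintro ⟨x, y⟩ hp
    simp only [lcell, abs_neg]

/-! ### Reduction to pointwise limits -/

/-- primitive vectors of sup-norm `a` -/
noncomputable def shell (a : ℕ) : Finset (ℤ × ℤ) :=
  (Finset.box a).filter (fun p => Int.gcd p.1 p.2 = 1)

theorem mem_shell {a : ℕ} {p : ℤ × ℤ} :
    p ∈ shell a ↔ max p.1.natAbs p.2.natAbs = a ∧ Int.gcd p.1 p.2 = 1 := by
  simp [shell, Int.mem_box]

theorem shell_zero : shell 0 = ∅ := by
  ext p
  simp only [mem_shell, Finset.notMem_empty, iff_false, not_and]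
  intro h
  have h1 : p.1 = 0 := by omega
  have h2 : p.2 = 0 := by omega
  simp [h1, h2]

theorem shell_card_le (a : ℕ) : ((shell a).card : ℝ) ≤ 8 * a := by
  rcases Nat.eq_zero_or_pos a with rfl | ha
  · simp [shell_zero]
  · have : (shell a).card ≤ 8 * a := by
      rw [← Int.card_box ha.ne']
      exact Finset.card_filter_le _ _
    exact_mod_cast this

theorem sum_dirs {M : Type*} [AddCommMonoid M] (n : ℕ) (F : ℤ × ℤ → M) :
    ∑ p ∈ dirs n, F p = ∑ a ∈ Finset.range (n + 1), ∑ p ∈ shell a, F p := by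
  rw [← Finset.sum_fiberwise_of_maps_to (s := dirs n) (t := Finset.range (n + 1))
    (g := fun p : ℤ × ℤ => max p.1.natAbs p.2.natAbs)]
  · apply Finset.sum_congr rfl
    intro a ha
    apply Finset.sum_congr _ (fun _ _ => rfl)
    ext p
    simp only [dirs, Finset.mem_filter, Finset.mem_product, Finset.mem_Icc, mem_shell, Finset.mem_range] at *
    constructor
    · rintro ⟨⟨_, h⟩, h2⟩; exact ⟨h2, h⟩
    · rintro ⟨h, h2⟩; exact ⟨⟨by omega, h2⟩, h⟩
  · intro p hp
    simp only [dirs, Finset.mem_filter, Finset.mem_product, Finset.mem_Icc, Finset.mem_range] at *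
    omega

theorem shell_tannery (S : ℕ → ℤ × ℤ → ℕ) (lim : ℤ × ℤ → ℝ) (K : ℝ) (hK : 0 ≤ K)
    (hb : ∀ n a p, p ∈ shell a → 1 ≤ a → (S n p : ℝ) * (a : ℝ) ^ 3 ≤ K * (n : ℝ) ^ 5)
    (hz : ∀ n a p, p ∈ shell a → n < a → S n p = 0)
    (hl : ∀ a p, p ∈ shell a → Filter.Tendsto (fun n : ℕ => (S n p : ℝ) / (n : ℝ) ^ 5) Filter.atTop (nhds (lim p))) :
    Filter.Tendsto (fun n : ℕ => ((∑ p ∈ dirs n, S n p : ℕ) : ℝ) / (n : ℝ) ^ 5) Filter.atTop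
      (nhds (∑' a : ℕ, ∑ p ∈ shell a, lim p)) ∧ Summable (fun a : ℕ => ∑ p ∈ shell a, lim p) := by
  have hbd : ∀ n a : ℕ, ‖∑ p ∈ shell a, (S n p : ℝ) / (n : ℝ) ^ 5‖ ≤ 8 * K * (1 / (a : ℝ) ^ 2) := by
    intro n a
    rw [Real.norm_of_nonneg (by positivity)]
    rcases Nat.eq_zero_or_pos a with rfl | ha
    · simp [shell_zero]
    have ha' : (0 : ℝ) < a := by exact_mod_cast ha
    calc ∑ p ∈ shell a, (S n p : ℝ) / (n : ℝ) ^ 5 ≤ ∑ p ∈ shell a, K / (a : ℝ) ^ 3 := by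
          apply Finset.sum_le_sum
          intro p hp
          rcases Nat.eq_zero_or_pos n with rfl | hn
          · simp; positivity
          have hn' : (0 : ℝ) < n := by exact_mod_cast hn
          rw [div_le_div_iff₀ (by positivity) (by positivity)]
          exact hb n a p hp ha
      _ = (shell a).card * (K / (a : ℝ) ^ 3) := by simp
      _ ≤ (8 * a) * (K / (a : ℝ) ^ 3) := by
          apply mul_le_mul_of_nonneg_right (shell_card_le a); positivity
      _ = _ := by field_simp
  have hsum : Summable (fun a : ℕ => 8 * K * (1 / (a : ℝ) ^ 2)) :=
    (Real.summable_one_div_nat_pow.mpr (by norm_num)).mul_left _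
  have hlim : ∀ a, Filter.Tendsto (fun n : ℕ => ∑ p ∈ shell a, (S n p : ℝ) / (n : ℝ) ^ 5) Filter.atTop
      (nhds (∑ p ∈ shell a, lim p)) := fun a => tendsto_finsetSum _ (fun p hp => hl a p hp)
  constructor
  · have := tendsto_tsum_of_dominated_convergence hsum hlim (Filter.Eventually.of_forall (fun n a => hbd n a))
    refine this.congr ?_
    intro n
    rw [sum_dirs, tsum_eq_sum (s := Finset.range (n + 1))]
    · push_cast
      rw [Finset.sum_div]
      apply Finset.sum_congr rfl
      intro a _
      rw [Finset.sum_div]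
    · intro a ha
      apply Finset.sum_eq_zero
      intro p hp
      rw [hz n a p hp (by simpa using ha)]
      simp
  · apply Summable.of_norm_bounded hsum
    intro a
    exact le_of_tendsto (hlim a).norm (Filter.Eventually.of_forall (fun n => hbd n a))

/-- trapezoid count in a direction -/
noncomputable def trapDir (n : ℕ) (p : ℤ × ℤ) : ℕ :=
  ∑ t ∈ shapes n, if trapOK p.1 p.2 t.1 t.2.1 t.2.2 then cell n p.1 p.2 t.1 t.2.1 t.2.2 else 0

/-- collinear count in a direction -/
noncomputable def collDir (n : ℕ) (p : ℤ × ℤ) : ℕ :=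
  ∑ k ∈ Finset.range (n + 1), prs n k * lcell n p.1 p.2 k

theorem lcell_le (n : ℕ) (x y : ℤ) (k : ℕ) : lcell n x y k ≤ n * n := by
  unfold lcell
  apply Nat.mul_le_mul
  · have : 0 ≤ (k : ℤ) * |x| := by positivity
    omega
  · have : 0 ≤ (k : ℤ) * |y| := by positivity
    omega

theorem lcell_zero {n a k : ℕ} {p : ℤ × ℤ} (hp : max p.1.natAbs p.2.natAbs = a) (h : n ≤ k * a) :
    lcell n p.1 p.2 k = 0 := by
  unfold lcell
  have h' : (n : ℤ) ≤ k * a := by exact_mod_cast h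
  rcases le_total p.1.natAbs p.2.natAbs with hh | hh
  · have : |p.2| = a := by rw [Int.abs_eq_natAbs]; omega
    rw [this, Int.toNat_of_nonpos (z := (n : ℤ) - k * a) (by linarith), mul_zero]
  · have : |p.1| = a := by rw [Int.abs_eq_natAbs]; omega
    rw [this, Int.toNat_of_nonpos (z := (n : ℤ) - k * a) (by linarith), zero_mul]

theorem prs_zero (n : ℕ) : prs n 0 = 0 := by simp [prs]

theorem prs_le (n k : ℕ) : prs n k ≤ k * k := by
  unfold prs
  rw [← Finset.card_range k, ← Finset.card_product, Finset.card_range]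
  apply Finset.card_le_card
  intro p
  simp only [Finset.mem_filter, Finset.mem_product, Finset.mem_range]
  omega

theorem collDir_zero {n a : ℕ} {p : ℤ × ℤ} (hp : p ∈ shell a) (h : n < a) : collDir n p = 0 := by
  unfold collDir
  apply Finset.sum_eq_zero
  intro k _
  rcases Nat.eq_zero_or_pos k with rfl | hk
  · simp [prs_zero]
  · rw [lcell_zero (mem_shell.mp hp).1 (by nlinarith), mul_zero]

theorem collDir_bound {n a : ℕ} {p : ℤ × ℤ} (hp : p ∈ shell a) (ha : 1 ≤ a) :
    (collDir n p : ℝ) * (a : ℝ) ^ 3 ≤ 1 * (n : ℝ) ^ 5 := by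
  have h : collDir n p ≤ ∑ k ∈ Finset.range (n + 1), if k ∈ Finset.Icc 1 (n / a) then (n / a) * (n / a) * (n * n) else 0 := by
    apply Finset.sum_le_sum
    intro k _
    split_ifs with hk
    · rw [Finset.mem_Icc] at hk
      exact Nat.mul_le_mul ((prs_le n k).trans (Nat.mul_le_mul hk.2 hk.2)) (lcell_le _ _ _ _)
    · rcases Nat.eq_zero_or_pos k with rfl | hk0
      · simp [prs_zero]
      · rw [lcell_zero (mem_shell.mp hp).1, mul_zero]
        rw [Finset.mem_Icc] at hk
        have h1 : n / a < k := by omega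
        exact ((Nat.div_lt_iff_lt_mul ha).mp h1).le
  have h2 : (∑ k ∈ Finset.range (n + 1), if k ∈ Finset.Icc 1 (n / a) then (n / a) * (n / a) * (n * n) else 0) ≤
      (n / a) * ((n / a) * (n / a) * (n * n)) := by
    rw [← Finset.sum_filter, Finset.sum_const, smul_eq_mul]
    apply Nat.mul_le_mul_right
    calc _ ≤ (Finset.Icc 1 (n / a)).card := Finset.card_le_card (fun k hk => (Finset.mem_filter.mp hk).2)
      _ = n / a := by simp
  have h3 : n / a * a ≤ n := Nat.div_mul_le_self n a
  have h4 : collDir n p * a ^ 3 ≤ n ^ 5 := by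
    calc collDir n p * a ^ 3 ≤ (n / a) * ((n / a) * (n / a) * (n * n)) * a ^ 3 := Nat.mul_le_mul_right _ (h.trans h2)
      _ = (n / a * a) ^ 3 * n ^ 2 := by ring
      _ ≤ n ^ 3 * n ^ 2 := Nat.mul_le_mul_right _ (Nat.pow_le_pow_left h3 3)
      _ = n ^ 5 := by ring
  rw [one_mul]; exact_mod_cast h4

theorem cell_le (n : ℕ) (x y k D O : ℤ) (hk : 0 ≤ k) : cell n x y k D O ≤ n * n := by
  unfold cell Wf
  apply Nat.mul_le_mul
  · have : 0 ≤ k * |x| := by positivity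
    omega
  · have : 0 ≤ k * |y| := by positivity
    omega

theorem cell_support {n a : ℕ} {p : ℤ × ℤ} {k D O : ℤ} (hp : max p.1.natAbs p.2.natAbs = a)
    (hD : 0 < D) (hDk : D < k) (h : cell n p.1 p.2 k D O ≠ 0) :
    k * a < n ∧ O * a ≤ 2 * n := by
  unfold cell at h
  rw [Nat.mul_ne_zero_iff] at h
  have key : ∀ b : ℤ, 0 ≤ b → 0 < (n : ℤ) - Wf a b k D O → 0 < (n : ℤ) - Wf b a k D O → k * a < n ∧ O * a ≤ 2 * n := by
    intro b hb h1 h2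
    unfold Wf at h1 h2
    have h3 : D * b ≤ k * b := mul_le_mul_of_nonneg_right hDk.le hb
    have h4 : 0 ≤ D * b := by positivity
    constructor
    · omega
    · omega
  rcases le_total p.1.natAbs p.2.natAbs with hh | hh
  · have e : |p.2| = a := by rw [Int.abs_eq_natAbs]; omega
    rw [e] at h
    exact key |p.1| (abs_nonneg _) (by omega) (by omega)
  · have e : |p.1| = a := by rw [Int.abs_eq_natAbs]; omega
    rw [e] at h
    exact key |p.2| (abs_nonneg _) (by omega) (by omega)

theorem trapDir_zero {n a : ℕ} {p : ℤ × ℤ} (hp : p ∈ shell a) (h : n < a) : trapDir n p = 0 := by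
  unfold trapDir
  apply Finset.sum_eq_zero
  intro t _
  split_ifs with ht
  · by_contra hc
    have := (cell_support (mem_shell.mp hp).1 ht.1 ht.2.1 hc).1
    have h2 : 1 ≤ t.1 := by have := ht.1; have := ht.2.1; omega
    have h3 : (n : ℤ) < a := by exact_mod_cast h
    nlinarith
  · rfl

theorem trapDir_bound {n a : ℕ} {p : ℤ × ℤ} (hp : p ∈ shell a) (ha : 1 ≤ a) :
    (trapDir n p : ℝ) * (a : ℝ) ^ 3 ≤ 2 * (n : ℝ) ^ 5 := by
  have ha' : (0 : ℤ) < a := by exact_mod_cast ha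
  set B : Finset (ℤ × ℤ × ℤ) := Finset.Icc 1 ((n / a : ℕ) : ℤ) ×ˢ Finset.Icc 1 ((n / a : ℕ) : ℤ) ×ˢ Finset.Icc 1 ((2 * n / a : ℕ) : ℤ) with hB
  have h : trapDir n p ≤ ∑ t ∈ shapes n, if t ∈ B then n * n else 0 := by
    apply Finset.sum_le_sum
    intro t _
    split_ifs with ht htB htB
    · exact cell_le _ _ _ _ _ _ (by have := ht.1; have := ht.2.1; omega)
    · by_contra hc
      have hs := cell_support (mem_shell.mp hp).1 ht.1 ht.2.1 (n := n) (O := t.2.2) (by intro h0; apply hc; rw [h0])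
      apply htB
      simp only [hB, Finset.mem_product, Finset.mem_Icc]
      have k1 : t.1 ≤ ((n / a : ℕ) : ℤ) := by
        push_cast
        exact (Int.le_ediv_iff_mul_le ha').mpr hs.1.le
      have k2 : t.2.2 ≤ ((2 * n / a : ℕ) : ℤ) := by
        push_cast
        exact (Int.le_ediv_iff_mul_le ha').mpr hs.2
      obtain ⟨h1, h2, h3, _⟩ := ht
      refine ⟨⟨by omega, k1⟩, ⟨by omega, by omega⟩, by omega, k2⟩
    · exact Nat.zero_le _
    · exact le_rfl
  have h2 : (∑ t ∈ shapes n, if t ∈ B then n * n else 0) ≤ (n / a) * ((n / a) * (2 * n / a)) * (n * n) := by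
    rw [← Finset.sum_filter, Finset.sum_const, smul_eq_mul]
    apply Nat.mul_le_mul_right
    calc _ ≤ B.card := Finset.card_le_card (fun k hk => (Finset.mem_filter.mp hk).2)
      _ = _ := by
        rw [hB, Finset.card_product, Finset.card_product, Int.card_Icc, Int.card_Icc]
        simp only [add_sub_cancel_right, Int.toNat_natCast]
  have h3 : n / a * a ≤ n := Nat.div_mul_le_self n a
  have h3' : 2 * n / a * a ≤ 2 * n := Nat.div_mul_le_self _ a
  have h4 : trapDir n p * a ^ 3 ≤ 2 * n ^ 5 := by
    calc trapDir n p * a ^ 3 ≤ (n / a) * ((n / a) * (2 * n / a)) * (n * n) * a ^ 3 := Nat.mul_le_mul_right _ (h.trans h2)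
      _ = (n / a * a) * (n / a * a) * (2 * n / a * a) * n ^ 2 := by ring
      _ ≤ n * n * (2 * n) * n ^ 2 := by gcongr
      _ = 2 * n ^ 5 := by ring
  exact_mod_cast h4

/-- Reduction of the theorem to pointwise limits. -/
theorem reduction (T C : ℤ × ℤ → ℝ)
    (hT : ∀ a p, p ∈ shell a → Filter.Tendsto (fun n : ℕ => (trapDir n p : ℝ) / (n : ℝ) ^ 5) Filter.atTop (nhds (T p)))
    (hC : ∀ a p, p ∈ shell a → Filter.Tendsto (fun n : ℕ => (collDir n p : ℝ) / (n : ℝ) ^ 5) Filter.atTop (nhds (C p))) :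
    Filter.Tendsto (fun n : ℕ => (badQuadCount n : ℝ) / (n : ℝ) ^ 5) Filter.atTop
      (nhds (∑' a : ℕ, ∑ p ∈ shell a, T p + (∑' a : ℕ, ∑ p ∈ shell a, C p) / 2)) ∧
    Summable (fun a : ℕ => ∑ p ∈ shell a, T p) ∧ Summable (fun a : ℕ => ∑ p ∈ shell a, C p) := by
  obtain ⟨t1, t2⟩ := shell_tannery trapDir T 2 (by norm_num) (fun n a p hp ha => trapDir_bound hp ha)
    (fun n a p hp h => trapDir_zero hp h) hT
  obtain ⟨c1, c2⟩ := shell_tannery collDir C 1 (by norm_num) (fun n a p hp ha => collDir_bound hp ha)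
    (fun n a p hp h => collDir_zero hp h) hC
  refine ⟨?_, t2, c2⟩
  have := (conc_trap_tendsto.add t1).add (c1.div_const 2)
  rw [zero_add] at this
  refine this.congr ?_
  intro n
  have e1 : (∑ p ∈ dirs n, trapDir n p) = (trapSet n).card := (trapSet_card n).symm
  have e2 : ∑ p ∈ dirs n, collDir n p = 2 * (collSet n).card := (collSet_card n).symm
  rw [e1, e2, badQuad_split]
  push_cast
  ring

/-! ### The pointwise limit for collinear quadruples -/

/-- larger coordinate -/
def pmax (p : ℤ × ℤ) : ℕ := max p.1.natAbs p.2.natAbs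
/-- smaller coordinate -/
def pmin (p : ℤ × ℤ) : ℕ := min p.1.natAbs p.2.natAbs

theorem pmin_le_pmax (p : ℤ × ℤ) : pmin p ≤ pmax p := min_le_max

theorem shell_pmax {a : ℕ} {p : ℤ × ℤ} (hp : p ∈ shell a) : pmax p = a := (mem_shell.mp hp).1

theorem shell_coprime {a : ℕ} {p : ℤ × ℤ} (hp : p ∈ shell a) : Nat.gcd (pmax p) (pmin p) = 1 := by
  have := (mem_shell.mp hp).2
  rw [Int.gcd_eq_natAbs] at this
  unfold pmax pmin
  rcases le_total p.1.natAbs p.2.natAbs with h | h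
  · rw [max_eq_right h, min_eq_left h, Nat.gcd_comm]; exact this
  · rw [max_eq_left h, min_eq_right h]; exact this

theorem shell_pmax_pos {a : ℕ} {p : ℤ × ℤ} (hp : p ∈ shell a) : 0 < pmax p := by
  rcases Nat.eq_zero_or_pos a with rfl | h
  · simp [shell_zero] at hp
  · rw [shell_pmax hp]; exact h

theorem lcell_eq (n : ℕ) (p : ℤ × ℤ) (k : ℕ) :
    lcell n p.1 p.2 k = (n - k * pmax p) * (n - k * pmin p) := by
  have e1 : ∀ z : ℤ, ((n : ℤ) - k * |z|).toNat = n - k * z.natAbs := by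
    intro z
    rw [Int.abs_eq_natAbs]
    have : (k : ℤ) * (z.natAbs : ℤ) = ((k * z.natAbs : ℕ) : ℤ) := by push_cast; ring
    rw [this]; omega
  unfold lcell pmax pmin
  rw [e1, e1]
  rcases le_total p.1.natAbs p.2.natAbs with h | h
  · rw [max_eq_right h, min_eq_left h, mul_comm]
  · rw [max_eq_left h, min_eq_right h]

/-- power sums -/
noncomputable def psum (j m : ℕ) : ℝ := ∑ k ∈ Finset.Icc 1 m, (k : ℝ) ^ j

theorem psum_succ (j m : ℕ) : psum j (m + 1) = psum j m + ((m : ℝ) + 1) ^ j := by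
  unfold psum
  rw [Finset.sum_Icc_succ_top (by omega)]
  push_cast; rfl

theorem psum0 (m : ℕ) : psum 0 m = m := by simp [psum]
theorem psum1 (m : ℕ) : psum 1 m = (m : ℝ) ^ 2 / 2 + m / 2 := by
  induction m with
  | zero => simp [psum]
  | succ m ih => rw [psum_succ, ih]; push_cast; ring
theorem psum2 (m : ℕ) : psum 2 m = (m : ℝ) ^ 3 / 3 + (m : ℝ) ^ 2 / 2 + m / 6 := by
  induction m with
  | zero => simp [psum]
  | succ m ih => rw [psum_succ, ih]; push_cast; ring
theorem psum3 (m : ℕ) : psum 3 m = (m : ℝ) ^ 4 / 4 + (m : ℝ) ^ 3 / 2 + (m : ℝ) ^ 2 / 4 := by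
  induction m with
  | zero => simp [psum]
  | succ m ih => rw [psum_succ, ih]; push_cast; ring
theorem psum4 (m : ℕ) : psum 4 m = (m : ℝ) ^ 5 / 5 + (m : ℝ) ^ 4 / 2 + (m : ℝ) ^ 3 / 3 - m / 30 := by
  induction m with
  | zero => simp [psum]
  | succ m ih => rw [psum_succ, ih]; push_cast; ring

theorem collDir_eq {n : ℕ} {p : ℤ × ℤ} (ha : 0 < pmax p) :
    (collDir n p : ℝ) = ∑ k ∈ Finset.Icc 1 (n / pmax p),
      ((k : ℝ) - 1) * (k - 2) / 2 * (((n : ℝ) - k * pmax p) * (n - k * pmin p)) := by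
  unfold collDir
  push_cast
  have hsub : Finset.Icc 1 (n / pmax p) ⊆ Finset.range (n + 1) := by
    intro k hk
    rw [Finset.mem_Icc] at hk
    rw [Finset.mem_range]
    have := Nat.div_le_self n (pmax p)
    omega
  rw [← Finset.sum_subset hsub]
  · apply Finset.sum_congr rfl
    intro k hk
    rw [Finset.mem_Icc] at hk
    have h1 : k * pmax p ≤ n := (Nat.le_div_iff_mul_le ha).mp hk.2
    have h2 : k * pmin p ≤ n := (Nat.mul_le_mul_left k (pmin_le_pmax p)).trans h1
    have h3 := Nat.div_le_self n (pmax p)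
    rw [prs_eq (by omega) hk.1, lcell_eq]
    push_cast [Nat.cast_sub h1, Nat.cast_sub h2]
    ring
  · intro k _ hk
    rw [Finset.mem_Icc] at hk
    rcases Nat.eq_zero_or_pos k with rfl | hk0
    · simp [prs_zero]
    · have h1 : n / pmax p < k := by omega
      have h2 := ((Nat.div_lt_iff_lt_mul ha).mp h1).le
      rw [lcell_eq, Nat.sub_eq_zero_of_le h2]
      simp

/-- the limit density of collinear quadruples in a direction -/
noncomputable def Clim (p : ℤ × ℤ) : ℝ :=
  1 / (2 * (pmax p : ℝ) ^ 3) * (1 / 12 - (pmin p : ℝ) / (20 * pmax p))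

theorem tendsto_floor_ratio {a : ℕ} (ha : 0 < a) :
    Filter.Tendsto (fun n : ℕ => ((n / a : ℕ) : ℝ) / n) Filter.atTop (nhds (1 / (a : ℝ))) := by
  have ha' : (0 : ℝ) < a := by exact_mod_cast ha
  have h0 : Filter.Tendsto (fun n : ℕ => 1 / (a : ℝ) - 1 / (n : ℝ)) Filter.atTop (nhds (1 / (a : ℝ) - 0)) :=
    tendsto_const_nhds.sub tendsto_one_div_atTop_nhds_zero_nat
  rw [sub_zero] at h0
  refine tendsto_of_tendsto_of_tendsto_of_le_of_le' h0 tendsto_const_nhds ?_ ?_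
  · filter_upwards [Filter.eventually_gt_atTop 0] with n hn
    have hn' : (0 : ℝ) < n := by exact_mod_cast hn
    have : n < (n / a + 1) * a := by
      have := Nat.lt_mul_div_succ n ha
      rw [mul_comm] at this; exact this
    have h2 : (n : ℝ) < (((n / a : ℕ) : ℝ) + 1) * a := by exact_mod_cast this
    rw [div_sub_div _ _ ha'.ne' hn'.ne', div_le_div_iff₀ (by positivity) hn']
    nlinarith
  · filter_upwards [Filter.eventually_gt_atTop 0] with n hn
    have hn' : (0 : ℝ) < n := by exact_mod_cast hn
    rw [div_le_div_iff₀ hn' ha']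
    have := Nat.div_mul_le_self n a
    have h2 : ((n / a : ℕ) : ℝ) * a ≤ n := by exact_mod_cast this
    linarith

theorem coll_limit {a : ℕ} {p : ℤ × ℤ} (hp : p ∈ shell a) :
    Filter.Tendsto (fun n : ℕ => (collDir n p : ℝ) / (n : ℝ) ^ 5) Filter.atTop (nhds (Clim p)) := by
  have ha : 0 < pmax p := shell_pmax_pos hp
  have hu := tendsto_floor_ratio ha
  have hv : Filter.Tendsto (fun n : ℕ => 1 / (n : ℝ)) Filter.atTop (nhds 0) := tendsto_one_div_atTop_nhds_zero_nat
  have ha' : (0 : ℝ) < pmax p := by exact_mod_cast ha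
  unfold Clim
  generalize hA : (pmax p : ℝ) = A at *
  generalize hBB : (pmin p : ℝ) = B at *
  set G : ℝ × ℝ → ℝ := fun w =>
    (1 / 2) * ((w.1 ^ 3 / 3 + w.1 ^ 2 * w.2 / 2 + w.1 * w.2 ^ 2 / 6) * (1 + 3 * (A + B) * w.2 + 2 * A * B * w.2 ^ 2)
      - (w.1 ^ 4 / 4 + w.1 ^ 3 * w.2 / 2 + w.1 ^ 2 * w.2 ^ 2 / 4) * ((A + B) + 3 * A * B * w.2)
      + (w.1 ^ 5 / 5 + w.1 ^ 4 * w.2 / 2 + w.1 ^ 3 * w.2 ^ 2 / 3 - w.1 * w.2 ^ 4 / 30) * (A * B)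
      - (w.1 ^ 2 / 2 + w.1 * w.2 / 2) * (3 * w.2 + 2 * (A + B) * w.2 ^ 2) + 2 * w.1 * w.2 ^ 2) with hG
  have hGc : Continuous G := by rw [hG]; fun_prop
  have hlim := (hGc.tendsto (1 / A, 0)).comp (hu.prodMk_nhds hv)
  have e : G (1 / A, 0) = 1 / (2 * A ^ 3) * (1 / 12 - B / (20 * A)) := by
    simp only [hG]; field_simp; ring
  rw [e] at hlim
  refine hlim.congr' ?_
  filter_upwards [Filter.eventually_gt_atTop 0] with n hn
  have hn' : (0 : ℝ) < n := by exact_mod_cast hn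
  rw [collDir_eq ha, hA, hBB]
  have e2 : ∀ m : ℕ, ∑ k ∈ Finset.Icc 1 m,
      ((k : ℝ) - 1) * (k - 2) / 2 * (((n : ℝ) - k * A) * (n - k * B)) =
      (1 / 2) * (psum 2 m * (n ^ 2 + 3 * (A + B) * n + 2 * A * B) - psum 3 m * ((A + B) * n + 3 * A * B)
        + psum 4 m * (A * B) - psum 1 m * (3 * n ^ 2 + 2 * (A + B) * n) + psum 0 m * (2 * n ^ 2)) := by
    intro m
    unfold psum
    simp only [Finset.sum_mul, ← Finset.sum_sub_distrib, ← Finset.sum_add_distrib, Finset.mul_sum]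
    apply Finset.sum_congr rfl
    intro k _
    ring
  rw [e2, psum0, psum1, psum2, psum3, psum4]
  simp only [hG, Function.comp]
  generalize ((n / pmax p : ℕ) : ℝ) = m
  field_simp

/-! ### Integrals over simplices and cones -/

open MeasureTheory in
theorem setIntegral_Ioo_poly {c : ℝ} (hc : 0 ≤ c) (f G : ℝ → ℝ) (h : ∀ x, HasDerivAt G (f x) x)
    (hf : Continuous f) : ∫ x in Set.Ioo 0 c, f x = G c - G 0 := by
  rw [← integral_Ioc_eq_integral_Ioo, ← intervalIntegral.integral_of_le hc]
  exact intervalIntegral.integral_eq_sub_of_hasDerivAt (fun x _ => h x) (hf.intervalIntegrable _ _)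

open MeasureTheory in
theorem integrable_indicator_of_bounded {E : Type*} [MeasureSpace E] [MetricSpace E] [ProperSpace E]
    [OpensMeasurableSpace E] [IsFiniteMeasureOnCompacts (volume : Measure E)] {s : Set E} {f : E → ℝ}
    (hs : MeasurableSet s) (hb : Bornology.IsBounded s) (hf : Continuous f) :
    Integrable (s.indicator f) := by
  rw [integrable_indicator_iff hs]
  exact (hf.continuousOn.integrableOn_compact hb.isCompact_closure).mono_set subset_closure

/-- weight function on the simplex -/
noncomputable def sfun (h0 h1 h2 x y z : ℝ) : ℝ := (1 - (x + y + z)) * (1 - (h0 * x + h1 * y + h2 * z))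

open MeasureTheory in
theorem simplex3 (h0 h1 h2 : ℝ) :
    ∫ w : ℝ × ℝ × ℝ, Set.indicator {w : ℝ × ℝ × ℝ | 0 < w.1 ∧ 0 < w.2.1 ∧ 0 < w.2.2 ∧ w.1 + w.2.1 + w.2.2 < 1}
      (fun w => sfun h0 h1 h2 w.1 w.2.1 w.2.2) w = 1 / 24 - (h0 + h1 + h2) / 120 := by
  set S : Set (ℝ × ℝ × ℝ) := {w : ℝ × ℝ × ℝ | 0 < w.1 ∧ 0 < w.2.1 ∧ 0 < w.2.2 ∧ w.1 + w.2.1 + w.2.2 < 1} with hS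
  have hSo : IsOpen S := by
    simp only [hS, Set.setOf_and]
    refine IsOpen.inter (isOpen_lt ?_ ?_) (IsOpen.inter (isOpen_lt ?_ ?_) (IsOpen.inter (isOpen_lt ?_ ?_) (isOpen_lt ?_ ?_))) <;> fun_prop
  have hSb : Bornology.IsBounded S := by
    apply (Metric.isBounded_Icc (0 : ℝ × ℝ × ℝ) (1, 1, 1)).subset
    rintro ⟨x, y, z⟩ ⟨h1, h2, h3, h4⟩
    simp only at h1 h2 h3 h4
    simp only [Set.mem_Icc, Prod.le_def, Prod.fst_zero, Prod.snd_zero]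
    refine ⟨⟨h1.le, h2.le, h3.le⟩, by linarith, by linarith, by linarith⟩
  have hc : Continuous (fun w : ℝ × ℝ × ℝ => sfun h0 h1 h2 w.1 w.2.1 w.2.2) := by unfold sfun; fun_prop
  have hi := integrable_indicator_of_bounded hSo.measurableSet hSb hc
  rw [Measure.volume_eq_prod, integral_prod _ (by rw [← Measure.volume_eq_prod]; exact hi)]
  have step1 : ∀ x : ℝ, ∫ w : ℝ × ℝ, S.indicator (fun w => sfun h0 h1 h2 w.1 w.2.1 w.2.2) (x, w) =
      Set.indicator (Set.Ioo 0 1) (fun x => ((1 - x) ^ 3 / 6 * (1 - h0 * x) - (h1 + h2) * (1 - x) ^ 4 / 24)) x := by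
    intro x
    by_cases hx : x ∈ Set.Ioo (0 : ℝ) 1
    · rw [Set.indicator_of_mem hx]
      set S2 : Set (ℝ × ℝ) := {w | 0 < w.1 ∧ 0 < w.2 ∧ x + w.1 + w.2 < 1} with hS2
      have e1 : ∀ w : ℝ × ℝ, S.indicator (fun w => sfun h0 h1 h2 w.1 w.2.1 w.2.2) (x, w) =
          S2.indicator (fun w => sfun h0 h1 h2 x w.1 w.2) w := by
        intro w
        by_cases hw : w ∈ S2
        · rw [Set.indicator_of_mem hw, Set.indicator_of_mem]
          exact ⟨hx.1, hw⟩
        · rw [Set.indicator_of_notMem hw, Set.indicator_of_notMem]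
          exact fun h => hw h.2
      simp_rw [e1]
      have hSo2 : IsOpen S2 := by
        simp only [hS2, Set.setOf_and]
        refine IsOpen.inter (isOpen_lt ?_ ?_) (IsOpen.inter (isOpen_lt ?_ ?_) (isOpen_lt ?_ ?_)) <;> fun_prop
      have hSb2 : Bornology.IsBounded S2 := by
        apply (Metric.isBounded_Icc (0 : ℝ × ℝ) (1, 1)).subset
        rintro ⟨y, z⟩ ⟨h2, h3, h4⟩
        simp only at h2 h3 h4
        simp only [Set.mem_Icc, Prod.le_def, Prod.fst_zero, Prod.snd_zero]
        refine ⟨⟨h2.le, h3.le⟩, by linarith [hx.1], by linarith [hx.1]⟩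
      have hc2 : Continuous (fun w : ℝ × ℝ => sfun h0 h1 h2 x w.1 w.2) := by unfold sfun; fun_prop
      have hi2 := integrable_indicator_of_bounded hSo2.measurableSet hSb2 hc2
      rw [Measure.volume_eq_prod, integral_prod _ (by rw [← Measure.volume_eq_prod]; exact hi2)]
      have step2 : ∀ y : ℝ, ∫ z : ℝ, S2.indicator (fun w => sfun h0 h1 h2 x w.1 w.2) (y, z) =
          Set.indicator (Set.Ioo 0 (1 - x)) (fun y => (1 - x - y) ^ 2 / 2 * (1 - h0 * x - h1 * y) - h2 * (1 - x - y) ^ 3 / 6) y := by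
        intro y
        by_cases hy : y ∈ Set.Ioo (0 : ℝ) (1 - x)
        · rw [Set.indicator_of_mem hy]
          have e2 : ∀ z : ℝ, S2.indicator (fun w => sfun h0 h1 h2 x w.1 w.2) (y, z) =
              (Set.Ioo 0 (1 - x - y)).indicator (fun z => sfun h0 h1 h2 x y z) z := by
            intro z
            by_cases hz : z ∈ Set.Ioo 0 (1 - x - y)
            · rw [Set.indicator_of_mem hz, Set.indicator_of_mem]
              exact ⟨hy.1, hz.1, by have := hz.2; simp only; linarith⟩
            · rw [Set.indicator_of_notMem hz, Set.indicator_of_notMem]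
              exact fun h => hz ⟨h.2.1, by have := h.2.2; simp only at this; linarith⟩
          simp_rw [e2]
          rw [integral_indicator measurableSet_Ioo, setIntegral_Ioo_poly (by linarith [hy.2]) _
            (fun z => (1 - x - y) * (1 - h0 * x - h1 * y) * z - ((1 - h0 * x - h1 * y) + (1 - x - y) * h2) * (z ^ 2 / 2) + h2 * (z ^ 3 / 3))]
          · ring
          · intro z
            have := (((hasDerivAt_id z).const_mul ((1 - x - y) * (1 - h0 * x - h1 * y))).sub
              (((hasDerivAt_pow 2 z).div_const 2).const_mul ((1 - h0 * x - h1 * y) + (1 - x - y) * h2))).add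
              (((hasDerivAt_pow 3 z).div_const 3).const_mul h2)
            refine this.congr_deriv ?_
            unfold sfun; push_cast; ring
          · unfold sfun; fun_prop
        · rw [Set.indicator_of_notMem hy]
          apply integral_eq_zero_of_ae
          filter_upwards with z
          rw [Set.indicator_of_notMem]; rfl
          intro h
          apply hy
          exact ⟨h.1, by have h1 := h.2.1; have := h.2.2; simp only at this h1; linarith⟩
      simp_rw [step2]
      rw [integral_indicator measurableSet_Ioo, setIntegral_Ioo_poly (by linarith [hx.2]) _
            (fun y => -((1 - x - y) ^ 3 / 6) * (1 - h0 * x - h1 * y) + h1 * ((1 - x - y) ^ 4 / 24) + h2 * ((1 - x - y) ^ 4 / 24))]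
      · ring
      · intro y
        have hl : HasDerivAt (fun y : ℝ => 1 - x - y) (-1) y := by
          simpa using (hasDerivAt_id y).const_sub (1 - x)
        have hl2 : HasDerivAt (fun y : ℝ => 1 - h0 * x - h1 * y) (-h1) y := by
          simpa using ((hasDerivAt_id y).const_mul h1).const_sub (1 - h0 * x)
        have := ((((hl.pow 3).div_const 6).neg.mul hl2).add (((hl.pow 4).div_const 24).const_mul h1)).add
          (((hl.pow 4).div_const 24).const_mul h2)
        refine this.congr_deriv ?_
        simp only [Pi.pow_apply, Pi.neg_apply]
        push_cast; ring
      · fun_prop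
    · rw [Set.indicator_of_notMem hx]
      apply integral_eq_zero_of_ae
      filter_upwards with w
      rw [Set.indicator_of_notMem]; rfl
      intro h
      apply hx
      exact ⟨h.1, by have h1 := h.2.1; have h2 := h.2.2.1; have := h.2.2.2; simp only at this h1 h2; linarith⟩
  simp_rw [step1]
  rw [integral_indicator measurableSet_Ioo, setIntegral_Ioo_poly (by norm_num) _
            (fun x => -((1 - x) ^ 4 / 24) * (1 - h0 * x) + h0 * ((1 - x) ^ 5 / 120) + (h1 + h2) * ((1 - x) ^ 5 / 120))]
  · ring
  · intro x
    have hl : HasDerivAt (fun x : ℝ => 1 - x) (-1) x := by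
      simpa using (hasDerivAt_id x).const_sub 1
    have hl2 : HasDerivAt (fun x : ℝ => 1 - h0 * x) (-h0) x := by
      simpa using ((hasDerivAt_id x).const_mul h0).const_sub 1
    have := ((((hl.pow 4).div_const 24).neg.mul hl2).add (((hl.pow 5).div_const 120).const_mul h0)).add
          (((hl.pow 5).div_const 120).const_mul (h1 + h2))
    refine this.congr_deriv ?_
    simp only [Pi.pow_apply, Pi.neg_apply]
    push_cast; ring
  · fun_prop

open MeasureTheory in
theorem integral_fin3 (G : (Fin 3 → ℝ) → ℝ) :
    ∫ v : Fin 3 → ℝ, G v = ∫ w : ℝ × ℝ × ℝ, G ![w.1, w.2.1, w.2.2] := by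
  have m1 := (volume_preserving_piFinSuccAbove (fun _ : Fin 3 => ℝ) 0).symm
  have m2 := (volume_preserving_finTwoArrow ℝ).symm
  have m3 := (MeasurePreserving.id (volume : Measure ℝ)).prod m2
  have m := m1.comp m3
  have he : MeasurableEmbedding (((MeasurableEquiv.piFinSuccAbove (fun _ : Fin 3 => ℝ) 0).symm) ∘
      Prod.map id (MeasurableEquiv.finTwoArrow (α := ℝ)).symm) := by
    apply (MeasurableEquiv.measurableEmbedding _).comp
    exact ((MeasurableEquiv.refl ℝ).prodCongr (MeasurableEquiv.finTwoArrow (α := ℝ)).symm).measurableEmbedding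
  have := m.integral_comp he G
  rw [← this]
  apply integral_congr_ae
  filter_upwards with w
  congr 1
  ext i
  fin_cases i <;> rfl

/-- point of a cone -/
def cpt (a b c : ℝ × ℝ × ℝ) (x y z : ℝ) : Fin 3 → ℝ :=
  ![x * a.1 + y * b.1 + z * c.1, x * a.2.1 + y * b.2.1 + z * c.2.1, x * a.2.2 + y * b.2.2 + z * c.2.2]

/-- determinant -/
def cdet (a b c : ℝ × ℝ × ℝ) : ℝ :=
  a.1 * (b.2.1 * c.2.2 - b.2.2 * c.2.1) - a.2.1 * (b.1 * c.2.2 - b.2.2 * c.1) + a.2.2 * (b.1 * c.2.1 - b.2.1 * c.1)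

open MeasureTheory in
theorem cone_int {L : Set (Fin 3 → ℝ)} (hL : MeasurableSet L) {F : (Fin 3 → ℝ) → ℝ} (hF : Continuous F)
    (a b c w m : ℝ × ℝ × ℝ) (hw0 : 0 < w.1) (hw1 : 0 < w.2.1) (hw2 : 0 < w.2.2)
    (h1 : ∀ x y z : ℝ, 0 < x → 0 < y → 0 < z → x * w.1 + y * w.2.1 + z * w.2.2 < 1 →
      cpt a b c x y z ∈ L ∧ F (cpt a b c x y z) =
        (1 - (x * w.1 + y * w.2.1 + z * w.2.2)) * (1 - (x * m.1 + y * m.2.1 + z * m.2.2)))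
    (h2 : ∀ x y z : ℝ, cpt a b c x y z ∈ L → 0 ≤ x ∧ 0 ≤ y ∧ 0 ≤ z ∧ x * w.1 + y * w.2.1 + z * w.2.2 < 1)
    (hd : cdet a b c ≠ 0) :
    ∫ v in L, F v = |cdet a b c| / (w.1 * w.2.1 * w.2.2) *
      (1 / 24 - (m.1 / w.1 + m.2.1 / w.2.1 + m.2.2 / w.2.2) / 120) := by
  set M : Matrix (Fin 3) (Fin 3) ℝ := !![a.1 / w.1, b.1 / w.2.1, c.1 / w.2.2;
    a.2.1 / w.1, b.2.1 / w.2.1, c.2.1 / w.2.2; a.2.2 / w.1, b.2.2 / w.2.1, c.2.2 / w.2.2] with hM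
  have hdet : M.det = cdet a b c / (w.1 * w.2.1 * w.2.2) := by
    rw [hM, Matrix.det_fin_three, cdet]
    simp
    field_simp
    ring
  have hMne : M.det ≠ 0 := by rw [hdet]; positivity
  have hMv : ∀ x y z : ℝ, Matrix.toLin' M ![x, y, z] = cpt a b c (x / w.1) (y / w.2.1) (z / w.2.2) := by
    intro x y z
    ext i
    fin_cases i <;> simp [hM, Matrix.mulVec, cpt, dotProduct, Fin.sum_univ_three] <;> ring
  rw [← integral_indicator hL]
  have hmap := Real.map_matrix_volume_pi_eq_smul_volume_pi hMne
  have hme : Measurable (Matrix.toLin' M) := (LinearMap.continuous_of_finiteDimensional _).measurable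
  have hi := integral_map (μ := volume) hme.aemeasurable (f := L.indicator F)
    ((hF.measurable.indicator hL).aestronglyMeasurable)
  rw [hmap, integral_smul_measure, integral_fin3 (fun v => L.indicator F (Matrix.toLin' M v))] at hi
  have key : ∫ q : ℝ × ℝ × ℝ, L.indicator F (Matrix.toLin' M ![q.1, q.2.1, q.2.2]) =
      1 / 24 - (m.1 / w.1 + m.2.1 / w.2.1 + m.2.2 / w.2.2) / 120 := by
    rw [← simplex3]
    apply integral_congr_ae
    have n1 : ∀ᵐ q : ℝ × ℝ × ℝ, q.1 ≠ 0 :=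
      (Measure.quasiMeasurePreserving_fst (μ := (volume : Measure ℝ)) (ν := (volume : Measure (ℝ × ℝ)))).ae
        (Measure.ae_ne volume (0 : ℝ))
    have n2' : ∀ᵐ q : ℝ × ℝ, q.1 ≠ 0 :=
      (Measure.quasiMeasurePreserving_fst (μ := (volume : Measure ℝ)) (ν := (volume : Measure ℝ))).ae
        (Measure.ae_ne volume (0 : ℝ))
    have n3' : ∀ᵐ q : ℝ × ℝ, q.2 ≠ 0 :=
      (Measure.quasiMeasurePreserving_snd (μ := (volume : Measure ℝ)) (ν := (volume : Measure ℝ))).ae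
        (Measure.ae_ne volume (0 : ℝ))
    have n2 : ∀ᵐ q : ℝ × ℝ × ℝ, q.2.1 ≠ 0 :=
      (Measure.quasiMeasurePreserving_snd (μ := (volume : Measure ℝ)) (ν := (volume : Measure (ℝ × ℝ)))).ae n2'
    have n3 : ∀ᵐ q : ℝ × ℝ × ℝ, q.2.2 ≠ 0 :=
      (Measure.quasiMeasurePreserving_snd (μ := (volume : Measure ℝ)) (ν := (volume : Measure (ℝ × ℝ)))).ae n3'
    filter_upwards [n1, n2, n3] with q q1 q2 q3
    rw [hMv]
    have es : q.1 / w.1 * w.1 + q.2.1 / w.2.1 * w.2.1 + q.2.2 / w.2.2 * w.2.2 = q.1 + q.2.1 + q.2.2 := by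
      field_simp
    by_cases hq : q ∈ {q : ℝ × ℝ × ℝ | 0 < q.1 ∧ 0 < q.2.1 ∧ 0 < q.2.2 ∧ q.1 + q.2.1 + q.2.2 < 1}
    · rw [Set.indicator_of_mem hq]
      obtain ⟨p1, p2, p3, p4⟩ := hq
      have hh := h1 (q.1 / w.1) (q.2.1 / w.2.1) (q.2.2 / w.2.2) (by positivity) (by positivity) (by positivity)
        (by rw [es]; exact p4)
      rw [Set.indicator_of_mem hh.1, hh.2, es, sfun]
      ring
    · rw [Set.indicator_of_notMem hq, Set.indicator_of_notMem]
      intro hc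
      apply hq
      obtain ⟨p1, p2, p3, p4⟩ := h2 _ _ _ hc
      rw [es] at p4
      have r1 : 0 ≤ q.1 := by rwa [le_div_iff₀ hw0, zero_mul] at p1
      have r2 : 0 ≤ q.2.1 := by rwa [le_div_iff₀ hw1, zero_mul] at p2
      have r3 : 0 ≤ q.2.2 := by rwa [le_div_iff₀ hw2, zero_mul] at p3
      exact ⟨lt_of_le_of_ne r1 (Ne.symm q1), lt_of_le_of_ne r2 (Ne.symm q2), lt_of_le_of_ne r3 (Ne.symm q3), p4⟩
  rw [key, ENNReal.toReal_ofReal (abs_nonneg _), smul_eq_mul, abs_inv] at hi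
  have hpos : 0 < |M.det| := abs_pos.mpr hMne
  have e : |M.det| = |cdet a b c| / (w.1 * w.2.1 * w.2.2) := by
    rw [hdet, abs_div, abs_of_pos (a := w.1 * w.2.1 * w.2.2) (by positivity)]
  rw [← e, ← hi]
  field_simp

/-! ### The trapezoid integral -/

/-- normalized width -/
noncomputable def Wr (a b : ℝ) (v : Fin 3 → ℝ) : ℝ := v 0 * a + max 0 (v 2 * b - v 1 * a)

/-- normalized shape region -/
def Sr (a b : ℝ) : Set (Fin 3 → ℝ) :=
  {v | 0 < v 1 ∧ 2 * v 1 < v 0 ∧ 0 < v 2 ∧ Wr a b v < 1 ∧ Wr b a v < 1}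

/-- normalized number of translates -/
noncomputable def Fr (a b : ℝ) (v : Fin 3 → ℝ) : ℝ := (1 - Wr a b v) * (1 - Wr b a v)

theorem Wr_cont (a b : ℝ) : Continuous (Wr a b) := by unfold Wr; fun_prop

theorem Fr_cont (a b : ℝ) : Continuous (Fr a b) := by
  have := Wr_cont a b
  have := Wr_cont b a
  unfold Fr; fun_prop

theorem Sr_open (a b : ℝ) : IsOpen (Sr a b) := by
  have := Wr_cont a b
  have := Wr_cont b a
  simp only [Sr, Set.ofPred_and]
  refine IsOpen.inter (isOpen_lt ?_ ?_) (IsOpen.inter (isOpen_lt ?_ ?_) (IsOpen.inter (isOpen_lt ?_ ?_)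
    (IsOpen.inter (isOpen_lt ?_ ?_) (isOpen_lt ?_ ?_)))) <;> fun_prop

theorem Wr_convex (a b : ℝ) : ConvexOn ℝ Set.univ (Wr a b) := by
  refine ⟨convex_univ, ?_⟩
  intro x _ y _ p q hp hq _
  simp only [Wr, Pi.add_apply, Pi.smul_apply, smul_eq_mul]
  have h1 : max 0 ((p * x 2 + q * y 2) * b - (p * x 1 + q * y 1) * a) ≤
      p * max 0 (x 2 * b - x 1 * a) + q * max 0 (y 2 * b - y 1 * a) := by
    apply max_le
    · positivity
    · have e1 := mul_le_mul_of_nonneg_left (le_max_right 0 (x 2 * b - x 1 * a)) hp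
      have e2 := mul_le_mul_of_nonneg_left (le_max_right 0 (y 2 * b - y 1 * a)) hq
      linarith
  linarith

theorem Sr_convex (a b : ℝ) : Convex ℝ (Sr a b) := by
  have h1 := (Wr_convex a b).convex_lt 1
  have h2 := (Wr_convex b a).convex_lt 1
  have e : Sr a b = {v | 0 < v 1 ∧ 2 * v 1 < v 0 ∧ 0 < v 2} ∩ ({v ∈ Set.univ | Wr a b v < 1} ∩ {v ∈ Set.univ | Wr b a v < 1}) := by
    ext v; simp [Sr]; tauto
  rw [e]
  apply Convex.inter _ (h1.inter h2)
  intro x hx y hy p q hp hq hpq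
  obtain ⟨x1, x2, x3⟩ := hx
  obtain ⟨y1, y2, y3⟩ := hy
  simp only [Set.mem_ofPred_eq, Pi.add_apply, Pi.smul_apply, smul_eq_mul]
  rcases eq_or_lt_of_le hp with rfl | hp'
  · have : q = 1 := by linarith
    subst this
    simp only [zero_mul, zero_add, one_mul]
    exact ⟨y1, y2, y3⟩
  · refine ⟨?_, ?_, ?_⟩
    · have := mul_pos hp' x1; have := mul_nonneg hq y1.le; linarith
    · have := mul_pos hp' (sub_pos.mpr x2); have := mul_nonneg hq (sub_pos.mpr y2).le; linarith
    · have := mul_pos hp' x3; have := mul_nonneg hq y3.le; linarith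

theorem Sr_bounded {a b : ℝ} (ha : 0 < a) (hb : 0 ≤ b) : Bornology.IsBounded (Sr a b) := by
  apply (Metric.isBounded_Icc (0 : Fin 3 → ℝ) (fun _ => 2 / a)).subset
  rintro v ⟨h1, h2, h3, h4, h5⟩
  unfold Wr at h4 h5
  have e1 := le_max_left 0 (v 2 * b - v 1 * a)
  have e2 := le_max_right 0 (v 2 * a - v 1 * b)
  have k1 : v 0 ≤ 2 / a := by rw [le_div_iff₀ ha]; linarith
  have k2 : v 2 ≤ 2 / a := by
    rw [le_div_iff₀ ha]
    have : 0 ≤ (v 0 - v 1) * b := mul_nonneg (by linarith) hb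
    linarith
  constructor
  · intro i; fin_cases i <;> simp <;> linarith
  · intro i; fin_cases i <;> simp <;> linarith

theorem nn_of_mul {c y : ℝ} (hc : 0 < c) (h : 0 ≤ c * y) : 0 ≤ y := nonneg_of_mul_nonneg_right h hc

open MeasureTheory in
theorem leafA {a b : ℝ} (hb : 0 ≤ b) (hab : b ≤ a) (ha : 0 < a) :
    ∫ v in Sr a b ∩ {v | v 2 * a < v 1 * b}, Fr a b v =
      b / (a * (2 * a) * (2 * a * a)) * (1 / 24 - (b / a + (2 * b) / (2 * a) + (2 * a * b) / (2 * a * a)) / 120) := by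
  rcases eq_or_lt_of_le hb with rfl | hb
  · have : Sr a 0 ∩ {v | v 2 * a < v 1 * 0} = ∅ := by
      ext v
      simp only [Sr, Set.mem_inter_iff, Set.mem_ofPred_eq, Set.mem_empty_iff_false, iff_false]
      rintro ⟨⟨_, _, h3, _⟩, h⟩
      have := mul_pos h3 ha
      linarith
    rw [this]; simp
  have hd : cdet (1, 0, 0) (2, 1, 0) (2 * a, a, b) = b := by simp [cdet]
  have := cone_int (L := Sr a b ∩ {v | v 2 * a < v 1 * b}) ?_ (Fr_cont a b) (1, 0, 0) (2, 1, 0) (2 * a, a, b)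
    (a, 2 * a, 2 * a * a) (b, 2 * b, 2 * a * b) (by positivity) (by positivity) (by positivity) ?_ ?_ (by rw [hd]; exact hb.ne')
  · rw [this, hd, abs_of_pos hb]
  · exact (Sr_open a b).measurableSet.inter (measurableSet_lt (by fun_prop) (by fun_prop))
  · intro x y z hx hy hz hs
    have e1 : max 0 (z * b * b - (y + z * a) * a) = 0 := by
      apply max_eq_left
      have := mul_le_mul hab hab hb.le ha.le
      have := mul_le_mul_of_nonneg_left this hz.le
      have := mul_pos hy ha
      linarith
    have e2 : max 0 (z * b * a - (y + z * a) * b) = 0 := by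
      apply max_eq_left
      have := mul_pos hy hb
      linarith
    have p1 := mul_pos hz ha
    have p2 := mul_pos hz hb
    have p3 := mul_pos hy hb
    have hm : 0 ≤ (a - b) * (x + y * 2 + z * (2 * a)) := mul_nonneg (by linarith) (by positivity)
    simp only [cpt, Sr, Fr, Wr, Set.mem_inter_iff, Set.mem_ofPred_eq, Matrix.cons_val, mul_zero, mul_one, zero_add, e1, e2] at hs ⊢
    refine ⟨⟨⟨by positivity, by linarith, by positivity, by linarith, by linarith⟩, by linarith⟩, by ring⟩
  · intro x y z h
    simp only [cpt, Sr, Wr, Set.mem_inter_iff, Set.mem_ofPred_eq, Matrix.cons_val, mul_zero, mul_one, zero_add] at h ⊢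
    obtain ⟨⟨h1, h2, h3, h4, h5⟩, h6⟩ := h
    have e1 := le_max_left 0 (z * b * b - (y + z * a) * a)
    refine ⟨by linarith, nn_of_mul hb (by linarith), nn_of_mul hb (by linarith), by linarith⟩

set_option linter.unusedSimpArgs false

open MeasureTheory in
theorem leafB1 {a b : ℝ} (hb : 0 ≤ b) (hab : b ≤ a) (ha : 0 < a) :
    ∫ v in Sr a b \ {v | v 2 * a < v 1 * b} ∩ {v | v 2 * b < v 1 * a} ∩ {v | v 2 * a - v 1 * b ≤ v 0 * (a - b)} ∩ {v | v 2 * a < v 1 * (2 * a - b)}, Fr a b v =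
      (2 * a * (a - b)) / (a * (2 * a * a) * (2 * a * a)) * (1 / 24 - ((b) / (a) + (2 * a * b) / (2 * a * a) + (2 * a * a) / (2 * a * a)) / 120) := by
  rcases eq_or_lt_of_le hab with rfl | hab'
  · have : Sr b b \ {v | v 2 * b < v 1 * b} ∩ {v | v 2 * b < v 1 * b} ∩ {v | v 2 * b - v 1 * b ≤ v 0 * (b - b)} ∩ {v | v 2 * b < v 1 * (2 * b - b)} = ∅ := by
      ext v
      simp only [Sr, Wr, Set.mem_inter_iff, Set.mem_sdiff, Set.mem_ofPred_eq, Set.mem_empty_iff_false, iff_false, not_lt, not_le]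
      rintro ⟨⟨⟨⟨_, h1⟩, h2⟩, h3⟩, h4⟩
      linarith
    rw [this]; simp
  have hc : 0 < a - b := by linarith
  have hd : cdet (1, 0, 0) (2 * a, a, b) (2 * a, a, 2 * a - b) = 2 * a * (a - b) := by simp [cdet]; try ring
  have hd2 : |cdet (1, 0, 0) (2 * a, a, b) (2 * a, a, 2 * a - b)| = (2 * a * (a - b)) := by
    rw [hd]; exact abs_of_pos (by positivity)
  have := cone_int (L := Sr a b \ {v | v 2 * a < v 1 * b} ∩ {v | v 2 * b < v 1 * a} ∩ {v | v 2 * a - v 1 * b ≤ v 0 * (a - b)} ∩ {v | v 2 * a < v 1 * (2 * a - b)}) ?_ (Fr_cont a b) (1, 0, 0) (2 * a, a, b) (2 * a, a, 2 * a - b)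
    (a, 2 * a * a, 2 * a * a) (b, 2 * a * b, 2 * a * a) (by positivity) (by positivity) (by positivity) ?_ ?_
    (by intro h0; rw [h0, abs_zero] at hd2; have : 0 < (2 * a * (a - b)) := (by positivity); linarith)
  · rw [this, hd2]
  · 
    refine (((((Sr_open a b).measurableSet).diff (measurableSet_lt ?_ ?_)).inter (measurableSet_lt ?_ ?_)).inter (measurableSet_le ?_ ?_)).inter (measurableSet_lt ?_ ?_) <;> fun_prop
  · intro x y z hx hy hz hs
    have p1 := mul_pos hy ha
    have p2 := mul_pos hz ha
    have p3 : 0 < z * (2 * a - b) := mul_pos hz (by linarith)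
    have p4 := mul_nonneg hy.le hb
    have p5 : 0 ≤ z * (a - b) * a := by positivity
    have p5' : 0 < z * (a - b) * a := by positivity
    have p6' : 0 < y * (a - b) * a := by positivity
    have p6 : 0 ≤ (a - b) * (x + 2 * a * y) := by positivity
    have p7 : 0 < z * (a - b) ^ 2 := by positivity
    have p8 : 0 < y * ((a - b) * (a + b)) := by positivity
    have p9 : 0 < x * (a - b) := by positivity
    have e1 : max 0 ((y * b + z * (2 * a - b)) * b - (y * a + z * a) * a) = 0 := by
      apply max_eq_left
      linarith
    have e2 : max 0 ((y * b + z * (2 * a - b)) * a - (y * a + z * a) * b) = (y * b + z * (2 * a - b)) * a - (y * a + z * a) * b := by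
      apply max_eq_right
      linarith
    simp only [cpt, Sr, Fr, Wr, Set.mem_inter_iff, Set.mem_sdiff, Set.mem_ofPred_eq, Matrix.cons_val, mul_zero, mul_one, zero_add, add_zero, not_lt, not_le, e1, e2] at hs ⊢
    refine ⟨⟨⟨⟨⟨⟨by positivity, by linarith, by linarith, by linarith, by linarith⟩, by linarith⟩, by linarith⟩, by linarith⟩, by linarith⟩, by ring⟩
  · intro x y z h
    simp only [cpt, Sr, Fr, Wr, Set.mem_inter_iff, Set.mem_sdiff, Set.mem_ofPred_eq, Matrix.cons_val, mul_zero, mul_one, zero_add, add_zero, not_lt, not_le] at h ⊢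
    obtain ⟨⟨⟨⟨⟨h1, h2, h3, h4, h5⟩, h6⟩, h7⟩, h8⟩, h9⟩ := h
    have e1 := le_max_left 0 ((y * b + z * (2 * a - b)) * b - (y * a + z * a) * a)
    have hac : 0 < a * (a - b) := by positivity
    refine ⟨by linarith, nn_of_mul hac (by linarith), nn_of_mul hac (by linarith), by linarith⟩

open MeasureTheory in
theorem leafB2 {a b : ℝ} (hb : 0 ≤ b) (hab : b ≤ a) (ha : 0 < a) :
    ∫ v in (Sr a b \ {v | v 2 * a < v 1 * b} ∩ {v | v 2 * b < v 1 * a} ∩ {v | v 2 * a - v 1 * b ≤ v 0 * (a - b)}) \ {v | v 2 * a < v 1 * (2 * a - b)}, Fr a b v =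
      ((a - b) ^ 2) / (a * (2 * a * a) * (a * (a + b))) * (1 / 24 - ((b) / (a) + (2 * a * a) / (2 * a * a) + (a * (a + b)) / (a * (a + b))) / 120) := by
  rcases eq_or_lt_of_le hab with rfl | hab'
  · have : (Sr b b \ {v | v 2 * b < v 1 * b} ∩ {v | v 2 * b < v 1 * b} ∩ {v | v 2 * b - v 1 * b ≤ v 0 * (b - b)}) \ {v | v 2 * b < v 1 * (2 * b - b)} = ∅ := by
      ext v
      simp only [Sr, Wr, Set.mem_inter_iff, Set.mem_sdiff, Set.mem_ofPred_eq, Set.mem_empty_iff_false, iff_false, not_lt, not_le]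
      rintro ⟨⟨⟨⟨_, h1⟩, h2⟩, h3⟩, h4⟩
      linarith
    rw [this]; simp
  have hc : 0 < a - b := by linarith
  have hd : cdet (1, 0, 0) (2 * a, a, 2 * a - b) (a + b, b, a) = (a - b) ^ 2 := by simp [cdet]; try ring
  have hd2 : |cdet (1, 0, 0) (2 * a, a, 2 * a - b) (a + b, b, a)| = ((a - b) ^ 2) := by
    rw [hd]; exact abs_of_pos (by positivity)
  have := cone_int (L := (Sr a b \ {v | v 2 * a < v 1 * b} ∩ {v | v 2 * b < v 1 * a} ∩ {v | v 2 * a - v 1 * b ≤ v 0 * (a - b)}) \ {v | v 2 * a < v 1 * (2 * a - b)}) ?_ (Fr_cont a b) (1, 0, 0) (2 * a, a, 2 * a - b) (a + b, b, a)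
    (a, 2 * a * a, a * (a + b)) (b, 2 * a * a, a * (a + b)) (by positivity) (by positivity) (by positivity) ?_ ?_
    (by intro h0; rw [h0, abs_zero] at hd2; have : 0 < ((a - b) ^ 2) := (by positivity); linarith)
  · rw [this, hd2]
  · 
    refine (((((Sr_open a b).measurableSet).diff (measurableSet_lt ?_ ?_)).inter (measurableSet_lt ?_ ?_)).inter (measurableSet_le ?_ ?_)).diff (measurableSet_lt ?_ ?_) <;> fun_prop
  · intro x y z hx hy hz hs
    have p1 := mul_pos hy ha
    have p2 := mul_pos hz ha
    have p3 : 0 < y * (2 * a - b) := mul_pos hy (by linarith)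
    have p4 := mul_nonneg hz.le hb
    have p5 : 0 < y * (a - b) * a := by positivity
    have p6 : 0 < z * ((a - b) * (a + b)) := by positivity
    have p6' : 0 < z * (a - b) := by positivity
    have p7 : 0 < y * (a - b) ^ 2 := by positivity
    have p8 : 0 < z * (a - b) ^ 2 := by positivity
    have p9 : 0 < x * (a - b) := by positivity
    have e1 : max 0 ((y * (2 * a - b) + z * a) * b - (y * a + z * b) * a) = 0 := by
      apply max_eq_left
      linarith
    have e2 : max 0 ((y * (2 * a - b) + z * a) * a - (y * a + z * b) * b) = (y * (2 * a - b) + z * a) * a - (y * a + z * b) * b := by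
      apply max_eq_right
      linarith
    simp only [cpt, Sr, Fr, Wr, Set.mem_inter_iff, Set.mem_sdiff, Set.mem_ofPred_eq, Matrix.cons_val, mul_zero, mul_one, zero_add, add_zero, not_lt, not_le, e1, e2] at hs ⊢
    refine ⟨⟨⟨⟨⟨⟨by positivity, by linarith, by linarith, by linarith, by linarith⟩, by linarith⟩, by linarith⟩, by linarith⟩, by linarith⟩, by ring⟩
  · intro x y z h
    simp only [cpt, Sr, Fr, Wr, Set.mem_inter_iff, Set.mem_sdiff, Set.mem_ofPred_eq, Matrix.cons_val, mul_zero, mul_one, zero_add, add_zero, not_lt, not_le] at h ⊢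
    obtain ⟨⟨⟨⟨⟨h1, h2, h3, h4, h5⟩, h6⟩, h7⟩, h8⟩, h9⟩ := h
    have e1 := le_max_left 0 ((y * (2 * a - b) + z * a) * b - (y * a + z * b) * a)
    have hac : 0 < (a - b) ^ 2 := by positivity
    refine ⟨nn_of_mul hc (by linarith), nn_of_mul hac (by linarith), nn_of_mul hac (by linarith), by linarith⟩

open MeasureTheory in
theorem leafD {a b : ℝ} (hb : 0 ≤ b) (hab : b ≤ a) (ha : 0 < a) :
    ∫ v in (Sr a b \ {v | v 2 * a < v 1 * b} ∩ {v | v 2 * b < v 1 * a}) \ {v | v 2 * a - v 1 * b ≤ v 0 * (a - b)}, Fr a b v =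
      ((a - b) ^ 3) / (a * (a + b) * (2 * a * a) * (a * a + b * b)) * (1 / 24 - ((a * (a + b)) / (a * (a + b)) + (2 * a * a) / (2 * a * a) + (2 * a * b) / (a * a + b * b)) / 120) := by
  rcases eq_or_lt_of_le hab with rfl | hab'
  · have : (Sr b b \ {v | v 2 * b < v 1 * b} ∩ {v | v 2 * b < v 1 * b}) \ {v | v 2 * b - v 1 * b ≤ v 0 * (b - b)} = ∅ := by
      ext v
      simp only [Sr, Wr, Set.mem_inter_iff, Set.mem_sdiff, Set.mem_ofPred_eq, Set.mem_empty_iff_false, iff_false, not_lt, not_le]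
      rintro ⟨⟨⟨_, h1⟩, h2⟩, h3⟩
      linarith
    rw [this]; simp
  have hc : 0 < a - b := by linarith
  have hd : cdet (a + b, b, a) (2 * a, a, 2 * a - b) (2 * b, b, a) = (a - b) ^ 3 := by simp [cdet]; try ring
  have hd2 : |cdet (a + b, b, a) (2 * a, a, 2 * a - b) (2 * b, b, a)| = ((a - b) ^ 3) := by
    rw [hd]; exact abs_of_pos (by positivity)
  have := cone_int (L := (Sr a b \ {v | v 2 * a < v 1 * b} ∩ {v | v 2 * b < v 1 * a}) \ {v | v 2 * a - v 1 * b ≤ v 0 * (a - b)}) ?_ (Fr_cont a b) (a + b, b, a) (2 * a, a, 2 * a - b) (2 * b, b, a)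
    (a * (a + b), 2 * a * a, a * a + b * b) (a * (a + b), 2 * a * a, 2 * a * b) (by positivity) (by positivity) (by positivity) ?_ ?_
    (by intro h0; rw [h0, abs_zero] at hd2; have : 0 < ((a - b) ^ 3) := (by positivity); linarith)
  · rw [this, hd2]
  · 
    refine ((((Sr_open a b).measurableSet).diff (measurableSet_lt ?_ ?_)).inter (measurableSet_lt ?_ ?_)).diff (measurableSet_le ?_ ?_) <;> fun_prop
  · intro x y z hx hy hz hs
    have p1 := mul_pos hx ha
    have p1' := mul_nonneg hx.le hb
    have p2 := mul_pos hy ha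
    have p2' := mul_pos hz ha
    have p3 : 0 < y * (2 * a - b) := mul_pos hy (by linarith)
    have p4 := mul_nonneg hz.le hb
    have p5 : 0 < y * (a - b) * a := by positivity
    have p6 : 0 < z * ((a - b) * (a + b)) := by positivity
    have p6' : 0 < x * (a - b) := by positivity
    have p7 : 0 < y * (a - b) ^ 2 := by positivity
    have p8 : 0 < z * (a - b) ^ 2 := by positivity
    have p9 : 0 < x * ((a - b) * (a + b)) := by positivity
    have e1 : max 0 ((x * a + y * (2 * a - b) + z * a) * b - (x * b + y * a + z * b) * a) = 0 := by
      apply max_eq_left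
      linarith
    have e2 : max 0 ((x * a + y * (2 * a - b) + z * a) * a - (x * b + y * a + z * b) * b) = (x * a + y * (2 * a - b) + z * a) * a - (x * b + y * a + z * b) * b := by
      apply max_eq_right
      linarith
    simp only [cpt, Sr, Fr, Wr, Set.mem_inter_iff, Set.mem_sdiff, Set.mem_ofPred_eq, Matrix.cons_val, mul_zero, mul_one, zero_add, add_zero, not_lt, not_le, e1, e2] at hs ⊢
    refine ⟨⟨⟨⟨⟨by positivity, by linarith, by linarith, by linarith, by linarith⟩, by linarith⟩, by linarith⟩, by linarith⟩, by ring⟩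
  · intro x y z h
    simp only [cpt, Sr, Fr, Wr, Set.mem_inter_iff, Set.mem_sdiff, Set.mem_ofPred_eq, Matrix.cons_val, mul_zero, mul_one, zero_add, add_zero, not_lt, not_le] at h ⊢
    obtain ⟨⟨⟨⟨h1, h2, h3, h4, h5⟩, h6⟩, h7⟩, h8⟩ := h
    have e1 := le_max_right 0 ((x * a + y * (2 * a - b) + z * a) * a - (x * b + y * a + z * b) * b)
    have hac : 0 < (a - b) ^ 2 := by positivity
    refine ⟨nn_of_mul hc (by linarith), nn_of_mul hac (by linarith), nn_of_mul hac (by linarith), by linarith⟩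

open MeasureTheory in
theorem leafC {a b : ℝ} (hb : 0 ≤ b) (hab : b ≤ a) (ha : 0 < a) :
    ∫ v in (Sr a b \ {v | v 2 * a < v 1 * b}) \ {v | v 2 * b < v 1 * a} ∩ {v | v 2 + v 1 ≤ v 0}, Fr a b v =
      b / (a * (a + b) * (a * (a + b))) * (1 / 24 - ((b) / (a) + (a + b) / (a + b) + (a * (a + b)) / (a * (a + b))) / 120) := by
  rcases eq_or_lt_of_le hb with rfl | hb'
  · have : (Sr a 0 \ {v | v 2 * a < v 1 * 0}) \ {v | v 2 * 0 < v 1 * a} ∩ {v | v 2 + v 1 ≤ v 0} = ∅ := by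
      ext v
      simp only [Sr, Wr, Set.mem_inter_iff, Set.mem_sdiff, Set.mem_ofPred_eq, Set.mem_empty_iff_false, iff_false, not_lt, not_le]
      rintro ⟨⟨⟨⟨h1, _⟩, _⟩, h2⟩, _⟩
      have := mul_pos h1 ha
      linarith
    rw [this]; simp
  have hd : cdet (1, 0, 0) (1, 0, 1) (a + b, b, a) = -b := by simp [cdet]; try ring
  have hd2 : |cdet (1, 0, 0) (1, 0, 1) (a + b, b, a)| = b := by
    rw [hd]; rw [abs_neg]; exact abs_of_pos hb'
  have := cone_int (L := (Sr a b \ {v | v 2 * a < v 1 * b}) \ {v | v 2 * b < v 1 * a} ∩ {v | v 2 + v 1 ≤ v 0}) ?_ (Fr_cont a b) (1, 0, 0) (1, 0, 1) (a + b, b, a)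
    (a, a + b, a * (a + b)) (b, a + b, a * (a + b)) (by positivity) (by positivity) (by positivity) ?_ ?_
    (by intro h0; rw [h0, abs_zero] at hd2; have : 0 < b := (by positivity); linarith)
  · rw [this, hd2]
  · 
    refine ((((Sr_open a b).measurableSet).diff (measurableSet_lt ?_ ?_)).diff (measurableSet_lt ?_ ?_)).inter (measurableSet_le ?_ ?_) <;> fun_prop
  · intro x y z hx hy hz hs
    have p2 := mul_pos hz ha
    have p3 := mul_pos hz hb'
    have p4 := mul_pos hy ha
    have p5 := mul_pos hy hb'
    have p6 : 0 ≤ z * ((a - b) * (a + b)) := mul_nonneg hz.le (mul_nonneg (by linarith) (by linarith))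
    have p6' : 0 ≤ z * (a - b) := mul_nonneg hz.le (by linarith)
    have p9 : 0 ≤ x * (a - b) := mul_nonneg hx.le (by linarith)
    have e1 : max 0 ((y + z * a) * b - z * b * a) = (y + z * a) * b - z * b * a := by
      apply max_eq_right
      linarith
    have e2 : max 0 ((y + z * a) * a - z * b * b) = (y + z * a) * a - z * b * b := by
      apply max_eq_right
      linarith
    simp only [cpt, Sr, Fr, Wr, Set.mem_inter_iff, Set.mem_sdiff, Set.mem_ofPred_eq, Matrix.cons_val, mul_zero, mul_one, zero_add, add_zero, not_lt, not_le, e1, e2] at hs ⊢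
    refine ⟨⟨⟨⟨⟨by positivity, by linarith, by linarith, by linarith, by linarith⟩, by linarith⟩, by linarith⟩, by linarith⟩, by ring⟩
  · intro x y z h
    simp only [cpt, Sr, Fr, Wr, Set.mem_inter_iff, Set.mem_sdiff, Set.mem_ofPred_eq, Matrix.cons_val, mul_zero, mul_one, zero_add, add_zero, not_lt, not_le] at h ⊢
    obtain ⟨⟨⟨⟨h1, h2, h3, h4, h5⟩, h6⟩, h7⟩, h8⟩ := h
    have e1 := le_max_right 0 ((y + z * a) * b - z * b * a)
    refine ⟨by linarith, nn_of_mul hb' (by linarith), nn_of_mul hb' (by linarith), by linarith⟩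

open MeasureTheory in
theorem leafE1 {a b : ℝ} (hb : 0 ≤ b) (hab : b ≤ a) (ha : 0 < a) :
    ∫ v in ((Sr a b \ {v | v 2 * a < v 1 * b}) \ {v | v 2 * b < v 1 * a}) \ {v | v 2 + v 1 ≤ v 0} ∩ {v | v 1 * (a + b) ≤ v 0 * b}, Fr a b v =
      b / ((a + b) * (a) * (a * (a + b))) * (1 / 24 - ((a + b) / ((a + b)) + (b) / (a) + (a * (a + b)) / (a * (a + b))) / 120) := by
  rcases eq_or_lt_of_le hb with rfl | hb'
  · have : ((Sr a 0 \ {v | v 2 * a < v 1 * 0}) \ {v | v 2 * 0 < v 1 * a}) \ {v | v 2 + v 1 ≤ v 0} ∩ {v | v 1 * (a + 0) ≤ v 0 * 0} = ∅ := by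
      ext v
      simp only [Sr, Wr, Set.mem_inter_iff, Set.mem_sdiff, Set.mem_ofPred_eq, Set.mem_empty_iff_false, iff_false, not_lt, not_le]
      rintro ⟨⟨⟨⟨⟨h1, _⟩, _⟩, h2⟩, _⟩, _⟩
      have := mul_pos h1 ha
      linarith
    rw [this]; simp
  have hd : cdet (1, 0, 1) (0, 0, 1) (a + b, b, a) = -b := by simp [cdet]; try ring
  have hd2 : |cdet (1, 0, 1) (0, 0, 1) (a + b, b, a)| = b := by
    rw [hd]; rw [abs_neg]; exact abs_of_pos hb'
  have := cone_int (L := ((Sr a b \ {v | v 2 * a < v 1 * b}) \ {v | v 2 * b < v 1 * a}) \ {v | v 2 + v 1 ≤ v 0} ∩ {v | v 1 * (a + b) ≤ v 0 * b}) ?_ (Fr_cont a b) (1, 0, 1) (0, 0, 1) (a + b, b, a)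
    ((a + b), a, a * (a + b)) (a + b, b, a * (a + b)) (by positivity) (by positivity) (by positivity) ?_ ?_
    (by intro h0; rw [h0, abs_zero] at hd2; have : 0 < b := (by positivity); linarith)
  · rw [this, hd2]
  · 
    refine (((((Sr_open a b).measurableSet).diff (measurableSet_lt ?_ ?_)).diff (measurableSet_lt ?_ ?_)).diff (measurableSet_le ?_ ?_)).inter (measurableSet_le ?_ ?_) <;> fun_prop
  · intro x y z hx hy hz hs
    have p2 := mul_pos hz ha
    have p3 := mul_pos hz hb'
    have p4 := mul_pos hy ha
    have p5 := mul_pos hy hb'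
    have p4' := mul_pos hx ha
    have p5' := mul_pos hx hb'
    have p6 : 0 ≤ z * ((a - b) * (a + b)) := mul_nonneg hz.le (mul_nonneg (by linarith) (by linarith))
    have p6' : 0 ≤ z * (a - b) := mul_nonneg hz.le (by linarith)
    have p9 : 0 ≤ y * (a - b) := mul_nonneg hy.le (by linarith)
    have e1 : max 0 ((x + y + z * a) * b - z * b * a) = (x + y + z * a) * b - z * b * a := by
      apply max_eq_right
      linarith
    have e2 : max 0 ((x + y + z * a) * a - z * b * b) = (x + y + z * a) * a - z * b * b := by
      apply max_eq_right
      linarith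
    simp only [cpt, Sr, Fr, Wr, Set.mem_inter_iff, Set.mem_sdiff, Set.mem_ofPred_eq, Matrix.cons_val, mul_zero, mul_one, zero_add, add_zero, not_lt, not_le, e1, e2] at hs ⊢
    refine ⟨⟨⟨⟨⟨⟨by positivity, by linarith, by linarith, by linarith, by linarith⟩, by linarith⟩, by linarith⟩, by linarith⟩, by linarith⟩, by ring⟩
  · intro x y z h
    simp only [cpt, Sr, Fr, Wr, Set.mem_inter_iff, Set.mem_sdiff, Set.mem_ofPred_eq, Matrix.cons_val, mul_zero, mul_one, zero_add, add_zero, not_lt, not_le] at h ⊢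
    obtain ⟨⟨⟨⟨⟨h1, h2, h3, h4, h5⟩, h6⟩, h7⟩, h8⟩, h9⟩ := h
    have e1 := le_max_right 0 ((x + y + z * a) * a - z * b * b)
    refine ⟨nn_of_mul hb' (by linarith), by linarith, nn_of_mul hb' (by linarith), by linarith⟩

open MeasureTheory in
theorem leafE2 {a b : ℝ} (hb : 0 ≤ b) (hab : b ≤ a) (ha : 0 < a) :
    ∫ v in (((Sr a b \ {v | v 2 * a < v 1 * b}) \ {v | v 2 * b < v 1 * a}) \ {v | v 2 + v 1 ≤ v 0}) \ {v | v 1 * (a + b) ≤ v 0 * b}, Fr a b v =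
      (b * (a - b)) / (a * (a * (a + b)) * (a * a + b * b)) * (1 / 24 - ((b) / (a) + (a * (a + b)) / (a * (a + b)) + (2 * a * b) / (a * a + b * b)) / 120) := by
  rcases eq_or_lt_of_le hb with rfl | hb'
  · have : (((Sr a 0 \ {v | v 2 * a < v 1 * 0}) \ {v | v 2 * 0 < v 1 * a}) \ {v | v 2 + v 1 ≤ v 0}) \ {v | v 1 * (a + 0) ≤ v 0 * 0} = ∅ := by
      ext v
      simp only [Sr, Wr, Set.mem_inter_iff, Set.mem_sdiff, Set.mem_ofPred_eq, Set.mem_empty_iff_false, iff_false, not_lt, not_le]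
      rintro ⟨⟨⟨⟨⟨h1, _⟩, _⟩, h2⟩, _⟩, _⟩
      have := mul_pos h1 ha
      linarith
    rw [this]; simp
  rcases eq_or_lt_of_le hab with rfl | hab'
  · have : (((Sr b b \ {v | v 2 * b < v 1 * b}) \ {v | v 2 * b < v 1 * b}) \ {v | v 2 + v 1 ≤ v 0}) \ {v | v 1 * (b + b) ≤ v 0 * b} = ∅ := by
      ext v
      simp only [Sr, Wr, Set.mem_inter_iff, Set.mem_sdiff, Set.mem_ofPred_eq, Set.mem_empty_iff_false, iff_false, not_lt, not_le]
      rintro ⟨⟨⟨⟨⟨_, h0, _⟩, _⟩, h2⟩, _⟩, h5⟩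
      nlinarith
    rw [this]; simp
  have hc : 0 < a - b := by linarith
  have hd : cdet (0, 0, 1) (a + b, b, a) (2 * b, b, a) = b * (a - b) := by simp [cdet]; try ring
  have hd2 : |cdet (0, 0, 1) (a + b, b, a) (2 * b, b, a)| = (b * (a - b)) := by
    rw [hd]; exact abs_of_pos (by positivity)
  have := cone_int (L := (((Sr a b \ {v | v 2 * a < v 1 * b}) \ {v | v 2 * b < v 1 * a}) \ {v | v 2 + v 1 ≤ v 0}) \ {v | v 1 * (a + b) ≤ v 0 * b}) ?_ (Fr_cont a b) (0, 0, 1) (a + b, b, a) (2 * b, b, a)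
    (a, a * (a + b), a * a + b * b) (b, a * (a + b), 2 * a * b) (by positivity) (by positivity) (by positivity) ?_ ?_
    (by intro h0; rw [h0, abs_zero] at hd2; have : 0 < (b * (a - b)) := (by positivity); linarith)
  · rw [this, hd2]
  · 
    refine (((((Sr_open a b).measurableSet).diff (measurableSet_lt ?_ ?_)).diff (measurableSet_lt ?_ ?_)).diff (measurableSet_le ?_ ?_)).diff (measurableSet_le ?_ ?_) <;> fun_prop
  · intro x y z hx hy hz hs
    have p2 := mul_pos hz ha
    have p3 := mul_pos hz hb'
    have p4 := mul_pos hy ha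
    have p5 := mul_pos hy hb'
    have p4' := mul_pos hx ha
    have p5' := mul_pos hx hb'
    have p6 : 0 < z * ((a - b) * (a + b)) := by positivity
    have p7 : 0 < y * ((a - b) * (a + b)) := by positivity
    have p6' : 0 < z * (a - b) := by positivity
    have p6'' : 0 < b * z * (a - b) := by positivity
    have p7' : 0 < y * (a - b) := by positivity
    have p8 : 0 < z * (a - b) ^ 2 := by positivity
    have p9 : 0 < x * (a - b) := by positivity
    have e1 : max 0 ((x + y * a + z * a) * b - (y * b + z * b) * a) = (x + y * a + z * a) * b - (y * b + z * b) * a := by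
      apply max_eq_right
      linarith
    have e2 : max 0 ((x + y * a + z * a) * a - (y * b + z * b) * b) = (x + y * a + z * a) * a - (y * b + z * b) * b := by
      apply max_eq_right
      linarith
    simp only [cpt, Sr, Fr, Wr, Set.mem_inter_iff, Set.mem_sdiff, Set.mem_ofPred_eq, Matrix.cons_val, mul_zero, mul_one, zero_add, add_zero, not_lt, not_le, e1, e2] at hs ⊢
    refine ⟨⟨⟨⟨⟨⟨by positivity, by linarith, by linarith, by linarith, by linarith⟩, by linarith⟩, by linarith⟩, by linarith⟩, by linarith⟩, by ring⟩
  · intro x y z h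
    simp only [cpt, Sr, Fr, Wr, Set.mem_inter_iff, Set.mem_sdiff, Set.mem_ofPred_eq, Matrix.cons_val, mul_zero, mul_one, zero_add, add_zero, not_lt, not_le] at h ⊢
    obtain ⟨⟨⟨⟨⟨h1, h2, h3, h4, h5⟩, h6⟩, h7⟩, h8⟩, h9⟩ := h
    have e1 := le_max_right 0 ((x + y * a + z * a) * a - (y * b + z * b) * b)
    have hbc : 0 < b * (a - b) := by positivity
    refine ⟨nn_of_mul hb' (by linarith), nn_of_mul hc (by linarith), nn_of_mul hbc (by linarith), by linarith⟩

open MeasureTheory in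
theorem trap_integral {a b : ℝ} (hb : 0 ≤ b) (hab : b ≤ a) (ha : 0 < a) :
    ∫ v in Sr a b, Fr a b v = (20 * a ^ 6 + 25 * a ^ 5 * b - 7 * a ^ 4 * b ^ 2
      + 28 * a ^ 3 * b ^ 3 - 20 * a ^ 2 * b ^ 4 + 3 * a * b ^ 5 - b ^ 6) /
    (240 * a ^ 5 * (a + b) ^ 2 * (a ^ 2 + b ^ 2)) / 2 := by
  have hInt : IntegrableOn (Fr a b) (Sr a b) :=
    ((Fr_cont a b).continuousOn.integrableOn_compact (Sr_bounded ha hb).isCompact_closure).mono_set subset_closure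
  have hInt' : ∀ T : Set (Fin 3 → ℝ), T ⊆ Sr a b → IntegrableOn (Fr a b) T := fun T hT => hInt.mono_set hT
  have m1 : MeasurableSet {v : Fin 3 → ℝ | v 2 * a < v 1 * b} := measurableSet_lt (by fun_prop) (by fun_prop)
  have m2 : MeasurableSet {v : Fin 3 → ℝ | v 2 * b < v 1 * a} := measurableSet_lt (by fun_prop) (by fun_prop)
  have m3 : MeasurableSet {v : Fin 3 → ℝ | v 2 * a - v 1 * b ≤ v 0 * (a - b)} := measurableSet_le (by fun_prop) (by fun_prop)
  have m4 : MeasurableSet {v : Fin 3 → ℝ | v 2 * a < v 1 * (2 * a - b)} := measurableSet_lt (by fun_prop) (by fun_prop)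
  have m5 : MeasurableSet {v : Fin 3 → ℝ | v 2 + v 1 ≤ v 0} := measurableSet_le (by fun_prop) (by fun_prop)
  have m6 : MeasurableSet {v : Fin 3 → ℝ | v 1 * (a + b) ≤ v 0 * b} := measurableSet_le (by fun_prop) (by fun_prop)
  rw [← integral_inter_add_sdiff m1 (hInt' _ subset_rfl),
    ← integral_inter_add_sdiff m2 (hInt' (Sr a b \ _) Set.sdiff_subset),
    ← integral_inter_add_sdiff m3 (hInt' (Sr a b \ {v | v 2 * a < v 1 * b} ∩ _) (by intro v hv; exact hv.1.1)),
    ← integral_inter_add_sdiff m4 (hInt' (Sr a b \ {v | v 2 * a < v 1 * b} ∩ {v | v 2 * b < v 1 * a} ∩ _) (by intro v hv; exact hv.1.1.1)),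
    ← integral_inter_add_sdiff m5 (hInt' ((Sr a b \ {v | v 2 * a < v 1 * b}) \ {v | v 2 * b < v 1 * a}) (by intro v hv; exact hv.1.1)),
    ← integral_inter_add_sdiff m6 (hInt' (((Sr a b \ {v | v 2 * a < v 1 * b}) \ {v | v 2 * b < v 1 * a}) \ _) (by intro v hv; exact hv.1.1.1)),
    leafA hb hab ha, leafB1 hb hab ha, leafB2 hb hab ha, leafD hb hab ha, leafC hb hab ha, leafE1 hb hab ha, leafE2 hb hab ha]
  field_simp
  ring

open scoped Pointwise

/-! ### Riemann sums -/

/-- lattice parametrization -/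
def Lpar (c e : ℝ) (v : Fin 3 → ℝ) : Fin 3 → ℝ := ![v 0, v 1 + c * v 2, e * v 2]

theorem Lpar_cont (c e : ℝ) : Continuous (Lpar c e) := by
  unfold Lpar
  apply continuous_pi
  intro i
  fin_cases i <;> simp <;> fun_prop

open MeasureTheory in
theorem riemann_trap {a b c e : ℝ} (ha : 0 < a) (hb : 0 ≤ b) (he : 0 < e) :
    Filter.Tendsto (fun n : ℕ => (∑' x : ((Lpar c e ⁻¹' (Sr a b)) ∩
        (n : ℝ)⁻¹ • (Submodule.span ℤ (Set.range (Pi.basisFun ℝ (Fin 3))) : Set (Fin 3 → ℝ)) : Set (Fin 3 → ℝ)),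
        Fr a b (Lpar c e x)) / (n : ℝ) ^ 3) Filter.atTop (nhds (e⁻¹ * ∫ v in Sr a b, Fr a b v)) := by
  set M : Matrix (Fin 3) (Fin 3) ℝ := !![1, 0, 0; 0, 1, c; 0, 0, e] with hM
  have hdet : M.det = e := by
    rw [hM, Matrix.det_fin_three]; simp
  have hMv : ∀ v, Matrix.toLin' M v = Lpar c e v := by
    intro v
    ext i
    fin_cases i <;> simp [hM, Matrix.mulVec, Lpar, dotProduct, Fin.sum_univ_three]
  have hmeas : MeasurableSet (Lpar c e ⁻¹' (Sr a b)) := ((Sr_open a b).preimage (Lpar_cont c e)).measurableSet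
  have hconv : Convex ℝ (Lpar c e ⁻¹' (Sr a b)) := by
    have := (Sr_convex a b).linear_preimage (Matrix.toLin' M)
    have h2 : ⇑(Matrix.toLin' M) = Lpar c e := funext hMv
    rwa [h2] at this
  have hbd : Bornology.IsBounded (Lpar c e ⁻¹' (Sr a b)) := by
    obtain ⟨R, hR⟩ := isBounded_iff_forall_norm_le.mp (Sr_bounded ha hb)
    apply isBounded_iff_forall_norm_le.mpr
    refine ⟨R + R / e + |c| * (R / e), fun v hv => ?_⟩
    have h0 := hR _ hv
    have hR0 : 0 ≤ R := (norm_nonneg _).trans h0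
    have hi := fun i => (norm_le_pi_norm (Lpar c e v) i).trans h0
    have i0 : |v 0| ≤ R := by simpa [Lpar] using hi 0
    have i1 : |v 1 + c * v 2| ≤ R := by simpa [Lpar] using hi 1
    have i2 : |e * v 2| ≤ R := by simpa [Lpar] using hi 2
    rw [abs_mul, abs_of_pos he] at i2
    have i2' : |v 2| ≤ R / e := by rw [le_div_iff₀ he]; linarith
    have i3 : |c * v 2| ≤ |c| * (R / e) := by
      rw [abs_mul]; exact mul_le_mul_of_nonneg_left i2' (abs_nonneg _)
    have i1' : |v 1| ≤ R + |c| * (R / e) := by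
      have := abs_sub (v 1 + c * v 2) (c * v 2)
      rw [add_sub_cancel_right] at this
      linarith
    have q1 : 0 ≤ R / e := by positivity
    have q2 : 0 ≤ |c| * (R / e) := by positivity
    rw [pi_norm_le_iff_of_nonneg (by positivity)]
    intro i
    rw [Real.norm_eq_abs]
    fin_cases i
    · simp; linarith
    · simp; linarith
    · simp; linarith
  have key := tendsto_tsum_div_pow_atTop_integral (Lpar c e ⁻¹' (Sr a b)) (fun v => Fr a b (Lpar c e v))
    ((Fr_cont a b).comp (Lpar_cont c e)) hbd hmeas (hconv.addHaar_frontier volume)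
  rw [Fintype.card_fin] at key
  have hInt : ∫ v in Lpar c e ⁻¹' (Sr a b), Fr a b (Lpar c e v) = e⁻¹ * ∫ v in Sr a b, Fr a b v := by
    rw [← integral_indicator hmeas, ← integral_indicator (Sr_open a b).measurableSet]
    have hmap := Real.map_matrix_volume_pi_eq_smul_volume_pi (M := M) (by rw [hdet]; exact he.ne')
    have hme : Measurable (Matrix.toLin' M) := (LinearMap.continuous_of_finiteDimensional _).measurable
    have hi := integral_map (μ := volume) hme.aemeasurable (f := (Sr a b).indicator (Fr a b))
      (((Fr_cont a b).measurable.indicator (Sr_open a b).measurableSet).aestronglyMeasurable)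
    rw [hmap, integral_smul_measure, hdet, ENNReal.toReal_ofReal (abs_nonneg _), smul_eq_mul, abs_of_pos (by positivity)] at hi
    rw [hi]
    apply integral_congr_ae
    filter_upwards with v
    rw [hMv]
    rfl
  rw [hInt] at key
  exact key

theorem mem_latt {n : ℕ} (hn : 0 < n) (v : Fin 3 → ℝ) :
    v ∈ (n : ℝ)⁻¹ • (Submodule.span ℤ (Set.range (Pi.basisFun ℝ (Fin 3))) : Set (Fin 3 → ℝ)) ↔
      ∃ k r q : ℤ, v = ![(k : ℝ) / n, (r : ℝ) / n, (q : ℝ) / n] := by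
  have hn' : (n : ℝ) ≠ 0 := by positivity
  rw [Set.mem_inv_smul_set_iff₀ hn', SetLike.mem_coe, Module.Basis.mem_span_iff_repr_mem]
  constructor
  · intro h
    obtain ⟨k, hk⟩ := h 0
    obtain ⟨r, hr⟩ := h 1
    obtain ⟨q, hq⟩ := h 2
    refine ⟨k, r, q, ?_⟩
    simp at hk hr hq
    ext i
    fin_cases i <;> simp [hk, hr, hq] <;> field_simp
  · rintro ⟨k, r, q, rfl⟩ i
    fin_cases i
    · exact ⟨k, by simp; field_simp⟩
    · exact ⟨r, by simp; field_simp⟩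
    · exact ⟨q, by simp; field_simp⟩

theorem two_dvd_abs_iff {D O x y : ℤ} : (2 ∣ O * |y| - D * |x|) ↔ 2 ∣ D * x - O * y := by
  rcases abs_choice x with h | h <;> rcases abs_choice y with h' | h' <;> rw [h, h'] <;>
    (try simp only [mul_neg]) <;> omega

theorem Wf_real {a b k D O : ℤ} (h : 2 ∣ O * b - D * a) :
    (Wf a b k D O : ℝ) = k * a + max 0 ((O : ℝ) / 2 * b - (D : ℝ) / 2 * a) := by
  obtain ⟨m, hm⟩ := h
  have hm' : (O : ℝ) * b - D * a = 2 * m := by exact_mod_cast hm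
  unfold Wf
  rw [hm, Int.mul_ediv_cancel_left _ (by norm_num)]
  push_cast
  congr 2
  linarith

/-- normalized point -/
noncomputable def npt (n : ℕ) (k D O : ℤ) : Fin 3 → ℝ := ![(k : ℝ) / n, (D : ℝ) / 2 / n, (O : ℝ) / 2 / n]

theorem Wf_npt {n : ℕ} (hn : 0 < n) {a b : ℕ} {k D O : ℤ} (h : 2 ∣ O * (b : ℤ) - D * (a : ℤ)) :
    (Wf a b k D O : ℝ) = n * Wr a b (npt n k D O) := by
  have hn' : (0 : ℝ) < n := by exact_mod_cast hn
  rw [Wf_real h]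
  simp only [Wr, npt, Matrix.cons_val]
  rw [mul_add]
  congr 1
  · push_cast; field_simp
  · rw [mul_max_of_nonneg _ _ hn'.le, mul_zero]
    congr 1
    push_cast; field_simp

theorem cell_pm (n : ℕ) (p : ℤ × ℤ) (k D O : ℤ) :
    cell n p.1 p.2 k D O = ((n : ℤ) - Wf (pmax p) (pmin p) k D O).toNat * ((n : ℤ) - Wf (pmin p) (pmax p) k D O).toNat := by
  unfold cell pmax pmin
  rw [Int.abs_eq_natAbs, Int.abs_eq_natAbs]
  rcases le_total p.1.natAbs p.2.natAbs with h | h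
  · rw [max_eq_right h, min_eq_left h, mul_comm]
  · rw [max_eq_left h, min_eq_right h]

theorem par_pm {p : ℤ × ℤ} {D O : ℤ} (h1 : 2 ∣ (D * p.1 - O * p.2)) (h2 : 2 ∣ (D * p.2 + O * p.1)) :
    (2 ∣ O * (pmin p : ℤ) - D * (pmax p : ℤ)) ∧ (2 ∣ O * (pmax p : ℤ) - D * (pmin p : ℤ)) := by
  have h2' : 2 ∣ (D * p.2 - O * p.1) := by omega
  have k1 := two_dvd_abs_iff.mpr h1
  have k2 := two_dvd_abs_iff.mpr h2'
  rw [Int.abs_eq_natAbs, Int.abs_eq_natAbs] at k1 k2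
  unfold pmax pmin
  rcases le_total p.1.natAbs p.2.natAbs with h | h
  · rw [max_eq_right h, min_eq_left h]; exact ⟨k2, k1⟩
  · rw [max_eq_left h, min_eq_right h]; exact ⟨k1, k2⟩

theorem cell_npt {n : ℕ} (hn : 0 < n) {p : ℤ × ℤ} {k D O : ℤ} (h : trapOK p.1 p.2 k D O) :
    (cell n p.1 p.2 k D O ≠ 0 ↔ npt n k D O ∈ Sr (pmax p) (pmin p)) ∧
    (cell n p.1 p.2 k D O ≠ 0 → (cell n p.1 p.2 k D O : ℝ) = (n : ℝ) ^ 2 * Fr (pmax p) (pmin p) (npt n k D O)) := by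
  obtain ⟨h1, h2, h3, h4, h5⟩ := h
  obtain ⟨d1, d2⟩ := par_pm h4 h5
  have w1 := Wf_npt (k := k) hn d1
  have w2 := Wf_npt (k := k) hn d2
  have hn' : (0 : ℝ) < n := by exact_mod_cast hn
  rw [cell_pm]
  have c1 : ∀ w : ℤ, ∀ x : ℝ, (w : ℝ) = n * x → (((n : ℤ) - w).toNat ≠ 0 ↔ x < 1) := by
    intro w x hw
    have : ((n : ℤ) - w).toNat ≠ 0 ↔ w < n := by omega
    rw [this, ← Int.cast_lt (R := ℝ), hw, Int.cast_natCast]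
    constructor
    · intro h; by_contra hc; push Not at hc; nlinarith
    · intro h; nlinarith
  have c2 : ∀ w : ℤ, ∀ x : ℝ, (w : ℝ) = n * x → ((n : ℤ) - w).toNat ≠ 0 → ((((n : ℤ) - w).toNat : ℕ) : ℝ) = n * (1 - x) := by
    intro w x hw h
    have h1 : ((((n : ℤ) - w).toNat : ℕ) : ℤ) = n - w := Int.toNat_of_nonneg (by omega)
    have h2 : ((((n : ℤ) - w).toNat : ℕ) : ℝ) = n - w := by exact_mod_cast h1
    rw [h2, hw]; ring
  constructor
  · rw [Nat.mul_ne_zero_iff, c1 _ _ w1, c1 _ _ w2]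
    simp only [Sr, Set.mem_ofPred_eq]
    constructor
    · rintro ⟨e1, e2⟩
      have h1' : (0 : ℝ) < D := by exact_mod_cast h1
      have h2' : (D : ℝ) < k := by exact_mod_cast h2
      have h3' : (0 : ℝ) < O := by exact_mod_cast h3
      refine ⟨?_, ?_, ?_, e1, e2⟩
      · simp only [npt, Matrix.cons_val]; positivity
      · simp only [npt, Matrix.cons_val]
        rw [← sub_pos]
        have : (k : ℝ) / n - 2 * (D / 2 / n) = (k - D) / n := by ring
        rw [this]; apply div_pos _ hn'; linarith
      · simp only [npt, Matrix.cons_val]; positivity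
    · rintro ⟨_, _, _, e1, e2⟩; exact ⟨e1, e2⟩
  · intro hne
    rw [Nat.mul_ne_zero_iff] at hne
    push_cast
    rw [c2 _ _ w1 hne.1, c2 _ _ w2 hne.2, Fr]
    ring

theorem trap_limit_gen {a : ℕ} {p : ℤ × ℤ} (hp : p ∈ shell a) {c e : ℝ} (he : 0 < e)
    (hp1 : ∀ D O : ℤ, 2 ∣ (D * p.1 - O * p.2) → 2 ∣ (D * p.2 + O * p.1) →
      ∃ r q : ℤ, (D : ℝ) / 2 = r + c * q ∧ (O : ℝ) / 2 = e * q)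
    (hp2 : ∀ r q : ℤ, ∃ D O : ℤ, 2 ∣ (D * p.1 - O * p.2) ∧ 2 ∣ (D * p.2 + O * p.1) ∧
      (D : ℝ) / 2 = r + c * q ∧ (O : ℝ) / 2 = e * q) :
    Filter.Tendsto (fun n : ℕ => (trapDir n p : ℝ) / (n : ℝ) ^ 5) Filter.atTop
      (nhds (e⁻¹ * (fab (pmax p) (pmin p) / 2))) := by
  have ha : 0 < pmax p := shell_pmax_pos hp
  have ha' : (0 : ℝ) < pmax p := by exact_mod_cast ha
  have hb' : (0 : ℝ) ≤ pmin p := by positivity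
  have hab : (pmin p : ℝ) ≤ pmax p := by exact_mod_cast pmin_le_pmax p
  have key := riemann_trap (c := c) ha' hb' he
  rw [trap_integral hb' hab ha'] at key
  refine key.congr' ?_
  filter_upwards [Filter.eventually_gt_atTop 0] with n hn
  have hn' : (0 : ℝ) < n := by exact_mod_cast hn
  classical
  set T : Finset (ℤ × ℤ × ℤ) := (shapes n).filter (fun t => trapOK p.1 p.2 t.1 t.2.1 t.2.2 ∧ cell n p.1 p.2 t.1 t.2.1 t.2.2 ≠ 0) with hT
  set ψ : ℤ × ℤ × ℤ → Fin 3 → ℝ := fun t =>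
    ![(t.1 : ℝ) / n, ((t.2.1 : ℝ) / 2 - c / e * ((t.2.2 : ℝ) / 2)) / n, (t.2.2 : ℝ) / 2 / e / n] with hψ
  have hLψ : ∀ t, Lpar c e (ψ t) = npt n t.1 t.2.1 t.2.2 := by
    intro t
    ext i
    fin_cases i
    · simp [Lpar, hψ, npt]
    · simp [Lpar, hψ, npt]; field_simp; ring
    · simp [Lpar, hψ, npt]; field_simp
  have hinj : Function.Injective ψ := by
    intro t t' h
    have h' : npt n t.1 t.2.1 t.2.2 = npt n t'.1 t'.2.1 t'.2.2 := by rw [← hLψ, ← hLψ, h]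
    have h0 := congrFun h' 0
    have h1 := congrFun h' 1
    have h2 := congrFun h' 2
    simp only [npt, Matrix.cons_val] at h0 h1 h2
    field_simp at h0 h1 h2
    ext
    · exact_mod_cast h0
    · exact_mod_cast h1
    · exact_mod_cast h2
  have hset : ((Lpar c e ⁻¹' (Sr (pmax p) (pmin p))) ∩
        (n : ℝ)⁻¹ • (Submodule.span ℤ (Set.range (Pi.basisFun ℝ (Fin 3))) : Set (Fin 3 → ℝ)) : Set (Fin 3 → ℝ)) =
        ((T.image ψ : Finset (Fin 3 → ℝ)) : Set (Fin 3 → ℝ)) := by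
    ext v
    rw [Set.mem_inter_iff, Set.mem_preimage, mem_latt hn, SetLike.mem_coe, Finset.mem_image]
    constructor
    · rintro ⟨hv, k, r, q, rfl⟩
      obtain ⟨D, O, q1, q2, q3, q4⟩ := hp2 r q
      have hve : ![(k : ℝ) / n, (r : ℝ) / n, (q : ℝ) / n] = ψ (k, D, O) := by
        ext i
        fin_cases i
        · simp [hψ]
        · simp only [hψ]; rw [q3, q4]; simp; field_simp; ring
        · simp only [hψ]; rw [q4]; simp; field_simp
      rw [hve, hLψ] at hv
      simp only at hv
      have hOK : trapOK p.1 p.2 k D O := by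
        obtain ⟨s1, s2, s3, _⟩ := hv
        simp only [npt, Matrix.cons_val] at s1 s2 s3
        have t1 : (0 : ℝ) < D := by
          have : (D : ℝ) = (D : ℝ) / 2 / n * (2 * n) := by field_simp
          rw [this]; positivity
        have t3 : (0 : ℝ) < O := by
          have : (O : ℝ) = (O : ℝ) / 2 / n * (2 * n) := by field_simp
          rw [this]; positivity
        have t2 : (D : ℝ) < k := by
          have : 2 * ((D : ℝ) / 2 / n) = D / n := by ring
          rw [this] at s2
          exact (div_lt_div_iff_of_pos_right hn').mp s2
        exact ⟨by exact_mod_cast t1, by exact_mod_cast t2, by exact_mod_cast t3, q1, q2⟩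
      have hne := (cell_npt hn hOK).1.mpr hv
      refine ⟨(k, D, O), ?_, hve.symm⟩
      rw [hT, Finset.mem_filter]
      refine ⟨?_, hOK, hne⟩
      have hs := cell_support (a := pmax p) rfl hOK.1 hOK.2.1 hne
      obtain ⟨s1, s2, s3, _⟩ := hOK
      have ha'' : (1 : ℤ) ≤ pmax p := by exact_mod_cast ha
      have u1 : k ≤ n := by nlinarith [hs.1]
      have u2 : O ≤ 2 * n := by nlinarith [hs.2]
      simp only [shapes, Finset.mem_product, Finset.mem_Icc]
      refine ⟨⟨by omega, by omega⟩, ⟨by omega, by omega⟩, by omega, by omega⟩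
    · rintro ⟨t, ht, rfl⟩
      rw [hT, Finset.mem_filter] at ht
      obtain ⟨_, hOK, hne⟩ := ht
      refine ⟨?_, ?_⟩
      · rw [hLψ]; exact (cell_npt hn hOK).1.mp hne
      · obtain ⟨r, q, e1, e2⟩ := hp1 t.2.1 t.2.2 hOK.2.2.2.1 hOK.2.2.2.2
        refine ⟨t.1, r, q, ?_⟩
        simp only [hψ]
        rw [e1, e2]
        ext i
        fin_cases i
        · simp
        · simp; field_simp; ring
        · simp; field_simp
  have hsum : (∑' x : ((Lpar c e ⁻¹' (Sr (pmax p) (pmin p))) ∩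
        (n : ℝ)⁻¹ • (Submodule.span ℤ (Set.range (Pi.basisFun ℝ (Fin 3))) : Set (Fin 3 → ℝ)) : Set (Fin 3 → ℝ)),
        Fr (pmax p) (pmin p) (Lpar c e x)) = ∑ t ∈ T, Fr (pmax p) (pmin p) (npt n t.1 t.2.1 t.2.2) := by
    rw [hset, Finset.tsum_subtype' (T.image ψ) (fun x => Fr (pmax p) (pmin p) (Lpar c e x)), Finset.sum_image (fun _ _ _ _ h => hinj h)]
    apply Finset.sum_congr rfl
    intro t _
    rw [hLψ]
  rw [hsum]
  have htrap : (trapDir n p : ℝ) = ∑ t ∈ T, (n : ℝ) ^ 2 * Fr (pmax p) (pmin p) (npt n t.1 t.2.1 t.2.2) := by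
    unfold trapDir
    push_cast
    rw [hT, Finset.sum_filter]
    apply Finset.sum_congr rfl
    intro t _
    by_cases hOK : trapOK p.1 p.2 t.1 t.2.1 t.2.2
    · by_cases hne : cell n p.1 p.2 t.1 t.2.1 t.2.2 ≠ 0
      · rw [if_pos hOK, if_pos ⟨hOK, hne⟩, (cell_npt hn hOK).2 hne]
      · push Not at hne
        rw [if_pos hOK, hne, if_neg (by tauto)]; simp
    · rw [if_neg hOK, if_neg (by tauto)]
  rw [htrap, ← Finset.mul_sum]
  field_simp

/-- the limit density of trapezoids in a direction -/
noncomputable def Tlim (p : ℤ × ℤ) : ℝ :=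
  (3 + (-1 : ℝ) ^ (pmax p + pmin p)) / 4 * fab (pmax p) (pmin p)

theorem trap_limit {a : ℕ} {p : ℤ × ℤ} (hp : p ∈ shell a) :
    Filter.Tendsto (fun n : ℕ => (trapDir n p : ℝ) / (n : ℝ) ^ 5) Filter.atTop (nhds (Tlim p)) := by
  have hsum : pmax p + pmin p = p.1.natAbs + p.2.natAbs := by unfold pmax pmin; omega
  have hg := (mem_shell.mp hp).2
  have hnot : ¬ (2 ∣ p.1 ∧ 2 ∣ p.2) := by
    rintro ⟨h1, h2⟩
    have := Int.dvd_coe_gcd h1 h2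
    rw [hg] at this
    norm_num at this
  unfold Tlim
  rw [hsum]
  rcases Nat.even_or_odd (p.1.natAbs + p.2.natAbs) with hpar | hpar
  · rw [hpar.neg_one_pow]
    obtain ⟨j, hj⟩ := hpar
    obtain ⟨x', hx⟩ : ∃ x', p.1 = 2 * x' + 1 := ⟨p.1 / 2, by omega⟩
    obtain ⟨y', hy⟩ : ∃ y', p.2 = 2 * y' + 1 := ⟨p.2 / 2, by omega⟩
    have := trap_limit_gen hp (c := 1 / 2) (e := 1 / 2) (by norm_num) ?_ ?_
    · convert this using 2; ring
    · intro D O h1 h2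
      have e1 : D * p.1 - O * p.2 = 2 * (D * x' - O * y') + (D - O) := by rw [hx, hy]; ring
      obtain ⟨r, hr⟩ : 2 ∣ D - O := by omega
      refine ⟨r, O, ?_, by ring⟩
      have : (D : ℝ) - O = 2 * r := by exact_mod_cast hr
      linarith
    · intro r q
      refine ⟨q + 2 * r, q, ⟨q * x' - q * y' + r * p.1, by rw [hx, hy]; ring⟩, ⟨q * (x' + y' + 1) + r * p.2, by rw [hx, hy]; ring⟩, by push_cast; ring, by ring⟩
  · rw [hpar.neg_one_pow]
    obtain ⟨j, hj⟩ := hpar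
    have := trap_limit_gen hp (c := 0) (e := 1) (by norm_num) ?_ ?_
    · convert this using 2; ring
    · intro D O h1 h2
      have : 2 ∣ D ∧ 2 ∣ O := by
        rcases Int.even_or_odd' p.1 with ⟨x', hx | hx⟩ <;> rcases Int.even_or_odd' p.2 with ⟨y', hy | hy⟩
        · omega
        · have e1 : D * p.1 - O * p.2 = 2 * (D * x' - O * y') - O := by rw [hx, hy]; ring
          have e2 : D * p.2 + O * p.1 = 2 * (D * y' + O * x') + D := by rw [hx, hy]; ring
          omega
        · have e1 : D * p.1 - O * p.2 = 2 * (D * x' - O * y') + D := by rw [hx, hy]; ring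
          have e2 : D * p.2 + O * p.1 = 2 * (D * y' + O * x') + O := by rw [hx, hy]; ring
          omega
        · omega
      obtain ⟨⟨r, hr⟩, ⟨q, hq⟩⟩ := this
      refine ⟨r, q, ?_, ?_⟩
      · rw [hr]; push_cast; ring
      · rw [hq]; push_cast; ring
    · intro r q
      refine ⟨2 * r, 2 * q, ⟨r * p.1 - q * p.2, by ring⟩, ⟨r * p.2 + q * p.1, by ring⟩, by push_cast; ring, by push_cast; ring⟩

/-! ### Sums over shells -/

/-- admissible smaller coordinates -/
def cop (a : ℕ) : Finset ℕ := (Finset.Ico 1 a).filter (fun b => Nat.gcd a b = 1)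

theorem fiber_card {a b : ℕ} (hb : 0 < b) (hba : b < a) (hg : Nat.gcd a b = 1) :
    ((shell a).filter (fun p => pmin p = b)).card = 8 := by
  have : (shell a).filter (fun p => pmin p = b) =
      ({((a:ℤ), (b:ℤ)), ((a:ℤ), -(b:ℤ)), (-(a:ℤ), (b:ℤ)), (-(a:ℤ), -(b:ℤ)),
       ((b:ℤ), (a:ℤ)), ((b:ℤ), -(a:ℤ)), (-(b:ℤ), (a:ℤ)), (-(b:ℤ), -(a:ℤ))} : Finset (ℤ × ℤ)) := by
    ext ⟨x, y⟩
    rw [Finset.mem_filter, mem_shell]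
    simp only [pmin, Finset.mem_insert, Finset.mem_singleton, Prod.mk.injEq]
    constructor
    · rintro ⟨⟨h1, h2⟩, h3⟩
      rcases le_total x.natAbs y.natAbs with h | h
      · rw [max_eq_right h] at h1
        rw [min_eq_left h] at h3
        rcases Int.natAbs_eq x with e | e <;> rcases Int.natAbs_eq y with e2 | e2 <;>
          rw [h3] at e <;> rw [h1] at e2 <;> simp [e, e2]
      · rw [max_eq_left h] at h1
        rw [min_eq_right h] at h3
        rcases Int.natAbs_eq x with e | e <;> rcases Int.natAbs_eq y with e2 | e2 <;>
          rw [h1] at e <;> rw [h3] at e2 <;> simp [e, e2]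
    · intro h
      have hg' : Nat.gcd b a = 1 := by rw [Nat.gcd_comm]; exact hg
      rw [Int.gcd_def]
      rcases h with ⟨rfl, rfl⟩ | ⟨rfl, rfl⟩ | ⟨rfl, rfl⟩ | ⟨rfl, rfl⟩ | ⟨rfl, rfl⟩ | ⟨rfl, rfl⟩ | ⟨rfl, rfl⟩ | ⟨rfl, rfl⟩ <;>
        simp [hg, hg', hba.le]
  rw [this]
  have ne1 : (a:ℤ) ≠ b := by omega
  have ne2 : (a:ℤ) ≠ -b := by omega
  have ne3 : (a:ℤ) ≠ -a := by omega
  have ne4 : (b:ℤ) ≠ -b := by omega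
  have ne5 : -(a:ℤ) ≠ b := by omega
  have ne6 : -(a:ℤ) ≠ -b := by omega
  have ne7 : (-(a:ℤ)) ≠ a := by omega
  have ne8 : (-(b:ℤ)) ≠ b := by omega
  have ne9 : (-(b:ℤ)) ≠ a := by omega
  repeat rw [Finset.card_insert_of_notMem
    (by simp only [Finset.mem_insert, Finset.mem_singleton, Prod.mk.injEq]; omega)]
  rw [Finset.card_singleton]

theorem shell_sum (g : ℕ → ℝ) {a : ℕ} (ha : 2 ≤ a) :
    ∑ p ∈ shell a, g (pmin p) = 8 * ∑ b ∈ cop a, g b := by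
  have hm : ∀ p ∈ shell a, pmin p ∈ cop a := by
    intro p hp
    have h1 := shell_coprime hp
    have h2 := shell_pmax hp
    have h3 := pmin_le_pmax p
    rw [h2] at h1 h3
    rw [cop, Finset.mem_filter, Finset.mem_Ico]
    refine ⟨⟨?_, ?_⟩, h1⟩
    · rcases Nat.eq_zero_or_pos (pmin p) with h | h
      · rw [h, Nat.gcd_zero_right] at h1; omega
      · exact h
    · rcases Nat.lt_or_eq_of_le h3 with h | h
      · exact h
      · rw [h, Nat.gcd_self] at h1; omega
  rw [← Finset.sum_fiberwise_of_maps_to hm, Finset.mul_sum]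
  apply Finset.sum_congr rfl
  intro b hb
  rw [cop, Finset.mem_filter, Finset.mem_Ico] at hb
  rw [Finset.sum_congr rfl (g := fun _ => g b), Finset.sum_const, fiber_card hb.1.1 hb.1.2 hb.2]
  · simp
  · intro p hp
    rw [(Finset.mem_filter.mp hp).2]

theorem shell_one : shell 1 = ({(1,0), (-1,0), (0,1), (0,-1), (1,1), (1,-1), (-1,1), (-1,-1)} : Finset (ℤ × ℤ)) := by
  ext ⟨x, y⟩
  rw [mem_shell]
  simp only [Finset.mem_insert, Finset.mem_singleton, Prod.mk.injEq]
  constructor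
  · rintro ⟨h1, h2⟩
    have hx : x = 1 ∨ x = -1 ∨ x = 0 := by omega
    have hy : y = 1 ∨ y = -1 ∨ y = 0 := by omega
    rcases hx with rfl | rfl | rfl <;> rcases hy with rfl | rfl | rfl <;> simp_all
  · intro h
    rcases h with ⟨rfl, rfl⟩ | ⟨rfl, rfl⟩ | ⟨rfl, rfl⟩ | ⟨rfl, rfl⟩ | ⟨rfl, rfl⟩ | ⟨rfl, rfl⟩ | ⟨rfl, rfl⟩ | ⟨rfl, rfl⟩ <;> decide

theorem shell_sum_one (g : ℕ → ℝ) : ∑ p ∈ shell 1, g (pmin p) = 4 * g 0 + 4 * g 1 := by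
  rw [shell_one]
  repeat rw [Finset.sum_insert (by decide)]
  rw [Finset.sum_singleton]
  simp [pmin]
  ring

theorem shell_sum_fn (G : ℕ → ℕ → ℝ) (a : ℕ) :
    ∑ p ∈ shell a, G (pmax p) (pmin p) = ∑ p ∈ shell a, G a (pmin p) :=
  Finset.sum_congr rfl (fun p hp => by rw [shell_pmax hp])

theorem cop_zero : cop 0 = ∅ := by decide
theorem cop_one : cop 1 = ∅ := by decide

/-- summand of gamma -/
noncomputable def gterm (a : ℕ) : ℝ := ∑ b ∈ cop a, 2 * (3 + (-1 : ℝ) ^ (a + b)) * fab a b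

theorem Tshell (a : ℕ) : ∑ p ∈ shell a, Tlim p = gterm a + (if a = 1 then 4 / 15 else 0) := by
  unfold Tlim
  rw [shell_sum_fn (fun a b => (3 + (-1 : ℝ) ^ (a + b)) / 4 * fab a b)]
  unfold gterm
  rcases Nat.lt_trichotomy a 1 with h | h | h
  · obtain rfl : a = 0 := by omega
    rw [shell_zero, cop_zero]; simp
  · subst h
    rw [shell_sum_one (fun b => (3 + (-1 : ℝ) ^ (1 + b)) / 4 * fab 1 b), cop_one]
    simp [fab]; norm_num
  · rw [shell_sum (fun b => (3 + (-1 : ℝ) ^ (a + b)) / 4 * fab a b) h, Finset.mul_sum, if_neg (by omega), add_zero]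
    apply Finset.sum_congr rfl
    intro b _
    ring

theorem gamma_eq (hs : Summable (fun a => ∑ p ∈ shell a, Tlim p)) :
    Summable gterm ∧ ∑' a, ∑ p ∈ shell a, Tlim p = gammaConst := by
  have h1 : Summable (fun a : ℕ => if a = 1 then (4 / 15 : ℝ) else 0) :=
    (hasSum_ite_eq 1 (4 / 15 : ℝ)).summable
  have h2 : Summable gterm := by
    have := hs.sub h1
    refine this.congr (fun a => ?_)
    rw [Tshell]; ring
  refine ⟨h2, ?_⟩
  simp_rw [Tshell]
  rw [h2.tsum_add h1, tsum_ite_eq, add_comm]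
  rfl

open scoped Real

/-! ### The zeta part -/

theorem cop_card {a : ℕ} (ha : 2 ≤ a) : (cop a).card = Nat.totient a := by
  rw [Nat.totient_eq_card_coprime]
  congr 1
  ext b
  rw [cop, Finset.mem_filter, Finset.mem_filter, Finset.mem_Ico, Finset.mem_range]
  constructor
  · rintro ⟨⟨h1, h2⟩, h3⟩; exact ⟨h2, h3⟩
  · rintro ⟨h2, h3⟩
    refine ⟨⟨?_, h2⟩, h3⟩
    rcases Nat.eq_zero_or_pos b with h | h
    · subst h; have : a = 1 := by simpa using h3
      omega
    · exact h

theorem cop_sum {a : ℕ} : 2 * ∑ b ∈ cop a, (b : ℝ) = a * (cop a).card := by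
  have h : ∑ b ∈ cop a, (b : ℝ) = ∑ b ∈ cop a, ((a : ℝ) - b) := by
    refine Finset.sum_nbij' (fun b => a - b) (fun b => a - b) ?_ ?_ ?_ ?_ ?_
    · intro b hb
      rw [cop, Finset.mem_filter, Finset.mem_Ico] at *
      refine ⟨by omega, ?_⟩
      rw [Nat.gcd_self_sub_right (by omega)]; exact hb.2
    · intro b hb
      rw [cop, Finset.mem_filter, Finset.mem_Ico] at *
      refine ⟨by omega, ?_⟩
      rw [Nat.gcd_self_sub_right (by omega)]; exact hb.2
    · intro b hb
      rw [cop, Finset.mem_filter, Finset.mem_Ico] at hb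
      omega
    · intro b hb
      rw [cop, Finset.mem_filter, Finset.mem_Ico] at hb
      omega
    · intro b hb
      rw [cop, Finset.mem_filter, Finset.mem_Ico] at hb
      rw [Nat.cast_sub (by omega)]; ring
  rw [Finset.sum_sub_distrib, Finset.sum_const, nsmul_eq_mul] at h
  linarith

theorem cop_lin {a : ℕ} (ha : 2 ≤ a) (u v : ℝ) :
    ∑ b ∈ cop a, (u - v * ((b : ℝ) / a)) = (u - v / 2) * Nat.totient a := by
  have h := cop_sum (a := a)
  have ha' : (a : ℝ) ≠ 0 := by positivity
  rw [cop_card ha] at h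
  rw [Finset.sum_sub_distrib, Finset.sum_const, nsmul_eq_mul, cop_card ha, ← Finset.mul_sum, ← Finset.sum_div]
  have : ∑ b ∈ cop a, (b : ℝ) = a * (Nat.totient a) / 2 := by linarith
  rw [this]
  field_simp

/-- summand of the totient series -/
noncomputable def phit (a : ℕ) : ℝ := (Nat.totient a : ℝ) / (a : ℝ) ^ 3

theorem Cshell (a : ℕ) : ∑ p ∈ shell a, Clim p = 7 / 30 * phit a := by
  unfold Clim
  rw [shell_sum_fn (fun a b => 1 / (2 * (a : ℝ) ^ 3) * (1 / 12 - (b : ℝ) / (20 * a)))]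
  unfold phit
  rcases Nat.lt_trichotomy a 1 with h | h | h
  · obtain rfl : a = 0 := by omega
    rw [shell_zero]; simp
  · subst h
    rw [shell_sum_one (fun b => 1 / (2 * ((1 : ℕ) : ℝ) ^ 3) * (1 / 12 - (b : ℝ) / (20 * ((1 : ℕ) : ℝ))))]
    simp; norm_num
  · have ha : (a : ℝ) ≠ 0 := by positivity
    rw [shell_sum (fun b => 1 / (2 * (a : ℝ) ^ 3) * (1 / 12 - (b : ℝ) / (20 * a))) h, ← Finset.mul_sum]
    have := cop_lin (a := a) h (1 / 12) (1 / 20)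
    rw [Finset.sum_congr rfl (g := fun b : ℕ => (1 / 12 : ℝ) - 1 / 20 * ((b : ℝ) / a)) (fun b _ => by field_simp), this]
    field_simp; norm_num

/-- real zeta three -/
noncomputable def zeta3 : ℝ := ∑' n : ℕ, 1 / (n : ℝ) ^ 3

theorem zeta3_re : (riemannZeta 3).re = zeta3 := by
  have := zeta_nat_eq_tsum_of_gt_one (k := 3) (by norm_num)
  have h2 : riemannZeta 3 = ((zeta3 : ℝ) : ℂ) := by
    rw [zeta3, Complex.ofReal_tsum]
    push_cast at this ⊢
    exact this
  rw [h2, Complex.ofReal_re]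

theorem zeta3_c : riemannZeta 3 = ((zeta3 : ℝ) : ℂ) := by
  have := zeta_nat_eq_tsum_of_gt_one (k := 3) (by norm_num)
  rw [zeta3, Complex.ofReal_tsum]
  push_cast at this ⊢
  exact this

theorem phi_term (a : ℕ) : LSeries.term (fun n => (Nat.totient n : ℂ)) 3 a = ((phit a : ℝ) : ℂ) := by
  rcases Nat.eq_zero_or_pos a with h | h
  · subst h; simp [phit]
  · rw [LSeries.term_of_ne_zero h.ne', phit]
    push_cast
    congr 1
    exact_mod_cast Complex.cpow_natCast (a : ℂ) 3

theorem phi_conv : LSeries.convolution (fun n => (Nat.totient n : ℂ)) 1 = fun n : ℕ => (n : ℂ) := by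
  rw [LSeries.convolution_def]
  ext n
  rw [Nat.sum_divisorsAntidiagonal (fun x y => (Nat.totient x : ℂ) * (1 : ℕ → ℂ) y)]
  simp only [Pi.one_apply, mul_one]
  exact_mod_cast Nat.sum_totient n

theorem phi_sum (hs : Summable phit) : (∑' a, phit a) * zeta3 = π ^ 2 / 6 := by
  have h1 : LSeriesSummable (fun n => (Nat.totient n : ℂ)) 3 := by
    unfold LSeriesSummable
    rw [funext phi_term]
    exact Complex.summable_ofReal.mpr hs
  have h2 : LSeriesSummable (1 : ℕ → ℂ) 3 := LSeriesSummable_one_iff.mpr (by norm_num)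
  have h3 := LSeries_convolution' h1 h2
  rw [phi_conv, LSeries_one_eq_riemannZeta (by norm_num), zeta3_c] at h3
  have h4 : LSeries (fun n => (Nat.totient n : ℂ)) 3 = ((∑' a, phit a : ℝ) : ℂ) := by
    unfold LSeries
    rw [Complex.ofReal_tsum]
    exact tsum_congr phi_term
  have h5 : LSeries (fun n : ℕ => (n : ℂ)) 3 = (π : ℂ) ^ 2 / 6 := by
    rw [← riemannZeta_two]
    have := zeta_nat_eq_tsum_of_gt_one (k := 2) (by norm_num)
    push_cast at this
    rw [this]
    unfold LSeries
    apply tsum_congr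
    intro a
    rcases Nat.eq_zero_or_pos a with h | h
    · subst h; simp
    · rw [LSeries.term_of_ne_zero h.ne']
      have e : (a : ℂ) ^ (3 : ℂ) = (a : ℂ) ^ 3 := by exact_mod_cast Complex.cpow_natCast (a : ℂ) 3
      have : (a : ℂ) ≠ 0 := by exact_mod_cast h.ne'
      rw [e]; field_simp
  rw [h4, h5] at h3
  exact_mod_cast h3.symm

theorem zeta3_summable : Summable (fun n : ℕ => 1 / (n : ℝ) ^ 3) :=
  Real.summable_one_div_nat_pow.mpr (by norm_num)

theorem zeta3_pos : 0 < zeta3 := by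
  apply zeta3_summable.tsum_pos (fun n => by positivity) 1
  norm_num

theorem main_limit : Filter.Tendsto (fun n : ℕ => (badQuadCount n : ℝ) / (n : ℝ) ^ 5) Filter.atTop
      (nhds (gammaConst + 7 / 60 * ∑' a, phit a)) ∧ Summable gterm ∧ Summable phit := by
  obtain ⟨h1, h2, h3⟩ := reduction Tlim Clim (fun a p hp => trap_limit hp) (fun a p hp => coll_limit hp)
  obtain ⟨h4, h5⟩ := gamma_eq h2
  have h6 : Summable phit := by
    have := h3.mul_left (30 / 7)
    refine this.congr (fun a => ?_)
    rw [Cshell]; ring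
  refine ⟨?_, h4, h6⟩
  rw [h5] at h1
  simp_rw [Cshell] at h1
  rw [tsum_mul_left] at h1
  convert h1 using 2
  ring

open scoped Real

/-! ### Numerics -/

/-- finite sum, kernel friendly -/
def sumN (f : ℕ → ℕ) (n : ℕ) : ℕ := Nat.rec 0 (fun k s => Nat.add s (f k)) n

theorem sumN_eq (f : ℕ → ℕ) (n : ℕ) : sumN f n = ∑ k ∈ Finset.range n, f k := by
  induction n with
  | zero => rfl
  | succ n ih => rw [Finset.sum_range_succ, ← ih]; rfl

/-- numerator of fab -/
def numP (a b : ℕ) : ℕ :=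
  (Nat.sub (Nat.mul a (Nat.add (Nat.mul (Nat.pow a 4) (Nat.add (Nat.mul 20 a) (Nat.mul 25 b))) (Nat.mul (Nat.pow b 3) (Nat.add (Nat.mul 28 (Nat.pow a 2)) (Nat.mul 3 (Nat.pow b 2))))))
       (Nat.mul (Nat.pow b 2) (Nat.add (Nat.mul 7 (Nat.pow a 4)) (Nat.mul (Nat.pow b 2) (Nat.add (Nat.mul 20 (Nat.pow a 2)) (Nat.pow b 2))))))

/-- denominator of fab -/
def denP (a b : ℕ) : ℕ :=
  (Nat.mul 240 (Nat.mul (Nat.pow a 5) (Nat.mul (Nat.pow (Nat.add a b) 2) (Nat.add (Nat.pow a 2) (Nat.pow b 2)))))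

/-- upper bound for a summand -/
def tU (a b : ℕ) : ℕ :=
  bif Nat.beq (Nat.gcd a b) 1 then
    Nat.succ (Nat.div (Nat.mul (Nat.sub 8 (Nat.mul 4 (Nat.mod (Nat.add a b) 2))) (Nat.mul 1000000000000 (numP a b))) (denP a b))
  else 0

/-- lower bound for a totient summand -/
def tV (a b : ℕ) : ℕ :=
  bif Nat.beq (Nat.gcd a b) 1 then Nat.div 13000000000000 (Nat.mul 30 (Nat.pow a 3)) else 0

theorem U_num : Nat.ble (sumN (fun a => sumN (tU a) a) 340) 425968739252 = true := by decide +kernel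
theorem V_num : Nat.ble 592211833735 (sumN (fun a => sumN (tV a) a) 340) = true := by decide +kernel
theorem Z_num : Nat.ble 1202006400617 (sumN (fun a => Nat.div 1000000000000 (Nat.pow a 3)) 100) = true := by decide +kernel

theorem nat_div_ge (x y : ℕ) : (Nat.div x y : ℝ) ≤ (x : ℝ) / y := Nat.cast_div_le

theorem nat_div_lt (x : ℕ) {y : ℕ} (hy : 0 < y) : (x : ℝ) / y ≤ (Nat.succ (Nat.div x y) : ℝ) := by
  have hy' : (0 : ℝ) < y := by exact_mod_cast hy
  rw [div_le_iff₀ hy']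
  have : x < Nat.succ (x / y) * y := by
    have h1 := Nat.div_add_mod x y
    have h2 := Nat.mod_lt x hy
    rw [Nat.succ_mul]; nlinarith
  have h3 : x ≤ Nat.succ (Nat.div x y) * y := this.le
  exact_mod_cast h3

theorem numP_cast {a b : ℕ} (hb : b ≤ a) : (numP a b : ℝ) = 20 * (a : ℝ) ^ 6 + 25 * (a : ℝ) ^ 5 * (b : ℝ) - 7 * (a : ℝ) ^ 4 * (b : ℝ) ^ 2
      + 28 * (a : ℝ) ^ 3 * (b : ℝ) ^ 3 - 20 * (a : ℝ) ^ 2 * (b : ℝ) ^ 4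
      + 3 * (a : ℝ) * (b : ℝ) ^ 5 - (b : ℝ) ^ 6 := by
  have h : numP a b = a * (a ^ 4 * (20 * a + 25 * b) + b ^ 3 * (28 * a ^ 2 + 3 * b ^ 2)) - b ^ 2 * (7 * a ^ 4 + b ^ 2 * (20 * a ^ 2 + b ^ 2)) := rfl
  have hle : b ^ 2 * (7 * a ^ 4 + b ^ 2 * (20 * a ^ 2 + b ^ 2)) ≤ a * (a ^ 4 * (20 * a + 25 * b) + b ^ 3 * (28 * a ^ 2 + 3 * b ^ 2)) := by
    obtain ⟨c, rfl⟩ := Nat.exists_eq_add_of_le hb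
    ring_nf
    nlinarith [Nat.zero_le (b ^ 6), Nat.zero_le (b ^ 5 * c), Nat.zero_le (b ^ 4 * c ^ 2), Nat.zero_le (b ^ 3 * c ^ 3), Nat.zero_le (b ^ 2 * c ^ 4), Nat.zero_le (b * c ^ 5), Nat.zero_le (c ^ 6)]
  rw [h, Nat.cast_sub hle]
  push_cast
  ring

theorem fab_eq {a b : ℕ} (hb : b ≤ a) : fab a b = (numP a b : ℝ) / (denP a b : ℝ) := by
  have h : denP a b = 240 * (a ^ 5 * ((a + b) ^ 2 * (a ^ 2 + b ^ 2))) := rfl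
  rw [numP_cast hb, h, fab]
  push_cast
  ring_nf

theorem tU_ge {a b : ℕ} (hb : b < a) (hg : Nat.gcd a b = 1) :
    2 * (3 + (-1 : ℝ) ^ (a + b)) * fab a b ≤ (tU a b : ℝ) / 1000000000000 := by
  have h : tU a b = Nat.succ (Nat.div ((8 - 4 * ((a + b) % 2)) * (1000000000000 * numP a b)) (denP a b)) := by
    unfold tU
    rw [hg]
    rfl
  have hd : 0 < denP a b := by
    have h : denP a b = 240 * (a ^ 5 * ((a + b) ^ 2 * (a ^ 2 + b ^ 2))) := rfl
    rw [h]
    have : 0 < a := by omega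
    positivity
  have hw : 2 * (3 + (-1 : ℝ) ^ (a + b)) = ((8 - 4 * ((a + b) % 2) : ℕ) : ℝ) := by
    rcases Nat.even_or_odd (a + b) with e | e
    · rw [e.neg_one_pow, Nat.even_iff.mp e]; norm_num
    · rw [e.neg_one_pow, Nat.odd_iff.mp e]; norm_num
  rw [h, le_div_iff₀ (by norm_num), hw, fab_eq hb.le]
  refine le_trans (le_of_eq ?_) (nat_div_lt _ hd)
  push_cast
  ring

theorem tV_le {a b : ℕ} (hg : Nat.gcd a b = 1) :
    (tV a b : ℝ) / 1000000000000 ≤ 13 / 30 * (1 / (a : ℝ) ^ 3) := by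
  have h : tV a b = Nat.div 13000000000000 (30 * a ^ 3) := by
    unfold tV
    rw [hg]
    rfl
  rw [h, div_le_iff₀ (by norm_num)]
  refine le_trans (nat_div_ge _ _) (le_of_eq ?_)
  push_cast
  rcases Nat.eq_zero_or_pos a with h | h
  · subst h; simp
  · field_simp; norm_num

theorem t_zero {a b : ℕ} (hg : Nat.gcd a b ≠ 1) : tU a b = 0 ∧ tV a b = 0 := by
  have : Nat.beq (Nat.gcd a b) 1 = false := by
    by_contra hc
    exact hg (Nat.eq_of_beq_eq_true (by simpa using hc))
  unfold tU tV
  rw [this]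
  exact ⟨rfl, rfl⟩

theorem cop_eq {a : ℕ} (ha : 2 ≤ a) : cop a = (Finset.range a).filter (fun b => Nat.gcd a b = 1) := by
  ext b
  rw [cop, Finset.mem_filter, Finset.mem_filter, Finset.mem_Ico, Finset.mem_range]
  constructor
  · rintro ⟨⟨h1, h2⟩, h3⟩; exact ⟨h2, h3⟩
  · rintro ⟨h2, h3⟩
    refine ⟨⟨?_, h2⟩, h3⟩
    rcases Nat.eq_zero_or_pos b with h | h
    · subst h; have : a = 1 := by simpa using h3
      omega
    · exact h

theorem U_term (a : ℕ) : gterm a + (if a = 1 then 1 / 3 else 0) ≤ (sumN (tU a) a : ℝ) / 1000000000000 := by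
  rcases Nat.lt_trichotomy a 1 with h | h | h
  · obtain rfl : a = 0 := by omega
    rw [gterm, cop_zero]; simp [sumN]
  · subst h
    rw [gterm, cop_one, sumN_eq]
    have := tU_ge (a := 1) (b := 0) (by norm_num) (by norm_num)
    norm_num [fab] at this ⊢
    linarith
  · rw [sumN_eq, gterm, cop_eq h, if_neg (by omega), add_zero, Finset.sum_filter]
    push_cast
    rw [Finset.sum_div]
    apply Finset.sum_le_sum
    intro b hb
    rw [Finset.mem_range] at hb
    split_ifs with hg
    · exact tU_ge hb hg
    · positivity

theorem V_term (a : ℕ) : (sumN (tV a) a : ℝ) / 1000000000000 ≤ 13 / 30 * phit a := by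
  rw [sumN_eq, phit, Nat.totient_eq_card_coprime, Finset.card_filter]
  push_cast
  rw [Finset.sum_div, Finset.sum_div, Finset.mul_sum]
  apply Finset.sum_le_sum
  intro b hb
  split_ifs with hg
  · exact tV_le hg
  · rw [(t_zero hg).2]; simp

theorem U_sum : ∑ a ∈ Finset.range 340, gterm a ≤ (425968739252 : ℝ) / 1000000000000 - 1 / 3 := by
  have h := Nat.le_of_ble_eq_true U_num
  rw [sumN_eq] at h
  have h' : ((∑ k ∈ Finset.range 340, sumN (tU k) k : ℕ) : ℝ) ≤ (425968739252 : ℕ) := Nat.cast_le.mpr h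
  push_cast at h'
  have h2 := Finset.sum_le_sum (s := Finset.range 340) (fun a _ => U_term a)
  rw [Finset.sum_add_distrib, ← Finset.sum_div, Finset.sum_ite_eq' (Finset.range 340) 1, if_pos (by simp)] at h2
  have h3 := div_le_div_of_nonneg_right h' (c := (1000000000000 : ℝ)) (by norm_num)
  linarith

theorem V_sum : (592211833735 : ℝ) / 1000000000000 ≤ 13 / 30 * ∑ a ∈ Finset.range 340, phit a := by
  have h := Nat.le_of_ble_eq_true V_num
  rw [sumN_eq] at h
  have h' : ((592211833735 : ℕ) : ℝ) ≤ ((∑ k ∈ Finset.range 340, sumN (tV k) k : ℕ) : ℝ) := Nat.cast_le.mpr h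
  push_cast at h'
  have h2 := Finset.sum_le_sum (s := Finset.range 340) (fun a _ => V_term a)
  rw [← Finset.sum_div, ← Finset.mul_sum] at h2
  have h3 := div_le_div_of_nonneg_right h' (c := (1000000000000 : ℝ)) (by norm_num)
  linarith

theorem Z_sum : (1202006400617 : ℝ) / 1000000000000 ≤ zeta3 := by
  have h := Nat.le_of_ble_eq_true Z_num
  rw [sumN_eq] at h
  have h' : ((1202006400617 : ℕ) : ℝ) ≤ ((∑ k ∈ Finset.range 100, Nat.div 1000000000000 (Nat.pow k 3) : ℕ) : ℝ) := Nat.cast_le.mpr h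
  rw [Nat.cast_sum] at h'
  have h1 : ∑ k ∈ Finset.range 100, ((Nat.div 1000000000000 (Nat.pow k 3) : ℕ) : ℝ) ≤ ∑ k ∈ Finset.range 100, 1000000000000 * (1 / (k : ℝ) ^ 3) := by
    apply Finset.sum_le_sum
    intro k _
    refine le_trans (nat_div_ge _ _) (le_of_eq ?_)
    have : Nat.pow k 3 = k ^ 3 := rfl
    rw [this]
    push_cast
    ring
  rw [← Finset.mul_sum] at h1
  have h2 := zeta3_summable.sum_le_tsum (Finset.range 100) (fun n _ => by positivity)
  have h3 : ∑ k ∈ Finset.range 100, (1 / (k : ℝ) ^ 3) ≤ zeta3 := h2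
  rw [div_le_iff₀ (by norm_num)]
  push_cast at h'
  linarith

theorem fab_le {a b : ℕ} (hb : b ≤ a) (ha : 0 < a) :
    fab a b ≤ 1 / (a : ℝ) ^ 3 * (1 / 12 - 7 / 120 * ((b : ℝ) / a)) := by
  have ha' : (0 : ℝ) < a := by exact_mod_cast ha
  have hb' : (b : ℝ) ≤ a := by exact_mod_cast hb
  have hb0 : (0 : ℝ) ≤ b := by positivity
  have key : 1 / (a : ℝ) ^ 3 * (1 / 12 - 7 / 120 * ((b : ℝ) / a)) - fab a b =
      b * (a - b) * (a ^ 4 + 20 * a ^ 3 * b + 4 * a ^ 2 * b ^ 2 + 16 * a * b ^ 3 - b ^ 4) /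
       (240 * (a : ℝ) ^ 5 * ((a : ℝ) + (b : ℝ)) ^ 2 * ((a : ℝ) ^ 2 + (b : ℝ) ^ 2)) := by
    unfold fab
    field_simp
    ring
  have h1 : (b : ℝ) ^ 4 ≤ 16 * a * b ^ 3 := by
    have : 0 ≤ (b : ℝ) ^ 3 := by positivity
    nlinarith
  have h2 : 0 ≤ (a : ℝ) ^ 4 + 20 * a ^ 3 * b + 4 * a ^ 2 * b ^ 2 + 16 * a * b ^ 3 - b ^ 4 := by
    have : 0 ≤ (a : ℝ) ^ 4 + 20 * a ^ 3 * b + 4 * a ^ 2 * b ^ 2 := by positivity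
    linarith
  have h3 : 0 ≤ (a : ℝ) - b := by linarith
  have : 0 ≤ 1 / (a : ℝ) ^ 3 * (1 / 12 - 7 / 120 * ((b : ℝ) / a)) - fab a b := by
    rw [key]; positivity
  linarith

theorem fab_nonneg {a b : ℕ} (hb : b ≤ a) : 0 ≤ fab a b := by
  rw [fab_eq hb]; positivity

theorem gterm_le (a : ℕ) : gterm a ≤ 13 / 30 * phit a := by
  rcases Nat.lt_or_ge a 2 with h | h
  · have h0 : gterm a = 0 := by
      unfold gterm
      obtain rfl | rfl : a = 0 ∨ a = 1 := by omega
      · rw [cop_zero]; simp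
      · rw [cop_one]; simp
    rw [h0]; unfold phit; positivity
  · have hl := cop_lin h (1 / 12) (7 / 120)
    have : gterm a ≤ ∑ b ∈ cop a, 8 * (1 / (a : ℝ) ^ 3 * (1 / 12 - 7 / 120 * ((b : ℝ) / a))) := by
      unfold gterm
      apply Finset.sum_le_sum
      intro b hb
      rw [cop, Finset.mem_filter, Finset.mem_Ico] at hb
      have hba : b ≤ a := by omega
      have h1 := fab_le hba (by omega)
      have h2 := fab_nonneg hba
      have hw : 2 * (3 + (-1 : ℝ) ^ (a + b)) ≤ 8 := by
        rcases neg_one_pow_eq_or ℝ (a + b) with e | e <;> rw [e] <;> norm_num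
      nlinarith
    rw [← Finset.mul_sum, ← Finset.mul_sum, hl] at this
    refine this.trans (le_of_eq ?_)
    unfold phit
    ring

theorem limit_lt (hg : Summable gterm) (hp : Summable phit) :
    gammaConst + 7 / 60 * ∑' a, phit a < 0.51983 := by
  have e1 : gammaConst = 4 / 15 + ∑' a, gterm a := rfl
  have t1 := hg.sum_add_tsum_nat_add 340
  have t2 := hp.sum_add_tsum_nat_add 340
  have t3 : ∑' i, gterm (i + 340) ≤ 13 / 30 * ∑' i, phit (i + 340) := by
    rw [← tsum_mul_left]
    exact Summable.tsum_le_tsum (fun i => gterm_le _) ((summable_nat_add_iff 340).mpr hg)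
      (((summable_nat_add_iff 340).mpr hp).mul_left _)
  have hU := U_sum
  have hV := V_sum
  have hZ := Z_sum
  have hS := phi_sum hp
  have hz := zeta3_pos
  have hpi := Real.pi_lt_d4
  have hpi0 := Real.pi_pos
  have hS' : ∑' a, phit a ≤ 3.1416 ^ 2 / 6 / (1202006400617 / 1000000000000) := by
    have hS0 : 0 ≤ ∑' a, phit a := tsum_nonneg (fun a => by unfold phit; positivity)
    rw [le_div_iff₀ (by norm_num)]
    have h1 : (∑' a, phit a) * (1202006400617 / 1000000000000) ≤ (∑' a, phit a) * zeta3 :=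
      mul_le_mul_of_nonneg_left hZ hS0
    have h2 : π ^ 2 ≤ 3.1416 ^ 2 := pow_le_pow_left₀ hpi0.le hpi.le 2
    linarith
  norm_num at hU hV hS' ⊢
  linarith

theorem collinear_or_concyclic_quadruples_count :
    Filter.Tendsto (fun n : ℕ => (badQuadCount n : ℝ) / (n : ℝ) ^ 5) Filter.atTop
      (nhds (gammaConst + 7 * π ^ 2 / (360 * (riemannZeta 3).re))) ∧
    ∃ N : ℕ, ∀ n ≥ N, (badQuadCount n : ℝ) ≤ 0.51983 * (n : ℝ) ^ 5 := by
  obtain ⟨h1, h2, h3⟩ := main_limit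
  have hz := zeta3_pos
  have hS := phi_sum h3
  have he : gammaConst + 7 * π ^ 2 / (360 * (riemannZeta 3).re) = gammaConst + 7 / 60 * ∑' a, phit a := by
    rw [zeta3_re]
    have : ∑' a, phit a = π ^ 2 / 6 / zeta3 := by rw [eq_div_iff hz.ne']; exact hS
    rw [this]
    field_simp
    ring
  refine ⟨by rw [he]; exact h1, ?_⟩
  have hev := (h1.eventually (gt_mem_nhds (limit_lt h2 h3))).and (Filter.eventually_gt_atTop 0)
  obtain ⟨N, hN⟩ := Filter.eventually_atTop.mp hev
  refine ⟨N, fun n hn => ?_⟩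
  obtain ⟨q1, q2⟩ := hN n hn
  have hn' : (0 : ℝ) < (n : ℝ) ^ 5 := by positivity
  rw [div_lt_iff₀ hn'] at q1
  exact q1.le
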